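/- Let r ≥ 1, d ≥ 4 and ε > 0. There exists a constant C = C(d,r,ε) with the following property. Let F ∈ ℤ[z_1,…,z_{r+2}] be a homogeneous polynomial of degree d which is absolutely irreducible over ℚ, defining the hypersurface Z = {F = 0} ⊂ P^{r+1} over ℚ, and suppose that only finitely many r-dimensional ℚ̄-linear subspaces of ℚ̄^{r+2} are contained in the zero set {z ∈ ℚ̄^{r+2} : F(z) = 0} (i.e. only finitely many (r−1)-planes over ℚ̄ lie on Z). Then for every real B ≥ 1 one has N(Z;B) ≤ C·B^{r+ε}. -/

import Mathlib

open MvPolynomial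
open Finset (range)
open Real (log)
open Finsupp (single)
open Function (Injective)
open Module (finrank)
open Fin (cons tail)
local notation "pC" => Polynomial.C
local notation "pX" => Polynomial.X
variable {R : Type*}
set_option autoImplicit true
local notation:75 b:76 "~^" x:75 => (b:ℝ)^x
set_option linter.all false
local notation "icr" => Int.castRingHom
local notation "Qb" => AlgebraicClosure ℚ
local notation:max "Mv" n:max => MvPolynomial (Fin n)
alias zz := Finset.mem_filter
alias zy := Finset.mem_image
alias zx := Nat.mul_le_mul_left
alias zv := Nat.mul_le_mul_right
alias zj := ZMod.intCast_zmod_eq_zero_iff_dvd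
alias zu := Finset.card_le_card
alias zk := Real.rpow_le_rpow_of_exponent_le
alias zq := Finset.sum_le_sum
alias zw := map_mul
alias zb := Real.log_natCast_nonneg
alias zd := Finset.card_image_of_injective
alias zg := Nat.pow_le_pow_right
alias zn := Finset.card_filter_add_card_filter_not
alias zm := div_le_iff₀
alias zp := map_zero
alias zc := smul_eq_mul
alias zs := Finset.sum_congr
alias zr := Finset.prod_pow_eq_pow_sum
alias zt := mul_le_mul_of_nonneg_left
alias zl := isUnit_iff_ne_zero
alias zf := Finset.sum_le_card_nsmul
alias za := MvPolynomial.induction_on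
alias ze := Finset.mem_image_of_mem
alias zo := Finset.mem_range
alias zi := Finset.card_le_mul_card_image
alias zh := mul_le_mul_of_nonneg_right
alias yz := MvPolynomial.coeff_C_mul
alias yy := MvPolynomial.totalDegree_finsetSum_le
alias yx := Real.log_le_log
alias yv := MvPolynomial.totalDegree_smul_le
alias yj := lt_of_le_of_lt
alias yu := Finset.mul_sum
alias yk := Finset.card_image_of_injOn
alias yq := add_le_add
alias yw := Finset.mem_univ
alias yb := DFunLike.congr_fun
alias yd := Nat.pow_le_pow_left
alias yg := MvPolynomial.totalDegree_eq_zero_iff_eq_C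
alias yn := MvPolynomial.degreeOf_le_totalDegree
alias ym := Finset.sum_range_succ
alias yp := MvPolynomial.mem_support_iff
alias yc := mul_le_mul
alias ys := Fin.cons_succ
alias yr := Int.cast_zero
alias yt := le_of_mul_le_mul_left
alias yl := Polynomial.natDegree_map_eq_of_injective
alias yf := MvPolynomial.totalDegree_mul_of_isDomain
alias ya := mul_left_cancel₀
alias ye := MvPolynomial.totalDegree_mul
alias yo := map_add
alias yi := right_ne_zero_of_mul
alias yh := Finset.sum_eq_single
alias xz := Finsupp.degree_eq_sum
alias xy := Finset.card_image_le
alias xx := Nat.prime_iff_prime_int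
alias xv := Real.log_pow
alias xj := Real.log_le_sub_one_of_pos
alias xu := MvPolynomial.totalDegree_monomial_le
alias xk := Real.rpow_natCast
alias xq := Finset.card_insert_of_notMem
alias xw := Finset.card_le_card_of_injOn
alias xb := mul_comm
alias xd := Fin.sum_univ_two
alias xg := MvPolynomial.le_totalDegree
alias xn := MvPolynomial.C_mul'
alias xm := Nat.le_of_dvd
alias xp := Fin.prod_univ_succ
alias xc := Finset.sum_le_sum_of_subset_of_nonneg
alias xs := Nat.mul_le_mul
alias xr := Real.one_le_rpow
alias xt := mul_ne_zero
alias xl := left_ne_zero_of_mul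
alias xf := MvPolynomial.coeff_map
alias xa := Nat.mul_pos
alias xe := Finset.mem_product
alias xo := le_mul_of_one_le_right
alias xi := inv_mul_cancel₀
alias xh := Finset.card_range
alias vz := max_le
alias vy := mul_eq_zero
alias vx := Polynomial.monic_of_natDegree_le_of_coeff_eq_one
alias vv := Finset.sum_add_distrib
alias vj := Nat.le_add_right
alias vu := exists_nat_ge
alias vk := Finset.prod_le_prod
alias vq := abs_nonneg
alias vw := Int.eq_zero_of_abs_lt_dvd
alias vb := Polynomial.monic_X_sub_C
alias vd := MvPolynomial.natDegree_finSuccEquiv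
alias vg := Function.iterate_succ_apply'
alias vn := MvPolynomial.degreeOf_C_mul_le
alias vm := map_sum
alias vp := Finset.eq_empty_of_forall_notMem
alias vc := MvPolynomial.coeff_eq_zero_of_totalDegree_lt
alias vs := Finset.card_biUnion_le_card_mul
alias vr := Polynomial.coeToPowerSeries.ringHom_apply
alias vt := pow_ne_zero
alias vl := lt_of_lt_of_le
alias vf := MvPolynomial.isUnit_iff_eq_C_of_isReduced
alias va := Finset.card_univ
alias ve := Nat.pos_of_ne_zero
alias vo := pow_le_pow_left₀
alias vi := MvPolynomial.isHomogeneous_X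
alias vh := Int.cast_injective
alias jz := Finset.mem_insert_of_mem
alias jy := Int.emod_add_mul_ediv
alias jx := Polynomial.coeff_map
alias jv := Module.finrank_fintype_fun_eq_card
alias jj := MvPolynomial.totalDegree_add
alias ju := Function.iterate_succ_apply
alias jk := ZMod.natCast_eq_zero_iff
alias jq := Finset.sum_eq_zero
alias jw := MvPolynomial.aeval_X
alias jb := MvPolynomial.X_pow_eq_monomial
alias jd := MvPolynomial.degreeOf_add_le
alias jg := Finset.mem_biUnion
alias jn := Finset.abs_sum_le_sum_abs
alias jm := AlgHom.comp_apply
alias jp := Polynomial.map_map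
alias jc := MvPolynomial.funext
alias js := MvPolynomial.ringHom_ext
alias jr := Polynomial.natDegree_sum_le_of_forall_le
alias jt := Nat.cast_nonneg
alias jl := Real.log_mul
alias jf := Real.rpow_add
alias ja := associated_unit_mul_left
alias je := le_trans
alias jo := Fin.ext
alias ji := if_neg
alias jh := Polynomial.map_mul
alias uz := Fintype.mem_piFinset
alias uy := LinearMap.mem_ker
alias ux := Int.natCast_dvd
alias uv := Matrix.of_apply
alias uj := mul_assoc
alias uu := nsmul_eq_mul
alias uk := Derivation.leibniz
alias uw := Module.End.pow_apply
alias ub := Nat.eq_zero_or_pos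
alias ud := Finset.prod_ne_zero_iff
alias ug := MvPolynomial.coeff_sum
alias un := Fintype.sum_prod_type
alias um := one_mul
alias up := MvPolynomial.eval₂_eq
alias uc := inv_ne_zero
alias us := Finset.card_filter
alias ur := Finsupp.prod_fintype
alias ut := Finset.dvd_prod_of_mem
alias ul := pow_dvd_pow_of_dvd
alias uf := Nat.cast_mul
alias ua := le_div_iff₀
alias ue := abs_mul
alias uo := pow_le_pow_right₀
alias ui := Nat.one_le_pow
alias uh := Nat.ceil_lt_add_one
alias kz := Finset.card_union_le
alias ky := Finset.filter_subset
alias kx := Nat.one_le_two_pow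
alias kv := Nat.le_floor
alias kj := Set.mem_ofPred_eq
alias ku := ZMod.card
alias kk := Finset.card_biUnion_le
alias kq := Int.natAbs_ne_zero
alias kw := Polynomial.eval_map_apply
alias kb := Polynomial.mem_roots
alias kd := le_rfl
alias kg := Finsupp.sum_fintype
alias kn := Subtype.ext
alias km := Finset.le_sup
alias kp := sub_eq_zero
alias kc := Nat.zero_le
alias ks := Fin.tail_cons
alias kr := mul_pow
alias kt := Finset.mem_singleton
alias kl := one_ne_zero
alias kf := Nat.le_zero
alias ka := Finset.mem_insert
alias ke := Finset.mem_union
alias ko := abs_of_nonneg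
alias ki := Finset.mem_Icc
alias kh := Finset.prod_const
alias qz := Fin.cons_zero
alias qy := Real.rpow_mul
alias qx := Nat.floor_le
alias qv := Polynomial.eval_zero
alias qj := add_zero
alias qu := mul_one

def YM [CommSemiring K] (d : ℕ) (f : Mv (n+1) K) : Prop :=
  f.totalDegree ≤ d ∧ f.coeff (single 0 d) ≠ 0

lemma ym_coeff [CommRing K] {f : Mv (n+1) K}
    (h : f.totalDegree ≤ d) :
    (finSuccEquiv K n f).coeff d = C (f.coeff (single 0 d)) := by
  have h1 : ((finSuccEquiv K n f).coeff d).totalDegree = 0 := by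
    by_cases h0 : (finSuccEquiv K n f).coeff d = 0
    · simp [h0]
    · have := totalDegree_coeff_finSuccEquiv_add_le f d h0
      omega
  rw [yg.mp h1, finSuccEquiv_coeff_coeff]
  congr 2
  ext i; refine Fin.cases ?_ (fun i => ?_) i <;> simp

lemma ym_deg [CommRing K] {f : Mv (n+1) K} (h : YM d f) :
    (finSuccEquiv K n f).natDegree = d := by
  apply le_antisymm
  · rw [vd]; exact (yn _ _).trans h.1
  · apply Polynomial.le_natDegree_of_ne_zero
    rw [ym_coeff h.1]; simpa using h.2

lemma eval_cons_fin [CommRing K] (f : Mv (n+1) K)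
    (P : Fin (n+1) → K) :
    ((finSuccEquiv K n f).map (eval (tail P))).eval (P 0) = eval P f := by
  rw [← eval_eq_eval_mv_eval', Fin.cons_self_tail]

lemma fib_card [CommRing K] [IsDomain K] [DecidableEq K]
    {f : Mv (n+1) K}
    (h : YM d f) (T : Finset (Fin (n+1) → K)) (hT : ∀ P ∈ T, eval P f = 0) :
    T.card ≤ d * (T.image tail).card := by
  classical
  apply zi
  intro x _
  set q := (finSuccEquiv K n f).map (eval x) with hq
  have hc : q.coeff d ≠ 0 := by rw [hq, jx, ym_coeff h.1]; simpa using h.2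
  have hq0 : q ≠ 0 := fun h0 => hc (by simp [h0])
  have hqd : q.natDegree ≤ d := Polynomial.natDegree_map_le.trans (ym_deg h).le
  have : (T.filter fun P => tail P = x).card ≤ q.roots.toFinset.card := by
    apply xw (fun P => P 0)
    · intro P hP
      simp only [Finset.coe_filter, kj] at hP
      simp only [Finset.mem_coe, Multiset.mem_toFinset, kb hq0, Polynomial.IsRoot]
      rw [hq, ← hP.2, eval_cons_fin]; exact hT P hP.1
    · intro P hP P' hP' e
      simp only [Finset.coe_filter, kj] at hP hP'
      rw [← Fin.cons_self_tail P, ← Fin.cons_self_tail P', hP.2, hP'.2]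
      simp only at e; rw [e]
  exact this.trans ((Multiset.toFinset_card_le _).trans ((Polynomial.card_roots' _).trans hqd))

lemma res_deg [CommRing K]
    (f g : Polynomial (Mv n K)) (hf : ∀ i, (f.coeff i).totalDegree ≤ a)
    (hg : ∀ i, (g.coeff i).totalDegree ≤ b) :
    (f.resultant g m k).totalDegree ≤ m * b + k * a := by
  unfold Polynomial.resultant
  rw [Matrix.det_apply]
  refine yy fun σ _ => ?_
  refine (yv _ _).trans ?_
  refine (totalDegree_finsetProd _ _).trans ?_
  rw [Fin.sum_univ_add]
  refine yq ((zf _ _ b ?_).trans (by simp))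
    ((zf _ _ a ?_).trans (by simp))
  · intro i _; simp only [Polynomial.sylvester, uv, Fin.addCases_left]
    split_ifs; exacts [hg _, by simp]
  · intro i _; simp only [Polynomial.sylvester, uv, Fin.addCases_right]
    split_ifs; exacts [hf _, by simp]

lemma totalDegree_coeff_fin [CommRing K] (f : Mv (n+1) K)
    (i : ℕ) : ((finSuccEquiv K n f).coeff i).totalDegree ≤ f.totalDegree := by
  by_cases h0 : (finSuccEquiv K n f).coeff i = 0
  · simp [h0]
  · have := totalDegree_coeff_finSuccEquiv_add_le f i h0
    omega

lemma elim [Field K] (hd : 1 ≤ d) {f g : Mv (n+1) K}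
    (h : YM d f) (hi : Irreducible f) (hg : ¬ f ∣ g) (hb : g.totalDegree ≤ b) :
    ∃ R : Mv n K, R ≠ 0 ∧ R.totalDegree ≤ 2 * d * b ∧
      ∀ P, eval P f = 0 → eval P g = 0 → eval (tail P) R = 0 := by
  set e := finSuccEquiv K n with he
  set F := e f with hF
  set G := e g with hG
  have hFd : F.natDegree = d := ym_deg h
  have hGd : G.natDegree ≤ b := by
    rw [hG, vd]; exact (yn _ _).trans hb
  refine ⟨F.resultant G, ?_, ?_, ?_⟩
  · intro h0
    set a := f.coeff (single 0 d)
    have hlead : F.leadingCoeff = C a := by rw [Polynomial.leadingCoeff, hFd, hF, ym_coeff h.1]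
    have ha : a ≠ 0 := h.2
    set u : Polynomial (Mv n K) := pC (C a⁻¹) with hu
    have huu : IsUnit u := by
      rw [hu]; exact ((ha.isUnit.inv).map C).map pC
    have hm : (u * F).Monic := by
      apply Polynomial.monic_C_mul_of_mul_leadingCoeff_eq_one
      rw [hlead, ← zw, xi ha, map_one]
    have hFi : Irreducible (u * F) :=
      (irreducible_isUnit_mul huu).mpr ((MulEquiv.irreducible_iff e).mpr hi)
    have hnd : ¬ (u * F) ∣ G := by
      rw [huu.mul_left_dvd]
      rintro ⟨c, hc⟩
      refine hg ⟨e.symm c, e.injective ?_⟩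
      rw [zw, e.apply_symm_apply]; exact hc
    let L := FractionRing (Mv n K)
    let φ := algebraMap (Mv n K) L
    have hφ : Injective φ := IsFractionRing.injective _ _
    have hi2 := (hm.irreducible_iff_irreducible_map_fraction_map (K := L)).mp hFi
    have hcop : IsCoprime ((u * F).map φ) (G.map φ) := by
      rw [hi2.coprime_iff_not_dvd, Polynomial.map_dvd_map φ hφ hm]; exact hnd
    rw [jh] at hcop
    have hcop2 : IsCoprime (F.map φ) (G.map φ) :=
      (isCoprime_mul_unit_left_left (huu.map (Polynomial.mapRingHom φ)) _ _).mp hcop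
    have h1 : (F.map φ).resultant (G.map φ) = 0 := by
      rw [yl hφ, yl hφ,
        Polynomial.resultant_map_map, h0, zp]
    exact (Polynomial.resultant_eq_zero_iff.mp h1).2 hcop2
  · refine (res_deg F G (a := d) (b := b) (fun i => (totalDegree_coeff_fin f i).trans h.1)
      (fun i => (totalDegree_coeff_fin g i).trans hb)).trans ?_
    rw [hFd]; nlinarith
  · intro P hf hg
    obtain ⟨p, q, -, -, e1⟩ := Polynomial.exists_mul_add_mul_eq_C_resultant F G kd kd
      (Or.inl (by omega))
    have := congrArg (fun z => (z.map (eval (tail P))).eval (P 0)) e1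
    simp only [Polynomial.map_add, jh, Polynomial.eval_add, Polynomial.eval_mul,
      Polynomial.map_C, Polynomial.eval_C] at this
    rw [eval_cons_fin, eval_cons_fin, hf, hg] at this
    simpa using this.symm

lemma sz [CommRing K] [IsDomain K] [DecidableEq K]
    {p : Mv (n+1) K}
    (hp : p ≠ 0) (S : Finset K) (T : Finset (Fin (n+1) → K)) (hS : ∀ P ∈ T, ∀ i, P i ∈ S)
    (hT : ∀ P ∈ T, eval P p = 0) : T.card ≤ p.totalDegree * S.card ^ n := by
  classical
  rcases S.eq_empty_or_nonempty with rfl | hne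
  · have : T = ∅ := vp fun P hP => by simpa using hS P hP 0
    simp [this]
  have hpos : (0 : ℚ≥0) < S.card := by exact_mod_cast hne.card_pos
  have h := schwartz_zippel_totalDegree hp S
  rw [div_le_div_iff₀ (by positivity) hpos, pow_succ, ← uj, mul_le_mul_iff_left₀ hpos] at h
  refine je (zu ?_) (by exact_mod_cast h)
  intro P hP
  simp [uz, hS P hP, hT P hP]

lemma cnt3 [Field K] [DecidableEq K] (hd : 1 ≤ d)
    {f g : Mv (n+2) K} (h : YM d f) (hi : Irreducible f) (hg : ¬ f ∣ g)
    (hb : g.totalDegree ≤ b) (S : Finset K) (T : Finset (Fin (n+2) → K))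
    (hS : ∀ P ∈ T, ∀ i, P i ∈ S) (hf : ∀ P ∈ T, eval P f = 0) (hg' : ∀ P ∈ T, eval P g = 0) :
    T.card ≤ 2 * d * d * b * S.card ^ n := by
  obtain ⟨R, hR, hRd, hRv⟩ := elim hd h hi hg hb
  have h1 := fib_card h T hf
  have h2 := sz hR S (T.image tail) (by
    intro P hP i; obtain ⟨Q, hQ, rfl⟩ := zy.mp hP; exact hS Q hQ _) (by
    intro P hP; obtain ⟨Q, hQ, rfl⟩ := zy.mp hP; exact hRv Q (hf Q hQ) (hg' Q hQ))
  calc _ ≤ _ := h1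
    _ ≤ d * (2 * d * b * S.card ^ n) := by gcongr; exact h2.trans (by gcongr)
    _ = _ := by ring

lemma finrank_rtd [Field K] (T : ℕ) :
    2 * finrank K (restrictTotalDegree (Fin 2) K T) = (T+1)*(T+2) := by
  classical
  have hb : finrank K (restrictTotalDegree (Fin 2) K T) =
      Nat.card {n : Fin 2 →₀ ℕ | (n.sum fun _ e => e) ≤ T} :=
    Module.finrank_eq_nat_card_basis (basisRestrictSupport K _)
  have hs : Nat.card {n : Fin 2 →₀ ℕ | (n.sum fun _ e => e) ≤ T} =
      ((range (T+1)).sigma fun i => range (i+1)).card := by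
    rw [Nat.card_coe_set_eq, ← Set.ncard_coe_finset]
    apply Set.ncard_congr (fun n _ => ⟨n 0 + n 1, n 0⟩)
    · intro n hn
      rw [kj, kg _ _ (by simp), xd] at hn
      simp; omega
    · intro n m _ _ e
      simp only [Sigma.mk.injEq, heq_eq_eq] at e
      ext i; fin_cases i <;> simp <;> omega
    · rintro ⟨k, i⟩ h
      simp at h
      refine ⟨Finsupp.equivFunOnFinite.symm ![i, k - i], ?_, ?_⟩
      · simp [kg, xd]; omega
      · simp; omega
  rw [hb, hs, Finset.card_sigma]
  simp only [xh]
  clear hb hs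
  induction T with
  | zero => simp
  | succ T ih => rw [ym, mul_add, ih]; ring

lemma bez0 [Field K] {f g : Mv 2 K} (hi : Irreducible f)
    (hg : ¬ f ∣ g) (hb : g.totalDegree ≤ b) [Fintype ι]
    (Λ : Mv 2 K →ₗ[K] (ι → K)) (hΛ : Function.Surjective Λ)
    (h1 : ∀ u, Λ (f * u) = 0) (h2 : ∀ u, Λ (g * u) = 0) :
    Fintype.card ι ≤ f.totalDegree * b := by
  classical
  set a := f.totalDegree with ha
  choose q hq using fun i => hΛ (Pi.single i 1)
  set S := Finset.univ.sup fun i => (q i).totalDegree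
  let V : ℕ → Submodule K (Mv 2 K) := fun T => restrictTotalDegree (Fin 2) K T
  have hV : ∀ T p, p ∈ V T ↔ p.totalDegree ≤ T := fun T p => mem_restrictTotalDegree _ _ _
  have hfin : ∀ T, Module.Finite K (V T) := fun T => by
    show Module.Finite K (restrictTotalDegree (Fin 2) K T); infer_instance
  have hrk : ∀ T, 2 * finrank K (V T) = (T+1)*(T+2) := finrank_rtd
  let φ : (V (b+S) × V (a+S)) →ₗ[K] Mv 2 K :=
    (LinearMap.mulLeft K f ∘ₗ (V (b+S)).subtype).coprod (LinearMap.mulLeft K g ∘ₗ (V (a+S)).subtype)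
  have hφ : ∀ x, φ x = f * x.1.1 + g * x.2.1 := fun x => rfl
  have hf0 : f ≠ 0 := hi.ne_zero
  have hker : finrank K (LinearMap.ker φ) ≤ finrank K (V S) := by
    have hex : ∀ x : LinearMap.ker φ, ∃ w : V S, (x.1.2 : Mv 2 K) = f * w := by
      rintro ⟨⟨⟨u, hu⟩, ⟨v, hv⟩⟩, hx⟩
      rw [uy, hφ] at hx
      simp only at hx
      have hd : f ∣ g * v := ⟨-u, by linear_combination hx⟩
      obtain ⟨w, rfl⟩ := (hi.prime.dvd_or_dvd hd).resolve_left hg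
      refine ⟨⟨w, ?_⟩, rfl⟩
      rw [hV] at hv ⊢
      by_cases hw : w = 0
      · simp [hw]
      · rw [yf hf0 hw] at hv; omega
    choose w hw using hex
    let ψ : LinearMap.ker φ →ₗ[K] V S :=
      { toFun := w
        map_add' := fun x y => by
          apply kn; apply ya hf0
          have := hw (x+y); simp only [Submodule.coe_add, Prod.snd_add] at this
          rw [← this, hw, hw]; simp only [Submodule.coe_add]; ring
        map_smul' := fun c x => by
          apply kn; apply ya hf0
          have := hw (c • x); simp only [Submodule.coe_smul, Prod.smul_snd] at this
          rw [← this, hw]; simp }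
    apply LinearMap.finrank_le_finrank_of_injective (f := ψ)
    intro x y hxy
    have h0 : (x.1.2 : Mv 2 K) = y.1.2 := by
      rw [hw x, hw y, show w x = w y from hxy]
    have h3 : f * x.1.1.1 + g * x.1.2.1 = 0 := x.2
    have h4 : f * y.1.1.1 + g * y.1.2.1 = 0 := y.2
    have h5 := ya hf0 (show f * x.1.1.1 = f * y.1.1.1 by
      rw [h0] at h3; linear_combination h3 - h4)
    exact kn (Prod.ext (kn h5) (kn h0))
  have hr1 := LinearMap.finrank_range_add_finrank_ker φ
  rw [Module.finrank_prod] at hr1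
  let Λ' : V (a+b+S) →ₗ[K] (ι → K) := Λ ∘ₗ (V (a+b+S)).subtype
  have hΛ' : LinearMap.range Λ' = ⊤ := by
    rw [eq_top_iff, ← (Pi.basisFun K ι).span_eq, Submodule.span_le]
    rintro _ ⟨i, rfl⟩
    refine ⟨⟨q i, (hV _ _).mpr ?_⟩, by rw [Pi.basisFun_apply]; exact hq i⟩
    have : (q i).totalDegree ≤ S :=
      km (f := fun i => (q i).totalDegree) (yw i)
    omega
  have hr2 := LinearMap.finrank_range_add_finrank_ker Λ'
  rw [hΛ', finrank_top, jv] at hr2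
  have hle : finrank K (LinearMap.range φ) ≤ finrank K (LinearMap.ker Λ') := by
    rw [← Submodule.finrank_map_subtype_eq (V (a+b+S)) (LinearMap.ker Λ')]
    apply Submodule.finrank_mono
    rintro _ ⟨x, rfl⟩
    have hx1 := (hV _ _).mp x.1.2
    have hx2 := (hV _ _).mp x.2.2
    have hm : φ x ∈ V (a+b+S) := by
      rw [hV, hφ]
      refine (jj _ _).trans (vz ?_ ?_) <;>
        refine (ye _ _).trans ?_ <;> omega
    refine ⟨⟨φ x, hm⟩, ?_, rfl⟩
    show Λ (φ x) = 0
    rw [hφ, yo, h1, h2, qj]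
  have e1 := hrk (b+S)
  have e2 := hrk (a+S)
  have e3 := hrk S
  have e4 := hrk (a+b+S)
  nlinarith

lemma der_kill [Field K] (D : Derivation K (Mv 2 K) (Mv 2 K))
    (P : Fin 2 → K) (r : ℕ) : ∀ g v, (∀ i ≤ r, eval P (D^[i] g) = 0) → eval P (D^[r] (g * v)) = 0 := by
  induction r with
  | zero => intro g v h; have := h 0 kd; simp at this; simp [this]
  | succ r ih =>
    intro g v h
    rw [ju, D.leibniz, zc, zc,
      show ∀ x y, D^[r] (x + y) = D^[r] x + D^[r] y from fun x y => iterate_map_add D r x y, yo, ih g _ (fun i hi => h i (by omega)), xb v,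
      ih (D g) v (fun i hi => by rw [← ju]; exact h (i+1) (by omega)), qj]

lemma der_pow [Field K] (D : Derivation K (Mv 2 K) (Mv 2 K))
    (P : Fin 2 → K) (w : Mv 2 K) (hw : eval P w = 0) (r : ℕ) :
    ∀ h, (∀ j < r, eval P (D^[j] (w^r * h)) = 0) ∧
      eval P (D^[r] (w^r * h)) = (r.factorial : K) * eval P (D w) ^ r * eval P h := by
  induction r with
  | zero => intro h; simp
  | succ r ih =>
    intro h
    have key : ∀ j, D^[j+1] (w^(r+1) * h) = D^[j] (w^r * (((r:Mv 2 K)+1) * D w * h + w * D h)) := by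
      intro j
      rw [ju, D.leibniz, D.leibniz_pow]
      congr 1
      simp only [zc, uu, Nat.add_sub_cancel]; push_cast; ring
    refine ⟨fun j hj => ?_, ?_⟩
    · rcases j with _ | j
      · simp [hw]
      · rw [key]; exact (ih _).1 j (by omega)
    · rw [key, (ih _).2, Nat.factorial_succ]; simp [hw]; ring

noncomputable def cD [Field K] (f : Mv 2 K) :
    Derivation K (Mv 2 K) (Mv 2 K) :=
  pderiv 0 f • pderiv 1 - pderiv 1 f • pderiv 0

lemma cD_apply [Field K] (f g : Mv 2 K) :
    cD f g = pderiv 0 f * pderiv 1 g - pderiv 1 f * pderiv 0 g := rfl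

lemma cD_f_mul [Field K] (f u : Mv 2 K) (r : ℕ) :
    (cD f)^[r] (f * u) = f * (cD f)^[r] u := by
  induction r generalizing u with
  | zero => rfl
  | succ r ih =>
    rw [ju, ju, ← ih, uk]
    congr 1; simp only [cD_apply, zc]; ring

lemma bez [Field K] [DecidableEq K] {f g : Mv 2 K} (hi : Irreducible f)
    (hg : ¬ f ∣ g) (hb : g.totalDegree ≤ b) (M : ℕ) (Z : Finset (Fin 2 → K))
    (hf : ∀ P ∈ Z, eval P f = 0) (hgv : ∀ P ∈ Z, ∀ r < M, eval P ((cD f)^[r] g) = 0)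
    (hs : 1 < M → ∀ P ∈ Z, eval P (pderiv 0 f) ≠ 0) (hM : ∀ r < M, (r.factorial : K) ≠ 0) :
    Z.card * M ≤ f.totalDegree * b := by
  classical
  have hlin : ∀ r x y, (cD f)^[r] (x + y) = (cD f)^[r] x + (cD f)^[r] y :=
    fun r x y => iterate_map_add (cD f) r x y
  let Λ : Mv 2 K →ₗ[K] (Z × Fin M → K) := LinearMap.pi fun x =>
    (aeval (R := K) x.1.1).toLinearMap ∘ₗ (cD f).toLinearMap ^ x.2.1
  have hΛ : ∀ u x, Λ u x = eval x.1.1 ((cD f)^[x.2.1] u) := by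
    intro u x
    simp only [Λ, LinearMap.pi_apply, LinearMap.comp_apply, uw]; rfl
  have := bez0 hi hg hb Λ ?_ ?_ ?_
  · simpa using this
  · have hex : ∀ P : Z, ∀ P' : Z, ∃ l : Mv 2 K, eval P'.1 l = 0 ∧ (P' ≠ P → eval P.1 l ≠ 0) := by
      intro P P'
      by_cases h : P' = P
      · exact ⟨0, by simp, fun h' => absurd h h'⟩
      · have : ∃ i, P'.1 i ≠ P.1 i := by
          by_contra hc; push Not at hc; exact h (kn (funext hc))
        obtain ⟨i, hi'⟩ := this
        exact ⟨X i - C (P'.1 i), by simp, fun _ => by simpa [kp] using hi'.symm⟩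
    choose l hl hl' using hex
    have hsing : ∀ k (x : Z × Fin M), M ≤ x.2.1 + k → Pi.single x 1 ∈ LinearMap.range Λ := by
      intro k
      induction k with
      | zero => intro x hx; exact absurd x.2.2 (by omega)
      | succ k ih =>
        intro x hx
        set w : Mv 2 K := X 1 - C (x.1.1 1) with hw
        set hh := ∏ P' ∈ Finset.univ.erase x.1, l x.1 P' ^ M
        have hwe : eval x.1.1 w = 0 := by simp [hw]
        set u := w ^ x.2.1 * hh with hu
        have h1 := der_pow (cD f) x.1.1 w hwe x.2.1 hh
        have hDw : cD f w = pderiv 0 f := by simp [cD_apply, hw, pderiv_X]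
        have hc : Λ u x ≠ 0 := by
          rw [hΛ, hu, h1.2, hDw]
          refine xt (xt (hM _ x.2.2) ?_) ?_
          · rcases ub x.2.1 with h0 | h0
            · simp [h0]
            · exact vt _ (hs (by omega) _ x.1.2)
          · rw [map_prod, ud]
            intro P' hP'
            rw [map_pow]; exact vt _ (hl' _ _ (Finset.ne_of_mem_erase hP'))
        have hz : ∀ y, y ≠ x → M ≤ y.2.1 + k ∨ Λ u y = 0 := by
          intro y hy
          by_cases hP : y.1 = x.1
          · rcases lt_trichotomy y.2.1 x.2.1 with h | h | h
            · right; rw [hΛ, hP, hu]; exact h1.1 _ h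
            · exact absurd (Prod.ext hP (jo h)) hy
            · left; omega
          · right
            rw [hΛ, hu, show hh = l x.1 y.1 ^ M * _ from (Finset.mul_prod_erase (Finset.univ.erase x.1)
              (fun P' => l x.1 P' ^ M) (Finset.mem_erase.mpr ⟨hP, yw _⟩)).symm,
              mul_left_comm]
            exact (der_pow (cD f) y.1.1 _ (hl _ _) M _).1 _ y.2.2
        have hsum : Λ u = ∑ y, Λ u y • Pi.single y (1:K) := by
          ext y; simp [Finset.sum_apply, Pi.single_apply]
        rw [← Finset.add_sum_erase _ _ (yw x)] at hsum
        have hmem : Λ u x • (Pi.single x 1 : Z × Fin M → K) ∈ LinearMap.range Λ := by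
          rw [eq_sub_of_add_eq hsum.symm]
          refine Submodule.sub_mem _ ⟨u, rfl⟩ (Submodule.sum_mem _ fun y hy => ?_)
          rcases hz y (Finset.ne_of_mem_erase hy) with h | h
          · exact Submodule.smul_mem _ _ (ih y h)
          · rw [h, zero_smul]; exact Submodule.zero_mem _
        simpa [smul_smul, xi hc] using Submodule.smul_mem _ (Λ u x)⁻¹ hmem
    rw [← LinearMap.range_eq_top, eq_top_iff, ← (Pi.basisFun K (Z × Fin M)).span_eq, Submodule.span_le]
    rintro _ ⟨x, rfl⟩
    rw [Pi.basisFun_apply]; exact hsing M x (by omega)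
  · intro u; ext x; rw [hΛ, cD_f_mul]; simp [hf _ x.1.2]
  · intro u; ext x; rw [hΛ]
    exact der_kill _ _ _ _ _ fun i hi => hgv _ x.1.2 i (by omega)

lemma bez1 [Field K] [DecidableEq K] {f g : Mv 2 K} (hi : Irreducible f)
    (hg : ¬ f ∣ g) (hb : g.totalDegree ≤ b) (Z : Finset (Fin 2 → K))
    (hf : ∀ P ∈ Z, eval P f = 0) (hgv : ∀ P ∈ Z, eval P g = 0) : Z.card ≤ f.totalDegree * b := by
  simpa using bez hi hg hb 1 Z hf (fun P hP r hr => by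
    obtain rfl : r = 0 := by omega
    exact hgv P hP) (by simp) (by simp)

lemma ym_ne [CommSemiring K] {f : Mv (n+1) K} (h : YM d f) :
    f ≠ 0 := fun h0 => h.2 (by simp [h0])

lemma ndvd [CommRing K] [IsDomain K] {f g : Mv (n+1) K}
    (h : YM d f) (hg : g ≠ 0) (hd : g.degreeOf 0 < d) : ¬ f ∣ g := by
  rintro ⟨c, rfl⟩
  rw [degreeOf_mul_eq (ym_ne h) (yi hg), ← vd f, ym_deg h] at hd
  omega

lemma ym_td [CommSemiring K] {f : Mv (n+1) K} (h : YM d f) :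
    f.totalDegree = d := by
  refine le_antisymm h.1 ?_
  have := xg (yp.mpr h.2)
  simpa using this

lemma td_map [Field K] [Field L] (φ : K →+* L)
    (f : MvPolynomial σ K) : (map φ f).totalDegree = f.totalDegree := by
  rw [totalDegree, totalDegree, support_map_of_injective _ φ.injective]

lemma td_pderiv [CommRing K] (i : σ) (f : MvPolynomial σ K) :
    (pderiv i f).totalDegree ≤ f.totalDegree - 1 := by
  refine Finset.sup_le fun m hm => ?_
  rw [yp, coeff_pderiv] at hm
  have := xg (yp.mpr (xl hm))
  rw [Finsupp.sum_add_index' (by simp) (by simp), Finsupp.sum_single_index (by simp)] at this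
  omega

lemma irr_of_map [Field K] [Field L] (φ : K →+* L)
    {f : MvPolynomial σ K} (h : Irreducible (map φ f)) : Irreducible f := by
  have hu : ∀ g : MvPolynomial σ K, IsUnit (map φ g) → IsUnit g := by
    intro g hg
    rw [MvPolynomial.isUnit_iff_totalDegree_of_isReduced] at hg ⊢
    rw [td_map, xf] at hg
    exact ⟨zl.mpr fun h0 => hg.1.ne_zero (by simp [h0]), hg.2⟩
  refine ⟨fun hf => h.not_isUnit (hf.map (map φ)), fun a b e => ?_⟩
  have := h.isUnit_or_isUnit (a := map φ a) (b := map φ b) (by rw [e, zw])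
  exact this.imp (hu _) (hu _)

lemma ym_map [Field K] [Field L] (φ : K →+* L)
    {f : Mv (n+1) K} (h : YM d f) : YM d (map φ f) :=
  ⟨(td_map _ _).trans_le h.1, by rw [xf]; simpa using h.2⟩

lemma fy_spec [CommRing K] [IsDomain K] {f : Mv (n+1) K}
    (hd : 1 ≤ d) (h : YM d f) (hk : (d : K) ≠ 0) :
    ¬ f ∣ pderiv 0 f ∧ (pderiv 0 f).totalDegree ≤ d := by
  have h0 : pderiv 0 f ≠ 0 := by
    intro e
    have := congrArg (coeff (single 0 (d-1))) e
    rw [coeff_pderiv, ← Finsupp.single_add, Nat.sub_add_cancel hd] at this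
    simp only [Finsupp.single_eq_same, coeff_zero, vy] at this
    rcases this with h' | h'
    · exact h.2 h'
    · apply hk; have : ((d - 1 : ℕ) : K) + 1 = ((d - 1 + 1 : ℕ) : K) := by push_cast; rfl
      rw [this, Nat.sub_add_cancel hd] at h'; exact h'
  have h1 : (pderiv 0 f).totalDegree ≤ f.totalDegree - 1 := td_pderiv _ _
  rw [ym_td h] at h1
  exact ⟨ndvd h h0 (yj (yn _ _) (by omega)), by omega⟩

lemma cD_td [Field K] {f : Mv 2 K} (h : f.totalDegree ≤ d)
    (g : Mv 2 K) (r : ℕ) : ((cD f)^[r] g).totalDegree ≤ g.totalDegree + r * d := by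
  induction r with
  | zero => simp
  | succ r ih =>
    rw [vg, cD_apply]
    have h1 := fun i => td_pderiv i f
    have h2 := fun i => td_pderiv i ((cD f)^[r] g)
    have e : g.totalDegree + (r+1) * d = g.totalDegree + r * d + d := by ring
    refine (totalDegree_sub _ _).trans (vz ?_ ?_) <;> refine (ye _ _).trans ?_
    · have := h1 0; have := h2 1; omega
    · have := h1 1; have := h2 0; omega

lemma cD_map [Field K] [Field L] (φ : K →+* L) (f g : Mv 2 K) (r : ℕ) :
    map φ ((cD f)^[r] g) = (cD (map φ f))^[r] (map φ g) := by
  induction r with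
  | zero => rfl
  | succ r ih =>
    rw [vg, vg, cD_apply, cD_apply, ← ih]
    simp only [map_sub, zw, pderiv_map]

lemma cD_pth [Field K] (p : ℕ) [CharP K p] (f c b : Mv 2 K) (r : ℕ) :
    (cD f)^[r] (b * c^p) = (cD f)^[r] b * c^p := by
  induction r with
  | zero => rfl
  | succ r ih =>
    rw [vg, vg, ih, uk,
      Derivation.leibniz_pow]
    simp [xb]

noncomputable def ex2 (l : Fin a × Fin b) : Fin 2 →₀ ℕ :=
  single 0 l.1.1 + single 1 l.2.1

lemma ex2_inj : Injective (ex2 : Fin a × Fin b → _) := by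
  intro l l' e
  have h0 := yb e 0
  have h1 := yb e 1
  simp [ex2] at h0 h1
  exact Prod.ext (jo h0) (jo h1)

lemma comb_spec [Field K] (c : Fin a × Fin (b+1) → K) (l : Fin a × Fin (b+1)) (hc : c l ≠ 0) :
    (∑ l, monomial (ex2 l) (c l)) ≠ 0 ∧ (∑ l, monomial (ex2 l) (c l)).degreeOf 0 < a ∧
    (∑ l, monomial (ex2 l) (c l)).totalDegree ≤ a + b := by
  classical
  refine ⟨fun h => hc ?_, ?_, ?_⟩
  · have := congrArg (coeff (ex2 l)) h
    rw [ug, yh l] at this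
    · simpa using this
    · intro l' _ hne; rw [coeff_monomial, ji fun e => hne (ex2_inj e)]
    · simp
  · refine yj (degreeOf_sum_le _ _ _) ((Finset.sup_lt_iff ?_).mpr fun x _ => ?_)
    · exact yj (kc _) l.1.2
    · by_cases h : c x = 0
      · simpa [h] using l.1.pos
      · rw [degreeOf_monomial_eq _ _ h]; simp [ex2, x.1.2]
  · refine yy fun x _ => (xu _ _).trans ?_
    have := x.1.2; have := x.2.2
    simp only [ex2]; rw [kg _ _ (by simp)]; simp; omega

lemma fr_pi {X : Type*} [Field K] [AddCommGroup X] [Module K X] [Module.Finite K X] (M : ℕ) :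
    finrank K (Fin M → X) = M * finrank K X := by
  rw [Module.finrank_pi_fintype]; simp

lemma siegel_f [Field K] {f : Mv 2 K} (h : YM d f)
    (hT : d ≤ T) [Fintype ι] (w : Fin M → ι → Mv 2 K)
    (hw : ∀ r x, (w r x).totalDegree ≤ T) (hc : M * (d * (T + 2)) < Fintype.card ι) :
    ∃ z : ι → K, z ≠ 0 ∧ ∀ r, f ∣ ∑ x, C (z x) * w r x := by
  classical
  obtain ⟨S, rfl⟩ := Nat.exists_eq_add_of_le hT
  let V := restrictTotalDegree (Fin 2) K (d+S)
  let V' := restrictTotalDegree (Fin 2) K S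
  let μ : V' →ₗ[K] V := LinearMap.codRestrict V (LinearMap.mulLeft K f ∘ₗ V'.subtype) fun c => by
    have := (mem_restrictTotalDegree _ _ _).mp c.2
    rw [mem_restrictTotalDegree]
    exact (ye _ _).trans (yq h.1 this)
  have hμ : Injective μ := by
    intro x y e
    have e' : f * x.1 = f * y.1 := congrArg Subtype.val e
    exact kn (ya (ym_ne h) e')
  let W := LinearMap.range μ
  have hW : finrank K W = finrank K V' := LinearMap.finrank_range_of_inj hμ
  let ψ : (ι → K) →ₗ[K] (Fin M → V ⧸ W) := LinearMap.pi fun r => W.mkQ ∘ₗ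
    (∑ x, (LinearMap.proj x).smulRight (⟨w r x, (mem_restrictTotalDegree _ _ _).mpr (hw r x)⟩ : V))
  have hrk : finrank K (Fin M → V ⧸ W) < finrank K (ι → K) := by
    rw [fr_pi, jv]
    refine yj (zx M ?_) hc
    have e1 := Submodule.finrank_quotient_add_finrank W
    rw [hW] at e1
    have e2 : 2 * finrank K V = _ := finrank_rtd (d+S)
    have e3 : 2 * finrank K V' = _ := finrank_rtd S
    nlinarith
  obtain ⟨z, hz, hz0⟩ := (Submodule.ne_bot_iff _).mp (LinearMap.ker_ne_bot_of_finrank_lt hrk (f := ψ))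
  refine ⟨z, hz0, fun r => ?_⟩
  have h1 : W.mkQ ((∑ x, (LinearMap.proj x).smulRight
      (⟨w r x, (mem_restrictTotalDegree _ _ _).mpr (hw r x)⟩ : V)) z) = 0 := congrFun hz r
  rw [Submodule.mkQ_apply, Submodule.Quotient.mk_eq_zero] at h1
  obtain ⟨c, hc⟩ := h1
  refine ⟨c.1, ?_⟩
  have := congrArg Subtype.val hc
  rw [show (μ c).1 = f * c.1 from rfl] at this
  rw [this]
  simp [LinearMap.sum_apply, xn]

lemma curve_pt [Field Ω] [IsAlgClosed Ω] (hd : 1 ≤ d)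
    {f g : Mv (n+1) Ω} (h : YM d f) (hi : Irreducible f) (hg : ¬ f ∣ g) :
    ∃ P, eval P f = 0 ∧ eval P g ≠ 0 := by
  classical
  obtain ⟨R, hR, -, hv⟩ := elim hd h hi hg kd
  have hinf : Infinite Ω := IsAlgClosed.instInfinite
  obtain ⟨x, hx⟩ : ∃ x, eval x R ≠ 0 := by
    by_contra hc; push Not at hc; exact hR (jc (by simpa using hc))
  set q := (finSuccEquiv Ω n f).map (eval x) with hq
  have hqd : q.degree ≠ 0 := by
    have : q.coeff d ≠ 0 := by rw [hq, jx, ym_coeff h.1]; simpa using h.2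
    have := Polynomial.le_degree_of_ne_zero this
    intro e; rw [e] at this; norm_cast at this; omega
  obtain ⟨y, hy⟩ := IsAlgClosed.exists_root q hqd
  have hy' : eval (cons y x : Fin (n+1) → Ω) f = 0 := by
    rw [← eval_cons_fin]; simpa [ks] using hy
  refine ⟨cons y x, hy', fun h0 => hx ?_⟩
  have := hv _ hy' h0
  rwa [ks] at this

lemma stepanov1 [Fact p.Prime] (hd : 1 ≤ d) (hL : 1 ≤ L)
    (hA : A = L * (L + 4 + 2 * d + d * d * L)) (hp : d * (A + d) + 1 ≤ p)
    (f : Mv 2 (ZMod p)) (h : YM d f)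
    (hi : Irreducible (map (algebraMap (ZMod p) (AlgebraicClosure (ZMod p))) f))
    (Z : Finset (Fin 2 → ZMod p)) (hZ : ∀ P ∈ Z, eval P f = 0 ∧ eval P (pderiv 0 f) ≠ 0) :
    Z.card * (d * L) ≤ d * ((d + A) + p * (d + (L + 1))) := by
  classical
  set Ω := AlgebraicClosure (ZMod p)
  set φ := algebraMap (ZMod p) Ω
  have hfi : Irreducible f := irr_of_map φ hi
  have : CharP Ω p := charP_of_injective_algebraMap φ.injective p
  have hfac : ∀ r < p, (r.factorial : ZMod p) ≠ 0 := fun r hr h0 => by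
    rw [jk, (Fact.out : p.Prime).dvd_factorial] at h0; omega
  have hdp : d < p := by nlinarith
  have hM : d * L < p := by
    have : L ≤ A := by rw [hA]; exact Nat.le_mul_of_pos_right _ (by omega)
    nlinarith
  let b : Fin d × Fin (A+1) → Mv 2 (ZMod p) := fun l => monomial (ex2 l) 1
  let a : Fin d × Fin (L+1+1) → Mv 2 (ZMod p) := fun l => monomial (ex2 l) 1
  have hb : ∀ l, (b l).totalDegree ≤ d + A := fun l => (xu _ _).trans (by
    have := l.1.2; have := l.2.2
    simp only [ex2]; rw [kg _ _ (by simp)]; simp; omega)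
  have ha : ∀ l, (a l).totalDegree ≤ d + (L + 1) := fun l => (xu _ _).trans (by
    have := l.1.2; have := l.2.2
    simp only [ex2]; rw [kg _ _ (by simp)]; simp; omega)
  obtain ⟨z, hz, hz'⟩ := siegel_f (M := d * L) (T := d + A + d * L * d + (d + (L+1))) h (by omega)
    (fun (r : Fin (d * L)) (x : (Fin d × Fin (A+1)) × (Fin d × Fin (L+1+1))) => (cD f)^[r.1] (b x.1) * a x.2)
    (fun r x => by
      refine (ye _ _).trans (yq ((cD_td h.1 _ _).trans ?_) (ha _))
      exact yq (hb _) (zv _ r.2.le)) (by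
      simp only [Fintype.card_prod, Fintype.card_fin]
      have : d * (A + 1) * (d * (L+1+1)) = d * L * (d * (A + 1)) + d * d * (2 * (A+1)) := by ring
      rw [this]
      have : d * L * (d * (d + A + d * L * d + (d + (L+1)) + 2)) =
        d * L * (d * (A+1)) + d * d * (L * (L + 2 + 2 * d + d * d * L)) := by ring
      rw [this, hA]
      have : 0 < d * d := by positivity
      refine Nat.add_lt_add_left (Nat.mul_lt_mul_of_pos_left ?_ this) _
      have : L * (L + 2 + 2 * d + d * d * L) ≤ L * (L + 4 + 2 * d + d * d * L) :=
        zx _ (by omega)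
      omega)
  set Φ := ∑ x, C (z x) * (b x.1 * a x.2 ^ p) with hΦ
  have hlin : ∀ (r : ℕ) {ι : Type} [Fintype ι] (c : ι → ZMod p) (v : ι → Mv 2 (ZMod p)),
      (cD f)^[r] (∑ x, C (c x) * v x) = ∑ x, C (c x) * (cD f)^[r] (v x) := by
    intro r ι _ c v
    have := vm ((cD f).toLinearMap ^ r) (fun x => c x • v x) Finset.univ
    simp only [uw, map_smul] at this
    simp only [xn]
    exact this
  have hDΦ : ∀ r, (cD f)^[r] Φ = ∑ x, C (z x) * ((cD f)^[r] (b x.1) * a x.2 ^ p) := by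
    intro r; rw [hΦ, hlin]; simp only [cD_pth p]
  have hΦd : Φ.totalDegree ≤ (d + A) + p * (d + (L+1)) := by
    refine yy fun x _ => ?_
    rw [xn]
    refine (yv _ _).trans ((ye _ _).trans (yq (hb _) ?_))
    exact (totalDegree_pow _ _).trans (zx _ (ha _))
  have hnd : ¬ f ∣ Φ := by
    intro hdv
    obtain ⟨x0, hx0⟩ := Function.ne_iff.mp hz
    set α : Fin d × Fin (A+1) → Mv 2 (ZMod p) :=
      fun l => ∑ m, monomial (ex2 m) (z (l, m)) with hα
    have hα0 := comb_spec (fun m => z (x0.1, m)) x0.2 hx0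
    have hΦα : Φ = ∑ l, b l * α l ^ p := by
      rw [hΦ, un]
      refine zs rfl fun l _ => ?_
      rw [hα, sum_pow_char, yu]
      refine zs rfl fun m _ => ?_
      simp only [a]
      rw [show monomial (ex2 m) (z (l, m)) = C (z (l,m)) * monomial (ex2 m) 1 by
        rw [C_mul_monomial, qu], kr, ← C_pow, ZMod.pow_card]
      ring
    have hY := ym_map φ h
    have hn1 : ¬ map φ f ∣ map φ (α x0.1) := by
      refine ndvd hY (fun h0 => hα0.1 (map_injective φ φ.injective (by rw [zp]; exact h0))) ?_
      have : (map φ (α x0.1)).degreeOf 0 ≤ (α x0.1).degreeOf 0 := by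
        rw [degreeOf_eq_sup, degreeOf_eq_sup, support_map_of_injective _ φ.injective]
      exact yj this hα0.2.1
    have hk : ((d : ℕ) : Ω) ≠ 0 := by
      rw [Ne, CharP.cast_eq_zero_iff Ω p]; exact fun hh => absurd (xm hd hh) (by omega)
    have hn2 := (fy_spec hd hY hk).1
    obtain ⟨P, hP, hP'⟩ := curve_pt hd hY hi (g := pderiv 0 (map φ f) * map φ (α x0.1))
      (fun hh => (hi.prime.dvd_or_dvd hh).elim hn2 hn1)
    rw [zw] at hP'
    have hfy := xl hP'
    set c : Fin d × Fin (A+1) → Ω := fun l => eval P (map φ (α l)) ^ p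
    have hc := comb_spec c x0.1 (vt _ (yi hP'))
    set β := ∑ l, monomial (ex2 l) (c l) with hβ
    have hnβ : ¬ map φ f ∣ β := ndvd hY hc.1 hc.2.1
    have hD : ∀ r, eval P ((cD (map φ f))^[r] β) = 0 := by
      intro r
      have e1 : eval P ((cD (map φ f))^[r] (map φ Φ)) = 0 := by
        obtain ⟨q, hq⟩ := hdv
        rw [hq, zw, cD_f_mul, zw, hP, zero_mul]
      have e2 := fun v : Fin d × Fin (A+1) → Mv 2 Ω =>
        vm ((cD (map φ f)).toLinearMap ^ r) v Finset.univ
      simp only [uw] at e2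
      have e3 : ∀ l, monomial (ex2 l) (c l) = c l • map φ (b l) := by
        intro l; simp [b, smul_monomial]
      have e4 : ∀ (t : Ω) u, (cD (map φ f))^[r] (t • u) = t • (cD (map φ f))^[r] u := fun t u => by
        have := map_smul ((cD (map φ f)).toLinearMap ^ r) t u
        simp only [uw] at this
        exact this
      rw [← e1, hΦα, hβ, vm]
      erw [e2, e2]
      rw [vm, vm]
      refine zs rfl fun l _ => ?_
      erw [e3, e4]
      rw [zw, map_pow]
      erw [cD_pth p]
      rw [zw, map_pow, smul_eval, xb]
    have := bez hi hnβ hc.2.2 (d * (d + A) + 1) {P} (by simpa using hP) (by simpa using fun r _ => hD r)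
      (fun _ P' hP' => by rw [kt.mp hP']; exact hfy) (fun r hr => by
        have := hfac r (vl hr (by rw [add_comm d A]; exact hp))
        exact fun h0 => this (φ.injective (by rw [map_natCast, zp]; exact h0)))
    rw [ym_td hY] at this
    simp at this
  have := bez hfi hnd hΦd (d * L) Z (fun P hP => (hZ P hP).1) (fun P hP r hr => by
    obtain ⟨q, hq⟩ := hz' ⟨r, hr⟩
    have e : eval P ((cD f)^[r] Φ) = eval P (∑ x, C (z x) * ((cD f)^[r] (b x.1) * a x.2)) := by
      rw [hDΦ, vm, vm]
      refine zs rfl fun x _ => ?_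
      simp [ZMod.pow_card]
    rw [e, hq, zw, (hZ P hP).1, zero_mul]) (fun _ P hP => (hZ P hP).2)
    (fun r hr => hfac r (hr.trans hM))
  rwa [ym_td h] at this

lemma stepanov (d L : ℕ) (hd : 1 ≤ d) (hL : 1 ≤ L) : ∃ C : ℕ, ∀ (p : ℕ) [Fact p.Prime]
    (f : Mv 2 (ZMod p)), YM d f →
    Irreducible (map (algebraMap (ZMod p) (AlgebraicClosure (ZMod p))) f) →
    ∀ Z : Finset (Fin 2 → ZMod p), (∀ P ∈ Z, eval P f = 0) →
      L * Z.card ≤ (L + d + 1) * p + C := by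
  classical
  obtain ⟨A, hA⟩ : ∃ A, A = L * (L + 4 + 2 * d + d * d * L) := ⟨_, rfl⟩
  refine ⟨L * (d * d) + (d + A) + L * (d * (A + d) + 1)^2, ?_⟩
  intro p _ f h hi Z hZ
  by_cases hp : d * (A + d) + 1 ≤ p
  · have h1 := stepanov1 hd hL hA hp f h hi (Z.filter fun P => eval P (pderiv 0 f) ≠ 0) (by
      intro P hP; rw [zz] at hP; exact ⟨hZ P hP.1, hP.2⟩)
    have hk : ((d : ℕ) : ZMod p) ≠ 0 := by
      rw [Ne, jk]; intro hh; have := xm hd hh; nlinarith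
    have hfy := fy_spec hd h hk
    have h2 := bez1 (irr_of_map _ hi) hfy.1 hfy.2 (Z.filter fun P => ¬ eval P (pderiv 0 f) ≠ 0)
      (fun P hP => hZ P (zz.mp hP).1)
      (fun P hP => by simpa using (zz.mp hP).2)
    rw [ym_td h] at h2
    have h3 := zn (s := Z) (fun P => eval P (pderiv 0 f) ≠ 0)
    rw [← h3]
    rw [mul_left_comm] at h1
    have h4 := Nat.le_of_mul_le_mul_left h1 hd
    nlinarith
  · have : Z.card ≤ p^2 := (Finset.card_le_univ _).trans (by simp [ku])
    have : p ≤ d * (A+d) + 1 := by omega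
    have : Z.card ≤ (d * (A + d) + 1)^2 := by nlinarith
    nlinarith

noncomputable def exf (s : Fin (n+1) → Fin (d+1)) : Fin (n+1) →₀ ℕ :=
  Finsupp.equivFunOnFinite.symm fun i => (s i : ℕ)

lemma exf_inj : Injective (exf : (Fin (n+1) → Fin (d+1)) → _) := by
  intro s t h
  funext i
  exact jo (by simpa [exf] using yb h i)

lemma exf_surj (m : Fin (n+1) →₀ ℕ) (h : m.degree ≤ d) :
    ∃ s : Fin (n+1) → Fin (d+1), exf s = m :=
  ⟨fun i => ⟨m i, Nat.lt_succ_of_le ((Finsupp.le_degree i m).trans h)⟩, by ext i; simp [exf]⟩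

def Ix (n d : ℕ) : Type := {s : Fin (n+1) → Fin (d+1) // (exf s).degree ≤ d ∧ exf s ≠ single 0 d}

noncomputable instance (n d : ℕ) : Fintype (Ix n d) := by
  classical exact (inferInstance : Fintype {s : Fin (n+1) → Fin (d+1) // (exf s).degree ≤ d ∧ exf s ≠ single 0 d})

noncomputable def GM [CommSemiring R] (d : ℕ) (c : Ix n d → R) :
    Mv (n+1) R := monomial (single 0 d) 1 + ∑ s, monomial (exf s.1) (c s)

lemma gm_lead [CommSemiring R] (d : ℕ) (c : Ix n d → R) :
    coeff (single 0 d) (GM d c) = 1 := by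
  classical
  simp only [GM, coeff_add, ug, coeff_monomial, if_true]
  rw [jq, qj]
  intro s _
  exact ji s.2.2

lemma gm_coeff [CommSemiring R] (d : ℕ) (c : Ix n d → R) (s : Ix n d) :
    coeff (exf s.1) (GM d c) = c s := by
  classical
  simp only [GM, coeff_add, ug, coeff_monomial]
  rw [ji s.2.2.symm, zero_add, yh s]
  · simp
  · intro t _ ht; exact ji fun h => ht (kn (exf_inj h))
  · simp

lemma gm_td [CommSemiring R] (d : ℕ) (c : Ix n d → R) :
    (GM d c).totalDegree ≤ d := by
  refine (jj _ _).trans (vz ((xu _ _).trans (by simp)) ?_)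
  refine yy fun s _ => (xu _ _).trans ?_
  exact s.2.1

lemma gm_map [CommSemiring R] [CommSemiring S] (φ : R →+* S) (d : ℕ)
    (c : Ix n d → R) : map φ (GM d c) = GM d (fun s => φ (c s)) := by
  simp [GM, map_monomial]

lemma gm_cf [CommSemiring R] {f : Mv (n+1) R}
    (hf : f.totalDegree ≤ d) (h1 : coeff (single 0 d) f = 1) :
    f = GM d (fun s : Ix n d => coeff (exf s.1) f) := by
  classical
  ext m
  by_cases h : m = single 0 d
  · rw [h, h1, gm_lead]
  by_cases hm : m.degree ≤ d
  · obtain ⟨s, rfl⟩ := exf_surj m hm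
    exact (gm_coeff d (fun s : Ix n d => coeff (exf s.1) f) ⟨s, hm, h⟩).symm
  · have hm' : d < m.degree := not_le.mp hm
    rw [vc, vc]
    · exact yj (gm_td _ _) hm'
    · exact yj hf hm'

lemma lead_mul [CommRing R] {p q : Mv (n+1) R}
    (hp : p.totalDegree ≤ a) (hq : q.totalDegree ≤ b) :
    coeff (single 0 (a+b)) (p*q) = coeff (single 0 a) p * coeff (single 0 b) q := by
  have h := ym_coeff ((ye p q).trans (yq hp hq))
  have e : ∀ {c} {p : Mv (n+1) R}, p.totalDegree ≤ c → (finSuccEquiv R n p).natDegree ≤ c :=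
    fun h => by rw [vd]; exact (yn _ _).trans h
  rw [zw, Polynomial.coeff_mul_add_eq_of_natDegree_le (e hp) (e hq), ym_coeff hp, ym_coeff hq, ← C_mul] at h
  exact (C_injective _ _ h).symm

lemma lift_int {R A K : Type} [CommRing R] [CommRing A] [Field K] [IsAlgClosed K]
    (θ : R →+* A) (hθ : θ.IsIntegral) (c : R →+* K) (h : RingHom.ker θ ≤ RingHom.ker c) :
    ∃ ψ : A →+* K, ψ.comp θ = c := by
  algebraize [θ]
  have hP : (RingHom.ker c).IsPrime := RingHom.ker_isPrime c
  obtain ⟨Q, -, hQ, hQP⟩ := Ideal.exists_ideal_over_prime_of_isIntegral (S := A) (RingHom.ker c) ⊥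
    (by rwa [← RingHom.ker_eq_comap_bot])
  have : Algebra.IsIntegral R A := ⟨hθ⟩
  have hlo : Q.LiesOver (RingHom.ker c) := ⟨hQP.symm⟩
  let k : R ⧸ RingHom.ker c →+* K := RingHom.kerLift c
  let _ := k.toAlgebra
  have : Module.IsTorsionFree (R ⧸ RingHom.ker c) K :=
    Module.isTorsionFree_iff_algebraMap_injective.mpr (RingHom.kerLift_injective c)
  have : Module.IsTorsionFree (R ⧸ RingHom.ker c) (A ⧸ Q) :=
    Module.isTorsionFree_iff_algebraMap_injective.mpr (FaithfulSMul.algebraMap_injective _ _)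
  have : Algebra.IsIntegral (R ⧸ RingHom.ker c) (A ⧸ Q) := Ideal.Quotient.algebra_isIntegral_of_liesOver _ _
  let ψ : A ⧸ Q →ₐ[R ⧸ RingHom.ker c] K := IsAlgClosed.lift
  refine ⟨ψ.toRingHom.comp (Ideal.Quotient.mk Q), RingHom.ext fun x => ?_⟩
  have := ψ.commutes (Ideal.Quotient.mk _ x)
  exact this

/-- the universal factorisation map -/
noncomputable def fmul [CommRing R] (c : Ix n a ⊕ Ix n b → R) :
    Mv (n+1) R := GM a (fun s => c (Sum.inl s)) * GM b (fun s => c (Sum.inr s))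

lemma fmul_map [CommRing R] [CommRing S] (φ : R →+* S)
    (c : Ix n a ⊕ Ix n b → R) : map φ (fmul c) = fmul (fun s => φ (c s)) := by
  simp [fmul, gm_map]

lemma fmul_cf [CommRing R] (hd : a + b = d) (c : Ix n a ⊕ Ix n b → R) :
    fmul c = GM d (fun s => coeff (exf s.1) (fmul c)) := by
  subst hd
  exact gm_cf ((ye _ _).trans (yq (gm_td _ _) (gm_td _ _)))
    (by rw [fmul, lead_mul (gm_td _ _) (gm_td _ _), gm_lead, gm_lead, qu])

noncomputable def thet (n a b d : ℕ) : MvPolynomial (Ix n d) ℤ →+* MvPolynomial (Ix n a ⊕ Ix n b) ℤ :=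
  (aeval (fun s : Ix n d => coeff (exf s.1) (fmul (X : Ix n a ⊕ Ix n b → MvPolynomial _ ℤ)))).toRingHom

lemma gm_monic [CommRing R] (c : Ix n d → R) :
    (finSuccEquiv R n (GM d c)).Monic := by
  refine vx d ?_ ?_
  · rw [vd]; exact (yn _ _).trans (gm_td _ _)
  · rw [ym_coeff (gm_td _ _), gm_lead, C_1]

lemma fse_map [CommRing R] [CommRing S] (φ : R →+* S)
    (f : Mv (n+1) R) :
    finSuccEquiv S n (map φ f) = (finSuccEquiv R n f).map (map φ) := by
  ext i m
  simp [finSuccEquiv_coeff_coeff, xf]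

attribute [local instance] MvPolynomial.algebraMvPolynomial in
lemma int_of_dvd [CommRing R] [CommRing S] (φ : R →+* S)
    (c : Ix n d → R) (u : Ix n e → S) (h : GM e u ∣ map φ (GM d c)) (s : Ix n e) :
    φ.IsIntegralElem (u s) := by
  algebraize [φ]
  have h1 : finSuccEquiv S n (GM e u) ∣ (finSuccEquiv R n (GM d c)).map
      (algebraMap (Mv n R) (Mv n S)) := by
    have := map_dvd (finSuccEquiv S n) h
    rwa [fse_map] at this
  have h2 := Polynomial.isIntegral_coeff_of_dvd _ _ (gm_monic c) (gm_monic u) h1 (exf s.1 0)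
  have h3 := MvPolynomial.isIntegral_iff_isIntegral_coeff.mp h2 (exf s.1).tail
  rw [finSuccEquiv_coeff_coeff, Finsupp.cons_tail, gm_coeff] at h3
  exact h3

lemma thet_int (n : ℕ) (hd : a + b = d) : (thet n a b d).IsIntegral := by
  have e : fmul (X : Ix n a ⊕ Ix n b → MvPolynomial _ ℤ) = map (thet n a b d) (GM d X) := by
    rw [gm_map]; conv_lhs => rw [fmul_cf hd]
    congr 1; funext s; simp [thet]
  have hs : ∀ s, (thet n a b d).IsIntegralElem (X s) := by
    rintro (s | s)
    · exact int_of_dvd (thet n a b d) X (fun s => X (Sum.inl s)) (by rw [← e]; exact dvd_mul_right _ _) s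
    · exact int_of_dvd (thet n a b d) X (fun s => X (Sum.inr s)) (by rw [← e]; exact dvd_mul_left _ _) s
  intro x
  induction x using za with
  | C z =>
    have : (C z : MvPolynomial (Ix n a ⊕ Ix n b) ℤ) = thet n a b d (C z) := by simp [thet]
    rw [this]; exact RingHom.isIntegralElem_map _
  | add p q hp hq => exact hp.add _ hq
  | mul_X p s hp => exact hp.mul _ (hs s)

lemma noe1 {K : Type} [Field K] [IsAlgClosed K] (hd : a + b = d) (c : Ix n d → K) :
    (∃ u : Ix n a ⊕ Ix n b → K, GM d c = fmul u) ↔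
    RingHom.ker (thet n a b d) ≤ RingHom.ker (aeval c : _ →ₐ[ℤ] K).toRingHom := by
  constructor
  · rintro ⟨u, hu⟩
    have : (aeval c : _ →ₐ[ℤ] K).toRingHom = (aeval u : _ →ₐ[ℤ] K).toRingHom.comp (thet n a b d) := by
      refine js (by simp [thet]) fun s => ?_
      have e : map (aeval u : _ →ₐ[ℤ] K).toRingHom (fmul (X : Ix n a ⊕ Ix n b → MvPolynomial _ ℤ)) = fmul u := by
        rw [fmul_map]; simp
      have e2 := congrArg (coeff (exf s.1)) e
      rw [xf, ← hu, gm_coeff] at e2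
      simpa [thet] using e2.symm
    rw [this]
    intro x hx
    rw [RingHom.mem_ker] at hx ⊢
    rw [RingHom.comp_apply, hx, zp]
  · intro h
    obtain ⟨ψ, hψ⟩ := lift_int _ (thet_int n hd) _ h
    refine ⟨fun s => ψ (X s), ?_⟩
    rw [← fmul_map, fmul_cf hd, gm_map]
    congr 1; funext s
    have := congrArg (fun g => g (X s)) hψ
    simpa [thet] using this.symm

lemma gm_irr {K : Type} [Field K] (hd : 1 ≤ d) (c : Ix n d → K) :
    ¬ Irreducible (GM d c) ↔ ∃ a b, a + b = d ∧ 1 ≤ a ∧ 1 ≤ b ∧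
      ∃ u : Ix n a ⊕ Ix n b → K, GM d c = fmul u := by
  have hunit : ∀ {e : ℕ} (v : Ix n e → K), 1 ≤ e → ¬ IsUnit (GM e v) := by
    intro e v he hu
    have h1 : (GM e v).totalDegree = e := ym_td ⟨gm_td _ _, by rw [gm_lead]; exact kl⟩
    obtain ⟨z, hz, e⟩ := vf.mp hu
    rw [e, totalDegree_C] at h1; omega
  have hne : GM d c ≠ 0 := fun h0 => by have := gm_lead d c; rw [h0] at this; simp at this
  constructor
  · intro h
    rw [irreducible_iff] at h
    push Not at h
    obtain ⟨p, q, hpq, hp, hq⟩ := h (hunit c hd)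
    have hp0 : p ≠ 0 := fun h0 => hne (by rw [hpq, h0, zero_mul])
    have hq0 : q ≠ 0 := fun h0 => hne (by rw [hpq, h0, mul_zero])
    have htd : p.totalDegree + q.totalDegree = d := by
      rw [← yf hp0 hq0, ← hpq]
      exact ym_td ⟨gm_td _ _, by rw [gm_lead]; exact kl⟩
    have hpos : ∀ p : Mv (n+1) K, p ≠ 0 → ¬ IsUnit p → 1 ≤ p.totalDegree := by
      intro p hp0 hp
      by_contra hh
      have e := yg.mp (show p.totalDegree = 0 by omega)
      refine hp (e ▸ (IsUnit.map C (zl.mpr fun h0 => hp0 ?_)))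
      rw [e, h0, C_0]
    refine ⟨_, _, htd, hpos p hp0 hp, hpos q hq0 hq, ?_⟩
    obtain ⟨a, ha⟩ : ∃ a, a = p.totalDegree := ⟨_, rfl⟩
    obtain ⟨b, hb⟩ : ∃ b, b = q.totalDegree := ⟨_, rfl⟩
    rw [← ha, ← hb] at htd
    rw [← ha, ← hb]
    subst htd
    have hl := lead_mul (p := p) (q := q) ha.ge hb.ge
    rw [← hpq, gm_lead] at hl
    have e1 := gm_cf (f := C (coeff (single 0 b) q) * p) (d := a)
      (by rw [xn]; exact (yv _ _).trans ha.ge) (by rw [yz, xb]; exact hl.symm)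
    have e2 := gm_cf (f := C (coeff (single 0 a) p) * q) (d := b)
      (by rw [xn]; exact (yv _ _).trans hb.ge) (by rw [yz]; exact hl.symm)
    refine ⟨Sum.elim (fun s => coeff (exf s.1) (C (coeff (single 0 b) q) * p))
      (fun s => coeff (exf s.1) (C (coeff (single 0 a) p) * q)), ?_⟩
    simp only [fmul, Sum.elim_inl, Sum.elim_inr]
    rw [← e1, ← e2, hpq]
    calc p * q = C (coeff (single 0 a) p * coeff (single 0 b) q) * (p*q) := by
          rw [← hl, C_1, um]
      _ = _ := by rw [C_mul]; ring
  · rintro ⟨a, b, rfl, ha, hb, u, hu⟩ hi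
    rcases hi.isUnit_or_isUnit hu with h | h
    · exact hunit _ ha h
    · exact hunit _ hb h

lemma noe2 (n d : ℕ) (hd : 1 ≤ d) : ∃ N : Finset (MvPolynomial (Ix n d) ℤ),
    ∀ (K : Type) [Field K] [IsAlgClosed K] (c : Ix n d → K),
      Irreducible (GM d c) ↔ ∃ g ∈ N, aeval c g ≠ 0 := by
  classical
  obtain ⟨N, hN⟩ := (inferInstance : IsNoetherian (MvPolynomial (Ix n d) ℤ) (MvPolynomial (Ix n d) ℤ)).noetherian
    (∏ a ∈ Finset.Ico 1 d, RingHom.ker (thet n a (d-a) d))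
  refine ⟨N, fun K _ _ c => ?_⟩
  rw [← not_iff_not, gm_irr hd]
  have hP : (RingHom.ker (aeval c : _ →ₐ[ℤ] K).toRingHom).IsPrime := RingHom.ker_isPrime _
  have h1 : (¬ ∃ g ∈ N, aeval c g ≠ 0) ↔ (∏ a ∈ Finset.Ico 1 d, RingHom.ker (thet n a (d-a) d)) ≤
      RingHom.ker (aeval c : _ →ₐ[ℤ] K).toRingHom := by
    rw [← hN]
    refine Iff.trans ?_ Ideal.span_le.symm
    push Not
    rfl
  rw [h1, hP.prod_le]
  constructor
  · rintro ⟨a, b, rfl, ha, hb, h⟩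
    refine ⟨a, Finset.mem_Ico.mpr ⟨ha, by omega⟩, ?_⟩
    rw [Nat.add_sub_cancel_left]
    exact (noe1 rfl c).mp h
  · rintro ⟨a, ha, h⟩
    rw [Finset.mem_Ico] at ha
    exact ⟨a, d - a, by omega, ha.1, by omega, (noe1 (by omega) c).mpr h⟩

noncomputable def cf [CommSemiring R] (d : ℕ) (f : Mv (n+1) R)
    (s : Fin (n+1) → Fin (d+1)) : R := coeff (exf s) f

lemma cf_map [CommSemiring R] [CommSemiring S] (φ : R →+* S) (d : ℕ)
    (f : Mv (n+1) R) : cf d (map φ f) = fun s => φ (cf d f s) := by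
  funext s; simp [cf, xf]

/-- Noether forms -/
lemma noether (n d : ℕ) (hd : 1 ≤ d) : ∃ N : Finset (MvPolynomial (Fin (n+1) → Fin (d+1)) ℤ),
    ∀ (K : Type) [Field K] [IsAlgClosed K] (f : Mv (n+1) K), YM d f →
      (Irreducible f ↔ ∃ g ∈ N, aeval (cf d f) g ≠ 0) := by
  classical
  obtain ⟨N, hN⟩ := noe2 n d hd
  obtain ⟨l, hl⟩ := exf_surj (n := n) (d := d) (single 0 d) (by simp)
  let hom : MvPolynomial (Ix n d) ℤ → MvPolynomial (Fin (n+1) → Fin (d+1)) ℤ := fun g =>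
    ∑ γ ∈ g.support, C (coeff γ g) * (X l ^ (g.totalDegree - γ.degree) * ∏ s, X s.1 ^ (γ s))
  refine ⟨N.image hom, fun K _ _ f hf => ?_⟩
  set a := coeff (single 0 d) f with ha
  have ha0 : a ≠ 0 := hf.2
  have h1 : f = C a * GM d (fun s : Ix n d => a⁻¹ * coeff (exf s.1) f) := by
    have := gm_cf (f := C a⁻¹ * f) (d := d) (by rw [xn]; exact (yv _ _).trans hf.1)
      (by rw [yz, ← ha, xi ha0])
    simp only [yz] at this
    rw [← this, ← uj, ← C_mul, mul_inv_cancel₀ ha0, C_1, um]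
  have h2 : Irreducible f ↔ Irreducible (GM d (fun s : Ix n d => a⁻¹ * coeff (exf s.1) f)) := by
    conv_lhs => rw [h1]
    exact irreducible_isUnit_mul (IsUnit.map C (zl.mpr ha0))
  rw [h2, hN]
  have h3 : ∀ g, aeval (cf d f) (hom g) = a ^ g.totalDegree *
      aeval (fun s : Ix n d => a⁻¹ * coeff (exf s.1) f) g := by
    intro g
    simp only [hom, vm, zw, map_pow, jw, map_prod]
    rw [aeval_def, eval₂_eq', yu]
    refine zs rfl fun γ hγ => ?_
    have hle : γ.degree ≤ g.totalDegree := xg hγ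
    simp only [kr, Finset.prod_mul_distrib, zr]
    rw [show cf d f l = a by rw [cf, hl]]
    have e : ∑ i, γ i = γ.degree := by rw [xz]
    rw [e]
    have e2 : a ^ g.totalDegree = a ^ (g.totalDegree - γ.degree) * a ^ γ.degree := by
      rw [← pow_add]; congr 1; omega
    rw [e2, inv_pow]
    have : a ^ γ.degree ≠ 0 := vt _ ha0
    field_simp
    simp [cf]
  constructor
  · rintro ⟨g, hg, h⟩
    exact ⟨hom g, ze _ hg, by rw [h3]; exact xt (vt _ ha0) h⟩
  · rintro ⟨g, hg, h⟩
    obtain ⟨g, hg', rfl⟩ := zy.mp hg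
    exact ⟨g, hg', by rw [h3] at h; exact yi h⟩

lemma hom_smul [CommRing R] [CommRing A] [Algebra R A] {H : MvPolynomial σ R}
    (hH : H.IsHomogeneous d) (c : A) (v : σ → A) :
    aeval (fun i => c * v i) H = c ^ d * aeval v H := by
  rw [aeval_def, aeval_def, up, up, yu]
  refine zs rfl fun m hm => ?_
  have : m.degree = d := by
    have := hH (yp.mp hm)
    exact (yb Finsupp.degree_eq_weight_one m).trans this
  simp only [kr, Finset.prod_mul_distrib, zr]
  rw [show ∑ i ∈ m.support, m i = d from this]
  ring

lemma hom_smul' [CommRing R] {H : MvPolynomial σ R}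
    (hH : H.IsHomogeneous d) (c : R) (v : σ → R) :
    eval (fun i => c * v i) H = c ^ d * eval v H := by
  have := hom_smul (A := R) hH c v
  simpa [aeval_def] using this

lemma hom_td [CommRing R] {H : MvPolynomial σ R} (hH : H.IsHomogeneous d) :
    H.totalDegree ≤ d := hH.totalDegree_le

lemma td_mono [CommRing R]
    (v : σ → MvPolynomial τ R) (hv : ∀ i, (v i).totalDegree ≤ 1) (m : σ →₀ ℕ) :
    (∏ i ∈ m.support, v i ^ m i).totalDegree ≤ m.degree := by
  refine (totalDegree_finsetProd _ _).trans (zq fun i _ => ?_)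
  exact (totalDegree_pow _ _).trans (by have := hv i; nlinarith)

lemma subst_td [CommRing R] {H : MvPolynomial σ R} (hH : H.totalDegree ≤ d)
    (v : σ → MvPolynomial τ R) (hv : ∀ i, (v i).totalDegree ≤ 1) : (aeval v H).totalDegree ≤ d := by
  rw [aeval_def, up]
  refine yy fun m hm => ?_
  rw [algebraMap_eq, xn]
  refine (yv _ _).trans ((td_mono v hv m).trans ?_)
  exact (xg hm).trans hH

lemma subst_lead [CommRing R] {H : Mv (k+1) R}
    (hH : H.totalDegree ≤ d) (v : Fin (k+1) → Mv (n+1) R) (l : R) (h0 : v 0 = C l * X 0)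
    (hv : ∀ i : Fin k, (v i.succ).degreeOf 0 = 0) :
    coeff (single 0 d) (aeval v H) = l ^ d * coeff (single 0 d) H := by
  classical
  have h : ∀ m ∈ H.support, coeff (single 0 d) (algebraMap R _ (coeff m H) * ∏ i, v i ^ m i)
      = if m = single 0 d then l ^ d * coeff m H else 0 := by
    intro m hm
    rw [algebraMap_eq, yz]
    split_ifs with e
    · subst e
      rw [xp, Finset.prod_eq_one, qu, h0, kr, ← C_pow, yz, jb]
      · simp [xb]
      · intro i _; simp
    · have hm0 : m 0 < d := by
        have h1 : m.degree ≤ d := (xg hm).trans hH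
        rcases lt_or_eq_of_le ((Finsupp.le_degree 0 m).trans h1) with h2 | h2
        · exact h2
        · exfalso; apply e
          rw [xz, Fin.sum_univ_succ] at h1
          ext i
          refine Fin.cases ?_ (fun j => ?_) i
          · simpa using h2
          · have : m j.succ ≤ ∑ i : Fin k, m i.succ := Finset.single_le_sum (f := fun i : Fin k => m i.succ) (fun _ _ => kc _) (yw j)
            simp; omega
      have : coeff (single 0 d) (∏ i, v i ^ m i) = 0 := by
        by_contra hc
        have h3 := monomial_le_degreeOf (0 : Fin (n+1)) (yp.mpr hc)
        have h4 : (∏ i, v i ^ m i).degreeOf 0 ≤ m 0 := by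
          rw [xp]
          refine (degreeOf_mul_le _ _ _).trans ?_
          have e1 : (v 0 ^ m 0).degreeOf 0 ≤ m 0 := by
            refine (degreeOf_pow_le _ _ _).trans ?_
            have : (v 0).degreeOf 0 ≤ 1 := by
              rw [h0]
              refine (vn _ _ _).trans ?_
              refine (yn _ _).trans ?_
              rw [X]; exact (xu _ _).trans (by simp)
            nlinarith
          have e2 : (∏ i : Fin k, v i.succ ^ m i.succ).degreeOf 0 ≤ 0 := by
            refine (degreeOf_prod_le _ _ _).trans ?_
            refine Finset.sum_nonpos fun i _ => (degreeOf_pow_le _ _ _).trans ?_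
            rw [hv]; simp
          omega
        simp at h3; omega
      rw [this, mul_zero]
  rw [aeval_def, eval₂_eq', ug, zs rfl h, Finset.sum_ite_eq']
  split_ifs with hs
  · rfl
  · rw [notMem_support_iff.mp hs, mul_zero]

lemma ym_factor [Field K] {f p q : Mv (n+1) K} (hf : YM d f)
    (h : f = p * q) : ∃ a b, a + b = d ∧ YM a p ∧ YM b q := by
  have hf0 := ym_ne hf
  have hp0 : p ≠ 0 := fun h0 => hf0 (by rw [h, h0, zero_mul])
  have hq0 : q ≠ 0 := fun h0 => hf0 (by rw [h, h0, mul_zero])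
  have htd : p.totalDegree + q.totalDegree = d := by
    rw [← yf hp0 hq0, ← h, ym_td hf]
  have hl := lead_mul (p := p) (q := q) kd kd
  rw [htd, ← h] at hl
  have := hf.2
  rw [hl] at this
  exact ⟨_, _, htd, ⟨kd, xl this⟩, ⟨kd, yi this⟩⟩

lemma ym_unit [Field K] {p : Mv (n+1) K} (hp : YM a p) :
    IsUnit p ↔ a = 0 := by
  constructor
  · intro h
    obtain ⟨z, hz, e⟩ := vf.mp h
    rw [← ym_td hp, e, totalDegree_C]
  · rintro rfl
    have e := yg.mp (ym_td hp)
    rw [e]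
    refine IsUnit.map C (zl.mpr fun h0 => ym_ne hp ?_)
    rw [e, h0, C_0]

lemma irr_spec [Field K] {f : Mv (k+1) K} (hf : YM d f)
    (v : Fin (k+1) → Mv (n+1) K) {l : K} (hl : l ≠ 0) (h0 : v 0 = C l * X 0)
    (hv : ∀ i : Fin k, (v i.succ).degreeOf 0 = 0) (hv1 : ∀ i, (v i).totalDegree ≤ 1)
    (hi : Irreducible (aeval v f)) : Irreducible f := by
  have hY : ∀ {a} {p : Mv (k+1) K}, YM a p → YM a (aeval v p) := fun h =>
    ⟨subst_td h.1 v hv1, by rw [subst_lead h.1 v l h0 hv]; exact xt (vt _ hl) h.2⟩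
  rw [irreducible_iff]
  refine ⟨fun hu => hi.not_isUnit (hu.map _), fun p q hpq => ?_⟩
  obtain ⟨a, b, -, ha, hb⟩ := ym_factor hf hpq
  have := hi.isUnit_or_isUnit (show aeval v f = aeval v p * aeval v q by rw [hpq, zw])
  rwa [ym_unit (hY ha), ym_unit (hY hb), ← ym_unit ha, ← ym_unit hb] at this

lemma sub_eval [CommRing R] (H : MvPolynomial σ R) (v : σ → MvPolynomial τ R) (P : τ → R) :
    eval P (aeval v H) = eval (fun i => eval P (v i)) H := by
  induction H using za with
  | C a => simp
  | add p q hp hq => simp only [yo, hp, hq]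
  | mul_X p i hp => simp only [zw, hp, jw, eval_X]

lemma sub_map [CommRing R] [CommRing S] (φ : R →+* S) (H : MvPolynomial σ R)
    (v : σ → MvPolynomial τ R) : map φ (aeval v H) = aeval (fun i => map φ (v i)) (map φ H) :=
  map_bind₁ φ v H

noncomputable def dh [CommRing R] (H : Mv 4 R) : Mv 3 R :=
  aeval ![X 0, X 1, X 2, 1] H
noncomputable def hs [CommRing R] (t : R) (H : Mv 4 R) : Mv 2 R :=
  aeval ![X 0, X 1, 1, C t] H

lemma dh_eval [CommRing R] (H : Mv 4 R) (P : Fin 3 → R) :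
    eval P (dh H) = eval ![P 0, P 1, P 2, 1] H := by
  rw [dh, sub_eval]; congr 2; funext i; fin_cases i <;> simp
lemma hs_eval [CommRing R] (t : R) (H : Mv 4 R) (P : Fin 2 → R) :
    eval P (hs t H) = eval ![P 0, P 1, 1, t] H := by
  rw [hs, sub_eval]; congr 2; funext i; fin_cases i <;> simp
lemma dh_map [CommRing R] [CommRing S] (φ : R →+* S) (H : Mv 4 R) :
    map φ (dh H) = dh (map φ H) := by
  rw [dh, sub_map, dh]; congr 2; funext i; fin_cases i <;> simp
lemma hs_map [CommRing R] [CommRing S] (φ : R →+* S) (t : R) (H : Mv 4 R) :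
    map φ (hs t H) = hs (φ t) (map φ H) := by
  rw [hs, sub_map, hs]; congr 2; funext i; fin_cases i <;> simp

lemma totalDegree_X_le [CommSemiring R] (i : σ) : (X i : MvPolynomial σ R).totalDegree ≤ 1 := by
  rw [X]; exact (xu _ _).trans (by simp)
lemma degreeOf_X_ne' [CommSemiring R] {i j : σ} (h : i ≠ j) :
    (X j : MvPolynomial σ R).degreeOf i = 0 := degreeOf_X_of_ne h

lemma aeval_hom [CommRing A] [CommRing B] (φ : A →+* B) (v : σ → A) (g : MvPolynomial σ ℤ) :
    φ (aeval v g) = aeval (fun s => φ (v s)) g := by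
  induction g using za with
  | C a => simp
  | add p q hp hq => simp only [yo, hp, hq]
  | mul_X p i hp => simp only [zw, hp, jw]

lemma dh_ym [CommRing K] {H : Mv 4 K} (hH : YM d H) : YM d (dh H) := by
  refine ⟨subst_td hH.1 _ fun i => ?_, ?_⟩
  · fin_cases i <;> simp [totalDegree_X_le]
  · rw [dh, subst_lead hH.1 _ 1 (by simp) (fun i => ?_)]
    · simpa using hH.2
    · fin_cases i <;> simp [degreeOf_X_ne']
lemma hs_ym [CommRing K] {H : Mv 4 K} (hH : YM d H) (t : K) : YM d (hs t H) := by
  refine ⟨subst_td hH.1 _ fun i => ?_, ?_⟩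
  · fin_cases i <;> simp [totalDegree_X_le]
  · rw [hs, subst_lead hH.1 _ 1 (by simp) (fun i => ?_)]
    · simpa using hH.2
    · fin_cases i <;> simp [degreeOf_X_ne']

lemma natDegree_aeval_le [Field K] (g : MvPolynomial σ ℤ) (v : σ → Polynomial K) (d : ℕ)
    (hv : ∀ s, (v s).natDegree ≤ d) : (aeval v g).natDegree ≤ d * g.totalDegree := by
  rw [aeval_def, up]
  refine jr _ _ fun m hm => ?_
  refine Polynomial.natDegree_mul_le.trans ?_
  have h1 : (algebraMap ℤ (Polynomial K) (coeff m g)).natDegree = 0 := by simp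
  rw [h1, zero_add]
  refine (Polynomial.natDegree_prod_le _ _).trans ?_
  calc _ ≤ ∑ i ∈ m.support, d * m i := zq fun i _ =>
        Polynomial.natDegree_pow_le.trans (by rw [xb]; exact zv _ (hv i))
    _ = d * m.degree := by rw [← yu]; rfl
    _ ≤ _ := zx _ (xg hm)

lemma hs_natDegree [Field K] {H : Mv 4 K} (hH : H.totalDegree ≤ d)
    (m : Fin 2 →₀ ℕ) : (coeff m (hs pX (map pC H))).natDegree ≤ d := by
  rw [hs, aeval_def, eval₂_eq', ug]
  refine jr _ _ fun k hk => ?_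
  have hk' : k.degree ≤ d := by
    refine (xg (support_map_subset _ _ hk)).trans hH
  have h3 := (Finsupp.le_degree 3 k).trans hk'
  rw [algebraMap_eq, yz, Fin.prod_univ_four, xf]
  simp only [Matrix.cons_val]
  rw [one_pow, qu, ← C_pow, xb _ (C _), yz]
  refine (Polynomial.natDegree_C_mul_le _ _).trans (Polynomial.natDegree_mul_le.trans ?_)
  rw [Polynomial.natDegree_X_pow]
  have : (coeff m ((X 0 : Mv 2 (Polynomial K)) ^ k 0 * X 1 ^ k 1)).natDegree = 0 := by
    classical
    rw [jb, jb, monomial_mul, coeff_monomial]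
    split_ifs <;> simp
  omega

lemma pencil (d : ℕ) (hd : 1 ≤ d) : ∃ c : ℕ, ∀ (K : Type) [Field K] (H : Mv 4 K), YM d H →
    Irreducible (map (algebraMap K (AlgebraicClosure K)) (hs 0 H)) →
    ∃ bad : Finset K, bad.card ≤ c ∧ ∀ t ∉ bad, Irreducible (map (algebraMap K (AlgebraicClosure K)) (hs t H)) := by
  classical
  obtain ⟨N, hN⟩ := noether 1 d hd
  refine ⟨d * N.sup totalDegree, fun K _ H hH hi => ?_⟩
  set φ := algebraMap K (AlgebraicClosure K)
  obtain ⟨g, hg, hg0⟩ := (hN _ _ (ym_map φ (hs_ym hH 0))).mp hi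
  set q : Polynomial K := aeval (cf d (hs pX (map pC H))) g with hq
  have hev : ∀ t, φ (q.eval t) = aeval (cf d (map φ (hs t H))) g := by
    intro t
    have e1 : hs t H = map (Polynomial.evalRingHom t) (hs pX (map pC H)) := by
      rw [hs_map, map_map]
      have : (Polynomial.evalRingHom t).comp pC = RingHom.id K := by ext; simp
      rw [this, map_id]; simp
    rw [e1, cf_map, cf_map, hq]
    exact aeval_hom (φ.comp (Polynomial.evalRingHom t)) _ g
  have hq0 : q ≠ 0 := fun h0 => hg0 ((hev 0).symm.trans (by rw [h0]; simp))
  refine ⟨q.roots.toFinset, ?_, fun t ht => ?_⟩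
  · refine (Multiset.toFinset_card_le _).trans ((Polynomial.card_roots' q).trans ?_)
    refine (natDegree_aeval_le g _ d fun s => hs_natDegree hH.1 _).trans ?_
    exact zx _ (km (f := totalDegree) hg)
  · rw [hN _ _ (ym_map φ (hs_ym hH t))]
    refine ⟨g, hg, ?_⟩
    refine fun h0 => ht ?_
    replace h0 := (hev t).trans h0
    rw [Multiset.mem_toFinset, kb hq0]
    exact φ.injective (by rw [h0, zp])

lemma dh_irr [Field K] {H : Mv 4 K} (hY : YM d H) (hH : H.IsHomogeneous d)
    {t : K} (ht : t ≠ 0) (hi : Irreducible (hs t H)) : Irreducible (dh H) := by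
  refine irr_spec (dh_ym hY) (![C t⁻¹ * X 0, C t⁻¹ * X 1, C t⁻¹] : Fin 3 → Mv 2 K) (uc ht) (by simp) (fun i => ?_) (fun i => ?_) ?_
  · fin_cases i
    · simp only [Matrix.cons_val_succ]
      exact kf.mp ((vn _ _ _).trans (degreeOf_X_ne' (by simp)).le)
    · simp
  · fin_cases i
    · simp only [xn]; exact (yv _ _).trans (totalDegree_X_le _)
    · simp only [xn]; exact (yv _ _).trans (totalDegree_X_le _)
    · simp
  · have e : aeval ![C t⁻¹ * X 0, C t⁻¹ * X 1, C t⁻¹] (dh H) = (C t⁻¹ : Mv 2 K) ^ d * hs t H := by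
      rw [hs, ← hom_smul hH]
      rw [dh]
      have := bind₁_bind₁ (R := K) ![X 0, X 1, X 2, (1 : Mv 3 K)] ![C t⁻¹ * X 0, C t⁻¹ * X 1, (C t⁻¹ : Mv 2 K)] H
      refine this.trans ?_
      change aeval _ H = aeval _ H
      congr 2
      funext i
      fin_cases i <;> simp
      rw [← C_mul, xi ht, C_1]
    rw [e, ← C_pow]
    exact (irreducible_isUnit_mul (IsUnit.map C (zl.mpr (vt _ (uc ht))))).mpr hi

lemma langweil (d L : ℕ) (hd : 1 ≤ d) (hL : 1 ≤ L) : ∃ c : ℕ, ∀ (p : ℕ) [Fact p.Prime], c ≤ p →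
    ∀ H : Mv 4 (ZMod p), YM d H → H.IsHomogeneous d →
    Irreducible (map (algebraMap (ZMod p) (AlgebraicClosure (ZMod p))) (hs 0 H)) →
    (∀ Z : Finset (Fin 3 → ZMod p), (∀ P ∈ Z, eval P (dh H) = 0) →
      L * Z.card ≤ (L + d + 1) * p ^ 2 + c * p) ∧
    (∀ Z : Finset (Fin 3 → ZMod p), (∀ P ∈ Z, eval P (dh H) = 0 ∧ eval P (pderiv 0 (dh H)) = 0) →
      Z.card ≤ c * p) := by
  classical
  obtain ⟨c1, h1⟩ := stepanov d L hd hL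
  obtain ⟨c2, h2⟩ := pencil d hd
  refine ⟨c1 + L * (c2 + 1) * d + c2 + 2 + 2 * d * d * d + d, fun p _ hp H hY hH hi => ?_⟩
  obtain ⟨bad, hbc, hbad⟩ := h2 _ H hY hi
  set bd : Finset (ZMod p) := insert 0 (bad.image (·⁻¹)) with hbd
  have hbdc : bd.card ≤ c2 + 1 := (Finset.card_insert_le _ _).trans
    (Nat.succ_le_succ (xy.trans hbc))
  have hgood : ∀ c ∉ bd, c ≠ 0 ∧ Irreducible (map (algebraMap (ZMod p) (AlgebraicClosure (ZMod p))) (hs c⁻¹ H)) := by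
    intro c hc
    rw [hbd, ka, not_or] at hc
    exact ⟨hc.1, hbad _ fun h => hc.2 (zy.mpr ⟨_, h, inv_inv c⟩)⟩
  constructor
  · intro Z hZ
    have hfib : ∀ c : ZMod p, L * (Z.filter (fun P => P 2 = c)).card ≤
        ((L + d + 1) * p + c1) + if c ∈ bd then L * d * p else 0 := by
      intro c
      split_ifs with hc
      · have hT := fib_card (dh_ym hY) (Z.filter (fun P => P 2 = c)) (fun P hP => hZ P (zz.mp hP).1)
        have : ((Z.filter (fun P => P 2 = c)).image tail).card ≤ p := by
          calc _ ≤ ((Finset.univ : Finset (ZMod p)).image fun x => (![x, c] : Fin 2 → ZMod p)).card := by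
                refine zu fun Q hQ => ?_
                obtain ⟨P, hP, rfl⟩ := zy.mp hQ
                refine zy.mpr ⟨P 1, yw _, ?_⟩
                have := (zz.mp hP).2
                funext i; fin_cases i
                · rfl
                · exact this.symm
            _ ≤ _ := xy.trans (by simp [ku])
        calc _ ≤ L * (d * p) := zx _ (hT.trans (zx _ this))
          _ ≤ _ := by rw [uj]; omega
      · obtain ⟨hc0, hci⟩ := hgood c hc
        rw [qj]
        have hinj : Set.InjOn (fun P : Fin 3 → ZMod p => (![c⁻¹ * P 0, c⁻¹ * P 1] : Fin 2 → ZMod p))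
            (Z.filter (fun P => P 2 = c)) := by
          intro P hP Q hQ e
          have hP2 := (zz.mp (Finset.mem_coe.mp hP)).2
          have hQ2 := (zz.mp (Finset.mem_coe.mp hQ)).2
          have e0 := congrFun e 0
          have e1 := congrFun e 1
          simp [hc0] at e0 e1
          funext i; fin_cases i
          · exact e0
          · exact e1
          · exact hP2.trans hQ2.symm
        rw [← yk hinj]
        refine h1 p _ (hs_ym hY c⁻¹) hci _ fun Q hQ => ?_
        obtain ⟨P, hP, rfl⟩ := zy.mp hQ
        rw [zz] at hP
        have e := hZ P hP.1
        rw [dh_eval] at e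
        rw [hs_eval]
        have := hom_smul' hH c⁻¹ ![P 0, P 1, P 2, 1]
        rw [e, mul_zero] at this
        rw [← this]
        congr 2
        funext i; fin_cases i <;> simp [hP.2, hc0]
    have hsum : Z.card = ∑ c : ZMod p, (Z.filter (fun P => P 2 = c)).card :=
      Finset.card_eq_sum_card_fiberwise (fun _ _ => yw _)
    rw [hsum, yu]
    refine (zq fun c _ => hfib c).trans ?_
    rw [vv, Finset.sum_const, va, ku, Finset.sum_ite_mem,
      Finset.univ_inter, Finset.sum_const, zc, zc]
    have : bd.card * (L * d * p) ≤ (c2 + 1) * (L * d * p) := zv _ hbdc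
    have e : (L + d + 1) * p ^ 2 + (c1 + L * (c2 + 1) * d + c2 + 2 + 2 * d * d * d + d) * p =
      p * ((L + d + 1) * p + c1) + (c2 + 1) * (L * d * p) + (c2 + 2 + 2 * d * d * d + d) * p := by ring
    rw [e]
    exact (Nat.add_le_add_left this _).trans (vj _ _)
  · intro Z hZ
    have hex : ∃ c, c ∉ bd := by
      by_contra hc; push Not at hc
      have := zu (fun c _ => hc c : (Finset.univ : Finset (ZMod p)) ⊆ bd)
      rw [va, ku] at this; omega
    obtain ⟨c, hc⟩ := hex
    obtain ⟨hc0, hci⟩ := hgood c hc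
    have hirr := dh_irr hY hH (uc hc0) (irr_of_map _ hci)
    have hk : ((d : ℕ) : ZMod p) ≠ 0 := by
      rw [Ne, jk]; intro hh; have := xm hd hh; omega
    have hfy := fy_spec hd (dh_ym hY) hk
    have := cnt3 hd (dh_ym hY) hirr hfy.1 hfy.2 Finset.univ Z (fun _ _ _ => yw _)
      (fun P hP => (hZ P hP).1) (fun P hP => (hZ P hP).2)
    rw [va, ku, pow_one] at this
    refine this.trans (zv _ (by omega))

lemma det_expand {S : Type} [Fintype S] [DecidableEq S] (X : Matrix (Fin s) S ℤ) (Y : Matrix S (Fin s) ℤ) :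
    (X * Y).det = ∑ f : Fin s → S, (∏ j, Y (f j) j) * (X.submatrix id f).det := by
  classical
  rw [← Matrix.det_transpose]
  have e : (X * Y).transpose = fun j => ∑ β : S, Y β j • X.transpose β := by
    funext j i
    simp [Matrix.mul_apply, Finset.sum_apply, xb]
  rw [e]
  have := (Matrix.detRowAlternating (R := ℤ) (n := Fin s)).toMultilinearMap.map_sum
    (fun (j : Fin s) (β : S) => Y β j • X.transpose β)
  refine this.trans (zs rfl fun f _ => ?_)
  have h2 := (Matrix.detRowAlternating (R := ℤ) (n := Fin s)).toMultilinearMap.map_smul_univ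
    (fun j => Y (f j) j) (fun j => X.transpose (f j))
  refine h2.trans ?_
  rw [zc, ← Matrix.det_transpose (X.submatrix id f)]
  rfl

lemma det_cols_dvd (p : ℤ) (A : Matrix (Fin s) (Fin s) ℤ) (w : Fin s → ℕ)
    (h : ∀ i j, p ^ w j ∣ A i j) : p ^ (∑ j, w j) ∣ A.det := by
  rw [Matrix.det_apply]
  refine Finset.dvd_sum fun σ _ => ?_
  rw [Units.smul_def, zc]
  refine Dvd.dvd.mul_left ?_ _
  rw [← zr]
  exact Finset.prod_dvd_prod_of_dvd _ _ fun i _ => h _ _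

lemma det_dvd (p : ℤ) {S : Type} [Fintype S] (M Z : Matrix (Fin s) (Fin s) ℤ)
    (X : Matrix (Fin s) S ℤ) (Y : Matrix S (Fin s) ℤ) (wt : S → ℕ) (hX : ∀ i β, p ^ wt β ∣ X i β)
    (hM : ∀ i j, M i j = ∑ β, X i β * Y β j + p ^ K * Z i j) :
    p ^ (∑ k ∈ range K, (s - (Finset.univ.filter fun β => wt β ≤ k).card)) ∣ M.det := by
  classical
  let X' : Matrix (Fin s) (S ⊕ Fin s) ℤ := fun i => Sum.elim (X i) (fun j => if i = j then p ^ K else 0)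
  let Y' : Matrix (S ⊕ Fin s) (Fin s) ℤ := fun β j => Sum.elim (fun b => Y b j) (fun i => Z i j) β
  let wt' : S ⊕ Fin s → ℕ := Sum.elim wt (fun _ => K)
  have hXY : M = X' * Y' := by
    ext i j
    rw [hM, Matrix.mul_apply, Fintype.sum_sum_type]
    simp [X', Y']
  have hX' : ∀ i β, p ^ wt' β ∣ X' i β := by
    rintro i (β | j)
    · exact hX i β
    · simp only [wt', X', Sum.elim_inr]; split_ifs <;> simp
  rw [hXY, det_expand]
  refine Finset.dvd_sum fun f _ => Dvd.dvd.mul_left ?_ _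
  by_cases hf : Injective f
  · refine (pow_dvd_pow p ?_).trans (det_cols_dvd p _ (fun j => wt' (f j)) fun i j => hX' _ _)
    have h1 : ∀ j, ((range K).filter fun k => k < wt' (f j)).card ≤ wt' (f j) := fun j => by
      refine (zu (t := range (wt' (f j))) fun k hk => ?_).trans (xh _).le
      exact zo.mpr (zz.mp hk).2
    refine je ?_ (zq fun j _ => h1 j)
    simp only [us]
    rw [Finset.sum_comm]
    refine zq fun k hk => ?_
    rw [← us, ← us]
    have h2 := zn (s := (Finset.univ : Finset (Fin s))) (fun j => k < wt' (f j))
    rw [va, Fintype.card_fin] at h2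
    have h3 : (Finset.univ.filter fun j => ¬ k < wt' (f j)).card ≤ (Finset.univ.filter fun β => wt β ≤ k).card := by
      rw [← zd _ hf, ← zd _ (Sum.inl_injective (α := S) (β := Fin s))]
      refine zu fun x hx => ?_
      obtain ⟨j, hj, rfl⟩ := zy.mp hx
      have hj' := (zz.mp hj).2
      have hk' := zo.mp hk
      rcases hb : f j with β | i
      · rw [hb] at hj'
        exact zy.mpr ⟨β, zz.mpr ⟨yw _, not_lt.mp hj'⟩, rfl⟩
      · rw [hb] at hj'; exact absurd hk' hj'
    omega
  · rw [Function.not_injective_iff] at hf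
    obtain ⟨a, b, hab, hne⟩ := hf
    rw [Matrix.det_zero_of_column_eq hne (fun i => by simp [hab])]
    exact dvd_zero _

/-- second order Taylor in the first variable -/
lemma taylor2 (f : Mv (n+1) ℤ) (x : Fin (n+1) → ℤ) (δ : ℤ) :
    δ ^ 2 ∣ eval (x + Pi.single 0 δ) f - eval x f - δ * eval x (pderiv 0 f) := by
  induction f using za with
  | C a => simp
  | add p q hp hq =>
    obtain ⟨z, hz⟩ := hp
    obtain ⟨w, hw⟩ := hq
    simp only [yo]
    exact ⟨z + w, by linear_combination hz + hw⟩
  | mul_X p i hp =>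
    obtain ⟨z, hz⟩ := hp
    have hz' : eval (x + Pi.single 0 δ) p = eval x p + δ * eval x (pderiv 0 p) + δ^2 * z := by linarith
    simp only [zw, eval_X, uk, yo, zc, hz', Pi.add_apply]
    by_cases hi : i = 0
    · subst hi
      simp only [Pi.single_eq_same, pderiv_X_self, map_one]
      exact ⟨z * (x 0 + δ) + eval x (pderiv 0 p), by ring⟩
    · rw [Pi.single_eq_of_ne hi, pderiv_X_of_ne hi]
      exact ⟨z * x i, by simp; ring⟩

lemma eval_congr_mod (m : ℤ) (f : MvPolynomial σ ℤ) (x y : σ → ℤ) (h : ∀ i, m ∣ x i - y i) :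
    m ∣ eval x f - eval y f := by
  induction f using za with
  | C a => simp
  | add p q hp hq =>
    obtain ⟨z, hz⟩ := hp
    obtain ⟨w, hw⟩ := hq
    simp only [yo]
    exact ⟨z + w, by linear_combination hz + hw⟩
  | mul_X p i hp =>
    simp only [zw, eval_X]
    obtain ⟨z, hz⟩ := hp
    obtain ⟨w, hw⟩ := h i
    exact ⟨z * x i + eval y p * w, by linear_combination x i * hz + eval y p * hw⟩

/-- Hensel: the first coordinate is polynomial in the others modulo p^K -/
lemma hens (p : ℕ) (hp : p.Prime) (f : Mv (n+1) ℤ) (Q : Fin (n+1) → ℤ)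
    (hQ : ¬ (p : ℤ) ∣ eval Q (pderiv 0 f)) (K : ℕ) :
    ∃ φ : Mv n ℤ, ∀ P : Fin (n+1) → ℤ, eval P f = 0 → (∀ i, (p : ℤ) ∣ P i - Q i) →
      (p : ℤ) ^ (K+1) ∣ (P 0 - Q 0) - eval (fun i => P i.succ - Q i.succ) φ := by
  obtain ⟨v, hv⟩ : ∃ v : ℤ, (p : ℤ) ∣ v * eval Q (pderiv 0 f) - 1 := by
    have hc : IsCoprime (p : ℤ) (eval Q (pderiv 0 f)) :=
      (xx.mp hp).coprime_iff_not_dvd.mpr hQ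
    obtain ⟨a, b, hab⟩ := hc
    exact ⟨b, -a, by linear_combination hab⟩
  induction K with
  | zero => exact ⟨0, fun P _ h => by simpa using h 0⟩
  | succ K ih =>
    obtain ⟨φ, hφ⟩ := ih
    refine ⟨φ - C v * aeval (cons (C (Q 0) + φ) (fun i => C (Q i.succ) + X i) : Fin (n+1) → Mv n ℤ) f,
      fun P hP h => ?_⟩
    set u : Fin n → ℤ := fun i => P i.succ - Q i.succ with hu
    obtain ⟨δ', hδ⟩ := hφ P hP h
    set δ := (P 0 - Q 0) - eval u φ with hδd
    set x : Fin (n+1) → ℤ := P - Pi.single 0 δ with hx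
    have e1 : eval u (aeval (cons (C (Q 0) + φ) (fun i => C (Q i.succ) + X i) : Fin (n+1) → Mv n ℤ) f)
        = eval x f := by
      rw [sub_eval]; congr 2
      funext i
      refine Fin.cases ?_ (fun j => ?_) i
      · simp [hx, hδd]; ring
      · simp [hx, hu]
    have hpx : ∀ i, (p : ℤ) ∣ x i - Q i := by
      intro i
      have hd : (p : ℤ) ∣ δ := hδ ▸ (dvd_pow_self _ (by omega)).mul_right _
      refine Fin.cases ?_ (fun j => ?_) i
      · have := dvd_sub (h 0) hd
        simpa [hx, sub_right_comm] using this
      · simpa [hx] using h j.succ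
    have t1 := taylor2 f x δ
    have hxP : x + Pi.single 0 δ = P := by simp [hx]
    rw [hxP, hP] at t1
    have t2 := eval_congr_mod p (pderiv 0 f) x Q hpx
    rw [map_sub, zw, eval_C, e1]
    obtain ⟨a, ha⟩ := t1
    obtain ⟨b, hb⟩ := t2
    obtain ⟨c, hc⟩ := hv
    have : (P 0 - Q 0) - (eval u φ - v * eval x f) = δ - δ * (v * eval Q (pderiv 0 f)) - δ * (p * b) * v - v * δ^2 * a := by
      have e3 : eval x f = - δ * eval x (pderiv 0 f) - δ^2 * a := by linarith
      have e4 : eval x (pderiv 0 f) = eval Q (pderiv 0 f) + p * b := by linarith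
      rw [e3, e4, hδd]; ring
    rw [this]
    have e5 : v * eval Q (pderiv 0 f) = 1 + p * c := by linarith
    rw [e5, hδ]
    refine ⟨- δ' * c - δ' * b * v - v * δ'^2 * p^K * a, ?_⟩
    ring

lemma degreeOf_shift (Q : Fin (n+1) → ℤ) (i : Fin (n+1)) (r : Mv (n+1) ℤ) :
    degreeOf i (aeval (fun i => (X i + C (Q i) : Mv (n+1) ℤ)) r) ≤ degreeOf i r := by
  classical
  conv_lhs => rw [r.as_sum]
  rw [vm]
  refine (degreeOf_sum_le _ _ _).trans (Finset.sup_le fun m hm => ?_)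
  rw [aeval_monomial, ur _ _ (fun j => pow_zero _)]
  have h1 : ∀ j, degreeOf i ((X j + C (Q j) : Mv (n+1) ℤ) ^ m j) ≤ if j = i then m i else 0 := fun j => by
    refine (degreeOf_pow_le _ _ _).trans ?_
    have h2 : degreeOf i (X j + C (Q j) : Mv (n+1) ℤ) ≤ if j = i then 1 else 0 := by
      refine (jd _ _ _).trans ?_
      rw [degreeOf_C, degreeOf_X]; simp [eq_comm]
    split_ifs with h
    · subst h; rw [if_pos rfl] at h2; nlinarith
    · rw [ji h] at h2; nlinarith
  refine (degreeOf_mul_le _ _ _).trans ?_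
  have : degreeOf i ((algebraMap ℤ (Mv (n+1) ℤ)) (coeff m r)) = 0 := degreeOf_C _ _
  rw [this, zero_add]
  refine (degreeOf_prod_le _ _ _).trans ((zq fun j _ => h1 j).trans ?_)
  simp only [Finset.sum_ite_eq', yw, if_true]
  exact monomial_le_degreeOf i hm

/-- remainder by y-monic polynomial modulo p^K -/
lemma red_sing (hd : 1 ≤ d) (p : ℕ) (hp : p.Prime) (f : Mv (n+1) ℤ) (hf : YM d f)
    (ha : ¬ (p : ℤ) ∣ coeff (single 0 d) f) (Q : Fin (n+1) → ℤ) (K : ℕ) (m : Mv (n+1) ℤ) :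
    ∃ g : Mv (n+1) ℤ, g.degreeOf 0 < d ∧ ∀ P : Fin (n+1) → ℤ, eval P f = 0 →
      (p : ℤ) ^ K ∣ eval P m - eval (P - Q) g := by
  obtain ⟨b, c, hbc⟩ : ∃ b c : ℤ, b * coeff (single 0 d) f + c * (p : ℤ) ^ K = 1 := by
    have hc : IsCoprime (coeff (single 0 d) f) ((p : ℤ) ^ K) :=
      ((xx.mp hp).coprime_iff_not_dvd.mpr ha).symm.pow_right
    obtain ⟨a, b, hab⟩ := hc
    exact ⟨a, b, hab⟩
  let sh : Fin (n+1) → Mv (n+1) ℤ := fun i => X i + C (Q i)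
  let f0 := C b * f + C (c * p ^ K) * X 0 ^ d
  have hf0 : f0.totalDegree ≤ d := by
    refine (jj _ _).trans (vz ?_ ?_)
    · rw [xn]; exact (yv _ _).trans hf.1
    · rw [xn]; exact (yv _ _).trans ((totalDegree_pow _ _).trans (by have := totalDegree_X_le (R := ℤ) (0 : Fin (n+1)); nlinarith))
  have hf1 : coeff (single 0 d) f0 = 1 := by
    simp only [f0, coeff_add, yz, jb, coeff_monomial, if_true]
    linarith
  have hm := ym_coeff (f := f0) hf0
  rw [hf1, C_1] at hm
  have hdeg : (finSuccEquiv ℤ n f0).natDegree ≤ d := by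
    rw [vd]; exact (yn _ _).trans hf0
  have hmon : (finSuccEquiv ℤ n f0).Monic := vx d hdeg hm
  have hnd : (finSuccEquiv ℤ n f0).natDegree = d :=
    le_antisymm hdeg (Polynomial.le_natDegree_of_ne_zero (by rw [hm]; exact kl))
  let r := (finSuccEquiv ℤ n).symm (finSuccEquiv ℤ n m %ₘ finSuccEquiv ℤ n f0)
  let q := (finSuccEquiv ℤ n).symm (finSuccEquiv ℤ n m /ₘ finSuccEquiv ℤ n f0)
  have hqr : m = r + f0 * q := by
    apply (finSuccEquiv ℤ n).injective
    simp only [yo, zw, r, q, AlgEquiv.apply_symm_apply]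
    exact (Polynomial.modByMonic_add_div _ _).symm
  have hr : r.degreeOf 0 < d := by
    rw [← vd]
    simp only [r, AlgEquiv.apply_symm_apply]
    have := Polynomial.natDegree_modByMonic_lt (finSuccEquiv ℤ n m) hmon (fun h1 => by rw [h1, Polynomial.natDegree_one] at hnd; omega)
    rwa [hnd] at this
  refine ⟨aeval sh r, (degreeOf_shift _ _ _).trans_lt hr, fun P hP => ?_⟩
  have e1 : eval (P - Q) (aeval sh r) = eval P r := by
    rw [sub_eval]; congr 2; funext i; simp [sh]
  rw [e1]
  refine ⟨c * P 0 ^ d * eval P q, ?_⟩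
  have e2 : eval P f0 = c * p ^ K * P 0 ^ d := by simp [f0, hP]
  conv_lhs => rw [hqr]
  rw [yo, zw, e2]; ring

lemma red_smooth (p : ℕ) (hp : p.Prime) (f : Mv (n+1) ℤ) (Q : Fin (n+1) → ℤ)
    (hQ : ¬ (p : ℤ) ∣ eval Q (pderiv 0 f)) (K : ℕ) (m : Mv (n+1) ℤ) :
    ∃ g : Mv (n+1) ℤ, g.degreeOf 0 < 1 ∧ ∀ P : Fin (n+1) → ℤ, eval P f = 0 → (∀ i, (p : ℤ) ∣ P i - Q i) →
      (p : ℤ) ^ K ∣ eval P m - eval (P - Q) g := by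
  obtain ⟨φ, hφ⟩ := hens p hp f Q hQ K
  refine ⟨rename Fin.succ (aeval (cons (C (Q 0) + φ) (fun i => C (Q i.succ) + X i) : Fin (n+1) → Mv n ℤ) m),
    ?_, fun P hP h => ?_⟩
  · classical
    refine (degreeOf_lt_iff one_pos).mpr fun e he => ?_
    rw [support_rename_of_injective (Fin.succ_injective n)] at he
    obtain ⟨e', _, rfl⟩ := zy.mp he
    rw [Finsupp.mapDomain_of_notMem_range _ _ (by simp)]; exact one_pos
  · rw [eval_rename, sub_eval]
    refine eval_congr_mod _ _ _ _ fun i => ?_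
    refine Fin.cases ?_ (fun j => ?_) i
    · have := (pow_dvd_pow (p : ℤ) (Nat.le_succ K)).trans (hφ P hP h)
      have e : (fun i : Fin n => P i.succ - Q i.succ) = (P - Q) ∘ Fin.succ := rfl
      rw [e] at this
      simpa [sub_sub] using this
    · simp

noncomputable def ecv (β : Fin d × (Fin n → Fin K)) : Fin (n+1) →₀ ℕ :=
  Finsupp.equivFunOnFinite.symm (cons (β.1 : ℕ) (fun j => (β.2 j : ℕ)))

lemma trunc (p : ℤ) (g : Mv (n+1) ℤ) (hg : degreeOf 0 g < d) (u : Fin (n+1) → ℤ)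
    (hu : ∀ i, p ∣ u i) :
    p ^ K ∣ eval u g - ∑ β : Fin d × (Fin n → Fin K), (u 0 ^ (β.1 : ℕ) * ∏ j, u j.succ ^ (β.2 j : ℕ)) * coeff (ecv β) g := by
  classical
  have hinj : Injective (ecv (n := n) (d := d) (K := K)) := by
    intro a b hab
    have h := Finsupp.equivFunOnFinite.symm.injective hab
    have h0 := Fin.cons_inj.mp h
    refine Prod.ext (jo h0.1) (funext fun j => jo (congrFun h0.2 j))
  have e1 : eval u g = ∑ m ∈ g.support ∪ Finset.univ.image (ecv (n := n) (d := d) (K := K)), coeff m g * ∏ i, u i ^ m i := by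
    rw [eval_eq']
    refine Finset.sum_subset Finset.subset_union_left fun m _ hm => ?_
    rw [notMem_support_iff.mp hm, zero_mul]
  have e2 : ∑ β : Fin d × (Fin n → Fin K), (u 0 ^ (β.1 : ℕ) * ∏ j, u j.succ ^ (β.2 j : ℕ)) * coeff (ecv β) g
      = ∑ m ∈ Finset.univ.image (ecv (n := n) (d := d) (K := K)), coeff m g * ∏ i, u i ^ m i := by
    rw [Finset.sum_image (fun a _ b _ h => hinj h)]
    refine zs rfl fun β _ => ?_
    rw [xb, xp]; simp [ecv]
  rw [e1, e2, ← Finset.sum_sdiff (Finset.subset_union_right (s₁ := g.support)), add_sub_cancel_right]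
  refine Finset.dvd_sum fun m hm => Dvd.dvd.mul_left ?_ _
  rw [Finset.mem_sdiff, ke] at hm
  have hms : m ∈ g.support := hm.1.resolve_right hm.2
  have h0 := (degreeOf_lt_iff (by omega)).mp hg m hms
  by_contra hnd
  refine hm.2 (zy.mpr ⟨(⟨m 0, h0⟩, fun j => ⟨m j.succ, ?_⟩), yw _, ?_⟩)
  · by_contra hk
    refine hnd (Dvd.dvd.trans ?_ (ut _ (yw j.succ)))
    exact (pow_dvd_pow _ (not_lt.mp hk)).trans (ul (hu _) _)
  · ext i
    refine Fin.cases ?_ (fun j => ?_) i <;> simp [ecv]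

lemma detdiv (hd : 1 ≤ d) (p : ℕ) (hp : p.Prime) (f : Mv (n+1) ℤ) (hf : YM d f)
    (𝒬 : Finset (Fin (n+1) → ℤ))
    (ha : ∀ Q ∈ 𝒬, (p : ℤ) ∣ eval Q (pderiv 0 f) → ¬ (p : ℤ) ∣ coeff (single 0 d) f)
    (m : Fin s → Mv (n+1) ℤ) (P : Fin s → Fin (n+1) → ℤ) (hP : ∀ i, eval (P i) f = 0)
    (hPQ : ∀ i, ∃ Q ∈ 𝒬, ∀ j, (p : ℤ) ∣ P i j - Q j) (cn : ℕ → ℕ)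
    (hcn : ∀ k, (Finset.univ.filter fun γ : Fin n → Fin K => ∑ j, (γ j : ℕ) ≤ k).card ≤ cn k) :
    ∃ e, (p : ℤ) ^ e ∣ (Matrix.of fun i j => eval (P i) (m j)).det ∧
      K * s ≤ e + (𝒬.card + d * (𝒬.filter fun Q => (p : ℤ) ∣ eval Q (pderiv 0 f)).card) * ∑ k ∈ range K, cn k := by
  classical
  let w : (Fin (n+1) → ℤ) → ℕ := fun Q => if (p : ℤ) ∣ eval Q (pderiv 0 f) then d else 1
  have hwd : ∀ Q, w Q ≤ d := fun Q => by simp only [w]; split_ifs <;> omega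
  have hred : ∀ Q : 𝒬, ∀ j, ∃ g : Mv (n+1) ℤ, g.degreeOf 0 < w Q ∧ ∀ P : Fin (n+1) → ℤ, eval P f = 0 →
      (∀ i, (p : ℤ) ∣ P i - Q.1 i) → (p : ℤ) ^ K ∣ eval P (m j) - eval (P - Q.1) g := by
    intro Q j
    by_cases h : (p : ℤ) ∣ eval Q.1 (pderiv 0 f)
    · obtain ⟨g, h1, h2⟩ := red_sing hd p hp f hf (ha Q.1 Q.2 h) Q.1 K (m j)
      exact ⟨g, by simpa [w, h] using h1, fun P hP _ => h2 P hP⟩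
    · obtain ⟨g, h1, h2⟩ := red_smooth p hp f Q.1 h K (m j)
      exact ⟨g, by simpa [w, h] using h1, h2⟩
  choose g hg1 hg2 using hred
  have hPQ' : ∀ i, ∃ Q : 𝒬, ∀ j, (p : ℤ) ∣ P i j - Q.1 j := fun i => by
    obtain ⟨Q, hQ, h⟩ := hPQ i
    exact ⟨⟨Q, hQ⟩, h⟩
  choose q hq using hPQ'
  let S := 𝒬 × (Fin d × (Fin n → Fin K))
  let wt : S → ℕ := fun β => if (β.2.1 : ℕ) < w β.1 then β.2.1 + ∑ j, (β.2.2 j : ℕ) else K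
  let Xm : Matrix (Fin s) S ℤ := fun i β => if β.1 = q i ∧ (β.2.1 : ℕ) < w β.1 then
    ((P i - (q i).1) 0 ^ (β.2.1 : ℕ) * ∏ j, (P i - (q i).1) (Fin.succ j) ^ (β.2.2 j : ℕ)) else 0
  let Ym : Matrix S (Fin s) ℤ := fun β j => coeff (ecv β.2) (g β.1 j)
  have hX : ∀ i β, (p : ℤ) ^ wt β ∣ Xm i β := by
    intro i β
    simp only [Xm]
    split_ifs with h
    · simp only [wt]; rw [if_pos h.2, pow_add, ← zr]
      exact mul_dvd_mul (ul (hq i 0) _) (Finset.prod_dvd_prod_of_dvd _ _ fun j _ => ul (hq i _) _)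
    · exact dvd_zero _
  have hZ : ∀ i j, (p : ℤ) ^ K ∣ eval (P i) (m j) - ∑ β, Xm i β * Ym β j := by
    intro i j
    have h1 := hg2 (q i) j (P i) (hP i) (hq i)
    have h2 := trunc (K := K) (p : ℤ) (g (q i) j) ((hg1 (q i) j).trans_le (hwd _)) (P i - (q i).1) (hq i)
    have h3 : ∑ β, Xm i β * Ym β j = ∑ β : Fin d × (Fin n → Fin K), ((P i - (q i).1) 0 ^ (β.1 : ℕ) *
        ∏ j, (P i - (q i).1) (Fin.succ j) ^ (β.2 j : ℕ)) * coeff (ecv β) (g (q i) j) := by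
      rw [un, yh (q i)]
      · refine zs rfl fun β _ => ?_
        simp only [Xm, Ym, true_and]
        split_ifs with h
        · rfl
        · have : coeff (ecv β) (g (q i) j) = 0 := by
            by_contra hc
            have := (degreeOf_lt_iff (Nat.zero_lt_of_lt (hg1 (q i) j))).mp (hg1 (q i) j) _ (yp.mpr hc)
            exact h this
          rw [this]; ring
      · intro Q _ hQ
        refine jq fun β _ => ?_
        simp [Xm, hQ]
      · simp
    rw [h3]
    have := dvd_add h1 h2
    rwa [sub_add_sub_cancel] at this
  choose Z hZ' using hZ
  refine ⟨_, det_dvd (K := K) (p : ℤ) _ (Matrix.of Z) Xm Ym wt hX (fun i j => ?_), ?_⟩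
  · have := hZ' i j
    simp only [uv]; linarith
  · have hc : ∀ k ∈ range K, (Finset.univ.filter fun β => wt β ≤ k).card ≤
        (𝒬.card + d * (𝒬.filter fun Q => (p : ℤ) ∣ eval Q (pderiv 0 f)).card) * cn k := by
      intro k hk
      have hk := zo.mp hk
      have hsub : (Finset.univ.filter fun β => wt β ≤ k) ⊆
          (Finset.univ.filter fun a : 𝒬 × Fin d => (a.2 : ℕ) < w a.1).biUnion fun a =>
            (Finset.univ.filter fun γ : Fin n → Fin K => ∑ j, (γ j : ℕ) ≤ k).image fun γ => ((a.1, (a.2, γ)) : S) := by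
        rintro ⟨Q, a, γ⟩ hβ
        have hβ := (zz.mp hβ).2
        simp only [wt] at hβ
        split_ifs at hβ with h
        · refine jg.mpr ⟨(Q, a), by simpa using h, zy.mpr ⟨γ, by simp; omega, rfl⟩⟩
        · omega
      refine (zu hsub).trans (kk.trans ?_)
      refine (zf _ _ (cn k) fun a _ => xy.trans (hcn k)).trans ?_
      rw [zc]
      refine zv _ ?_
      have h5 : (Finset.univ.filter fun a : 𝒬 × Fin d => (a.2 : ℕ) < w a.1).card ≤ ∑ Q : 𝒬, w Q := by
        rw [us, un]
        refine zq fun Q _ => ?_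
        rw [← us]
        rw [← xh (w Q), ← zd _ Fin.val_injective]
        refine zu fun x hx => ?_
        obtain ⟨a, h, rfl⟩ := zy.mp hx
        exact zo.mpr (zz.mp h).2
      refine h5.trans ?_
      rw [Finset.sum_coe_sort 𝒬 w, Finset.card_eq_sum_ones, us, yu, ← vv]
      refine zq fun Q _ => ?_
      simp only [w]; split_ifs <;> omega
    rw [yu, ← vv]
    calc K * s = ∑ k ∈ range K, s := by simp
      _ ≤ _ := zq fun k hk => by have := hc k hk; omega

lemma mert0 (D : ℕ) (hD : 1 ≤ D) :
    log D - 1 ≤ ∑ p ∈ (range (D+1)).filter Nat.Prime, log p / (p - 1) := by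
  have hD0 : (0:ℝ) < D := by exact_mod_cast hD
  have h1 : (D:ℝ) * (log D - 1) ≤ log (D.factorial) := by
    have h := Real.pow_div_factorial_le_exp (D : ℝ) hD0.le D
    have hf : (0:ℝ) < D.factorial := by exact_mod_cast D.factorial_pos
    have h2 := yx (by positivity) h
    rw [Real.log_exp, Real.log_div (by positivity) (by positivity), xv] at h2
    linarith
  have h2 : log (D.factorial) ≤ ∑ p ∈ (range (D+1)).filter Nat.Prime, (D:ℝ) * (log p / (p - 1)) := by
    rw [Real.log_nat_eq_sum_factorization, Finsupp.sum, Nat.support_factorization]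
    refine (xc (t := (range (D+1)).filter Nat.Prime) (fun p hp => ?_) fun p _ _ => ?_).trans
      (zq fun p hp => ?_)
    · have hp' := Nat.prime_of_mem_primeFactors hp
      have := (hp'.dvd_factorial).mp (Nat.dvd_of_mem_primeFactors hp)
      exact zz.mpr ⟨zo.mpr (by omega), hp'⟩
    · exact mul_nonneg (jt _) (zb _)
    · have hp' := (zz.mp hp).2
      have : Fact p.Prime := ⟨hp'⟩
      have h3 := sub_one_mul_padicValNat_factorial (p := p) D
      rw [Nat.factorization_def _ hp']
      have h4 : (p - 1) * padicValNat p D.factorial ≤ D := by omega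
      have h5 : ((p:ℝ) - 1) * padicValNat p D.factorial ≤ D := by
        have := (Nat.cast_le (α := ℝ)).mpr h4
        rwa [uf, Nat.cast_sub hp'.one_le, Nat.cast_one] at this
      have h6 : (0:ℝ) < p - 1 := by have : (1:ℝ) < p := by exact_mod_cast hp'.one_lt
                                    linarith
      rw [← mul_div_assoc, ua h6]
      nlinarith [zb p]
  rw [← yu] at h2
  exact yt (h1.trans h2) hD0

lemma mert (δ : ℝ) (hδ : 0 < δ) (hδ1 : δ ≤ 1) (p0 : ℕ) : ∃ C : ℝ, 0 ≤ C ∧ ∀ D : ℕ, 1 ≤ D → ∀ M : ℕ, M ≠ 0 →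
    (1 - δ) * log D - δ * log M - C ≤
      ∑ p ∈ (range (D+1)).filter (fun p => p.Prime ∧ p0 ≤ p ∧ ¬ p ∣ M), log p / p := by
  obtain ⟨q1, hq1⟩ := vu (1 / δ)
  set q0 := p0 + q1 + 1 with hq0
  have hq0' : 1 ≤ δ * q0 := by
    rw [zm hδ] at hq1
    have : (q1:ℝ) ≤ q0 := by exact_mod_cast (by omega : q1 ≤ q0)
    nlinarith
  refine ⟨1 + q0, by positivity, fun D hD M hM => ?_⟩
  have hm := mert0 D hD
  have hpos : ∀ p : ℕ, p.Prime → (0:ℝ) < p - 1 := fun p hp => by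
    have : (1:ℝ) < p := by exact_mod_cast hp.one_lt
    linarith
  rw [← Finset.sum_filter_add_sum_filter_not _ (fun p => q0 ≤ p)] at hm
  have hs : ∑ p ∈ ((range (D+1)).filter Nat.Prime).filter (fun p => ¬ q0 ≤ p), log p / (p - 1) ≤ q0 := by
    have : (((range (D+1)).filter Nat.Prime).filter (fun p => ¬ q0 ≤ p)).card ≤ q0 := by
      refine (zu (t := range q0) fun p hp => ?_).trans (xh _).le
      exact zo.mpr (not_le.mp (zz.mp hp).2)
    refine (zf _ _ 1 fun p hp => ?_).trans ?_
    · have hp' := (zz.mp (zz.mp hp).1).2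
      rw [div_le_one (hpos p hp')]
      exact xj (by exact_mod_cast hp'.pos)
    · rw [nsmul_one]; exact_mod_cast this
  set A := ((range (D+1)).filter Nat.Prime).filter (fun p => q0 ≤ p) with hA
  have hAm : ∀ p ∈ A, p.Prime ∧ q0 ≤ p ∧ p ≤ D := fun p hp => by
    have h1 := zz.mp hp
    have h2 := zz.mp h1.1
    exact ⟨h2.2, h1.2, by have := zo.mp h2.1; omega⟩
  have h1 : (1 - δ) * ∑ p ∈ A, log p / (p - 1) ≤ ∑ p ∈ A, log p / p := by
    rw [yu]
    refine zq fun p hp => ?_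
    obtain ⟨hp', hq, _⟩ := hAm p hp
    have hp0 : (0:ℝ) < p := by exact_mod_cast hp'.pos
    rw [← mul_div_assoc, div_le_div_iff₀ (hpos p hp') hp0]
    have : (q0:ℝ) ≤ p := by exact_mod_cast hq
    nlinarith [mul_nonneg (zb p) (by nlinarith : (0:ℝ) ≤ δ * p - 1)]
  have h2 : ∑ p ∈ A.filter (fun p => p ∣ M), log p / p ≤ δ * log M := by
    have h3 : ∑ p ∈ A.filter (fun p => p ∣ M), log p ≤ log M := by
      rw [← Real.log_prod (fun p hp => by have := (hAm p (zz.mp hp).1).1.pos; positivity)]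
      have hd : (∏ p ∈ A.filter (fun p => p ∣ M), p) ∣ M := by
        refine (Finset.prod_dvd_prod_of_subset _ M.primeFactors _ fun p hp => ?_).trans (Nat.prod_primeFactors_dvd M)
        have := zz.mp hp
        exact Nat.mem_primeFactors.mpr ⟨(hAm p this.1).1, this.2, hM⟩
      have hd' := xm (ve hM) hd
      refine yx ?_ (by rw [← Nat.cast_prod]; exact Nat.cast_le.mpr hd')
      exact Finset.prod_pos fun p hp => by exact_mod_cast (hAm p (zz.mp hp).1).1.pos
    refine je ?_ (zt h3 hδ.le)
    rw [yu]
    refine zq fun p hp => ?_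
    obtain ⟨hp', hq, _⟩ := hAm p (zz.mp hp).1
    have hp0 : (0:ℝ) < p := by exact_mod_cast hp'.pos
    rw [zm hp0]
    have : (q0:ℝ) ≤ p := by exact_mod_cast hq
    nlinarith [mul_nonneg (zb p) (by nlinarith : (0:ℝ) ≤ δ * p - 1)]
  have h3 : ∑ p ∈ A.filter (fun p => ¬ p ∣ M), log p / p ≤
      ∑ p ∈ (range (D+1)).filter (fun p => p.Prime ∧ p0 ≤ p ∧ ¬ p ∣ M), log p / p := by
    refine xc (fun p hp => ?_) fun p _ _ => div_nonneg (zb _) (jt _)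
    have h4 := zz.mp hp
    obtain ⟨h5, h6, h7⟩ := hAm p h4.1
    exact zz.mpr ⟨zo.mpr (by omega), h5, by omega, h4.2⟩
  have h4 := Finset.sum_filter_add_sum_filter_not A (fun p => p ∣ M) (fun p => log p / (p:ℝ))
  nlinarith [jt (α := ℝ) q0]

/-- all maximal minors vanish -/
lemma minors (v : ι → Fin s → ℤ) (h : ∀ i : Fin s → ι, (Matrix.of fun a b => v (i a) b).det = 0) :
    ∃ a : Fin s → ℚ, a ≠ 0 ∧ ∀ i, ∑ j, (v i j : ℚ) * a j = 0 := by
  classical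
  let v' : ι → Fin s → ℚ := fun i j => v i j
  by_cases hs : Submodule.span ℚ (Set.range v') = ⊤
  · exfalso
    obtain ⟨b, hb1, hb2, hb3⟩ := exists_linearIndependent ℚ (Set.range v')
    rw [hs] at hb2
    let bas := Module.Basis.mk hb3 (by rw [Subtype.range_coe]; exact hb2.ge)
    have : Fintype b := FiniteDimensional.fintypeBasisIndex bas
    have hc : Fintype.card b = s := by
      rw [← Module.finrank_eq_card_basis bas]; simp
    let e : Fin s ≃ b := (Fintype.equivFinOfCardEq hc).symm
    have hch : ∀ a : Fin s, ∃ i, v' i = (e a).1 := fun a => hb1 (e a).2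
    choose i hi using hch
    have h1 := h i
    have hli : LinearIndependent ℚ (Matrix.of fun a b => v' (i a) b).row := by
      have : (Matrix.of fun a b => v' (i a) b).row = fun a => (e a).1 := by
        funext a; rw [← hi a]; rfl
      rw [this]
      exact hb3.comp e e.injective
    rw [Matrix.linearIndependent_rows_iff_isUnit, Matrix.isUnit_iff_isUnit_det] at hli
    refine hli.ne_zero ?_
    have : (Matrix.of fun a b => v' (i a) b) = (Matrix.of fun a b => v (i a) b).map (icr ℚ) := by
      ext; simp [v']
    rw [this, ← RingHom.mapMatrix_apply, ← RingHom.map_det, h1, zp]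
  · obtain ⟨φ, h1, h2⟩ := Submodule.exists_le_ker_of_lt_top _ (lt_top_iff_ne_top.mpr hs)
    refine ⟨fun j => φ (Pi.single j 1), fun h0 => h1 ?_, fun i => ?_⟩
    · apply LinearMap.pi_ext'
      intro j
      ext
      simpa using congrFun h0 j
    · have h3 : φ (v' i) = 0 := h2 (Submodule.subset_span ⟨i, rfl⟩)
      rw [LinearMap.pi_apply_eq_sum_univ φ (v' i)] at h3
      rw [← h3]
      refine zs rfl fun j _ => ?_
      rw [zc]; congr 1
      exact congrArg φ (funext fun k => by simp [Pi.single_apply, eq_comm])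

lemma det_le (m : Fin s → Fin n →₀ ℕ) (P : Fin s → Fin n → ℤ) (hP : ∀ i j, |P i j| ≤ B) :
    |(Matrix.of fun i j => eval (P i) (monomial (m j) (1:ℤ))).det| ≤ s.factorial * (B:ℤ) ^ (∑ j, (m j).degree) := by
  rw [Matrix.det_apply]
  refine (jn _ _).trans ?_
  have : ∀ σ ∈ (Finset.univ : Finset (Equiv.Perm (Fin s))),
      |Equiv.Perm.sign σ • ∏ i, (Matrix.of fun i j => eval (P i) (monomial (m j) (1:ℤ))) (σ i) i| ≤ (B:ℤ) ^ (∑ j, (m j).degree) := by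
    intro σ _
    rw [Units.smul_def, zc, ue, Int.isUnit_iff_abs_eq.mp (Equiv.Perm.sign σ).isUnit, um, Finset.abs_prod, ← zr]
    refine vk (fun _ _ => vq _) fun i _ => ?_
    simp only [uv, eval_monomial, um]
    rw [ur _ _ (fun _ => pow_zero _), Finset.abs_prod, xz, ← zr]
    refine vk (fun _ _ => vq _) fun j _ => ?_
    rw [abs_pow]; exact vo (vq _) (hP _ _) _
  refine (zf _ _ _ this).trans ?_
  rw [va, Fintype.card_perm, Fintype.card_fin, uu]

lemma eval_le [Fintype σ] (g : MvPolynomial σ ℤ) (x : σ → ℤ) (A : ℕ) (hA : 1 ≤ A) (hx : ∀ i, |x i| ≤ A) :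
    |eval x g| ≤ (∑ m ∈ g.support, |coeff m g|) * (A:ℤ) ^ g.totalDegree := by
  rw [eval_eq', Finset.sum_mul]
  refine (jn _ _).trans (zq fun m hm => ?_)
  rw [ue]
  refine zt ?_ (vq _)
  rw [Finset.abs_prod]
  calc ∏ i, |x i ^ m i| ≤ ∏ i, (A:ℤ) ^ m i := vk (fun _ _ => vq _) fun i _ => by
        rw [abs_pow]; exact vo (vq _) (hx i) _
    _ = (A:ℤ) ^ m.degree := by rw [zr, xz]
    _ ≤ _ := by
      refine uo (by exact_mod_cast hA) ?_
      exact xg hm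

lemma td_map_le [CommSemiring R] [CommSemiring S] (φ : R →+* S) (f : MvPolynomial σ R) :
    (map φ f).totalDegree ≤ f.totalDegree :=
  Finset.sup_mono (support_map_subset _ _)

lemma map_ev [CommSemiring R] [CommSemiring S] (φ : R →+* S) (Q : σ → R) (g : MvPolynomial σ R) :
    φ (eval Q g) = eval (φ ∘ Q) (map φ g) := by
  rw [eval_map, ← coe_eval₂Hom, eval, coe_eval₂Hom, coe_eval₂Hom, eval₂_comp_left, RingHom.comp_id]

lemma supp_card [CommSemiring R] (H : Mv (n+1) R) (h : H.totalDegree ≤ d) :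
    H.support.card ≤ (d+1)^(n+1) := by
  classical
  have : H.support ⊆ Finset.univ.image (exf : (Fin (n+1) → Fin (d+1)) → _) := fun m hm => by
    obtain ⟨s, hs⟩ := exf_surj (n := n) (d := d) m ((xg hm).trans h)
    exact zy.mpr ⟨s, yw _, hs⟩
  exact (zu this).trans (xy.trans (by simp))

/-- coefficient bound for monomial substitution -/
lemma hs_coeff (H : Mv 4 ℤ) (h : H.totalDegree ≤ d) (A : ℕ) (hA : ∀ m, |coeff m H| ≤ A) (e : Fin 2 →₀ ℕ) :
    |coeff e (hs 0 H)| ≤ ((d+1)^4 * A : ℕ) := by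
  have e1 : hs 0 H = ∑ m ∈ H.support, (C (coeff m H) * (if m 3 = 0 then monomial (single 0 (m 0) + single 1 (m 1)) (1:ℤ) else 0) : Mv 2 ℤ) := by
    rw [hs]
    conv_lhs => rw [H.as_sum, vm]
    refine zs rfl fun m _ => ?_
    rw [aeval_monomial, ur _ _ (fun _ => pow_zero _), Fin.prod_univ_four]
    congr 1
    simp only [Matrix.cons_val, one_pow, qu, jb, monomial_mul, zp]
    split_ifs with h0 <;> simp [h0]
  rw [e1, ug]
  refine (jn _ _).trans ((zf _ _ (A:ℤ) fun m _ => ?_).trans ?_)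
  · rw [yz, ue]
    have : |coeff e (if m 3 = 0 then monomial (single 0 (m 0) + single 1 (m 1)) (1:ℤ) else 0 : Mv 2 ℤ)| ≤ 1 := by
      split_ifs
      · rw [coeff_monomial]; split_ifs <;> simp
      · simp
    nlinarith [hA m, vq (coeff m H)]
  · rw [uu]; push_cast
    have := supp_card H h
    gcongr
    exact_mod_cast this

lemma good (d : ℕ) (hd : 1 ≤ d) : ∃ C1 : ℕ, ∀ H : Mv 4 ℤ, YM d H →
    Irreducible (map (icr Qb) (hs 0 H)) → ∀ A : ℕ, 1 ≤ A → (∀ m, |coeff m H| ≤ A) →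
    ∃ M : ℕ, M ≠ 0 ∧ M ≤ C1 * A ^ C1 ∧ ∀ (p : ℕ) [Fact p.Prime], ¬ p ∣ M → YM d (map (icr (ZMod p)) H) ∧
      Irreducible (map (algebraMap (ZMod p) (AlgebraicClosure (ZMod p))) (hs 0 (map (icr (ZMod p)) H))) := by
  classical
  obtain ⟨N, hN⟩ := noether 1 d hd
  let s1 : ℕ := N.sup fun g => (∑ m ∈ g.support, |coeff m g|).natAbs
  let t1 : ℕ := N.sup totalDegree
  refine ⟨s1 * ((d+1)^4) ^ t1 + t1 + 1, fun H hH hi A hA1 hA => ?_⟩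
  have key : ∀ (K : Type) [Field K] [IsAlgClosed K] (φ : ℤ →+* K), φ (coeff (single 0 d) H) ≠ 0 →
      (Irreducible (map φ (hs 0 H)) ↔ ∃ g ∈ N, φ (aeval (cf d (hs 0 H)) g) ≠ 0) := by
    intro K _ _ φ hφ
    have hY : YM d (map φ H) := ⟨(td_map_le _ _).trans hH.1, by rwa [xf]⟩
    have := hN K (map φ (hs 0 H)) (by rw [hs_map]; exact hs_ym hY _)
    rw [this]
    refine exists_congr fun g => and_congr_right fun _ => ?_
    rw [aeval_hom, ← cf_map]
  obtain ⟨g, hg, hg0⟩ := (key _ (icr Qb) (by simpa using hH.2)).mp hi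
  have hg1 : aeval (cf d (hs 0 H)) g ≠ 0 := fun h => hg0 (by rw [h]; simp)
  refine ⟨(coeff (single 0 d) H * aeval (cf d (hs 0 H)) g).natAbs, kq.mpr (xt hH.2 hg1), ?_, ?_⟩
  · have h1 := eval_le g (cf d (hs 0 H)) ((d+1)^4 * A) (by nlinarith [ui 4 (d+1) (by omega)])
      (fun i => hs_coeff H hH.1 A hA _)
    have h2 : (aeval (cf d (hs 0 H)) g).natAbs ≤ s1 * ((d+1)^4 * A) ^ t1 := by
      have h3 : (∑ m ∈ g.support, |coeff m g|).natAbs ≤ s1 := km (f := fun g : MvPolynomial (Fin 2 → Fin (d+1)) ℤ => (∑ m ∈ g.support, |coeff m g|).natAbs) hg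
      have h4 : g.totalDegree ≤ t1 := km (f := totalDegree) hg
      have h5 : (aeval (cf d (hs 0 H)) g).natAbs ≤ (∑ m ∈ g.support, |coeff m g|).natAbs * ((d+1)^4*A) ^ g.totalDegree := by
        zify
        rw [ko (Finset.sum_nonneg fun m _ => vq (coeff m g))]
        exact_mod_cast h1
      refine h5.trans (xs h3 (zg ?_ h4))
      exact xa (by positivity) hA1
    have h3 : (coeff (single 0 d) H).natAbs ≤ A := by
      have := hA (single 0 d); rw [Int.abs_eq_natAbs] at this; exact_mod_cast this
    rw [Int.natAbs_mul]
    calc _ ≤ A * (s1 * ((d+1)^4 * A) ^ t1) := xs h3 h2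
      _ = s1 * ((d+1)^4) ^ t1 * A ^ (t1 + 1) := by generalize (d+1)^4 = w; rw [kr, pow_succ]; ring
      _ ≤ _ := xs (by omega) (zg hA1 (by omega))
  · intro p _ hp
    rw [Int.natAbs_mul] at hp
    have h1 : ∀ z : ℤ, ¬ p ∣ z.natAbs → (z : ZMod p) ≠ 0 := fun z hz h0 => hz (by
      rw [zj] at h0; exact ux.mp h0)
    have h2 := h1 _ fun h => hp (h.mul_right _)
    have h3 := h1 _ fun h => hp (h.mul_left _)
    refine ⟨⟨(td_map_le _ _).trans hH.1, by rw [xf]; exact h2⟩, ?_⟩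
    have h4 := (key (AlgebraicClosure (ZMod p)) ((algebraMap (ZMod p) _).comp (icr (ZMod p))) ?_).mpr ⟨g, hg, ?_⟩
    · rw [← map_map, hs_map] at h4; simpa using h4
    · rw [RingHom.comp_apply, map_ne_zero]; exact h2
    · rw [RingHom.comp_apply, map_ne_zero]; exact h3

lemma cls (d : ℕ) (hd : 1 ≤ d) (δ : ℝ) (hδ : 0 < δ) : ∃ p0 : ℕ, ∀ (p : ℕ) [Fact p.Prime], p0 ≤ p → ∀ H : Mv 4 ℤ,
    H.IsHomogeneous d → YM d (map (icr (ZMod p)) H) →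
      Irreducible (map (algebraMap (ZMod p) (AlgebraicClosure (ZMod p))) (hs 0 (map (icr (ZMod p)) H))) →
    ∃ 𝒬 : Finset (Fin 3 → ℤ), (∀ P, eval P (dh H) = 0 → ∃ Q ∈ 𝒬, ∀ j, (p : ℤ) ∣ P j - Q j) ∧
      ((𝒬.card + d * (𝒬.filter fun Q => (p : ℤ) ∣ eval Q (pderiv 0 (dh H))).card : ℕ) : ℝ) ≤ (1 + δ) * p ^ 2 := by
  classical
  obtain ⟨L, hL⟩ := vu (2 * (d + 1) / δ + 1)
  have hL1 : 1 ≤ L := by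
    have : (1:ℝ) ≤ L := je (by linarith [show 0 ≤ 2 * ((d:ℝ) + 1) / δ by positivity]) hL
    exact_mod_cast this
  obtain ⟨c, hc⟩ := langweil d L hd hL1
  obtain ⟨p1, hp1⟩ := vu (2 * (c + d * c) / δ)
  refine ⟨c + p1, fun p _ hp H hH hY hi => ?_⟩
  obtain ⟨h1, h2⟩ := hc p (by omega) _ hY (hH.map _) hi
  let φ := icr (ZMod p)
  let Z : Finset (Fin 3 → ZMod p) := Finset.univ.filter fun z => eval z (dh (map φ H)) = 0
  let li : (Fin 3 → ZMod p) → (Fin 3 → ℤ) := fun z j => ((z j).val : ℤ)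
  have hli : ∀ z, φ ∘ li z = z := fun z => by funext j; simp [φ, li]
  have hev : ∀ (Q : Fin 3 → ℤ) (g : Mv 3 ℤ), φ (eval Q g) = eval (φ ∘ Q) (map φ g) := fun Q g => (map_ev φ Q g)
  refine ⟨Z.image li, fun P hP => ?_, ?_⟩
  · refine ⟨li (φ ∘ P), ze _ (zz.mpr ⟨yw _, ?_⟩), fun j => ?_⟩
    · rw [← dh_map, ← hev, hP, zp]
    · rw [← zj]
      have := congrFun (hli (φ ∘ P)) j
      simp only [Function.comp, φ, Int.coe_castRingHom] at this
      push_cast; rw [kp]; exact this.symm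
  · have h3 := h1 Z fun P hP => (zz.mp hP).2
    have h4 := h2 (Z.filter fun z => eval z (pderiv 0 (dh (map φ H))) = 0) fun P hP =>
      ⟨(zz.mp (zz.mp hP).1).2, (zz.mp hP).2⟩
    have h5 : ((Z.image li).filter fun Q => (p : ℤ) ∣ eval Q (pderiv 0 (dh H))).card ≤ c * p := by
      refine je ?_ h4
      rw [Finset.filter_image]
      refine xy.trans (zu fun z hz => ?_)
      obtain ⟨h6, h7⟩ := zz.mp hz
      refine zz.mpr ⟨h6, ?_⟩
      rw [← dh_map, pderiv_map]
      have := hev (li z) (pderiv 0 (dh H))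
      rw [hli] at this
      rw [← this]
      exact (zj _ _).mpr h7
    have h6 : (Z.image li).card ≤ Z.card := xy
    have hp0 : (0:ℝ) ≤ p := jt _
    have hL0 : (0:ℝ) < L := by exact_mod_cast hL1
    have h7 : (L:ℝ) * Z.card ≤ (L + d + 1) * p ^ 2 + c * p := by exact_mod_cast h3
    have h8 : 2 * ((d:ℝ) + 1) ≤ L * δ := by
      rw [← zm hδ]; linarith
    have h9 : 2 * ((c:ℝ) + d * c) ≤ p * δ := by
      rw [← zm hδ]; refine hp1.trans ?_; exact_mod_cast (by omega : p1 ≤ p)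
    have h10 : (Z.card : ℝ) ≤ (1 + δ/2) * p^2 + c * p := by
      have : (L:ℝ) * Z.card ≤ L * ((1 + δ/2) * p^2 + c * p) := by
        have : (1:ℝ) ≤ L := by exact_mod_cast hL1
        have : 0 ≤ (c:ℝ) * p := by positivity
        nlinarith [sq_nonneg (p:ℝ)]
      exact yt this hL0
    have h11 : (((Z.image li).card + d * ((Z.image li).filter fun Q => (p : ℤ) ∣ eval Q (pderiv 0 (dh H))).card : ℕ) : ℝ) ≤ Z.card + d * (c * p) := by
      exact_mod_cast Nat.add_le_add h6 (zx _ h5)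
    nlinarith

lemma monos (D : ℕ) : ∃ m : Fin (2*(D+1)*(D+2)) → Fin 3 →₀ ℕ, Injective m ∧
    6 * ∑ j, (m j).degree = 2*(D+1)*(D+2) * (4*D+9) ∧ (∀ j, m j 0 < 4) ∧ ∀ j, (m j).degree ≤ D + 4 := by
  classical
  let S : Finset (Σ _ : ℕ, ℕ × ℕ) := (range (D+1)).sigma fun t => range (t+1) ×ˢ range 4
  have hc : S.card = 2*(D+1)*(D+2) := by
    rw [Finset.card_sigma]
    simp only [Finset.card_product, xh]
    induction D with
    | zero => simp
    | succ D ih => rw [ym, ih]; ring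
  let g : (Σ _ : ℕ, ℕ × ℕ) → Fin 3 →₀ ℕ := fun x => Finsupp.equivFunOnFinite.symm ![x.2.2, x.2.1, x.1 - x.2.1]
  have hg : ∀ x ∈ S, (g x).degree = x.2.2 + x.1 := by
    rintro ⟨t, i, k⟩ hx
    simp only [S, Finset.mem_sigma, xe, zo] at hx
    rw [xz, Fin.sum_univ_three]
    simp [g]; omega
  let e : Fin (2*(D+1)*(D+2)) ≃ S := (finCongr hc.symm).trans S.equivFin.symm
  refine ⟨fun j => g (e j), ?_, ?_, ?_, ?_⟩
  · intro a b hab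
    change g (e a) = g (e b) at hab
    have h0 := yb hab 0
    have h1 := yb hab 1
    have h2 := yb hab 2
    have ha := (e a).2
    have hb := (e b).2
    apply e.injective
    apply kn
    generalize (e a : Σ _ : ℕ, ℕ × ℕ) = x at *
    generalize (e b : Σ _ : ℕ, ℕ × ℕ) = y at *
    obtain ⟨t, i, k⟩ := x
    obtain ⟨t', i', k'⟩ := y
    simp only [S, Finset.mem_sigma, xe, zo] at ha hb
    simp [g] at h0 h1 h2
    obtain rfl : t = t' := by omega
    simp [h0, h1]
  · rw [Equiv.sum_comp e (fun x => (g x).degree), Finset.sum_coe_sort S (fun x => (g x).degree), zs rfl hg, Finset.sum_sigma]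
    simp only [Finset.sum_product]
    have : ∀ t : ℕ, ∑ i ∈ range (t+1), ∑ k ∈ range 4, (k + t) = (t+1)*(4*t+6) := fun t => by
      simp [ym]; ring
    rw [zs rfl fun t _ => this t]
    clear * -
    induction D with
    | zero => simp
    | succ D ih => rw [ym, mul_add, ih]; ring
  · intro j
    change g (e j) 0 < 4
    have hx := (e j).2
    generalize (e j : Σ _ : ℕ, ℕ × ℕ) = x at *
    simp only [S, Finset.mem_sigma, xe, zo] at hx
    simpa [g] using hx.2.2
  · intro j
    have hx := (e j).2
    rw [hg _ hx]
    simp only [S, Finset.mem_sigma, xe, zo] at hx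
    omega

lemma cn2 (K k : ℕ) : (Finset.univ.filter fun γ : Fin 2 → Fin K => ∑ j, (γ j : ℕ) ≤ k).card ≤ ∑ t ∈ range (k+1), (t+1) := by
  classical
  have : ∑ t ∈ range (k+1), (t+1) = ((range (k+1)).sigma fun t => range (t+1)).card := by
    rw [Finset.card_sigma]; simp
  rw [this]
  refine xw (fun γ => ⟨γ 0 + γ 1, γ 0⟩) ?_ ?_
  · intro γ hγ
    simp [xd] at hγ ⊢; omega
  · intro a _ b _ h
    simp only [Sigma.mk.injEq, heq_eq_eq] at h
    have h0 : a 0 = b 0 := jo h.2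
    have h1 : a 1 = b 1 := jo (by omega)
    funext i; fin_cases i <;> assumption

lemma cn2s (K : ℕ) : 6 * ∑ k ∈ range K, ∑ t ∈ range (k+1), (t+1) = K*(K+1)*(K+2) := by
  have h2 : ∀ k, 2 * ∑ t ∈ range (k+1), (t+1) = (k+1)*(k+2) := fun k => by
    induction k with
    | zero => simp
    | succ k ih => rw [ym, mul_add, ih]; ring
  induction K with
  | zero => simp
  | succ K ih => rw [ym, mul_add, ih]; linarith [h2 K]

/-- arithmetic for a small good prime -/
lemma arith1 (D p K e W : ℕ) (δ : ℝ) (hδ0 : 0 ≤ δ) (hδ : δ ≤ 1) (hp : 1 ≤ p) (hpD : p ≤ D) (hK : K = 2*D/p) (hW : (W:ℝ) ≤ (1+δ)*p^2)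
    (S : ℕ) (hS : 6 * S = K*(K+1)*(K+2))
    (h : K * (2*(D+1)*(D+2)) ≤ e + W * S) : ((2*(D+1)*(D+2) : ℕ):ℝ) * ((4/3-δ)*(D/p) - 4) ≤ e := by
  have hp0 : (0:ℝ) < p := by exact_mod_cast hp
  have hpD' : (p:ℝ) ≤ D := by exact_mod_cast hpD
  have hD0 : (0:ℝ) < D := vl hp0 hpD'
  have hK1 : (K:ℝ) ≤ 2*(D/p) := by
    rw [← mul_div_assoc, ua hp0, hK]; exact_mod_cast Nat.div_mul_le_self _ _
  have hK2 : 2*((D:ℝ)/p) - 1 ≤ K := by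
    rw [← mul_div_assoc, sub_le_iff_le_add, zm hp0, hK]
    have := Nat.lt_div_mul_add (a := 2*D) (b := p) hp
    have : 2 * D ≤ (2*D/p + 1) * p := by nlinarith
    exact_mod_cast this
  set s : ℕ := 2*(D+1)*(D+2) with hs
  have hsD : 2 * (D:ℝ)^2 ≤ s := by rw [hs]; push_cast; nlinarith
  have hs0 : (0:ℝ) < s := by nlinarith
  set u : ℝ := (p:ℝ)/D with hu
  have hu0 : 0 < u := by positivity
  have hu1 : u ≤ 1 := by rw [hu, div_le_one hD0]; exact hpD'
  have hDu : (D:ℝ)/p = 1/u := by rw [hu]; field_simp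
  have hpu : (p:ℝ) = u * D := by rw [hu]; field_simp
  obtain ⟨v, hv⟩ : ∃ v, v = 1/u := ⟨_, rfl⟩
  rw [hDu, ← hv] at hK1 hK2 ⊢
  clear_value u
  have huv : u * v = 1 := by rw [hv]; field_simp
  have hv1 : 1 ≤ v := by rw [hv, ua hu0]; linarith
  have hK0 : (0:ℝ) ≤ K := jt _
  have h' : (K:ℝ) * s ≤ e + W * S := by exact_mod_cast h
  have hS' : 6 * (S:ℝ) = K*(K+1)*(K+2) := by exact_mod_cast hS
  have h1 : (W:ℝ) * ((K+1)*(K+2)) ≤ (1+δ)*p^2 * ((2*v+1)*(2*v+2)) := by gcongr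
  have h2 : (1+δ)*(p:ℝ)^2 * ((2*v+1)*(2*v+2)) = (1+δ) * D^2 * (4 + 6*u + 2*u^2) := by
    rw [hpu]
    linear_combination (1+δ)*D^2*(4*(u*v+1) + 6*u) * huv
  have h3 : (1+δ) * (D:ℝ)^2 * (4 + 6*u + 2*u^2) ≤ s * ((1+δ)*(2+4*u)) := by
    have hu2 : u^2 ≤ u := by rw [sq]; exact mul_le_of_le_one_left hu0.le hu1
    have : 4 + 6*u + 2*u^2 ≤ 2*(2+4*u) := by linarith
    calc _ ≤ (1+δ) * (D:ℝ)^2 * (2*(2+4*u)) := by gcongr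
      _ = 2 * D^2 * ((1+δ)*(2+4*u)) := by ring
      _ ≤ _ := by gcongr
  set b : ℝ := 1 - (1+δ)*(2+4*u)/6 with hb
  have h4 : (K:ℝ) * s * b ≤ e := by
    have : (K:ℝ) * (W * ((K+1)*(K+2))) ≤ K * (s * ((1+δ)*(2+4*u))) := zt (by linarith) hK0
    have e1 : (W:ℝ) * S = K * (W * ((K+1)*(K+2)))/6 := by rw [show (S:ℝ) = K*(K+1)*(K+2)/6 by linarith]; ring
    rw [e1] at h'
    rw [hb]; linarith
  have hud : u * δ ≤ u := mul_le_of_le_one_right hu0.le hδ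
  have hud0 : 0 ≤ u * δ := by positivity
  have hdv : 0 ≤ δ * v := by positivity
  have hb1 : 2/3 - δ/3 - 4/3*u ≤ b := by rw [hb]; linarith
  have hb2 : b ≤ 2/3 := by rw [hb]; linarith
  clear_value b
  have h6 : 2*v*(2/3 - δ/3 - 4/3*u) ≤ 2*v*b := by gcongr
  have h7 : 2*v*(2/3-δ/3-4/3*u) = 4/3*v - 2/3*(δ*v) - 8/3 := by linear_combination (-8/3)*huv
  rcases le_or_gt 0 b with hb0 | hb0
  · refine je ?_ h4
    rw [xb (K:ℝ), uj]
    refine zt ?_ hs0.le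
    have h5 : (2*v-1)*b ≤ K*b := by gcongr
    linarith
  · have h8 : 2 * v * b ≤ 0 := mul_nonpos_of_nonneg_of_nonpos (by linarith) hb0.le
    have : (4/3-δ)*v - 4 ≤ 0 := by linarith
    exact je (mul_nonpos_of_nonneg_of_nonpos hs0.le this) (jt e)

lemma prod_log (G : Finset ℕ) (hG : ∀ p ∈ G, p.Prime) (e : ℕ → ℕ) (N : ℕ) (hN : N ≠ 0) (h : ∀ p ∈ G, p ^ e p ∣ N) :
    ∑ p ∈ G, (e p : ℝ) * log p ≤ log N := by
  have h1 : ∏ p ∈ G, p ^ e p ∣ N := Finset.prod_dvd_of_isRelPrime (fun p hp q hq hpq => by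
    change IsRelPrime (p ^ e p) (q ^ e q)
    rw [← Nat.coprime_iff_isRelPrime]
    exact Nat.Coprime.pow _ _ ((Nat.coprime_primes (hG p hp) (hG q hq)).mpr hpq)) h
  have h2 := xm (ve hN) h1
  have h3 : log (∏ p ∈ G, p ^ e p : ℕ) ≤ log N := yx (by
    exact_mod_cast Finset.prod_pos fun p hp => pow_pos (hG p hp).pos _) (by exact_mod_cast h2)
  push_cast at h3
  rw [Real.log_prod (fun p hp => vt _ (by exact_mod_cast (hG p hp).ne_zero))] at h3
  simpa [xv] using h3

lemma dhQ_irr (hd : 1 ≤ d) (H : Mv 4 ℤ) (hH : H.IsHomogeneous d) (hY : YM d H)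
    (hi : Irreducible (map (icr Qb) (hs 0 H))) :
    YM d (map (icr ℚ) (dh H)) ∧ Irreducible (map (icr ℚ) (dh H)) := by
  classical
  have hY' : YM d (map (icr ℚ) H) := ⟨(td_map_le _ _).trans hY.1, by rw [xf]; simpa using hY.2⟩
  rw [dh_map]
  refine ⟨dh_ym hY', ?_⟩
  obtain ⟨c, hc⟩ := pencil d hd
  obtain ⟨bad, -, hb⟩ := hc ℚ (map (icr ℚ) H) hY' (by
    have : (0:ℚ) = icr ℚ 0 := by simp
    rw [this, ← hs_map, map_map, RingHom.ext_int (RingHom.comp _ _) (icr _)]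
    exact hi)
  obtain ⟨t, ht⟩ := Infinite.exists_notMem_finset (insert 0 bad)
  simp only [ka, not_or] at ht
  exact dh_irr hY' (hH.map _) ht.1 (irr_of_map _ (hb t ht.2))

lemma arith2 (D : ℕ) (hD1 : 1 ≤ D) (δ ε' lD lq L lM S1 S2 ls C c2 C0 : ℝ) (hδ0 : 0 ≤ δ) (hδ1 : δ ≤ 1)
    (hε : 0 < ε') (hc2 : 0 ≤ c2) (hC : 0 ≤ C) (hDε : 9 / (2*ε') ≤ D)
    (hδ : δ * (7/3 + 4/3*(c2+C0)) ≤ ε'/2) (hL0 : 0 ≤ L) (hL : 2/ε' * (11 + 4/3*C + 4/3*c2) < L)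
    (h : (4/3-δ)*D*S1 - 4*S2 + 4/3*D*lq ≤ ls + (2*D/3+3/2)*L)
    (hls : ls ≤ 5*D) (hS2 : S2 ≤ D * (3/2)) (hS1 : (1-δ)*lD - δ*(lM+lq) - C ≤ S1) (hD : lD ≤ L) (hD0 : 0 ≤ lD)
    (hM : lM ≤ c2 + c2*L) (hM0 : 0 ≤ lM) (hq : lq ≤ C0*L) (hq0 : 0 ≤ lq) (hDq : (1/2+ε')*L ≤ lD + lq) : False := by
  have hD0' : (0:ℝ) < D := by exact_mod_cast hD1
  have h1 : 3/2*L ≤ D*(ε'/3*L) := by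
    have : 9 ≤ D * (2*ε') := by rwa [zm (by positivity)] at hDε
    have := zh this hL0
    linarith
  have h2 : (4/3-δ)*S1 - 6 + 4/3*lq ≤ 5 + (2/3+ε'/3)*L := by
    refine yt ?_ hD0'
    linarith
  have h3 := zt hS1 (by linarith : (0:ℝ) ≤ 4/3-δ)
  have h4 : δ*lD ≤ δ*L := by gcongr
  have h5 : δ*(lM+lq) ≤ δ*(c2+c2*L+C0*L) := by gcongr
  have h6 : 0 ≤ δ * (δ*lD) := by positivity
  have h7 : 0 ≤ δ * (δ*(lM+lq)) := by positivity
  have h8 : 0 ≤ δ * C := by positivity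
  have h9 : δ * (7/3 + 4/3*(c2+C0))*L ≤ ε'/2*L := by gcongr
  have h10 : δ * c2 ≤ c2 := mul_le_of_le_one_left hc2 hδ1
  have h11 : 2 * (11 + 4/3*C + 4/3*c2) < ε' * L := by
    have := mul_lt_mul_of_pos_left hL hε
    rwa [← uj, mul_div_cancel₀ _ hε.ne'] at this
  have h12 : (4/3-δ)*((1-δ)*lD - δ*(lM+lq) - C) = 4/3*lD - 7/3*(δ*lD) + δ*(δ*lD) - 4/3*(δ*(lM+lq)) + δ*(δ*(lM+lq)) - 4/3*C + δ*C := by ring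
  rw [h12] at h3
  linarith

lemma aux (d : ℕ) (hd : 4 ≤ d) (ε' : ℝ) (hε : 0 < ε') (C0 : ℕ) (hC0 : 1 ≤ C0) : ∃ Ds B0 : ℕ, 1 ≤ Ds ∧ 1 ≤ B0 ∧ ∀ B : ℕ, B0 ≤ B → ∀ D : ℕ, Ds ≤ D → D ≤ B →
    ∀ Q0 : Finset ℕ, (∀ q ∈ Q0, q.Prime) → ∏ q ∈ Q0, q ≤ B ^ C0 → (B:ℝ) ^ (1/2 + ε') ≤ (∏ q ∈ Q0, q : ℕ) * D →
    ∀ H : Mv 4 ℤ, H.IsHomogeneous d → YM d H →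
    Irreducible (map (icr Qb) (hs 0 H)) → (∀ m, |coeff m H| ≤ (C0 * B ^ C0 : ℕ)) →
    ∀ T : Set (Fin 3 → ℤ), (∀ P ∈ T, (∀ i, |P i| ≤ B) ∧ eval P (dh H) = 0) →
    (∀ q ∈ Q0, ∀ P ∈ T, ¬ (q:ℤ) ∣ eval P (pderiv 0 (dh H)) ∧ ∀ P' ∈ T, ∀ j, (q:ℤ) ∣ P j - P' j) →
    ∃ R : Mv 2 ℚ, R ≠ 0 ∧ R.totalDegree ≤ 2 * d * (D + 4) ∧ ∀ P ∈ T, eval (fun i => (P (Fin.succ i) : ℚ)) R = 0 := by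
  classical
  have hd1 : 1 ≤ d := by omega
  obtain ⟨C1, hC1⟩ := good d hd1
  set c2 : ℝ := C1 + C1 * C0 with hc2
  have hc20 : 0 ≤ c2 := by positivity
  set X : ℝ := 7/3 + 4/3*(c2+C0) with hX
  have hX0 : 0 < X := by positivity
  obtain ⟨δ, hδ0, hδ1, hδX⟩ : ∃ δ : ℝ, 0 < δ ∧ δ ≤ 1 ∧ δ * X ≤ ε'/2 := by
    refine ⟨min 1 (ε'/2/X), by positivity, min_le_left _ _, ?_⟩
    rw [← ua hX0]; exact min_le_right _ _
  obtain ⟨p0, hp0⟩ := cls d hd1 δ hδ0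
  obtain ⟨C, hCnn, hC⟩ := mert δ hδ0 hδ1 p0
  obtain ⟨Ds, hDs⟩ := vu (9 / (2*ε'))
  obtain ⟨B0, hB0⟩ := exists_nat_gt (Real.exp (2/ε' * (11 + 4/3*C + 4/3*c2)))
  refine ⟨Ds + 1, B0 + 1, by omega, by omega, fun B hB D hD hDB Q0 hQ0 hqB hqD H hH hY hi hA T hT hTQ => ?_⟩
  obtain ⟨M, hM0, hM, hMp⟩ := hC1 H hY hi (C0 * B ^ C0) (xa hC0 (Nat.pow_pos (by omega))) hA
  set q : ℕ := ∏ q ∈ Q0, q with hq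
  have hqpos : 0 < q := Finset.prod_pos fun p hp => (hQ0 p hp).pos
  obtain ⟨s, hs⟩ : ∃ s, s = 2*(D+1)*(D+2) := ⟨_, rfl⟩
  have hm := monos D
  rw [← hs] at hm
  obtain ⟨m, hminj, hmdeg, hm4, hmD⟩ := hm
  have hspos : 0 < s := by rw [hs]; positivity
  have hs0 : (0:ℝ) < s := by exact_mod_cast hspos
  have hD1 : 1 ≤ D := by omega
  have hB1 : 1 ≤ B := by omega
  have hD0 : (0:ℝ) < D := by exact_mod_cast hD1
  have hBpos : (0:ℝ) < B := by exact_mod_cast hB1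
  have hdet : ∀ P : Fin s → T, (Matrix.of fun i j => eval (P i : Fin 3 → ℤ) (monomial (m j) (1:ℤ))).det = 0 := by
    intro P
    by_contra hne
    set Δ := (Matrix.of fun i j => eval (P i : Fin 3 → ℤ) (monomial (m j) (1:ℤ))).det with hΔ
    set G := (range (D+1)).filter (fun p => p.Prime ∧ p0 ≤ p ∧ ¬ p ∣ M * q) with hG
    have hbig : ∀ p ∈ G, ∃ e : ℕ, p ^ e ∣ Δ.natAbs ∧ (s:ℝ) * ((4/3-δ)*(D/p) - 4) ≤ e := by
      intro p hp
      simp only [hG, zz, zo] at hp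
      obtain ⟨hpD, hpp, hpp0, hpM⟩ := hp
      have : Fact p.Prime := ⟨hpp⟩
      obtain ⟨h1, h2⟩ := hMp p fun h => hpM (h.mul_right _)
      obtain ⟨𝒬, h3, h4⟩ := hp0 p hpp0 H hH h1 h2
      obtain ⟨e, he, he2⟩ := detdiv (K := 2*D/p) hd1 p hpp (dh H) (dh_ym hY) 𝒬 (fun Q _ _ hdv => by
          have h5 := (dh_ym h1).2
          rw [← dh_map, xf] at h5
          exact h5 ((zj _ _).mpr hdv))
        (fun j => monomial (m j) 1) (fun i => P i) (fun i => (hT _ (P i).2).2) (fun i => h3 _ (hT _ (P i).2).2) _ (cn2 _)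
      exact ⟨e, ux.mp (by exact_mod_cast he), by
        rw [hs]; exact arith1 D p _ e _ δ hδ0.le hδ1 hpp.one_lt.le (by omega) rfl h4 _ (cn2s _) (hs ▸ he2)⟩
    have hcl : ∀ p ∈ Q0, ∃ e : ℕ, p ^ e ∣ Δ.natAbs ∧ (s:ℝ) * (4/3*D) ≤ e := by
      intro p hp
      obtain ⟨e, he, he2⟩ := detdiv (K := 2*D) hd1 p (hQ0 p hp) (dh H) (dh_ym hY) {(P ⟨0, hspos⟩ : Fin 3 → ℤ)} (fun Q hQ hdv => by
          rw [kt] at hQ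
          rw [hQ] at hdv
          exact absurd hdv (hTQ p hp _ (P _).2).1)
        (fun j => monomial (m j) 1) (fun i => P i) (fun i => (hT _ (P i).2).2) (fun i => ⟨_, Finset.mem_singleton_self _, (hTQ p hp _ (P i).2).2 _ (P _).2⟩) _ (cn2 _)
      refine ⟨e, ux.mp (by exact_mod_cast he), ?_⟩
      rw [Finset.filter_singleton, ji (hTQ p hp _ (P _).2).1, Finset.card_empty, Finset.card_singleton] at he2
      have h6 := cn2s (2*D)
      have h7 : 4 * D * s ≤ 3 * e := by
        have h8 : 2*D*(2*D+1)*(2*D+2) ≤ 2*D*(2*s) := by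
          rw [uj]; exact zx _ (by
            have : 2*(2*(D+1)*(D+2)) = (2*D+1)*(2*D+2) + (6*D+6) := by ring
            rw [hs]; omega)
        have : 6 * (2*D*s) ≤ 6 * e + 2*D*(2*s) := by omega
        have e1 : 6*(2*D*s) = 12*(D*s) := by ring
        have e2 : 2*D*(2*s) = 4*(D*s) := by ring
        have e3 : 4*D*s = 4*(D*s) := by ring
        omega
      have h7' : 4 * (D:ℝ) * s ≤ 3 * e := by exact_mod_cast h7
      linarith
    choose! e1 he1 he1' using hbig
    choose! e2 he2 he2' using hcl
    have hdisj : Disjoint G Q0 := Finset.disjoint_left.mpr fun p hp hp' => by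
      simp only [hG, zz] at hp
      exact hp.2.2.2 ((ut _ hp').mul_left _)
    have hGp : ∀ p ∈ G, p.Prime := fun p hp => by
      simp only [hG, zz] at hp; exact hp.2.1
    have hlog := prod_log (G ∪ Q0) (fun p hp => (ke.mp hp).elim (hGp p) (hQ0 p))
      (fun p => if p ∈ G then e1 p else e2 p) Δ.natAbs (kq.mpr hne) (fun p hp => by
        by_cases hpG : p ∈ G
        · simp only [hpG, if_true]; exact he1 p hpG
        · simp only [hpG, if_false]; exact he2 p ((ke.mp hp).resolve_left hpG))
    rw [Finset.sum_union hdisj] at hlog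
    have hl1 : (s:ℝ) * ((4/3-δ)*D * (∑ p ∈ G, log p / p) - 4 * ∑ p ∈ G, log p) ≤
        ∑ p ∈ G, ((if p ∈ G then e1 p else e2 p : ℕ) : ℝ) * log p := by
      rw [yu, yu, ← Finset.sum_sub_distrib, yu]
      refine zq fun p hp => ?_
      rw [if_pos hp]
      have := zh (he1' p hp) (zb p)
      refine je (le_of_eq ?_) this
      ring
    have hl2 : (s:ℝ) * (4/3*D * log q) ≤ ∑ p ∈ Q0, ((if p ∈ G then e1 p else e2 p : ℕ) : ℝ) * log p := by
      rw [hq, Nat.cast_prod, Real.log_prod (fun p hp => by exact_mod_cast (hQ0 p hp).ne_zero), yu, yu]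
      refine zq fun p hp => ?_
      rw [ji fun h => Finset.disjoint_left.mp hdisj h hp, ← uj]
      exact zh (he2' p hp) (zb p)
    have hup : log Δ.natAbs ≤ s * log s + s * ((2*D/3+3/2) * log B) := by
      have h1 := det_le m (fun i => (P i : Fin 3 → ℤ)) (fun i j => (hT _ (P i).2).1 j)
      have h2 : Δ.natAbs ≤ s ^ s * B ^ (∑ j, (m j).degree) := by
        have h3 : Δ.natAbs ≤ s.factorial * B ^ (∑ j, (m j).degree) := by
          zify; exact h1
        exact h3.trans (zv _ (Nat.factorial_le_pow s))
      have h3 : log Δ.natAbs ≤ log (s ^ s * B ^ (∑ j, (m j).degree) : ℕ) :=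
        yx (by exact_mod_cast ve (kq.mpr hne)) (by exact_mod_cast h2)
      push_cast at h3
      rw [jl (by positivity) (by positivity), xv, xv] at h3
      have h4 : 6 * ((∑ j, (m j).degree : ℕ) : ℝ) = s * (4*D+9) := by exact_mod_cast hmdeg
      have h5 : ((∑ j, (m j).degree : ℕ) : ℝ) = s * (2*D/3+3/2) := by linarith
      rw [h5] at h3
      linarith
    have hmain : (4/3-δ)*D * (∑ p ∈ G, log p / p) - 4 * (∑ p ∈ G, log p) + 4/3*D*log q ≤ log s + (2*D/3+3/2) * log B := by
      refine yt ?_ hs0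
      linarith
    have hLB : 2/ε' * (11 + 4/3*C + 4/3*c2) < log B := by
      rw [Real.lt_log_iff_exp_lt hBpos]
      exact hB0.trans_le (by exact_mod_cast (by omega : B0 ≤ B))
    have hL0 : 0 ≤ log B := zb B
    have hC1pos : 1 ≤ C1 := by
      by_contra h
      obtain rfl : C1 = 0 := by omega
      simp at hM; exact hM0 hM
    refine arith2 D hD1 δ ε' (log D) (log q) (log B) (log M) _ _ _ C c2 C0 hδ0.le hδ1 hε hc20 hCnn ?_ hδX hL0 hLB hmain ?_ ?_ ?_ ?_ (zb _) ?_ (zb _) ?_ (zb _) ?_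
    · exact hDs.trans (by exact_mod_cast (by omega : Ds ≤ D))
    · have h1 : (s:ℝ) ≤ 12 * D^2 := by
        have : s ≤ 12 * D^2 := by
          have e1 : D ≤ D^2 := Nat.le_self_pow (by norm_num) D
          have e2 : 2*(D+1)*(D+2) = 2*D^2+6*D+4 := by ring
          rw [hs]; omega
        exact_mod_cast this
      have h2 := yx hs0 h1
      rw [jl (by norm_num) (by positivity), xv] at h2
      have h3 := xj hD0
      have h4 : log 12 ≤ 3 := by
        rw [Real.log_le_iff_le_exp (by norm_num)]
        have := Real.exp_one_gt_d9
        have h5 : Real.exp 3 = Real.exp 1 ^ 3 := by rw [← Real.exp_nat_mul]; norm_num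
        rw [h5]
        calc (12:ℝ) ≤ 2.7^3 := by norm_num
          _ ≤ _ := vo (by norm_num) (by linarith) 3
      have h5 : (1:ℝ) ≤ D := by exact_mod_cast hD1
      push_cast at h2
      linarith
    · have h1 : ∑ p ∈ G, log p ≤ Chebyshev.theta D := by
        rw [Chebyshev.theta_eq_sum_Icc, Nat.floor_natCast]
        refine xc (fun p hp => ?_) fun p _ _ => zb p
        simp only [hG, zz, zo] at hp
        simp only [zz, ki]
        exact ⟨by omega, hp.2.1⟩
      have h2 := Chebyshev.theta_le_log4_mul_x (x := (D:ℝ)) (by positivity)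
      have h3 : log 4 ≤ 3/2 := by
        rw [show (4:ℝ) = 2^2 by norm_num, xv]; have := Real.log_two_lt_d9; push_cast; linarith
      have := zh h3 hD0.le
      linarith
    · have h1 := hC D hD1 (M*q) (Nat.mul_ne_zero hM0 hqpos.ne')
      push_cast at h1
      rwa [jl (by exact_mod_cast hM0) (by exact_mod_cast hqpos.ne')] at h1
    · exact yx hD0 (by exact_mod_cast hDB)
    · have h1 : (M:ℝ) ≤ C1 * (C0 * B^C0)^C1 := by exact_mod_cast hM
      have hC1' : (0:ℝ) < C1 := by exact_mod_cast hC1pos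
      have hC0' : (0:ℝ) < C0 := by exact_mod_cast hC0
      have h2 := yx (by exact_mod_cast ve hM0) h1
      rw [jl (by positivity) (by positivity), xv, jl (by positivity) (by positivity), xv] at h2
      have h3 := xj hC1'
      have h4 := xj hC0'
      have h5 : (C1:ℝ) * log C0 ≤ C1 * C0 := by gcongr; linarith
      have h6 : 0 ≤ (C1:ℝ) * log B := by positivity
      rw [hc2]
      linarith
    · have h1 : (q:ℝ) ≤ B^C0 := by exact_mod_cast hqB
      have h2 := yx (by exact_mod_cast hqpos) h1
      rwa [xv] at h2
    · have h2 := yx (by positivity) hqD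
      rw [Real.log_rpow hBpos, jl (by exact_mod_cast hqpos.ne') hD0.ne'] at h2
      linarith
  obtain ⟨a, ha0, ha⟩ := minors (fun (P : T) j => eval (P : Fin 3 → ℤ) (monomial (m j) (1:ℤ))) hdet
  obtain ⟨hYQ, hiQ⟩ := dhQ_irr hd1 H hH hY hi
  let g : Mv 3 ℚ := ∑ j, monomial (m j) (a j)
  have hg0 : g ≠ 0 := by
    obtain ⟨j, hj⟩ := Function.ne_iff.mp ha0
    intro h
    apply hj
    have := congrArg (coeff (m j)) h
    simpa [g, ug, coeff_monomial, hminj.eq_iff] using this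
  have hgd : g.degreeOf 0 < d := by
    have : g.degreeOf 0 ≤ 3 := by
      refine (degreeOf_sum_le _ _ _).trans (Finset.sup_le fun j _ => ?_)
      rw [degreeOf_le_iff]
      intro x hx
      have := kt.mp (support_monomial_subset hx)
      subst this
      have := hm4 j; omega
    omega
  have hgt : g.totalDegree ≤ D + 4 := by
    refine (yy fun j _ => ?_)
    exact (xu _ _).trans (hmD j)
  obtain ⟨R, hR, hRd, hRv⟩ := elim hd1 hYQ hiQ (ndvd hYQ hg0 hgd) hgt
  refine ⟨R, hR, hRd, fun P hP => ?_⟩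
  have h1 := hRv (fun i => (P i : ℚ)) ?_ ?_
  · exact h1
  · have := map_ev (icr ℚ) P (dh H)
    rw [(hT P hP).2, zp] at this
    exact this.symm
  · have := ha ⟨P, hP⟩
    simp only [g, vm]
    rw [← this]
    refine zs rfl fun j _ => ?_
    simp only [eval_monomial, um, ur _ _ (fun _ => pow_zero _)]
    push_cast
    ring

attribute [local instance] Matrix.seminormedAddCommGroup in
lemma siegel [Fintype β] (v : ι → β → ℤ) (A : ℕ) (hA : 1 ≤ A) (hv : ∀ i j, |v i j| ≤ A) (a : β → ℚ) (ha : a ≠ 0)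
    (h : ∀ i, ∑ j, (v i j : ℚ) * a j = 0) :
    ∃ b : β → ℤ, b ≠ 0 ∧ (∀ j, |b j| ≤ ((Fintype.card β * A) ^ Fintype.card β : ℕ)) ∧ ∀ i, ∑ j, v i j * b j = 0 := by
  classical
  let v' : ι → β → ℚ := fun i j => v i j
  obtain ⟨b, hb1, hb2, hb3⟩ := exists_linearIndependent ℚ (Set.range v')
  let φ : (β → ℚ) →ₗ[ℚ] ℚ := ∑ j, a j • LinearMap.proj j
  have hφ : ∀ x, φ x = ∑ j, x j * a j := fun x => by
    simp [φ, LinearMap.sum_apply, xb]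
  obtain ⟨j0, hj0⟩ := Function.ne_iff.mp ha
  have hker : LinearMap.ker φ ≠ ⊤ := fun h0 => by
    have : Pi.single j0 1 ∈ LinearMap.ker φ := h0 ▸ Submodule.mem_top
    rw [uy, hφ] at this
    simp [Pi.single_apply] at this
    exact hj0 this
  have hspan : Submodule.span ℚ b ≤ LinearMap.ker φ := by
    rw [hb2, Submodule.span_le]
    rintro _ ⟨i, rfl⟩
    rw [SetLike.mem_coe, uy, hφ]; exact h i
  have : Fintype b := hb3.setFinite.fintype
  have hc : Fintype.card b < Fintype.card β := by
    have h1 := finrank_span_set_eq_card hb3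
    have h2 := Submodule.finrank_lt_finrank_of_lt (yj hspan (lt_top_iff_ne_top.mpr hker))
    rw [h1, finrank_top, jv, Set.toFinset_card] at h2
    exact h2
  have hch : ∀ x : b, ∃ i, v' i = x := fun x => hb1 x.2
  choose i hi using hch
  have hfin : ∀ t : β → ℤ, (∀ x : b, ∑ j, v (i x) j * t j = 0) → ∀ i, ∑ j, v i j * t j = 0 := by
    intro t ht k
    let ψ : (β → ℚ) →ₗ[ℚ] ℚ := ∑ j, (t j : ℚ) • LinearMap.proj j
    have hψ : ∀ x, ψ x = ∑ j, x j * t j := fun x => by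
      simp [ψ, LinearMap.sum_apply, xb]
    have h1 : Submodule.span ℚ b ≤ LinearMap.ker ψ := by
      rw [Submodule.span_le]
      intro x hx
      rw [SetLike.mem_coe, uy, hψ, ← show v' (i ⟨x, hx⟩) = x from hi ⟨x, hx⟩]
      have := ht ⟨x, hx⟩
      have := congrArg (Int.cast : ℤ → ℚ) this
      push_cast at this
      exact this
    have h2 : v' k ∈ LinearMap.ker ψ := h1 (hb2 ▸ Submodule.subset_span ⟨k, rfl⟩)
    rw [uy, hψ] at h2
    have h3 : ((∑ j, v k j * t j : ℤ) : ℚ) = 0 := by push_cast; exact h2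
    exact_mod_cast h3
  have hβ : 1 ≤ Fintype.card β := Fintype.card_pos_iff.mpr ⟨j0⟩
  rcases ub (Fintype.card b) with h0 | h0
  · refine ⟨fun _ => 1, fun h => kl (congrFun h j0), fun j => ?_, hfin _ fun x => ?_⟩
    · rw [abs_one]; exact_mod_cast ui _ _ (xa hβ hA)
    · exact (Fintype.card_eq_zero_iff.mp h0).elim x
  · obtain ⟨t, ht0, ht1, ht2⟩ := Int.Matrix.exists_ne_zero_int_vec_norm_le (Matrix.of fun (x : b) j => v (i x) j) hc h0
    refine ⟨t, ht0, fun j => ?_, hfin t fun x => congrFun ht1 x⟩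
    have h1 : ‖(Matrix.of fun (x : b) j => v (i x) j)‖ ≤ A := by
      rw [Matrix.norm_le_iff (by positivity)]
      intro x j
      rw [uv, Int.norm_eq_abs]; exact_mod_cast hv _ _
    have h2 : (|t j| : ℝ) ≤ ‖t‖ := by rw [← Int.cast_abs, Int.cast_abs, ← Int.norm_eq_abs]; exact norm_le_pi_norm t j
    have hA' : (1:ℝ) ≤ A := by exact_mod_cast hA
    have hβ' : (1:ℝ) ≤ Fintype.card β := by exact_mod_cast hβ
    have hc' : (Fintype.card b : ℝ) + 1 ≤ Fintype.card β := by exact_mod_cast hc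
    have h3 : ‖t‖ ≤ ((Fintype.card β * A) ^ Fintype.card β : ℕ) := by
      refine ht2.trans ?_
      push_cast
      rw [← xk]
      refine (Real.rpow_le_rpow (by positivity) (zt (vz hA' h1) (by positivity)) ?_).trans
        (zk ?_ ?_)
      · exact div_nonneg (by positivity) (by linarith)
      · nlinarith
      · rw [zm (by linarith)]
        have : (0:ℝ) ≤ Fintype.card b := by positivity
        nlinarith
    have h4 := h2.trans h3
    exact_mod_cast h4

lemma height [Fintype σ] (f : MvPolynomial σ ℚ) (hf : f ≠ 0) (M : Finset (σ →₀ ℕ)) (hM : f.support ⊆ M) (d : ℕ)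
    (hMd : ∀ m ∈ M, m.degree ≤ d) (B : ℕ) (hB : 1 ≤ B) (T : Set (σ → ℤ)) (hT : ∀ P ∈ T, (∀ i, |P i| ≤ B) ∧ eval (fun i => (P i : ℚ)) f = 0) :
    ∃ g : MvPolynomial σ ℤ, g ≠ 0 ∧ g.support ⊆ M ∧ (∀ m, |coeff m g| ≤ ((M.card * B ^ d) ^ M.card : ℕ)) ∧ ∀ P ∈ T, eval P g = 0 := by
  classical
  obtain ⟨m0, hm0⟩ := ne_zero_iff.mp hf
  obtain ⟨b, hb0, hb1, hb2⟩ := siegel (fun (P : T) (m : M) => ∏ i, P.1 i ^ m.1 i) (B ^ d) (ui _ _ hB) (fun P m => by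
      rw [Finset.abs_prod]
      calc ∏ i, |P.1 i ^ m.1 i| ≤ ∏ i, (B:ℤ) ^ m.1 i := vk (fun _ _ => vq _) fun i _ => by
            rw [abs_pow]; exact vo (vq _) ((hT _ P.2).1 i) _
        _ = (B:ℤ) ^ m.1.degree := by rw [zr, xz]
        _ ≤ _ := by push_cast; exact uo (by exact_mod_cast hB) (hMd _ m.2))
    (fun m => coeff m.1 f) (fun h => hm0 (congrFun h ⟨m0, hM (yp.mpr hm0)⟩)) (fun P => by
      have := (hT _ P.2).2
      rw [eval_eq'] at this
      rw [Finset.sum_subset hM (fun m _ hm => by rw [notMem_support_iff.mp hm, zero_mul]), ← Finset.sum_coe_sort] at this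
      rw [← this]
      refine zs rfl fun m _ => ?_
      push_cast; ring)
  let g : MvPolynomial σ ℤ := ∑ m : M, monomial m.1 (b m)
  have hc : ∀ m, coeff m g = if h : m ∈ M then b ⟨m, h⟩ else 0 := by
    intro m
    simp only [g, ug, coeff_monomial]
    split_ifs with h
    · rw [yh ⟨m, h⟩]
      · simp
      · intro x _ hx; rw [ji fun e => hx (kn e)]
      · simp
    · exact jq fun x _ => ji fun (e : x.1 = m) => h (e ▸ x.2)
  refine ⟨g, fun h0 => hb0 (funext fun m => ?_), fun m hm => ?_, fun m => ?_, fun P hP => ?_⟩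
  · have := hc m.1
    rw [h0] at this; simpa using this.symm
  · by_contra h
    rw [yp, hc, dif_neg h] at hm; exact hm rfl
  · rw [hc]
    split_ifs
    · have := hb1 ⟨m, by assumption⟩
      rwa [Fintype.card_coe] at this
    · simp; positivity
  · have := hb2 ⟨P, hP⟩
    rw [← this]
    simp only [g, vm]
    refine zs rfl fun m _ => ?_
    rw [eval_monomial, ur _ _ (fun _ => pow_zero _), xb]

/-- many primes -/
lemma primes (J n : ℕ) (hn : 1 ≤ n) : ∃ PP : Finset ℕ, PP.card = J ∧ ∀ p ∈ PP, p.Prime ∧ n < p ∧ p ≤ 2 ^ J * n := by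
  classical
  induction J with
  | zero => exact ⟨∅, rfl, by simp⟩
  | succ J ih =>
    obtain ⟨PP, h1, h2⟩ := ih
    obtain ⟨p, hp, hp1, hp2⟩ := Nat.exists_prime_lt_and_le_two_mul (2 ^ J * n) (by positivity)
    have hJ : n ≤ 2 ^ J * n := Nat.le_mul_of_pos_left _ (by positivity)
    refine ⟨insert p PP, ?_, ?_⟩
    · rw [xq fun h => by have := (h2 p h).2.2; omega, h1]
    · intro q hq
      rcases ka.mp hq with rfl | hq
      · exact ⟨hp, by omega, by rw [pow_succ]; linarith⟩
      · obtain ⟨a, b, c⟩ := h2 q hq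
        refine ⟨a, b, c.trans ?_⟩
        rw [pow_succ]; linarith

lemma some_prime (PP : Finset ℕ) (n : ℕ) (h : ∀ p ∈ PP, p.Prime ∧ n < p) (N : ℤ) (hN : N ≠ 0) (hb : |N| ≤ (n ^ PP.card : ℕ)) (hc : 0 < PP.card) :
    ∃ p ∈ PP, ¬ (p:ℤ) ∣ N := by
  by_contra hcon
  push Not at hcon
  have h1 : ∏ p ∈ PP, p ∣ N.natAbs := Finset.prod_primes_dvd _ (fun p hp => (h p hp).1.prime) fun p hp => ux.mp (hcon p hp)
  have h2 := xm (Int.natAbs_pos.mpr hN) h1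
  have h3 : n ^ PP.card < ∏ p ∈ PP, p := by
    rw [← kh]
    obtain ⟨p, hp⟩ := Finset.card_pos.mp hc
    rcases ub n with rfl | hn
    · rw [kh, zero_pow (by omega)]; exact Finset.prod_pos fun p hp => (h p hp).1.pos
    · exact Finset.prod_lt_prod (fun _ _ => hn) (fun p hp => (h p hp).2.le) ⟨p, hp, (h p hp).2⟩
  have : N.natAbs ≤ n ^ PP.card := by zify; exact_mod_cast hb
  omega

lemma eval_le' (g : Mv (n+1) ℤ) (hd : g.totalDegree ≤ d) (A : ℕ) (hA : ∀ m, |coeff m g| ≤ A)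
    (x : Fin (n+1) → ℤ) (B : ℕ) (hB : 1 ≤ B) (hx : ∀ i, |x i| ≤ B) : |eval x g| ≤ ((d+1)^(n+1) * A * B ^ d : ℕ) := by
  refine (eval_le g x B hB hx).trans ?_
  push_cast
  have h1 : ∑ m ∈ g.support, |coeff m g| ≤ (((d+1)^(n+1) : ℕ) : ℤ) * A := by
    refine (zf _ _ (A:ℤ) fun m _ => hA m).trans ?_
    rw [uu]
    have := supp_card g hd
    gcongr
  push_cast at h1
  have hB' : (1:ℤ) ≤ B := by exact_mod_cast hB
  gcongr

lemma pderiv_coeff (g : Mv (n+1) ℤ) (hd : g.totalDegree ≤ d) (A : ℕ) (hA : ∀ m, |coeff m g| ≤ A)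
    (i : Fin (n+1)) (m : Fin (n+1) →₀ ℕ) : |coeff m (pderiv i g)| ≤ (d * A : ℕ) := by
  rw [coeff_pderiv, ue]
  by_cases h : coeff (m + single i 1) g = 0
  · rw [h]; simp; positivity
  · have h1 : m i + 1 ≤ d := by
      have h2 : (m + single i 1).degree ≤ g.totalDegree := xg (yp.mpr h)
      have h3 := Finsupp.le_degree i (m + single i 1)
      simp at h3
      rw [yo, Finsupp.degree_single] at h2; omega
    have h2 := hA (m + single i 1)
    push_cast
    rw [xb]
    refine yc ?_ h2 (vq _) (by positivity)
    rw [ko (by positivity)]; exact_mod_cast h1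

noncomputable def shv [CommRing K] (a : Fin n → K) : Fin (n+1) → Mv (n+1) K :=
  cons (X 0) fun i => X i.succ + C (a i) * X 0

lemma shv_inv [CommRing K] (a : Fin n → K) :
    (aeval (shv a)).comp (aeval (shv (-a))) = AlgHom.id K (Mv (n+1) K) := by
  refine algHom_ext fun i => ?_
  refine Fin.cases ?_ (fun i => ?_) i
  · simp only [jm, jw, shv, qz, AlgHom.id_apply]
  · simp only [jm, jw, shv, ys, AlgHom.id_apply, yo, zw, qz, aeval_C, algebraMap_eq, Pi.neg_apply, C_neg, map_neg]
    ring

lemma shv_irr [Field K] (a : Fin n → K) {f : Mv (n+1) K} (hf : Irreducible f) :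
    Irreducible (aeval (shv a) f) := by
  have h2 := shv_inv (-a)
  rw [neg_neg] at h2
  let e : Mv (n+1) K ≃ₐ[K] Mv (n+1) K := AlgEquiv.ofAlgHom _ _ (shv_inv a) h2
  exact (MulEquiv.irreducible_iff e.toMulEquiv).mpr hf

lemma shv_eval [CommRing K] (a : Fin n → K) (f : Mv (n+1) K) (P : Fin (n+1) → K) :
    eval (cons (P 0) fun i => P i.succ - a i * P 0 : Fin (n+1) → K) (aeval (shv a) f) = eval P f := by
  rw [sub_eval]
  congr 2
  funext i
  refine Fin.cases ?_ (fun i => ?_) i <;> simp [shv]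

lemma shv_td [CommRing K] (a : Fin n → K) (i : Fin (n+1)) : (shv a i).IsHomogeneous 1 := by
  refine Fin.cases ?_ (fun i => ?_) i
  · exact vi _ _
  · simp only [shv, ys]
    refine (vi _ _).add ?_
    simpa using (isHomogeneous_C _ (a i)).mul (vi K 0)

lemma hom_lead [CommRing K] {G : Mv (n+1) K} (hG : G.IsHomogeneous d) :
    coeff (single 0 d) G = eval (cons 1 0 : Fin (n+1) → K) G := by
  classical
  rw [eval_eq', yh (single 0 d)]
  · rw [xp]
    simp
  · intro m hm hne
    rw [xp]
    have : ∃ i : Fin n, m i.succ ≠ 0 := by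
      by_contra hcon
      push Not at hcon
      apply hne
      have h1 : m.degree = d := by
        have := hG (yp.mp hm)
        exact (yb Finsupp.degree_eq_weight_one m).trans this
      rw [xz, Fin.sum_univ_succ] at h1
      simp only [hcon, Finset.sum_const_zero, qj] at h1
      ext i
      refine Fin.cases ?_ (fun i => ?_) i
      · simpa using h1
      · rw [hcon]; simp
    obtain ⟨i, hi⟩ := this
    rw [Finset.prod_eq_zero (yw i)]
    · simp
    · simp [hi]
  · intro h
    rw [notMem_support_iff.mp h, zero_mul]

lemma shv_lead [CommRing K] (a : Fin n → K) (f : Mv (n+1) K) :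
    coeff (single 0 e) (aeval (shv a) f) = eval (cons 1 a : Fin (n+1) → K) (homogeneousComponent e f) := by
  classical
  have hc : ∀ i, (aeval (shv a) (homogeneousComponent i f)).IsHomogeneous i := fun i => by
    have := (homogeneousComponent_isHomogeneous i f).aeval (shv a) (shv_td a)
    simpa using this
  have h0 : coeff (single 0 e) (aeval (shv a) f) = coeff (single 0 e) (aeval (shv a) (homogeneousComponent e f)) := by
    conv_lhs => rw [← sum_homogeneousComponent f]
    rw [vm, ug]
    by_cases he : e ∈ range (f.totalDegree + 1)
    · rw [yh e]
      · intro i _ hne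
        refine (hc i).coeff_eq_zero ?_
        rw [Finsupp.degree_single]; exact hne.symm
      · exact fun h => absurd he h
    · rw [homogeneousComponent_eq_zero _ _ (by rw [zo] at he; omega), zp, coeff_zero]
      refine jq fun i hi => (hc i).coeff_eq_zero ?_
      rw [Finsupp.degree_single]; rintro rfl; exact he hi
  rw [h0, hom_lead (hc e), sub_eval]
  congr 2
  funext i
  refine Fin.cases ?_ (fun i => ?_) i <;> simp [shv]

/-- nonvanishing of a polynomial on a small grid -/
lemma grid [Field K] [CharZero K] (g : Mv n K) (hg : g ≠ 0) (e : ℕ) (he : g.totalDegree ≤ e) :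
    ∃ a : Fin n → ℕ, (∀ i, a i ≤ e) ∧ eval (fun i => (a i : K)) g ≠ 0 := by
  classical
  by_contra hcon
  push Not at hcon
  cases n with
  | zero =>
    have := hcon 0 (fun i => i.elim0)
    rw [eq_C_of_isEmpty g] at this hg
    simp at this hg
    exact hg this
  | succ n =>
    let S : Finset K := (range (e+1)).image Nat.cast
    have hS : S.card = e + 1 := by
      rw [zd _ Nat.cast_injective, xh]
    have h1 := sz hg S (Fintype.piFinset fun _ => S) (fun P hP i => uz.mp hP i) (fun P hP => by
      have h2 : ∀ i, ∃ k : ℕ, k ≤ e ∧ (k:K) = P i := fun i => by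
        have := uz.mp hP i
        simp only [S, zy, zo] at this
        obtain ⟨k, hk, hk2⟩ := this
        exact ⟨k, by omega, hk2⟩
      choose k hk hk2 using h2
      have := hcon k hk
      rwa [funext hk2] at this)
    rw [Fintype.card_piFinset_const, hS, pow_succ] at h1
    have h2 : 0 < (e+1)^n := by positivity
    have h3 : g.totalDegree * (e+1)^n ≤ e * (e+1)^n := zv _ he
    nlinarith

lemma dehom_ne [Field K] [CharZero K] {G : Mv (n+1) K} (hG : G.IsHomogeneous d) (h0 : G ≠ 0) :
    aeval (cons 1 X : Fin (n+1) → Mv n K) G ≠ 0 := by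
  intro h
  have h1 : ∀ a : Fin n → K, eval (cons 1 a : Fin (n+1) → K) G = 0 := fun a => by
    have := congrArg (eval a) h
    rw [sub_eval, zp] at this
    rw [← this]
    congr 2
    funext i
    refine Fin.cases ?_ (fun i => ?_) i <;> simp
  have h2 : X 0 * G = 0 := by
    refine jc fun z => ?_
    rw [zw, eval_X, zp]
    by_cases hz : z 0 = 0
    · rw [hz, zero_mul]
    · have := hom_smul' hG (z 0) (cons 1 (fun i => z i.succ / z 0) : Fin (n+1) → K)
      rw [h1, mul_zero] at this
      have e1 : (fun i => z 0 * (cons 1 (fun i => z i.succ / z 0) : Fin (n+1) → K) i) = z := by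
        funext i
        refine Fin.cases ?_ (fun i => ?_) i
        · simp
        · simp only [ys]; field_simp
      rw [e1] at this
      rw [this, mul_zero]
  exact h0 ((vy.mp h2).resolve_left (X_ne_zero 0))

lemma shear_ex [Field K] [CharZero K] (f : Mv (n+1) K) (hf : f ≠ 0) (e : ℕ) (he : f.totalDegree = e) :
    ∃ a : Fin n → ℕ, (∀ i, a i ≤ e) ∧ YM e (aeval (shv fun i => (a i : K)) f) := by
  have h0 : homogeneousComponent e f ≠ 0 := by
    obtain ⟨m, hm, hm2⟩ := Finset.exists_mem_eq_sup f.support (support_nonempty.mpr hf) fun s => s.sum fun _ e => e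
    intro h
    have h1 := congrArg (coeff m) h
    rw [coeff_homogeneousComponent, if_pos, coeff_zero] at h1
    · exact yp.mp hm h1
    · rw [← he]; exact hm2.symm
  obtain ⟨a, ha, ha2⟩ := grid _ (dehom_ne (homogeneousComponent_isHomogeneous e f) h0) e (by
    refine subst_td (homogeneousComponent_isHomogeneous e f).totalDegree_le _ fun i => ?_
    refine Fin.cases ?_ (fun i => ?_) i <;> simp [totalDegree_X_le])
  refine ⟨a, ha, subst_td he.le _ fun i => (shv_td _ i).totalDegree_le, ?_⟩
  rw [shv_lead]
  rw [sub_eval] at ha2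
  convert ha2 using 3
  funext i
  refine Fin.cases ?_ (fun i => ?_) i <;> simp

lemma cast_card (Z : Finset (Fin n → ℤ)) : (Z.image fun P i => (P i : ℚ)).card = Z.card := by
  classical
  refine zd _ fun P Q h => ?_
  funext i
  exact_mod_cast congrFun h i

lemma ev_q (f : Mv n ℤ) (P : Fin n → ℤ) :
    eval (fun i => (P i : ℚ)) (map (icr ℚ) f) = (eval P f : ℤ) := (map_ev (icr ℚ) P f).symm

/-- one residue class on a curve -/
lemma ccls (e : ℕ) (he : 2 ≤ e) (ε : ℝ) (hε : 0 < ε) (u : ℕ) (hu : 5/2 ≤ ε * (2*u-1)) (hu1 : 1 ≤ u) (B : ℕ) (hB : 2*u < B) (p : ℕ) (hp : p.Prime)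
    (hpB : B~^(1/2+ε) ≤ p) (f : Mv 2 ℤ) (hf : YM e f) (hi : Irreducible (map (icr ℚ) f))
    (T : Finset (Fin 2 → ℤ)) (hT : ∀ P ∈ T, (∀ i, |P i| ≤ B) ∧ eval P f = 0 ∧ ¬ (p:ℤ) ∣ eval P (pderiv 0 f))
    (hTT : ∀ P ∈ T, ∀ P' ∈ T, ∀ j, (p:ℤ) ∣ P j - P' j) : T.card ≤ e * (u + 1) := by
  classical
  let eq : Fin u × Fin 2 ≃ Fin (u*2) := finProdFinEquiv
  let m : Fin (u*2) → Fin 2 →₀ ℕ := fun j => Finsupp.equivFunOnFinite.symm ![((eq.symm j).2 : ℕ), ((eq.symm j).1 : ℕ)]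
  have hmdeg : ∀ j, (m j).degree = (eq.symm j).2 + (eq.symm j).1 := fun j => by
    rw [xz, xd]; simp [m]
  have hminj : Injective m := fun a b hab => by
    apply eq.symm.injective
    have h0 := yb hab 0
    have h1 := yb hab 1
    simp [m] at h0 h1
    exact Prod.ext (jo h1) (jo h0)
  have hsum : ∑ j, (m j).degree = u^2 := by
    simp only [hmdeg]
    rw [Equiv.sum_comp eq.symm (fun x => (x.2 : ℕ) + (x.1 : ℕ)), un]
    simp only [xd, Fin.val_zero, Fin.val_one]
    rw [Fin.sum_univ_eq_sum_range (fun i => 0 + i + (1 + i)) u]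
    clear * -
    induction u with
    | zero => simp
    | succ u ih => rw [ym, ih]; ring
  obtain ⟨s, hs⟩ : ∃ s, s = u * 2 := ⟨_, rfl⟩
  have hB0 : (0:ℝ) < B := by exact_mod_cast (by omega : 0 < B)
  have hu0 : (0:ℝ) < u := by exact_mod_cast hu1
  have hdet : ∀ P : Fin (u*2) → T, (Matrix.of fun i j => eval (P i : Fin 2 → ℤ) (monomial (m j) (1:ℤ))).det = 0 := by
    intro P
    by_contra hne
    let P0 : Fin 2 → ℤ := P ⟨0, by omega⟩
    have hP0 : P0 ∈ T := (P _).2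
    obtain ⟨k, hk, hk2⟩ := detdiv (n := 1) (K := u*2) (by omega) p hp f hf {P0} (fun Q hQ hdv => by
        rw [kt] at hQ
        rw [hQ] at hdv
        exact absurd hdv (hT _ hP0).2.2)
      (fun j => monomial (m j) 1) (fun i => P i) (fun i => (hT _ (P i).2).2.1) (fun i => ⟨_, Finset.mem_singleton_self _, hTT _ (P i).2 _ hP0⟩)
      (fun k => k + 1) (fun k => by
        have : k + 1 = (range (k+1)).card := by simp
        rw [this]
        refine xw (fun γ => (γ 0 : ℕ)) ?_ ?_
        · intro γ hγ
          simp at hγ ⊢; omega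
        · intro a _ b _ h
          funext i
          rw [Fin.fin_one_eq_zero i]; exact jo h)
    rw [Finset.filter_singleton, ji (hT _ hP0).2.2, Finset.card_empty, Finset.card_singleton] at hk2
    have h1 : ∑ k ∈ range (u*2), (k+1) = u * (2*u+1) := by
      clear * -
      induction u with
      | zero => simp
      | succ u ih => rw [show (u+1)*2 = u*2+1+1 by ring, ym, ym, ih]; ring
    rw [h1] at hk2
    have hk3 : 2*u^2 ≤ k + u := by
      have e1 : u*2*(u*2) = 4*u^2 := by ring
      have e2 : u*(2*u+1) = 2*u^2+u := by ring
      rw [e1, mul_zero, qj, um, e2] at hk2; omega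
    have hd := det_le m (fun i => (P i : Fin 2 → ℤ)) (fun i j => (hT _ (P i).2).1 j)
    rw [hsum] at hd
    generalize (Matrix.of fun i j => eval (P i : Fin 2 → ℤ) (monomial (m j) (1:ℤ))).det = Δ at hk hd hne
    have h2 : p ^ k ≤ (u*2)^(u*2) * B^(u^2) := by
      have h3 : p ^ k ∣ Δ.natAbs := ux.mp (by exact_mod_cast hk)
      have h4 := xm (Int.natAbs_pos.mpr hne) h3
      have h5 : Δ.natAbs ≤ (u*2).factorial * B ^ (u^2) := by zify; exact_mod_cast hd
      exact h4.trans (h5.trans (zv _ (Nat.factorial_le_pow _)))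
    have hp0 : (0:ℝ) < p := by exact_mod_cast hp.pos
    have h3 : (k:ℝ) * log p ≤ (u*2) * log (u*2) + u^2 * log B := by
      have h4 : ((p:ℝ)^k) ≤ (u*2)^(u*2) * B^(u^2) := by exact_mod_cast h2
      have := yx (by positivity) h4
      rw [jl (by positivity) (by positivity), xv, xv, xv] at this
      exact_mod_cast this
    have h4 : (1/2+ε) * log B ≤ log p := by
      rw [← Real.log_rpow hB0]; exact yx (by positivity) hpB
    have h5 : log (u*2) < log B := Real.log_lt_log (by positivity) (by exact_mod_cast (by omega : u*2 < B))
    have hk4 : (2*(u:ℝ)^2 - u) ≤ k := by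
      have : 2*(u:ℝ)^2 ≤ k + u := by exact_mod_cast hk3
      linarith
    have hL : 0 ≤ log B := zb B
    have hu1' : (1:ℝ) ≤ u := by exact_mod_cast hu1
    have h6 : (2*(u:ℝ)^2 - u) * ((1/2+ε) * log B) ≤ k * log p :=
      yc hk4 h4 (by positivity) (by positivity)
    have h7 : (u:ℝ)*(5/2)*log B ≤ u*(ε * (2*u-1))*log B := by gcongr
    have h8 : (u:ℝ)*log (u*2) < u * log B := mul_lt_mul_of_pos_left h5 hu0
    have h9 : (2*(u:ℝ)^2 - u) * ((1/2+ε) * log B) = u^2 * log B - 1/2*(u*log B) + u*(ε * (2*u-1))*log B := by ring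
    linarith
  obtain ⟨a, ha0, ha⟩ := minors (fun (P : T) j => eval (P : Fin 2 → ℤ) (monomial (m j) (1:ℤ))) hdet
  let g : Mv 2 ℚ := ∑ j, monomial (m j) (a j)
  have hYQ : YM e (map (icr ℚ) f) := ⟨(td_map_le _ _).trans hf.1, by rw [xf]; simpa using hf.2⟩
  have hg0 : g ≠ 0 := by
    obtain ⟨j, hj⟩ := Function.ne_iff.mp ha0
    intro h
    apply hj
    have := congrArg (coeff (m j)) h
    simpa [g, ug, coeff_monomial, hminj.eq_iff] using this
  have hgd : g.degreeOf 0 < e := by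
    have : g.degreeOf 0 ≤ 1 := by
      refine (degreeOf_sum_le _ _ _).trans (Finset.sup_le fun j _ => ?_)
      rw [degreeOf_le_iff]
      intro x hx
      have := kt.mp (support_monomial_subset hx)
      subst this
      simp [m]; omega
    omega
  have hgt : g.totalDegree ≤ u + 1 := by
    refine (yy fun j _ => ?_)
    refine (xu _ _).trans ((hmdeg j).le.trans ?_)
    omega
  have := bez1 hi (ndvd hYQ hg0 hgd) hgt (T.image fun P i => (P i : ℚ)) (fun P hP => by
    obtain ⟨P', hP', rfl⟩ := zy.mp hP
    rw [ev_q, (hT P' hP').2.1, yr]) (fun P hP => by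
    obtain ⟨P', hP', rfl⟩ := zy.mp hP
    have := ha ⟨P', hP'⟩
    simp only [g, vm]
    rw [← this]
    refine zs rfl fun j _ => ?_
    simp only [eval_monomial, um, ur _ _ (fun _ => pow_zero _)]
    push_cast
    ring)
  rw [cast_card] at this
  exact this.trans (zv _ hYQ.1)

/-- number of residue classes containing smooth points -/
lemma ncls (p : ℕ) [Fact p.Prime] (f : Mv (n+1) ℤ) (hf : f.totalDegree ≤ e) (Z : Finset (Fin (n+1) → ℤ))
    (hZ : ∀ P ∈ Z, eval P f = 0 ∧ ¬ (p:ℤ) ∣ eval P (pderiv 0 f)) :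
    (Z.image fun P i => (P i : ZMod p)).card ≤ e * p ^ n := by
  classical
  rcases Z.eq_empty_or_nonempty with rfl | ⟨P0, hP0⟩
  · simp
  have h0 : map (icr (ZMod p)) f ≠ 0 := by
    intro h
    apply (hZ P0 hP0).2
    rw [← zj]
    have := map_ev (icr (ZMod p)) P0 (pderiv 0 f)
    rw [← pderiv_map, h, zp, zp] at this
    exact this
  have h1 := sz h0 Finset.univ (Z.image fun P i => (P i : ZMod p)) (fun _ _ _ => yw _) (fun P hP => by
    obtain ⟨P', hP', rfl⟩ := zy.mp hP
    have := map_ev (icr (ZMod p)) P' f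
    rw [(hZ P' hP').1, zp] at this
    exact this.symm)
  rw [va, ku] at h1
  exact h1.trans (zv _ ((td_map_le _ _).trans hf))

lemma box_card (Z : Finset (Fin n → ℤ)) (B : ℕ) (h : ∀ P ∈ Z, ∀ i, |P i| ≤ B) : Z.card ≤ (2*B+1)^n := by
  classical
  have : Z ⊆ Fintype.piFinset fun _ => Finset.Icc (-(B:ℤ)) B := fun P hP => by
    rw [uz]
    intro i
    rw [ki]
    exact abs_le.mp (h P hP i)
  refine (zu this).trans ?_
  rw [Fintype.card_piFinset_const, Int.card_Icc, show ((B:ℤ) + 1 - -(B:ℤ)).toNat = 2*B+1 by omega]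

lemma prop_of_dvd [Field K] {f g : MvPolynomial σ K} (h : f ∣ g) (hg : g ≠ 0) (hd : g.totalDegree ≤ f.totalDegree) :
    ∃ c : K, c ≠ 0 ∧ g = C c * f := by
  obtain ⟨q, rfl⟩ := h
  have hf0 := xl hg
  have hq0 := yi hg
  rw [yf hf0 hq0] at hd
  have h0 : q.totalDegree = 0 := by omega
  rw [yg] at h0
  refine ⟨coeff 0 q, fun h => hq0 (by rw [h0, h, zp]), ?_⟩
  rw [xb, ← h0]

lemma curve1 (e : ℕ) (he : 2 ≤ e) (ε : ℝ) (hε : 0 < ε) (C0 : ℕ) (hC0 : 1 ≤ C0) : ∃ C : ℕ, ∀ B : ℕ, 1 ≤ B →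
    ∀ f : Mv 2 ℤ, YM e f → Irreducible (map (icr ℚ) f) → (∀ m, |coeff m f| ≤ (C0 * B ^ C0 : ℕ)) →
    ∀ Z : Finset (Fin 2 → ℤ), (∀ P ∈ Z, (∀ i, |P i| ≤ B) ∧ eval P f = 0) → (Z.card : ℝ) ≤ C * B~^(1/2+ε) := by
  classical
  obtain ⟨u, hu1, hu⟩ : ∃ u : ℕ, 1 ≤ u ∧ 5/2 ≤ ε * (2*u-1) := by
    obtain ⟨u, hu⟩ := vu (5/2/ε)
    refine ⟨u+1, by omega, ?_⟩
    rw [zm hε] at hu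
    push_cast
    have : (0:ℝ) ≤ u * ε := by positivity
    nlinarith
  obtain ⟨J, hJ⟩ : ∃ J, J = 2*(C0+e+1) := ⟨_, rfl⟩
  obtain ⟨B1, hB1⟩ : ∃ B1, B1 = 2*u+1 + (e+1)^2*(e*C0) := ⟨_, rfl⟩
  refine ⟨(2*B1+1)^2 + (e*e + J * (e*(2^J*2)*(e*(u+1)))), fun B hB f hf hi hco Z hZ => ?_⟩
  have hb1 : (1:ℝ) ≤ B~^(1/2+ε) := xr (by exact_mod_cast hB) (by positivity)
  rcases lt_or_ge B B1 with hlt | hge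
  · have h1 := box_card Z B fun P hP => (hZ P hP).1
    have h2 : (Z.card:ℝ) ≤ ((2*B1+1)^2:ℕ) := by
      exact_mod_cast h1.trans (yd (by omega) 2)
    refine h2.trans ?_
    refine je ?_ (xo (by positivity) hb1)
    exact_mod_cast vj _ _
  obtain ⟨n, hn⟩ : ∃ n, n = ⌈B~^(1/2+ε)⌉₊ := ⟨_, rfl⟩
  have hn1 : B~^(1/2+ε) ≤ n := hn ▸ Nat.le_ceil _
  have hn2 : (n:ℝ) ≤ 2 * B~^(1/2+ε) := by
    have := (uh (by positivity : (0:ℝ) ≤ B~^(1/2+ε))).le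
    rw [← hn] at this; linarith
  have hn0 : 1 ≤ n := by exact_mod_cast hb1.trans hn1
  have hnB : B ≤ n^2 := by
    have h1 : B~^(1/2+ε) * B~^(1/2+ε) ≤ n * n := by gcongr
    rw [← jf (by exact_mod_cast hB)] at h1
    have h2 : (B:ℝ) ≤ B~^((1/2+ε)+(1/2+ε)) := Real.self_le_rpow_of_one_le (by exact_mod_cast hB) (by linarith)
    have : (B:ℝ) ≤ (n^2:ℕ) := by push_cast; nlinarith
    exact_mod_cast this
  obtain ⟨PP, hPc, hPP⟩ := primes J n hn0
  have hYQ : YM e (map (icr ℚ) f) := ⟨(td_map_le _ _).trans hf.1, by rw [xf]; simpa using hf.2⟩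
  obtain ⟨hs1, hs2⟩ := fy_spec (by omega) hYQ (by exact_mod_cast (by omega : e ≠ 0))
  have hsing : (Z.filter fun P => eval P (pderiv 0 f) = 0).card ≤ e * e := by
    have := bez1 hi hs1 hs2 ((Z.filter fun P => eval P (pderiv 0 f) = 0).image fun P i => (P i : ℚ)) (fun P hP => by
      obtain ⟨P', hP', rfl⟩ := zy.mp hP
      rw [ev_q, (hZ P' (zz.mp hP').1).2, yr]) (fun P hP => by
      obtain ⟨P', hP', rfl⟩ := zy.mp hP
      rw [pderiv_map, ev_q, (zz.mp hP').2, yr])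
    rw [cast_card] at this
    exact this.trans (zv _ hYQ.1)
  have hcov : Z ⊆ (Z.filter fun P => eval P (pderiv 0 f) = 0) ∪ PP.biUnion fun p => Z.filter fun P => ¬ (p:ℤ) ∣ eval P (pderiv 0 f) := by
    intro P hP
    rw [ke, jg]
    by_cases h0 : eval P (pderiv 0 f) = 0
    · exact Or.inl (zz.mpr ⟨hP, h0⟩)
    right
    obtain ⟨p, hp, hp2⟩ := some_prime PP n (fun p hp => ⟨(hPP p hp).1, (hPP p hp).2.1⟩) _ h0 (by
      have h1 := eval_le' (pderiv 0 f) ((td_pderiv 0 f).trans ((Nat.sub_le _ _).trans hf.1)) _ (pderiv_coeff f hf.1 _ hco 0) P B hB (hZ P hP).1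
      refine h1.trans ?_
      rw [hPc, hJ, pow_mul]
      have h2 : B^(C0+e+1) ≤ (n^2)^(C0+e+1) := yd hnB _
      have h3 : (e+1)^2*(e*C0) * B^(C0+e) ≤ B * B^(C0+e) := zv _ (by omega)
      have h4 : (e+1)^(1+1) * (e*(C0*B^C0)) * B^e = (e+1)^2*(e*C0) * B^(C0+e) := by ring
      have h5 : B * B^(C0+e) = B^(C0+e+1) := by ring
      exact_mod_cast (by omega : (e+1)^(1+1) * (e*(C0*B^C0)) * B^e ≤ (n^2)^(C0+e+1))) (by omega)
    exact ⟨p, hp, zz.mpr ⟨hP, hp2⟩⟩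
  have hcl : ∀ p ∈ PP, (Z.filter fun P => ¬ (p:ℤ) ∣ eval P (pderiv 0 f)).card ≤ e*(2^J*n)*(e*(u+1)) := by
    intro p hp
    have : Fact p.Prime := ⟨(hPP p hp).1⟩
    have hpB : B~^(1/2+ε) ≤ p := hn1.trans (by exact_mod_cast (hPP p hp).2.1.le)
    have h1 := ncls p f hf.1 (Z.filter fun P => ¬ (p:ℤ) ∣ eval P (pderiv 0 f)) fun P hP =>
      ⟨(hZ P (zz.mp hP).1).2, (zz.mp hP).2⟩
    rw [pow_one] at h1
    have h2 := zi (f := fun (P : Fin 2 → ℤ) i => (P i : ZMod p)) (Z.filter fun P => ¬ (p:ℤ) ∣ eval P (pderiv 0 f)) (e*(u+1)) (fun κ hκ => by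
      refine ccls e he ε hε u hu hu1 B (by omega) p (hPP p hp).1 hpB f hf hi _ (fun P hP => ?_) fun P hP P' hP' j => ?_
      · have := zz.mp (zz.mp hP).1
        exact ⟨(hZ P this.1).1, (hZ P this.1).2, this.2⟩
      · have e1 := congrFun (zz.mp hP).2 j
        have e2 := congrFun (zz.mp hP').2 j
        rw [← zj]
        push_cast
        beta_reduce at e1 e2
        rw [e1, e2, sub_self])
    refine h2.trans ?_
    rw [xb]
    refine zv _ (h1.trans ?_)
    exact zx _ (hPP p hp).2.2
  have hfin : Z.card ≤ e*e + J * (e*(2^J*n)*(e*(u+1))) := by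
    refine (zu hcov).trans ((kz _ _).trans (Nat.add_le_add hsing ?_))
    refine kk.trans ?_
    rw [← hPc, ← zc]
    exact zf _ _ _ (hPc.symm ▸ hcl)
  have h1 : (Z.card:ℝ) ≤ e*e + J * (e*(2^J*n)*(e*(u+1))) := by exact_mod_cast hfin
  refine h1.trans ?_
  have h2 : (J:ℝ) * (e*(2^J*n)*(e*(u+1))) ≤ J * (e*(2^J*(2 * B~^(1/2+ε)))*(e*(u+1))) := by gcongr
  have h3 : (e*e:ℝ) ≤ e*e*B~^(1/2+ε) := xo (by positivity) hb1
  have h4 : 0 ≤ (((2*B1+1)^2:ℕ):ℝ) * B~^(1/2+ε) := by positivity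
  push_cast at h4 ⊢
  calc _ ≤ _ := yq h3 h2
    _ ≤ _ := by linarith

lemma curve0 (e : ℕ) (he : 2 ≤ e) (ε : ℝ) (hε : 0 < ε) : ∃ C : ℕ, ∀ B : ℕ, 1 ≤ B →
    ∀ f : Mv 2 ℚ, Irreducible f → f.totalDegree = e →
    ∀ Z : Finset (Fin 2 → ℤ), (∀ P ∈ Z, (∀ i, |P i| ≤ B) ∧ eval (fun i => (P i : ℚ)) f = 0) → (Z.card : ℝ) ≤ C * B~^(1/2+ε) := by
  classical
  obtain ⟨N, hN⟩ : ∃ N, N = (e+1)^2 := ⟨_, rfl⟩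
  have hN0 : 0 < N := by rw [hN]; positivity
  obtain ⟨C, hC⟩ := curve1 e he ε hε (N^N + e*N) (by have := Nat.pow_pos (n := N) hN0; omega)
  refine ⟨e*e + C*⌈((e+1:ℕ):ℝ)^(1/2+ε)⌉₊, fun B hB f hi he' Z hZ => ?_⟩
  have hb1 : (1:ℝ) ≤ B~^(1/2+ε) := xr (by exact_mod_cast hB) (by positivity)
  obtain ⟨a, ha, hY⟩ := shear_ex f hi.ne_zero e he'
  obtain ⟨f', hf'⟩ : ∃ f', f' = aeval (shv fun i => (a i : ℚ)) f := ⟨_, rfl⟩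
  have hi' : Irreducible f' := hf' ▸ shv_irr _ hi
  rw [← hf'] at hY
  let sh : (Fin 2 → ℤ) → Fin 2 → ℤ := fun P => cons (P 0) fun i => P i.succ - a i * P 0
  have hinj : Injective sh := fun P Q h => by
    have h0 := congrFun h 0
    have h1 := congrFun h 1
    simp only [sh, qz] at h0
    change P 1 - a 0 * P 0 = Q 1 - a 0 * Q 0 at h1
    rw [h0] at h1
    funext i
    fin_cases i
    · exact h0
    · simpa using h1
  obtain ⟨Z', hZ'⟩ : ∃ Z', Z' = Z.image sh := ⟨_, rfl⟩
  have hcard : Z'.card = Z.card := by rw [hZ']; exact zd _ hinj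
  have hZp : ∀ P ∈ Z', (∀ i, |P i| ≤ ((e+1)*B : ℕ)) ∧ eval (fun i => (P i : ℚ)) f' = 0 := by
    intro P hP
    rw [hZ'] at hP
    obtain ⟨P', hP', rfl⟩ := zy.mp hP
    obtain ⟨h1, h2⟩ := hZ P' hP'
    constructor
    · intro i
      have hh : (a 0 : ℤ) * |P' 0| ≤ e * B := yc (by exact_mod_cast ha 0) (h1 0) (vq _) (by positivity)
      have hh0 : (0:ℤ) ≤ e * B := by positivity
      fin_cases i
      · change |P' 0| ≤ _
        push_cast; linarith [h1 0]
      · change |P' 1 - a 0 * P' 0| ≤ _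
        have := abs_sub (P' 1) (a 0 * P' 0)
        rw [ue, Nat.abs_cast] at this
        push_cast; linarith [h1 1]
    · rw [← h2, ← shv_eval (fun i => (a i : ℚ)) f, hf']
      congr 2
      funext i
      refine Fin.cases ?_ (fun i => ?_) i <;> simp [sh]
  obtain ⟨g, hg0, hgs, hgc, hgZ⟩ := height f' hi'.ne_zero f'.support subset_rfl e (fun m hm => (xg hm).trans hY.1) ((e+1)*B)
    (xa (by omega) hB) (↑Z') hZp
  have hgd : (map (icr ℚ) g).totalDegree ≤ f'.totalDegree :=
    (td_map_le _ _).trans (Finset.sup_mono hgs)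
  have hg0' : map (icr ℚ) g ≠ 0 := fun h => hg0 (map_injective _ vh (by rw [h, zp]))
  rw [← hcard]
  by_cases hdv : f' ∣ map (icr ℚ) g
  · obtain ⟨c, hc, hgc'⟩ := prop_of_dvd hdv hg0' hgd
    have hsc : f'.support.card ≤ N := by rw [hN]; exact supp_card f' hY.1
    have h1 := hC ((e+1)*B) (xa (by omega) hB) g ⟨(Finset.sup_mono hgs).trans hY.1, fun h => by
        have := congrArg (coeff (single 0 e)) hgc'
        rw [xf, h, zp, yz] at this
        exact (xt hc hY.2) this.symm⟩ (by
        rw [hgc']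
        exact (ja f' (MvPolynomial.C c) ((zl.mpr hc).map MvPolynomial.C)).irreducible_iff.mpr hi') (fun m => (hgc m).trans (by
          have hB' : 1 ≤ (e+1)*B := xa (by omega) hB
          generalize (e+1)*B = B' at hB'
          have h2 : (f'.support.card * B'^e)^f'.support.card ≤ (N * B'^e)^N := by
            refine (yd (zv _ hsc) _).trans (zg ?_ hsc)
            exact xa hN0 (Nat.pow_pos hB')
          have h3 : (N * B'^e)^N ≤ (N^N+e*N) * B'^(N^N+e*N) := by
            rw [kr, ← pow_mul]
            exact xs (by omega) (zg hB' (by omega))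
          exact_mod_cast h2.trans h3)) Z' (fun P hP => ⟨(hZp P hP).1, hgZ P hP⟩)
    refine h1.trans ?_
    push_cast
    rw [Real.mul_rpow (by positivity) (by positivity)]
    have h2 := Nat.le_ceil (((e+1:ℕ):ℝ)^(1/2+ε))
    push_cast at h2
    have h3 : (C:ℝ) * (((e:ℝ)+1)^(1/2+ε) * B~^(1/2+ε)) ≤ C * (⌈((e:ℝ)+1)^(1/2+ε)⌉₊ * B~^(1/2+ε)) := by gcongr
    refine h3.trans ?_
    have : 0 ≤ (e*e:ℝ) * B~^(1/2+ε) := by positivity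
    linarith
  · have := bez1 hi' hdv (hgd.trans hY.1) (Z'.image fun P i => (P i : ℚ)) (fun P hP => by
      obtain ⟨P', hP', rfl⟩ := zy.mp hP
      exact (hZp P' hP').2) (fun P hP => by
      obtain ⟨P', hP', rfl⟩ := zy.mp hP
      rw [ev_q, hgZ P' hP', yr])
    rw [cast_card] at this
    have h1 : (Z'.card:ℝ) ≤ e*e := by exact_mod_cast this.trans (zv _ hY.1)
    have h3 : (e*e:ℝ) ≤ e*e*B~^(1/2+ε) := xo (by positivity) hb1
    refine h1.trans (h3.trans ?_)
    gcongr
    exact_mod_cast vj _ _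

lemma curve (E : ℕ) (ε : ℝ) (hε : 0 < ε) : ∃ C : ℕ, ∀ B : ℕ, 1 ≤ B →
    ∀ f : Mv 2 ℚ, Irreducible f → 2 ≤ f.totalDegree → f.totalDegree ≤ E →
    ∀ Z : Finset (Fin 2 → ℤ), (∀ P ∈ Z, (∀ i, |P i| ≤ B) ∧ eval (fun i => (P i : ℚ)) f = 0) → (Z.card : ℝ) ≤ C * B~^(1/2+ε) := by
  choose! C hC using fun e (he : 2 ≤ e) => curve0 e he ε hε
  refine ⟨∑ e ∈ range (E+1), C e, fun B hB f hi h2 hE Z hZ => (hC _ h2 B hB f hi rfl Z hZ).trans ?_⟩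
  gcongr
  exact Finset.single_le_sum (f := C) (fun _ _ => kc _) (zo.mpr (by omega))

lemma dh_pd [CommRing R] (H : Mv 4 R) : pderiv 0 (dh H) = dh (pderiv 0 H) := by
  unfold dh
  induction H using za with
  | C a => simp
  | add p q hp hq => simp only [yo, hp, hq]
  | mul_X p i hp =>
    simp only [zw, uk, hp, zc, yo, jw]
    congr 2
    fin_cases i <;> simp [pderiv_X]

lemma dh_fy (H : Mv 4 ℤ) (h : H.totalDegree ≤ d) (A : ℕ) (hA : ∀ m, |coeff m H| ≤ A) (P : Fin 3 → ℤ) (B : ℕ) (hB : 1 ≤ B)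
    (hP : ∀ i, |P i| ≤ B) : |eval P (pderiv 0 (dh H))| ≤ ((d+1)^4 * (d*A) * B^d : ℕ) := by
  rw [dh_pd, dh_eval]
  refine eval_le' (pderiv 0 H) ((td_pderiv 0 H).trans ((Nat.sub_le _ _).trans h)) _ (pderiv_coeff H h _ hA 0) _ B hB fun i => ?_
  fin_cases i
  · exact hP 0
  · exact hP 1
  · exact hP 2
  · simpa using hB

lemma bezR [Field K] [DecidableEq K] {R' : Mv 2 K} (hb : R'.totalDegree ≤ b) (R : Mv 2 K) :
    R ≠ 0 → ∀ Z : Finset (Fin 2 → K), (∀ x ∈ Z, eval x R' = 0 ∧ ∃ c, Irreducible c ∧ c ∣ R ∧ ¬ c ∣ R' ∧ eval x c = 0) →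
    Z.card ≤ R.totalDegree * b := by
  classical
  induction R using WfDvdMonoid.induction_on_irreducible with
  | zero => intro h; exact absurd rfl h
  | unit u hu =>
    intro _ Z hZ
    rw [Finset.card_eq_zero.mpr (vp fun x hx => ?_)]
    · exact kc _
    · obtain ⟨_, c, hc, hcu, _⟩ := hZ x hx
      exact hc.not_isUnit (isUnit_of_dvd_unit hcu hu)
  | mul a i ha hi ih =>
    intro _ Z hZ
    rw [yf hi.ne_zero ha, add_mul]
    have h1 : (Z.filter fun x => ¬ i ∣ R' ∧ eval x i = 0).card ≤ i.totalDegree * b := by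
      by_cases h : i ∣ R'
      · simp [h]
      · exact bez1 hi h hb _ (fun P hP => (zz.mp hP).2.2) fun P hP => (hZ P (zz.mp hP).1).1
    have h2 := ih ha (Z.filter fun x => ¬ (¬ i ∣ R' ∧ eval x i = 0)) fun x hx => by
      rw [zz] at hx
      obtain ⟨h0, c, hc, hcd, hcn, hcx⟩ := hZ x hx.1
      refine ⟨h0, c, hc, ?_, hcn, hcx⟩
      rcases (hc.prime.dvd_or_dvd hcd) with h | h
      · exfalso
        have hic := (hc.associated_of_dvd hi h).symm.dvd
        refine hx.2 ⟨fun h' => hcn (h.trans h'), ?_⟩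
        obtain ⟨q, rfl⟩ := h
        rw [zw, hcx, zero_mul]
      · exact h
    rw [← zn (s := Z) fun x => ¬ i ∣ R' ∧ eval x i = 0]
    exact yq h1 h2

lemma irr_td [Field K] {c : MvPolynomial σ K} (hc : Irreducible c) : 1 ≤ c.totalDegree := by
  by_contra h
  have h0 : c.totalDegree = 0 := by omega
  rw [yg] at h0
  have hc0 : coeff 0 c ≠ 0 := fun h => hc.ne_zero (by rw [h0, h, zp])
  exact hc.not_isUnit (h0 ▸ (zl.mpr hc0).map C)

lemma facs [Field K] (R : MvPolynomial σ K) : R ≠ 0 → ∃ S : Finset (MvPolynomial σ K), S.card ≤ R.totalDegree ∧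
    (∀ c ∈ S, Irreducible c ∧ c ∣ R) ∧ ∀ x, eval x R = 0 → ∃ c ∈ S, eval x c = 0 := by
  classical
  induction R using WfDvdMonoid.induction_on_irreducible with
  | zero => intro h; exact absurd rfl h
  | unit u hu =>
    intro _
    exact ⟨∅, by simp, by simp, fun x hx => absurd hx (hu.map (eval x)).ne_zero⟩
  | mul a i ha hi ih =>
    intro _
    obtain ⟨S, h1, h2, h3⟩ := ih ha
    refine ⟨insert i S, ?_, fun c hc => ?_, fun x hx => ?_⟩
    · rw [yf hi.ne_zero ha]
      have := Finset.card_insert_le i S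
      have := irr_td hi
      omega
    · rcases ka.mp hc with rfl | hc
      · exact ⟨hi, dvd_mul_right _ _⟩
      · exact ⟨(h2 c hc).1, (h2 c hc).2.trans (dvd_mul_left _ _)⟩
    · rw [zw, vy] at hx
      rcases hx with hx | hx
      · exact ⟨i, Finset.mem_insert_self _ _, hx⟩
      · obtain ⟨c, hc, hcx⟩ := h3 x hx
        exact ⟨c, jz hc, hcx⟩

lemma card_im [DecidableEq β] [DecidableEq γ] (Z : Finset α) (f : α → β) (g : α → γ)
    (h : ∀ P ∈ Z, ∀ P' ∈ Z, f P = f P' → g P = g P') : (Z.image g).card ≤ (Z.image f).card := by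
  classical
  rcases isEmpty_or_nonempty γ with hγ | hγ
  · rw [Finset.card_eq_zero.mpr (vp fun x _ => hγ.false x)]; exact kc _
  have : Z.image g ⊆ (Z.image f).image fun b => if hb : ∃ P ∈ Z, f P = b then g hb.choose else hγ.some := by
    intro c hc
    obtain ⟨P, hP, rfl⟩ := zy.mp hc
    have hb : ∃ P' ∈ Z, f P' = f P := ⟨P, hP, rfl⟩
    refine zy.mpr ⟨f P, ze _ hP, ?_⟩
    rw [dif_pos hb]
    exact h _ hb.choose_spec.1 _ hP hb.choose_spec.2
  exact (zu this).trans xy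

/-- residue class -/
def kap (N : ℕ) (P : Fin 3 → ℤ) : Fin 3 → ℤ := fun i => P i % N

lemma kap_eq {P P' : Fin 3 → ℤ} : kap N P = kap N P' ↔ ∀ i, (N:ℤ) ∣ P i - P' i := by
  rw [funext_iff]
  exact forall_congr' fun i => by
    simp only [kap]
    rw [Int.emod_eq_emod_iff_emod_sub_eq_zero, Int.dvd_iff_emod_eq_zero]

lemma clsN (f : Mv 3 ℤ) (hf : f.totalDegree ≤ d) (S : Finset ℕ) : (∀ p ∈ S, p.Prime) → ∀ (Z : Finset (Fin 3 → ℤ)),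
    (∀ P ∈ Z, eval P f = 0 ∧ ∀ p ∈ S, ¬ (p:ℤ) ∣ eval P (pderiv 0 f)) →
    (Z.image (kap (∏ p ∈ S, p))).card ≤ d ^ S.card * (∏ p ∈ S, p)^2 := by
  classical
  induction S using Finset.induction_on with
  | empty =>
    intro _ Z _
    simp only [Finset.prod_empty, Finset.card_empty]
    refine (card_im Z (fun _ => ()) _ fun P _ P' _ _ => kap_eq.mpr fun i => by simp).trans ?_
    exact (zu (Finset.subset_univ _)).trans (by simp)
  | insert p S hp ih =>
    intro hS Z hZ
    have h1 := ih (fun q hq => hS q (jz hq)) Z fun P hP => ⟨(hZ P hP).1, fun q hq => (hZ P hP).2 q (jz hq)⟩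
    have hpp := hS p (Finset.mem_insert_self _ _)
    have : Fact p.Prime := ⟨hpp⟩
    have h2 := ncls p f hf Z fun P hP => ⟨(hZ P hP).1, (hZ P hP).2 p (Finset.mem_insert_self _ _)⟩
    rw [Finset.prod_insert hp, xq hp]
    have hco : Nat.Coprime p (∏ q ∈ S, q) := Nat.Coprime.prod_right fun q hq =>
      (Nat.coprime_primes hpp (hS q (jz hq))).mpr fun h => hp (h ▸ hq)
    have h3 := card_im Z (fun P => ((fun i => (P i : ZMod p)), kap (∏ q ∈ S, q) P)) (kap (p * ∏ q ∈ S, q)) fun P _ P' _ h => by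
      rw [Prod.mk.injEq] at h
      rw [kap_eq] at h ⊢
      intro i
      rw [uf]
      refine IsCoprime.mul_dvd (Nat.isCoprime_iff_coprime.mpr hco) ?_ (h.2 i)
      rw [← zj]
      push_cast
      exact kp.mpr (congrFun h.1 i)
    have h4 : (Z.image fun P => ((fun i => (P i : ZMod p)), kap (∏ q ∈ S, q) P)) ⊆ (Z.image fun P i => (P i : ZMod p)) ×ˢ (Z.image (kap (∏ q ∈ S, q))) := by
      intro x hx
      obtain ⟨P, hP, rfl⟩ := zy.mp hx
      exact xe.mpr ⟨ze _ hP, ze _ hP⟩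
    have h5 := zu h4
    rw [Finset.card_product] at h5
    refine (h3.trans h5).trans ((xs h2 h1).trans (le_of_eq ?_))
    ring

lemma tree1 (hd : 1 ≤ d) (f : Mv 3 ℤ) (hf : YM d f) (Z : Finset (Fin 3 → ℤ)) (hZ : ∀ P ∈ Z, eval P f = 0)
    (PP : Finset ℕ) (hPP : ∀ p ∈ PP, p.Prime) (k E M : ℕ) (Dg : Finset ℕ → ℕ)
    (hR : ∀ S, S ⊆ PP → S.card ≤ k → ∀ κ, ∃ R : Mv 2 ℚ, R ≠ 0 ∧ R.totalDegree ≤ Dg S ∧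
      ∀ P ∈ Z, (∀ p ∈ S, ¬ (p:ℤ) ∣ eval P (pderiv 0 f)) → kap (∏ p ∈ S, p) P = κ → eval (fun i => (P (Fin.succ i) : ℚ)) R = 0)
    (hE : ∀ S, S ⊆ PP → S.card = k → Dg S ≤ E)
    (hsm : ∀ P ∈ Z, eval P (pderiv 0 f) ≠ 0 → k ≤ (PP.filter fun p : ℕ => ¬ (p:ℤ) ∣ eval P (pderiv 0 f)).card)
    (hM : ∀ S p, S ⊆ PP → S.card < k → p ∈ PP → p ∉ S → (d^k * (∏ q ∈ insert p S, q)^2) * (d * (Dg S * Dg (insert p S))) ≤ M) :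
    ∃ (Sc : Finset (Mv 2 ℚ)) (Bad : Finset (Fin 3 → ℤ)), Sc.card ≤ Dg ∅ ∧ (∀ c ∈ Sc, Irreducible c ∧ c.totalDegree ≤ E) ∧
      (∀ P ∈ Z, P ∉ Bad → ∃ c ∈ Sc, eval (fun i => (P (Fin.succ i) : ℚ)) c = 0) ∧ Bad.card ≤ (Z.filter fun P => eval P (pderiv 0 f) = 0).card + 2^PP.card * PP.card * M := by
  classical
  choose! R hR0 hRd hRv using hR
  obtain ⟨S0, hS0c, hS0i, hS0v⟩ := facs (R ∅ (kap 1 0)) (hR0 ∅ (by simp) (by simp) _)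
  let x : (Fin 3 → ℤ) → Fin 2 → ℚ := fun P i => (P (Fin.succ i) : ℚ)
  let sm : Finset ℕ → (Fin 3 → ℤ) → Prop := fun S P => ∀ p ∈ S, ¬ (p:ℤ) ∣ eval P (pderiv 0 f)
  let RR : Finset ℕ → (Fin 3 → ℤ) → Mv 2 ℚ := fun S P => R S (kap (∏ p ∈ S, p) P)
  let W : Finset ℕ → ℕ → Finset (Fin 3 → ℤ) := fun S p => if S.card < k ∧ p ∉ S then
    Z.filter fun P => sm (insert p S) P ∧ ∃ c, Irreducible c ∧ c ∣ RR S P ∧ ¬ c ∣ RR (insert p S) P ∧ eval (x P) c = 0 else ∅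
  have hW : ∀ S ∈ PP.powerset, ∀ p ∈ PP, (W S p).card ≤ M := by
    intro S hS p hp
    rw [Finset.mem_powerset] at hS
    simp only [W]
    split_ifs with hc
    swap
    · simp
    refine je ?_ (hM S p hS hc.1 hp hc.2)
    have hSS : insert p S ⊆ PP := Finset.insert_subset hp hS
    have hSc : (insert p S).card ≤ k := by rw [xq hc.2]; omega
    generalize hWW : (Z.filter fun P => sm (insert p S) P ∧ ∃ c, Irreducible c ∧ c ∣ RR S P ∧ ¬ c ∣ RR (insert p S) P ∧ eval (x P) c = 0) = WW
    have hmem : ∀ P ∈ WW, P ∈ Z ∧ sm (insert p S) P ∧ ∃ c, Irreducible c ∧ c ∣ RR S P ∧ ¬ c ∣ RR (insert p S) P ∧ eval (x P) c = 0 := fun P hP => by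
      rw [← hWW] at hP; exact zz.mp hP
    have h1 := clsN f hf.1 (insert p S) (fun q hq => hPP q (hSS hq)) WW fun P hP => ⟨hZ P (hmem P hP).1, (hmem P hP).2.1⟩
    have h1' : (WW.image (kap (∏ p ∈ insert p S, p))).card ≤ d^k * (∏ q ∈ insert p S, q)^2 :=
      h1.trans (zv _ (zg hd hSc))
    have h2 := zi (f := kap (∏ p ∈ insert p S, p)) WW (d * (Dg S * Dg (insert p S))) fun κ hκ => by
      obtain ⟨P0, hP0, hκ0⟩ := zy.mp hκ
      have hsame : ∀ P ∈ WW.filter fun P => kap (∏ p ∈ insert p S, p) P = κ, RR S P = RR S P0 ∧ RR (insert p S) P = RR (insert p S) P0 := by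
        intro P hP
        have h := ((zz.mp hP).2).trans hκ0.symm
        refine ⟨?_, by simp only [RR]; rw [h]⟩
        simp only [RR]
        congr 1
        rw [kap_eq] at h ⊢
        intro i
        refine dvd_trans ?_ (h i)
        rw [Finset.prod_insert hc.2]
        exact_mod_cast Dvd.intro_left p rfl
      have h3 := fib_card hf (WW.filter fun P => kap (∏ p ∈ insert p S, p) P = κ) fun P hP => hZ P (hmem P (zz.mp hP).1).1
      refine h3.trans (zx _ ?_)
      have h4 := bezR (R' := RR (insert p S) P0) (hRd _ hSS hSc _) (RR S P0) (hR0 _ hS hc.1.le _)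
        (((WW.filter fun P => kap (∏ p ∈ insert p S, p) P = κ).image tail).image fun P i => (P i : ℚ)) fun y hy => by
          obtain ⟨y', hy', rfl⟩ := zy.mp hy
          obtain ⟨P, hP, rfl⟩ := zy.mp hy'
          obtain ⟨hs1, hs2⟩ := hsame P hP
          obtain ⟨hPZ, hPs, c, hci, hcd, hcn, hcx⟩ := hmem P (zz.mp hP).1
          rw [hs1] at hcd
          rw [hs2] at hcn
          refine ⟨?_, c, hci, hcd, hcn, hcx⟩
          rw [← hs2]
          exact hRv _ hSS hSc _ P hPZ hPs rfl
      rw [cast_card] at h4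
      exact h4.trans (zv _ (hRd _ hS hc.1.le _))
    refine h2.trans ?_
    rw [xb]
    exact zv _ h1'
  refine ⟨S0.filter fun c => c.totalDegree ≤ E, (Z.filter fun P => eval P (pderiv 0 f) = 0) ∪ (PP.powerset ×ˢ PP).biUnion fun a => W a.1 a.2,
    (zu (ky _ _)).trans (hS0c.trans (hRd ∅ (by simp) (by simp) _)),
    fun c hc => ⟨(hS0i c (zz.mp hc).1).1, (zz.mp hc).2⟩, ?_, ?_⟩
  · intro P hPZ hPB
    by_contra hPc
    push Not at hPc
    apply hPB
    rw [ke, jg]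
    by_cases h0 : eval P (pderiv 0 f) = 0
    · exact Or.inl (zz.mpr ⟨hPZ, h0⟩)
    right
    by_contra hcon
    push Not at hcon
    have hk0 : kap 1 0 = kap (∏ p ∈ (∅ : Finset ℕ), p) P := kap_eq.mpr fun i => by simp
    obtain ⟨c, hcS, hcx⟩ := hS0v (x P) (by
      rw [hk0]; exact hRv ∅ (by simp) (by simp) _ P hPZ (by simp) rfl)
    obtain ⟨hci, hcd⟩ := hS0i c hcS
    have hcE : E < c.totalDegree := by
      by_contra h
      exact hPc c (zz.mpr ⟨hcS, not_lt.mp h⟩) hcx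
    have hind : ∀ j ≤ k, ∃ S, S ⊆ PP ∧ sm S P ∧ S.card = j ∧ c ∣ RR S P := by
      intro j
      induction j with
      | zero => intro _; exact ⟨∅, by simp, by simp [sm], rfl, by simp only [RR]; rw [← hk0]; exact hcd⟩
      | succ j ih =>
        intro hj
        obtain ⟨S, hS, hSs, hSj, hSd⟩ := ih (by omega)
        obtain ⟨p, hp, hpS⟩ := Finset.exists_mem_notMem_of_card_lt_card (vl (by omega : S.card < k) (hsm P hPZ h0))
        rw [zz] at hp
        have hsm' : sm (insert p S) P := fun q hq => by
          rcases ka.mp hq with rfl | hq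
          · exact hp.2
          · exact hSs q hq
        refine ⟨insert p S, Finset.insert_subset hp.1 hS, hsm', by rw [xq hpS, hSj], ?_⟩
        by_contra hn
        refine hcon (S, p) (xe.mpr ⟨Finset.mem_powerset.mpr hS, hp.1⟩) ?_
        simp only [W]
        rw [if_pos ⟨by omega, hpS⟩]
        exact zz.mpr ⟨hPZ, hsm', c, hci, hSd, hn, hcx⟩
    obtain ⟨S, hS, hSs, hSk, hSd⟩ := hind k kd
    have h1 := totalDegree_le_of_dvd_of_isDomain hSd (hR0 S hS hSk.le _)
    have h2 := hRd S hS hSk.le (kap (∏ p ∈ S, p) P)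
    have h3 := hE S hS hSk
    simp only [RR] at h1
    omega
  · refine (kz _ _).trans (Nat.add_le_add_left ?_ _)
    refine kk.trans ?_
    rw [← Finset.card_powerset, ← Finset.card_product, ← zc]
    exact zf _ _ _ fun a ha => hW _ (xe.mp ha).1 _ (xe.mp ha).2

lemma icc_card (B : ℕ) : ((Finset.Icc (-(B:ℤ)) B).image fun z : ℤ => (z:ℚ)).card = 2*B+1 := by
  classical
  rw [zd _ vh, Int.card_Icc]; omega

lemma cnt3Z (hd : 1 ≤ d) {f g : Mv 3 ℤ} (h : YM d (map (icr ℚ) f)) (hi : Irreducible (map (icr ℚ) f))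
    (hg : ¬ map (icr ℚ) f ∣ map (icr ℚ) g) (hb : (map (icr ℚ) g).totalDegree ≤ b) (B : ℕ) (T : Finset (Fin 3 → ℤ))
    (hT : ∀ P ∈ T, (∀ i, |P i| ≤ B) ∧ eval P f = 0 ∧ eval P g = 0) : T.card ≤ 2*d*d*b*(2*B+1) := by
  classical
  have := cnt3 (n := 1) hd h hi hg hb ((Finset.Icc (-(B:ℤ)) B).image fun z : ℤ => (z:ℚ)) (T.image fun P i => (P i : ℚ)) (fun P hP i => by
      obtain ⟨P', hP', rfl⟩ := zy.mp hP
      exact ze _ (ki.mpr (abs_le.mp ((hT P' hP').1 i)))) (fun P hP => by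
      obtain ⟨P', hP', rfl⟩ := zy.mp hP
      rw [ev_q, (hT P' hP').2.1, yr]) (fun P hP => by
      obtain ⟨P', hP', rfl⟩ := zy.mp hP
      rw [ev_q, (hT P' hP').2.2, yr])
  rwa [cast_card, icc_card, pow_one] at this

lemma tree (d : ℕ) (hd : 4 ≤ d) (ε : ℝ) (hε : 0 < ε) (hε1 : ε ≤ 1) (C0 : ℕ) : ∃ E C : ℕ, ∀ B : ℕ, 1 ≤ B →
    ∀ H : Mv 4 ℤ, H.IsHomogeneous d → YM d H →
    Irreducible (map (icr Qb) (hs 0 H)) → (∀ m, |coeff m H| ≤ (C0 * B ^ C0 : ℕ)) →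
    ∀ Z : Finset (Fin 3 → ℤ), (∀ P ∈ Z, (∀ i, |P i| ≤ B) ∧ eval P (dh H) = 0) →
    ∃ (Sc : Finset (Mv 2 ℚ)) (Bad : Finset (Fin 3 → ℤ)), (Sc.card : ℝ) ≤ C * B~^(1/2+ε) ∧ (∀ c ∈ Sc, Irreducible c ∧ c.totalDegree ≤ E) ∧
      (∀ P ∈ Z, P ∉ Bad → ∃ c ∈ Sc, eval (fun i => (P (Fin.succ i) : ℚ)) c = 0) ∧ (Bad.card : ℝ) ≤ C * B~^(1+ε) := by
  classical
  obtain ⟨ε', hε'⟩ : ∃ ε', ε' = ε/4 := ⟨_, rfl⟩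
  have he0 : 0 < ε' := by linarith
  obtain ⟨k, hk1, hk⟩ : ∃ k : ℕ, 1 ≤ k ∧ (1/2+ε')/k ≤ ε/2 := by
    obtain ⟨k, hk⟩ := vu ((1/2+ε')/(ε/2))
    rw [zm (by positivity)] at hk
    have h0 : (0:ℝ) < (k+1:ℕ) := by positivity
    refine ⟨k+1, by omega, ?_⟩
    rw [zm h0]; push_cast; linarith
  have hk0 : (0:ℝ) < k := by exact_mod_cast hk1
  obtain ⟨η, hη⟩ : ∃ η, η = (1/2+ε')/k := ⟨_, rfl⟩
  have hη0 : 0 < η := by rw [hη]; positivity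
  have hηk : η * k = 1/2+ε' := by rw [hη]; field_simp
  rw [← hη] at hk
  obtain ⟨Ds, B0, hDs, hB0, haux⟩ := aux d hd ε' he0 (C0+2) (by omega)
  obtain ⟨G0, hG0⟩ : ∃ G0 : ℕ, ((C0+d+1:ℕ):ℝ) ≤ η * G0 := by
    obtain ⟨G, hG⟩ := vu (((C0+d+1:ℕ):ℝ)/η)
    rw [zm hη0] at hG
    exact ⟨G, by linarith⟩
  obtain ⟨J, hJ⟩ : ∃ J, J = G0 + k := ⟨_, rfl⟩
  obtain ⟨K0, hK0⟩ : ∃ K0, K0 = 2^J*2 := ⟨_, rfl⟩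
  have hK01 : 1 ≤ K0 := by rw [hK0]; have := kx (n := J); omega
  obtain ⟨K1, hK1⟩ : ∃ K1, K1 = K0^k := ⟨_, rfl⟩
  have hK11 : 1 ≤ K1 := hK1 ▸ ui _ _ hK01
  obtain ⟨K2, hK2⟩ : ∃ K2, K2 = (Ds+5)*K1+1 := ⟨_, rfl⟩
  obtain ⟨K3, hK3⟩ : ∃ K3, K3 = d^(k+1)*K0*(2*d*K2)^2 := ⟨_, rfl⟩
  obtain ⟨B1, hB1⟩ : ∃ B1, B1 = B0 + 16 + (2*Ds+2) + K1 + (d+1)^4*d*C0 := ⟨_, rfl⟩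
  refine ⟨2*d*(Ds+5), (2*B1+1)^3 + (2*d*K2 + 6*d^3 + 2^J*J*K3), fun B hB H hH hY hirr hco Z hZ => ?_⟩
  have hBr : (1:ℝ) ≤ B := by exact_mod_cast hB
  have hBp : (0:ℝ) < B := by linarith
  have hb1 : (1:ℝ) ≤ B~^(1+ε) := xr hBr (by positivity)
  rcases lt_or_ge B B1 with hlt | hge
  · refine ⟨∅, Z, by simp; positivity, by simp, fun P hP hn => absurd hP hn, ?_⟩
    have h1 := box_card Z B fun P hP => (hZ P hP).1
    have h2 : (Z.card:ℝ) ≤ ((2*B1+1)^3:ℕ) := by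
      exact_mod_cast h1.trans (yd (by omega) 3)
    refine h2.trans ?_
    refine je ?_ (xo (by positivity) hb1)
    exact_mod_cast vj _ _
  obtain ⟨b, hb⟩ : ∃ b, b = (B:ℝ)^η := ⟨_, rfl⟩
  have hb1' : 1 ≤ b := hb ▸ xr hBr hη0.le
  have hb0 : 0 < b := by linarith
  obtain ⟨X, hX⟩ : ∃ X, X = B~^(1/2+ε') := ⟨_, rfl⟩
  have hXb : X = b^k := by rw [hX, hb, ← hηk, qy hBp.le, xk]
  have hX0 : 0 < X := by rw [hX]; positivity
  obtain ⟨n, hn⟩ : ∃ n, n = ⌈b⌉₊ := ⟨_, rfl⟩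
  have hn1 : b ≤ n := hn ▸ Nat.le_ceil _
  have hn2 : (n:ℝ) ≤ 2 * b := by
    have := (uh hb0.le).le
    rw [← hn] at this; linarith
  have hn0 : 1 ≤ n := by exact_mod_cast hb1'.trans hn1
  obtain ⟨PP, hPc, hPP⟩ := primes J n hn0
  have hp1 : ∀ p ∈ PP, b ≤ p := fun p hp => hn1.trans (by exact_mod_cast (hPP p hp).2.1.le)
  have hp2 : ∀ p ∈ PP, (p:ℝ) ≤ K0 * b := fun p hp => by
    have : (p:ℝ) ≤ 2^J*n := by exact_mod_cast (hPP p hp).2.2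
    refine this.trans ?_
    rw [hK0]; push_cast
    have : (2:ℝ)^J*n ≤ 2^J*(2*b) := by gcongr
    linarith
  have hN1 : ∀ S, S ⊆ PP → b ^ S.card ≤ ((∏ p ∈ S, p : ℕ) : ℝ) := fun S hS => by
    push_cast
    rw [← kh]
    exact vk (fun _ _ => hb0.le) fun p hp => hp1 p (hS hp)
  have hK0b : 1 ≤ (K0:ℝ) * b := by
    have : (1:ℝ) ≤ K0 := by exact_mod_cast hK01
    exact one_le_mul_of_one_le_of_one_le this hb1'
  have hN2 : ∀ S, S ⊆ PP → S.card ≤ k → ((∏ p ∈ S, p : ℕ) : ℝ) ≤ K1 * X := fun S hS hc => by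
    have : ((∏ p ∈ S, p : ℕ) : ℝ) ≤ ((K0:ℝ)*b) ^ S.card := by
      push_cast
      rw [← kh]
      exact vk (fun _ _ => by positivity) fun p hp => hp2 p (hS hp)
    refine this.trans ((uo hK0b hc).trans ?_)
    rw [kr, hXb, hK1]; push_cast; exact kd
  have hN0 : ∀ S, S ⊆ PP → (0:ℝ) < ((∏ p ∈ S, p : ℕ) : ℝ) := fun S hS => vl (by positivity) (hN1 S hS)
  have hXB : X ≤ B/2 := by
    have h1 : X ≤ B~^(3/4:ℝ) := hX ▸ zk hBr (by linarith)
    have h2 : (2:ℝ) ≤ B~^(1/4:ℝ) := by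
      have : (2:ℝ) = (16:ℝ)^(1/4:ℝ) := by
        rw [show (16:ℝ) = 2^(4:ℝ) by norm_num, ← qy (by norm_num)]; norm_num
      rw [this]
      exact Real.rpow_le_rpow (by norm_num) (by exact_mod_cast (by omega : 16 ≤ B)) (by norm_num)
    have h3 : B~^(3/4:ℝ) * B~^(1/4:ℝ) = B := by rw [← jf hBp]; norm_num
    have h4 : B~^(3/4:ℝ) * 2 ≤ B~^(3/4:ℝ) * B~^(1/4:ℝ) := by gcongr
    linarith
  let DD : Finset ℕ → ℕ := fun S => Ds + ⌈X / ((∏ p ∈ S, p : ℕ) : ℝ)⌉₊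
  have hNone : ∀ S, S ⊆ PP → (1:ℝ) ≤ ((∏ p ∈ S, p : ℕ) : ℝ) := fun S hS => (one_le_pow₀ hb1').trans (hN1 S hS)
  have hDD : ∀ S, (DD S : ℝ) ≤ Ds + 1 + X / ((∏ p ∈ S, p : ℕ) : ℝ) := fun S => by
    have := (uh (a := X / ((∏ p ∈ S, p : ℕ) : ℝ)) (by positivity)).le
    simp only [DD]; push_cast at this ⊢; linarith
  have hDg : ∀ S, S ⊆ PP → S.card ≤ k → ((2*d*(DD S+4):ℕ):ℝ) * ((∏ p ∈ S, p : ℕ) : ℝ) ≤ 2*d*K2*X := fun S hS hc => by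
    have h1 := hDD S
    have h2 := hN2 S hS hc
    have h3 := hN0 S hS
    generalize ((∏ p ∈ S, p : ℕ) : ℝ) = N at h1 h2 h3 ⊢
    push_cast
    have h4 : ((DD S:ℝ) + 4) * N ≤ (Ds+5+X/N)*N := zh (by linarith) h3.le
    have h5 : (Ds+5+X/N)*N = (Ds+5)*N + X := by field_simp
    have h6 : ((Ds:ℝ)+5)*N ≤ (Ds+5)*(K1*X) := by gcongr
    have h7 : ((DD S:ℝ) + 4) * N ≤ K2*X := by rw [hK2]; push_cast; linarith
    calc 2*(d:ℝ)*(DD S+4)*N = 2*d*((DD S+4)*N) := by ring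
      _ ≤ 2*d*(K2*X) := by gcongr
      _ = _ := by ring
  obtain ⟨hYQ, hiQ⟩ := dhQ_irr (by omega) H hH hY hirr
  obtain ⟨M, hM⟩ : ∃ M, M = ⌊(K3:ℝ) * (b * X^2)⌋₊ := ⟨_, rfl⟩
  have hcomax : C0 * B^C0 ≤ (C0+2)*B^(C0+2) := xs (by omega) (zg hB (by omega))
  obtain ⟨Sc, Bad, hSc1, hSc2, hSc3, hBad⟩ := tree1 (by omega) (dh H) (dh_ym hY) Z (fun P hP => (hZ P hP).2) PP (fun p hp => (hPP p hp).1) k (2*d*(Ds+5)) M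
    (fun S => 2*d*(DD S+4)) (fun S hS hc κ => by
      have hNS := hN0 S hS
      obtain ⟨R, hR0, hRd, hRv⟩ := haux B (by omega) (DD S) (vj _ _) (by
          have h1 := hDD S
          have h2 : X / ((∏ p ∈ S, p : ℕ) : ℝ) ≤ X := div_le_self hX0.le (hNone S hS)
          have h3 : (2*Ds+2:ℝ) ≤ B := by exact_mod_cast (by omega : 2*Ds+2 ≤ B)
          have : (DD S:ℝ) ≤ B := by linarith
          exact_mod_cast this) S (fun q hq => (hPP q (hS hq)).1) (by
          have h1 := hN2 S hS hc
          have h2 : (K1:ℝ) * X ≤ B * B := by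
            have : (K1:ℝ) ≤ B := by exact_mod_cast (by omega : K1 ≤ B)
            exact yc this (by linarith) hX0.le hBp.le
          have h3 : ∏ p ∈ S, p ≤ B*B := by exact_mod_cast h1.trans h2
          refine h3.trans ?_
          rw [← pow_two]
          exact zg hB (by omega)) (by
          rw [← hX]
          have h1 := Nat.le_ceil (X / ((∏ p ∈ S, p : ℕ) : ℝ))
          rw [zm hNS] at h1
          refine h1.trans ?_
          rw [xb]
          gcongr
          simp only [DD]; push_cast
          linarith [jt (α := ℝ) Ds]) H hH hY hirr (fun m => (hco m).trans (by exact_mod_cast hcomax))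
          {P | P ∈ Z ∧ (∀ p ∈ S, ¬ (p:ℤ) ∣ eval P (pderiv 0 (dh H))) ∧ kap (∏ p ∈ S, p) P = κ} (fun P hP => hZ P hP.1) (fun q hq P hP => ⟨hP.2.1 q hq, fun P' hP' j => by
            refine dvd_trans ?_ (kap_eq.mp (hP.2.2.trans hP'.2.2.symm) j)
            exact_mod_cast ut (fun p => p) hq⟩)
      exact ⟨R, hR0, hRd, fun P h1 h2 h3 => hRv P ⟨h1, h2, h3⟩⟩)
    (fun S hS hc => by
      have h1 : X / ((∏ p ∈ S, p : ℕ) : ℝ) ≤ 1 := by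
        rw [div_le_one (hN0 S hS), hXb, ← hc]; exact hN1 S hS
      have : ⌈X / ((∏ p ∈ S, p : ℕ) : ℝ)⌉₊ ≤ 1 := Nat.ceil_le.mpr (by simpa using h1)
      exact zx _ (by simp only [DD]; omega))
    (fun P hP h0 => by
      by_contra hcon
      have hadd := zn (s := PP) fun p : ℕ => (p:ℤ) ∣ eval P (pderiv 0 (dh H))
      obtain ⟨p, hp, hp2⟩ := some_prime (PP.filter fun p : ℕ => (p:ℤ) ∣ eval P (pderiv 0 (dh H))) n
        (fun p hp => ⟨(hPP p (zz.mp hp).1).1, (hPP p (zz.mp hp).1).2.1⟩) _ h0 (by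
          refine (dh_fy H hY.1 _ hco P B hB (hZ P hP).1).trans ?_
          have h1 : (d+1)^4*(d*(C0*B^C0))*B^d ≤ B^(C0+d+1) := by
            calc _ = ((d+1)^4*d*C0)*B^(C0+d) := by ring
              _ ≤ B * B^(C0+d) := zv _ (by omega)
              _ = _ := by ring
          have h2 : B^(C0+d+1) ≤ n^G0 := by
            have : (B~^(C0+d+1)) ≤ (n:ℝ)^G0 := by
              calc (B~^(C0+d+1)) = B~^((C0+d+1:ℕ):ℝ) := by rw [xk]
                _ ≤ B~^(η*G0) := zk hBr hG0
                _ = b^G0 := by rw [qy hBp.le, hb, xk]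
                _ ≤ _ := by gcongr
            exact_mod_cast this
          have h3 : n^G0 ≤ n^(PP.filter fun p : ℕ => (p:ℤ) ∣ eval P (pderiv 0 (dh H))).card := zg hn0 (by omega)
          exact_mod_cast (h1.trans h2).trans h3) (by omega)
      exact hp2 (zz.mp hp).2)
    (fun S p hS hc hp hpS => by
      have hSS : insert p S ⊆ PP := Finset.insert_subset hp hS
      have hSc : (insert p S).card ≤ k := by rw [xq hpS]; omega
      have h1 := hDg S hS hc.le
      have h2 := hDg (insert p S) hSS hSc
      have h3 := hp2 p hp
      rw [hM]
      apply kv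
      have hpr : ((∏ q ∈ insert p S, q : ℕ):ℝ) = p * ((∏ q ∈ S, q : ℕ):ℝ) := by rw [Finset.prod_insert hpS]; push_cast; rfl
      have hN0' : 0 ≤ ((∏ q ∈ S, q : ℕ):ℝ) := by positivity
      generalize ((∏ q ∈ S, q : ℕ):ℝ) = N at h1 hpr hN0'
      rw [uf, uf, uf, uf, Nat.cast_pow, Nat.cast_pow]
      have hN' : 0 ≤ ((∏ q ∈ insert p S, q : ℕ):ℝ) := by positivity
      generalize ((∏ q ∈ insert p S, q : ℕ):ℝ) = N' at h2 hpr hN' ⊢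
      have ha1 : 0 ≤ ((2*d*(DD S+4):ℕ):ℝ) := by positivity
      generalize ((2*d*(DD S+4):ℕ):ℝ) = a1 at h1 ha1 ⊢
      have ha2 : 0 ≤ ((2*d*(DD (insert p S)+4):ℕ):ℝ) := by positivity
      generalize ((2*d*(DD (insert p S)+4):ℕ):ℝ) = a2 at h2 ha2 ⊢
      calc (d:ℝ)^k*N'^2*(d*(a1*a2)) = d^(k+1)*p*((a1*N)*(a2*N')) := by
            rw [pow_two]; nth_rewrite 1 [hpr]; ring
        _ ≤ d^(k+1)*(K0*b)*((2*d*K2*X)*(2*d*K2*X)) := by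
            refine yc ?_ (yc h1 h2 (mul_nonneg ha2 hN') (by positivity)) ?_ (by positivity)
            · gcongr
            · exact mul_nonneg (mul_nonneg ha1 hN0') (mul_nonneg ha2 hN')
        _ = _ := by rw [hK3]; push_cast; ring)
  refine ⟨Sc, Bad, ?_, hSc2, hSc3, ?_⟩
  · have h1 := hDg ∅ (by simp) (by simp)
    rw [Finset.prod_empty, Nat.cast_one, qu] at h1
    have h2 : (Sc.card:ℝ) ≤ 2*d*K2*X := je (by exact_mod_cast hSc1) h1
    refine h2.trans ?_
    have h3 : X ≤ B~^(1/2+ε) := hX ▸ zk hBr (by linarith)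
    gcongr
    exact_mod_cast (by omega : 2*d*K2 ≤ (2*B1+1)^3 + (2*d*K2 + 6*d^3 + 2^J*J*K3))
  · obtain ⟨hs1, hs2⟩ := fy_spec (by omega) hYQ (by exact_mod_cast (by omega : d ≠ 0))
    rw [pderiv_map] at hs1 hs2
    have h1 := cnt3Z (by omega) hYQ hiQ hs1 hs2 B (Z.filter fun P => eval P (pderiv 0 (dh H)) = 0) fun P hP =>
      ⟨(hZ P (zz.mp hP).1).1, (hZ P (zz.mp hP).1).2, (zz.mp hP).2⟩
    rw [hPc] at hBad
    have h2 : Bad.card ≤ 2*d*d*d*(3*B) + 2^J*J*M := hBad.trans (Nat.add_le_add_right (h1.trans (zx _ (by omega))) _)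
    have h3 : (Bad.card:ℝ) ≤ 2*d*d*d*(3*B) + 2^J*J*M := by exact_mod_cast h2
    have h4 : (M:ℝ) ≤ K3*(b*X^2) := hM ▸ qx (by positivity)
    have h5 : b*X^2 ≤ B~^(1+ε) := by
      rw [hb, hX, ← xk, ← qy hBp.le, ← jf hBp]
      refine zk hBr ?_
      push_cast; linarith
    have h6 : (B:ℝ) ≤ B~^(1+ε) := Real.self_le_rpow_of_one_le hBr (by linarith)
    have h7 : (M:ℝ) ≤ K3*B~^(1+ε) := h4.trans (by gcongr)
    have h8 : (2:ℝ)*d*d*d*(3*B) + 2^J*J*M ≤ 2*d*d*d*(3*B~^(1+ε)) + 2^J*J*(K3*B~^(1+ε)) := by gcongr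
    refine (h3.trans h8).trans ?_
    have h9 : 0 ≤ (((2*B1+1)^3 + 2*d*K2:ℕ):ℝ)*B~^(1+ε) := by positivity
    push_cast at h9 ⊢
    linarith

noncomputable def ln [CommRing R] (x w : σ → R) (f : MvPolynomial σ R) : Polynomial R :=
  aeval (fun i => pC (x i) + pC (w i) * pX) f

lemma ln_eval [CommRing R] (x w : σ → R) (f : MvPolynomial σ R) (s : R) :
    (ln x w f).eval s = eval (fun i => x i + w i * s) f := by
  unfold ln
  induction f using za with
  | C a => simp
  | add p q hp hq => simp only [yo, Polynomial.eval_add, hp, hq]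
  | mul_X p i hp => simp [hp]

noncomputable def gw [CommRing R] (w : Fin n → R) (f : Mv n R) : Mv n R :=
  ∑ i, C (w i) * pderiv i f

lemma ln_der [CommRing R] (x w : Fin n → R) (f : Mv n R) :
    Polynomial.derivative (ln x w f) = ln x w (gw w f) := by
  classical
  unfold ln gw
  induction f using za with
  | C a => simp
  | add p q hp hq => simp only [yo, hp, hq, mul_add, vv]
  | mul_X p j hp =>
    have h1 : ∑ i, C (w i) * pderiv i (p * X j) = (∑ i, C (w i) * pderiv i p) * X j + C (w j) * p := by
      simp only [uk, pderiv_X, zc, mul_add, vv, Finset.sum_mul]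
      rw [yh j (fun i _ hi => by simp [hi.symm]) (by simp), add_comm]
      congr 1
      · exact zs rfl fun i _ => by ring
      · simp
    rw [zw, Polynomial.derivative_mul, hp, jw, h1]
    simp only [yo, zw, jw, aeval_C, Polynomial.derivative_C, Polynomial.derivative_X, Polynomial.derivative_mul,
      Polynomial.algebraMap_eq]
    ring

lemma gw_eval [CommRing R] (x w : Fin n → R) (f : Mv n R) :
    eval x (gw w f) = ∑ i, w i * eval x (pderiv i f) := by simp [gw, vm]

lemma ln_taylor (x w : Fin n → ℤ) (f : Mv n ℤ) (s : ℤ) :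
    s ^ 2 ∣ eval (fun i => x i + w i * s) f - eval x f - eval x (gw w f) * s := by
  obtain ⟨k, hk⟩ := (ln x w f).binomExpansion 0 s
  rw [zero_add, ln_der] at hk
  simp only [ln_eval, mul_zero, qj] at hk
  exact ⟨k, by rw [hk]; ring⟩

lemma ln_all (x w : σ → ℚ) (f : MvPolynomial σ ℚ) (h : ∀ s : ℤ, eval (fun i => x i + w i * s) f = 0) :
    ln x w f = 0 :=
  Polynomial.eq_zero_of_infinite_isRoot _ (Set.infinite_of_injective_forall_mem (f := fun s : ℤ => (s : ℚ)) vh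
    fun s => by simpa [ln_eval] using h s)

lemma dh_inj [Field K] [CharZero K] {G : Mv 4 K} (hG : G.IsHomogeneous e) (h : dh G = 0) : G = 0 := by
  have h1 : G * X 3 = 0 := jc fun v => by
    rw [zw, eval_X, zp, vy]
    by_cases hv : v 3 = 0
    · exact Or.inr hv
    · left
      have h2 := dh_eval G ![v 0 / v 3, v 1 / v 3, v 2 / v 3]
      rw [h, zp] at h2
      have h3 := hom_smul' hG (v 3) ![v 0 / v 3, v 1 / v 3, v 2 / v 3, 1]
      rw [show eval ![v 0 / v 3, v 1 / v 3, v 2 / v 3, 1] G = 0 by simpa using h2.symm, mul_zero] at h3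
      rw [← h3]
      congr 2
      funext i
      fin_cases i <;> simp <;> field_simp
  exact (vy.mp h1).resolve_right (X_ne_zero 3)

lemma ym_root [Field K] [IsAlgClosed K] (hd : 1 ≤ d) {f : Mv (n+1) K} (h : YM d f) (x : Fin n → K) :
    ∃ y, eval (cons y x : Fin (n+1) → K) f = 0 := by
  have hqd : ((finSuccEquiv K n f).map (eval x)).degree ≠ 0 := by
    have : ((finSuccEquiv K n f).map (eval x)).coeff d ≠ 0 := by rw [jx, ym_coeff h.1]; simpa using h.2
    have := Polynomial.le_degree_of_ne_zero this
    intro e; rw [e] at this; norm_cast at this; omega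
  obtain ⟨y, hy⟩ := IsAlgClosed.exists_root _ hqd
  exact ⟨y, by rw [← eval_cons_fin]; simpa [ks] using hy⟩

lemma lin_cnt [Field K] [DecidableEq K] (hd : 2 ≤ d) {g : Mv 2 K} (h : YM d g) (hi : Irreducible g)
    (n : Fin 3 → K) (hn : n ≠ 0) (T : Finset (Fin 2 → K)) (hT : ∀ P ∈ T, eval P g = 0 ∧ n 0 * P 0 + n 1 * P 1 + n 2 = 0) : T.card ≤ d := by
  have he : ∀ P, eval P (C (n 0) * X 0 + C (n 1) * X 1 + C (n 2) : Mv 2 K) = n 0 * P 0 + n 1 * P 1 + n 2 := fun P => by simp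
  have htd : (C (n 0) * X 0 + C (n 1) * X 1 + C (n 2) : Mv 2 K).totalDegree ≤ 1 := by
    have hm : ∀ (a : K) i, (C a * X i : Mv 2 K).totalDegree ≤ 1 := fun a i => by
      rw [xn]; exact (yv _ _).trans (totalDegree_X_le i)
    refine (jj _ _).trans (vz ((jj _ _).trans (vz (hm _ _) (hm _ _))) (by simp))
  refine (bez1 hi (ndvd h (fun h0 => hn ?_) ?_) htd T (fun P hP => (hT P hP).1) fun P hP => by rw [he]; exact (hT P hP).2).trans ?_
  · have h1 := he ![0, 0]
    have h2 := he ![1, 0]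
    have h3 := he ![0, 1]
    simp only [h0, zp, Matrix.cons_val_zero, Matrix.cons_val_one] at h1 h2 h3
    funext i
    fin_cases i
    · simp; linear_combination h1 - h2
    · simp; linear_combination h1 - h3
    · simp; linear_combination -h1
  · exact ((yn _ _).trans htd).trans_lt (by omega)
  · rw [qu]; exact h.1

lemma gw_ne [Field K] [IsAlgClosed K] [CharZero K] (hd : 2 ≤ d) {H : Mv 4 K} (hH : H.IsHomogeneous d)
    (hY : YM d H) (hi : Irreducible (hs 0 H)) (w : Fin 4 → K) (h3 : w 3 = 0) (hw : w 1 ≠ 0 ∨ w 2 ≠ 0) : dh (gw w H) ≠ 0 := by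
  classical
  intro h
  have hG : gw w H = 0 := dh_inj (e := d - 1) (IsHomogeneous.sum _ _ _ fun i _ => by
    simpa using (isHomogeneous_C _ (w i)).mul (hH.pderiv (i := i))) h
  have hinv : ∀ x s, eval (fun i => x i + w i * s) H = eval x H := fun x s => by
    have h1 := Polynomial.eq_C_of_derivative_eq_zero (p := ln x w H) (by rw [ln_der, hG]; simp [ln])
    have h2 := ln_eval x w H s
    have h3 := ln_eval x w H 0
    rw [h1] at h2 h3
    simp only [Polynomial.eval_C, mul_zero, qj] at h2 h3
    exact h2.symm.trans h3
  have key : ∀ a b a' b' : K, b' ≠ 0 → ¬ ∀ s : K, eval ![a + s * b, a' + s * b', 1, 0] H = 0 := fun a b a' b' hb hs' => by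
    have h1 := lin_cnt hd (hs_ym hY 0) hi ![b', -b, a' * b - a * b'] (fun h => hb (by simpa using congrFun h 0))
      ((range (d+1)).image fun s : ℕ => ![a + (s:K) * b, a' + (s:K) * b']) fun P hP => by
        obtain ⟨s, -, rfl⟩ := zy.mp hP
        rw [hs_eval]
        exact ⟨by simpa using hs' s, by simp; ring⟩
    rw [zd, xh] at h1
    · omega
    · intro s s' hss
      have := congrFun hss 1
      simp only [Matrix.cons_val_one, Matrix.cons_val_fin_one, add_right_inj] at this
      exact_mod_cast mul_right_cancel₀ hb this
  by_cases h2 : w 2 = 0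
  · obtain ⟨y, hy⟩ := ym_root (by omega) hY ![0, 1, 0]
    refine key y (w 0) 0 (w 1) (hw.resolve_right (not_not.mpr h2)) fun s => ?_
    rw [← hinv _ s] at hy
    refine Eq.trans ?_ hy
    congr 2
    funext i
    fin_cases i <;> simp [h2, h3, xb]
  · obtain ⟨y, hy⟩ := ym_root (by omega) hY ![1, 0, 0]
    refine key (w 0 / w 2) y (w 1 / w 2) 1 kl fun s => ?_
    have h4 := hom_smul' hH s (cons y ![1, 0, 0])
    rw [hy, mul_zero, ← hinv _ (1 / w 2)] at h4
    refine Eq.trans ?_ h4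
    congr 2
    funext i
    fin_cases i <;> simp [h2, h3] <;> ring

lemma det3 (p : ℕ) (hp : p.Prime) {H : Mv 3 ℤ} (hH : H.IsHomogeneous d) (z : Fin 3 → Fin 3 → ℤ)
    (hz : ∀ i, eval (z i) H = 0) (hc : ∀ i j, (p:ℤ) ∣ z i j - z 0 j) (hs : ¬ (p:ℤ) ∣ eval (z 0) (pderiv 0 H)) :
    (p:ℤ) ^ 3 ∣ (Matrix.of z).det := by
  have hE : ∀ i, (p:ℤ) ^ 2 ∣ ∑ j, z i j * eval (z 0) (pderiv j H) := fun i => by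
    choose v hv using fun j => hc i j
    have h1 := ln_taylor (z 0) v H p
    rw [show (fun j => z 0 j + v j * p) = z i by funext j; linarith [hv j], hz, hz, gw_eval] at h1
    have h2 := congrArg (eval (z 0)) hH.sum_X_mul_pderiv
    simp only [vm, zw, eval_X, uu, map_natCast, hz, mul_zero] at h2
    have h3 : ∑ j, z i j * eval (z 0) (pderiv j H) = ∑ j, z 0 j * eval (z 0) (pderiv j H) + (∑ j, v j * eval (z 0) (pderiv j H)) * p := by
      rw [Finset.sum_mul, ← vv]
      exact zs rfl fun j _ => by linear_combination (eval (z 0) (pderiv j H)) * hv j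
    rw [h3, h2]
    have := (dvd_neg (α := ℤ)).mpr h1
    simpa using this
  have hcop : IsCoprime ((p:ℤ)^3) (eval (z 0) (pderiv 0 H)) :=
    ((xx.mp hp).coprime_iff_not_dvd.mpr hs).pow_left
  refine hcop.dvd_of_dvd_mul_left ?_
  choose c hc' using hE
  choose v hv using hc
  have e : ∀ i j, z i j = z 0 j + p * v i j := fun i j => by linarith [hv i j]
  have h0 := hc' 0
  have h1 := hc' 1
  have h2 := hc' 2
  simp only [Fin.sum_univ_three] at h0 h1 h2
  simp only [Matrix.det_fin_three, uv]
  generalize eval (z 0) (pderiv 0 H) = g at *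
  generalize eval (z 0) (pderiv 1 H) = g1 at *
  generalize eval (z 0) (pderiv 2 H) = g2 at *
  rw [e 1 0, e 1 1, e 1 2] at h1 ⊢
  rw [e 2 0, e 2 1, e 2 2] at h2 ⊢
  refine ⟨p * c 0 * (v 1 1 * v 2 2 - v 1 2 * v 2 1) - (c 1 - c 0) * (z 0 1 * v 2 2 - z 0 2 * v 2 1)
    + (c 2 - c 0) * (z 0 1 * v 1 2 - z 0 2 * v 1 1), ?_⟩
  linear_combination ((z 0 1 + p * v 1 1) * (z 0 2 + p * v 2 2) - (z 0 2 + p * v 1 2) * (z 0 1 + p * v 2 1)) * h0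
    - (z 0 1 * (z 0 2 + p * v 2 2) - z 0 2 * (z 0 1 + p * v 2 1)) * h1 + (z 0 1 * (z 0 2 + p * v 1 2) - z 0 2 * (z 0 1 + p * v 1 1)) * h2

lemma ap_card (S : Finset ℤ) (B V : ℕ) (q : ℤ) (hV : 1 ≤ V) (hq : (V:ℤ) ≤ |q|) (hS : ∀ x ∈ S, |x| ≤ B)
    (hc : ∀ x ∈ S, ∀ y ∈ S, q ∣ x - y) : S.card ≤ 1 + 2 * B / V := by
  rw [add_comm, ← xh (2 * B / V + 1)]
  have hV' : (0:ℤ) < V := by exact_mod_cast hV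
  refine xw (fun x => ((x + B) / V).toNat) (fun x hx => ?_) fun x hx y hy h => ?_
  · have := abs_le.mp (hS x hx)
    have h2 : (x + B) / V ≤ ((2 * B / V : ℕ) : ℤ) := by push_cast; exact Int.ediv_le_ediv hV' (by linarith)
    simp only [Finset.coe_range, Set.mem_Iio]
    exact Nat.lt_succ_of_le (Int.toNat_le.mpr h2)
  · have h1 := abs_le.mp (hS x hx)
    have h2 := abs_le.mp (hS y hy)
    have h3 := Int.ediv_nonneg (a := x + B) (b := V) (by linarith) hV'.le
    have h4 := Int.ediv_nonneg (a := y + B) (b := V) (by linarith) hV'.le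
    have h5 : (x + B) / V = (y + B) / V := by simp only at h; omega
    have h6 := jy (x + B) V
    have h7 := jy (y + B) V
    rw [h5] at h6
    have := Int.emod_nonneg (x + B) hV'.ne'
    have := Int.emod_nonneg (y + B) hV'.ne'
    have := Int.emod_lt_of_pos (x + B) hV'
    have := Int.emod_lt_of_pos (y + B) hV'
    have h8 : |x - y| < (V:ℤ) := abs_lt.mpr ⟨by linarith, by linarith⟩
    have := vw ((abs_dvd _ _).mpr (hc x hx y hy)) (h8.trans_le hq)
    linarith

lemma gw_map [CommRing R] [CommRing S] (φ : R →+* S) (w : Fin n → R) (f : Mv n R) :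
    map φ (gw w f) = gw (fun i => φ (w i)) (map φ f) := by simp [gw, vm, pderiv_map]

lemma gw_td [CommRing R] (w : Fin n → R) (f : Mv n R) (h : f.totalDegree ≤ d) :
    (gw w f).totalDegree ≤ d - 1 :=
  yy fun i _ => by
    rw [xn]; exact (yv _ _).trans ((td_pderiv i f).trans (by omega))

lemma dh_td [CommRing R] {H : Mv 4 R} (h : H.totalDegree ≤ d) : (dh H).totalDegree ≤ d :=
  subst_td h _ fun i => by fin_cases i <;> simp [totalDegree_X_le]

/-- on the lines of the surface in direction `w` a nonzero polynomial of low degree in the tail vanishes -/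
lemma dir_R (hd : 2 ≤ d) (H : Mv 4 ℤ) (hH : H.IsHomogeneous d) (hY : YM d H)
    (hi : Irreducible (map (icr Qb) (hs 0 H))) (w : Fin 3 → ℤ) (hw : w 1 ≠ 0 ∨ w 2 ≠ 0) :
    ∃ R : Mv 2 ℚ, R ≠ 0 ∧ R.totalDegree ≤ 2 * d * d ∧ ∀ P : Fin 3 → ℤ, (∀ s : ℤ, eval (fun i => P i + w i * s) (dh H) = 0) →
      ln (fun i : Fin 2 => (P i.succ : ℚ)) (fun i => (w i.succ : ℚ)) R = 0 := by
  have hz : ∀ Q : Fin 3 → ℤ, (∀ s : ℤ, eval (fun i => Q i + w i * s) (dh H) = 0) → eval Q (dh (gw ![w 0, w 1, w 2, 0] H)) = 0 := fun Q hQ => by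
    have h1 : ∀ s : ℤ, s ≠ 0 → s ∣ eval Q (dh (gw ![w 0, w 1, w 2, 0] H)) := fun s hs0 => by
      have h2 := ln_taylor ![Q 0, Q 1, Q 2, 1] ![w 0, w 1, w 2, 0] H s
      have h3 := hQ s
      have h4 := hQ 0
      simp only [dh_eval, mul_zero, qj] at h3 h4 ⊢
      rw [h4, show (fun i => ![Q 0, Q 1, Q 2, 1] i + ![w 0, w 1, w 2, 0] i * s) = ![Q 0 + w 0 * s, Q 1 + w 1 * s, Q 2 + w 2 * s, 1] by
        funext i; fin_cases i <;> simp, h3, sub_zero, zero_sub, dvd_neg, pow_two] at h2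
      exact Int.dvd_of_mul_dvd_mul_right hs0 h2
    exact vw (h1 (|eval Q (dh (gw ![w 0, w 1, w 2, 0] H))| + 1) (by positivity)) (by simp)
  obtain ⟨hYQ, hiQ⟩ := dhQ_irr (by omega) H hH hY hi
  have hne : map (icr ℚ) (dh (gw ![w 0, w 1, w 2, 0] H)) ≠ 0 := fun h0 => by
    have hj : Injective (icr Qb) := vh
    have h1 := (map_injective _ (vh (α := ℚ))) (h0.trans (zp _).symm)
    have h2 := gw_ne hd (hH.map (icr Qb)) ⟨(td_map_le _ _).trans hY.1, by
        rw [xf]; exact (map_ne_zero_iff _ hj).mpr hY.2⟩ (by rw [hs_map, zp] at hi; exact hi)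
      (fun i => icr _ (![w 0, w 1, w 2, 0] i)) (by simp) (by simpa using hw)
    rw [← gw_map, ← dh_map, h1, zp] at h2
    exact h2 rfl
  have htd : (map (icr ℚ) (dh (gw ![w 0, w 1, w 2, 0] H))).totalDegree ≤ d - 1 := (td_map_le _ _).trans (dh_td (gw_td _ _ hY.1))
  obtain ⟨R, hR0, hRd, hR⟩ := elim (by omega) hYQ hiQ (ndvd hYQ hne ((yn _ _).trans_lt (htd.trans_lt (by omega))))
    (htd.trans (Nat.sub_le d 1))
  refine ⟨R, hR0, hRd, fun P hP => ln_all _ _ _ fun s => ?_⟩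
  have h1 := hR (fun i => ((P i + w i * s : ℤ) : ℚ)) (by rw [ev_q, hP, yr]) (by
    rw [ev_q, hz _ fun s' => ?_, yr]
    rw [← hP (s + s')]
    congr 2; funext i; ring)
  rw [← h1]
  congr 2
  funext i
  simp [tail]

lemma perdir (hd : 2 ≤ d) (H : Mv 4 ℤ) (hH : H.IsHomogeneous d) (hY : YM d H)
    (hi : Irreducible (map (icr Qb) (hs 0 H))) (w a : Fin 3 → ℤ) (ha : a 0 * w 0 + a 1 * w 1 + a 2 * w 2 = 1)
    (hw : w 1 ≠ 0 ∨ w 2 ≠ 0) (B V : ℕ) (hV : 1 ≤ V) (hj : ∃ j, (V:ℤ) ≤ |w j|) (L : Finset (Fin 3 → ℤ))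
    (hL : ∀ P ∈ L, (∀ i, |P i| ≤ B) ∧ ∀ s : ℤ, eval (fun i => P i + w i * s) (dh H) = 0) :
    L.card ≤ (1 + 2 * B / V) * (d * (2 * d * d)) := by
  classical
  obtain ⟨R, hR0, hRd, hR⟩ := dir_R hd H hH hY hi w hw
  obtain ⟨D, hD⟩ : ∃ D : ℤ, D = w 1 ^ 2 + w 2 ^ 2 := ⟨_, rfl⟩
  have hD0 : D ≠ 0 := by
    rw [hD]
    rcases hw with h | h <;> positivity
  have hDQ : (D:ℚ) ≠ 0 := by exact_mod_cast hD0
  have hDQ' : (D:ℚ) = (w 1:ℚ) ^ 2 + (w 2:ℚ) ^ 2 := by exact_mod_cast hD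
  let l : (Fin 3 → ℤ) → ℤ := fun P => P 1 * w 2 - P 2 * w 1
  let m : (Fin 3 → ℤ) → ℤ := fun P => w 1 * P 1 + w 2 * P 2
  let Φ : (Fin 3 → ℤ) → Fin 3 → ℤ := fun P i => D * P i - m P * w i
  have hA : (L.image l).card ≤ 2 * d * d := by
    let v : Fin 2 → Mv 2 ℚ := ![C (w 2 / D : ℚ) * X 0 + C (w 1:ℚ) * X 1, C (-w 1 / D : ℚ) * X 0 + C (w 2:ℚ) * X 1]
    have hev : ∀ x : Fin 2 → ℚ, eval x (aeval v R) = eval ![w 2 / D * x 0 + w 1 * x 1, -w 1 / D * x 0 + w 2 * x 1] R := fun x => by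
      rw [sub_eval]; congr 2; funext i; fin_cases i <;> simp [v]
    have hv0 : aeval v R ≠ 0 := fun h0 => hR0 <| jc fun x => by
      have := hev ![x 0 * w 2 - x 1 * w 1, (w 1 * x 0 + w 2 * x 1) / D]
      rw [h0, zp] at this
      rw [zp, this]
      congr 2
      funext i
      fin_cases i
      · simp; field_simp; rw [hDQ']; ring
      · simp; field_simp; rw [hDQ']; ring
    have hm : ∀ (a : ℚ) i, (C a * X i : Mv 2 ℚ).totalDegree ≤ 1 := fun a i => by
      rw [xn]; exact (yv _ _).trans (totalDegree_X_le i)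
    have hvd : (aeval v R).totalDegree ≤ 2 * d * d := subst_td hRd v fun i => by
      fin_cases i <;> exact (jj _ _).trans (vz (hm _ _) (hm _ _))
    have h1 := sz hv0 ((L.image l).image fun z : ℤ => (z:ℚ)) ((L.image l ×ˢ L.image l).image fun q => ![(q.1:ℚ), (q.2:ℚ)]) (fun P hP i => by
        obtain ⟨q, hq, rfl⟩ := zy.mp hP
        rw [xe] at hq
        fin_cases i
        · exact ze _ hq.1
        · exact ze _ hq.2) fun P hP => by
        obtain ⟨q, hq, rfl⟩ := zy.mp hP
        obtain ⟨P', hP', h2⟩ := zy.mp (xe.mp hq).1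
        have h3 := ln_eval (fun i : Fin 2 => (P' i.succ : ℚ)) (fun i => (w i.succ : ℚ)) R (q.2 - (w 1 * P' 1 + w 2 * P' 2) / D)
        rw [hR P' (hL P' hP').2, qv] at h3
        rw [hev, h3, ← h2]
        congr 2
        funext i
        fin_cases i
        · simp [l]; field_simp; rw [hDQ']; ring
        · simp [l]; field_simp; rw [hDQ']; ring
    rw [zd _ (fun x y h => ?_), zd _ vh, Finset.card_product, pow_one] at h1
    · by_contra h
      have := zv (L.image l).card hvd
      have := Nat.mul_lt_mul_of_pos_right (not_le.mp h) (by omega : 0 < (L.image l).card)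
      omega
    · have h1 := congrFun h 0
      have h2 := congrFun h 1
      simp at h1 h2
      exact Prod.ext h1 h2
  have hΦ0 : ∀ P ∈ L, eval (Φ P) (aeval ![X 0, X 1, X 2, C D] H : Mv 3 ℤ) = 0 := fun P hP => by
    have h1 : ln (fun i => ((![P 0, P 1, P 2, 1] i : ℤ) : ℚ)) (fun i => ((![w 0, w 1, w 2, 0] i : ℤ) : ℚ)) (map (icr ℚ) H) = 0 :=
      ln_all _ _ _ fun s => by
        have := (hL P hP).2 s
        rw [dh_eval] at this
        rw [show (fun i => ((![P 0, P 1, P 2, 1] i : ℤ) : ℚ) + ((![w 0, w 1, w 2, 0] i : ℤ) : ℚ) * s) =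
          fun i => ((![P 0 + w 0 * s, P 1 + w 1 * s, P 2 + w 2 * s, 1] i : ℤ) : ℚ) by funext i; fin_cases i <;> simp, ev_q, this, yr]
    have h2 := ln_eval (fun i => ((![P 0, P 1, P 2, 1] i : ℤ) : ℚ)) (fun i => ((![w 0, w 1, w 2, 0] i : ℤ) : ℚ)) (map (icr ℚ) H) (- m P / D)
    rw [h1, qv] at h2
    have h3 := hom_smul' (hH.map (icr ℚ)) (D:ℚ) (fun i => ((![P 0, P 1, P 2, 1] i : ℤ) : ℚ) + ((![w 0, w 1, w 2, 0] i : ℤ) : ℚ) * (- m P / D))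
    rw [← h2, mul_zero] at h3
    rw [sub_eval, ← Int.cast_inj (α := ℚ), ← ev_q, yr, ← h3]
    congr 2
    funext i
    fin_cases i <;> simp [Φ] <;> field_simp <;> ring
  have hfib := fib_card (d := d) ⟨subst_td hY.1 ![X 0, X 1, X 2, C D] fun i => by fin_cases i <;> simp [totalDegree_X_le, -eq_intCast], by
    rw [subst_lead hY.1 _ 1 (by simp) (fun i => by fin_cases i <;> simp [degreeOf_X_ne', -eq_intCast])]
    simpa using hY.2⟩ (L.image Φ) fun P hP => by
      obtain ⟨P', hP', rfl⟩ := zy.mp hP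
      exact hΦ0 P' hP'
  have htail : ((L.image Φ).image tail).card ≤ (L.image l).card := by
    rw [Finset.image_image]
    refine (zu (t := (L.image l).image fun z => ![z * w 2, - z * w 1]) fun x hx => ?_).trans xy
    obtain ⟨P, hP, rfl⟩ := zy.mp hx
    refine zy.mpr ⟨l P, ze _ hP, ?_⟩
    funext i
    fin_cases i <;> simp [l, Φ, m, tail, hD] <;> ring
  obtain ⟨j, hj⟩ := hj
  refine (zi (f := Φ) L (1 + 2 * B / V) fun κ hκ => ?_).trans
    (zx _ (hfib.trans (zx _ (htail.trans hA))))
  have hk : ∀ P ∈ L.filter (fun x => Φ x = κ), ∀ P' ∈ L.filter (fun x => Φ x = κ), ∃ k : ℤ, ∀ i, P i - P' i = k * w i := fun P hP P' hP' => by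
    have h1 : ∀ i, D * P i - m P * w i = D * P' i - m P' * w i :=
      fun i => congrFun ((zz.mp hP).2.trans (zz.mp hP').2.symm) i
    refine ⟨a 0 * (P 0 - P' 0) + a 1 * (P 1 - P' 1) + a 2 * (P 2 - P' 2), fun i => ya hD0 ?_⟩
    linear_combination h1 i - w i * (a 0 * h1 0 + a 1 * h1 1 + a 2 * h1 2) - w i * (m P - m P') * ha
  rw [← yk (f := fun P => P j)]
  · refine ap_card _ B V (w j) hV hj (fun x hx => ?_) fun x hx y hy => ?_
    · obtain ⟨P, hP, rfl⟩ := zy.mp hx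
      exact (hL P (zz.mp hP).1).1 j
    · obtain ⟨P, hP, rfl⟩ := zy.mp hx
      obtain ⟨P', hP', rfl⟩ := zy.mp hy
      obtain ⟨k, hk⟩ := hk P hP P' hP'
      exact ⟨k, by rw [hk j, xb]⟩
  · intro P hP P' hP' h
    obtain ⟨k, hk⟩ := hk P hP P' hP'
    have hwj : w j ≠ 0 := fun h0 => by rw [h0] at hj; simp at hj; omega
    have hk0 : k = 0 := by
      have h1 := hk j
      simp only at h
      rw [h, sub_self] at h1
      exact (vy.mp h1.symm).resolve_right hwj
    funext i
    have := hk i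
    rw [hk0, zero_mul] at this
    linarith

noncomputable def h3 [CommRing R] (H : Mv 4 R) : Mv 3 R := aeval ![X 0, X 1, X 2, 0] H

lemma h3_eval [CommRing R] (H : Mv 4 R) (w : Fin 3 → R) : eval w (h3 H) = eval ![w 0, w 1, w 2, 0] H := by
  rw [h3, sub_eval]; congr 2; funext i; fin_cases i <;> simp

lemma h3_pd [CommRing R] (H : Mv 4 R) : pderiv 0 (h3 H) = h3 (pderiv 0 H) := by
  unfold h3
  induction H using za with
  | C a => simp
  | add p q hp hq => simp only [yo, hp, hq]
  | mul_X p i hp =>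
    simp only [zw, uk, hp, zc, yo, jw]
    congr 2
    fin_cases i <;> simp [pderiv_X]

lemma hs_pd [CommRing R] (H : Mv 4 R) : pderiv 0 (hs 0 H) = hs 0 (pderiv 0 H) := by
  unfold hs
  induction H using za with
  | C a => simp
  | add p q hp hq => simp only [yo, hp, hq]
  | mul_X p i hp =>
    simp only [zw, uk, hp, zc, yo, jw]
    congr 2
    fin_cases i <;> simp [pderiv_X]

lemma h3_hom [CommRing R] {H : Mv 4 R} (h : H.IsHomogeneous d) : (h3 H).IsHomogeneous d := by
  have := h.aeval (![X 0, X 1, X 2, 0] : Fin 4 → Mv 3 R) (n := 1) (fun i => by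
    fin_cases i
    · exact vi _ _
    · exact vi _ _
    · exact vi _ _
    · exact isHomogeneous_zero _ _ _)
  rwa [um] at this

/-- homogeneity: value at the affine point -/
lemma rat_eval [Field K] {H : Mv 4 ℤ} (hH : H.IsHomogeneous d) (w : Fin 3 → ℤ) (φ : ℤ →+* K) (u : K) (hu : u * φ (w 2) = 1) :
    eval ![u * φ (w 0), u * φ (w 1)] (map φ (hs 0 H)) = u ^ d * φ (eval w (h3 H)) := by
  rw [hs_map, hs_eval, h3_eval, map_ev, ← hom_smul' (hH.map φ), zp]
  congr 2
  funext i
  fin_cases i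
  · simp
  · simp
  · simpa using hu.symm
  · simp

noncomputable def rat (w : Fin 3 → ℤ) : Fin 2 → ℚ := ![(w 2:ℚ)⁻¹ * (w 0:ℚ), (w 2:ℚ)⁻¹ * (w 1:ℚ)]

def Dir (H : Mv 4 ℤ) (V : ℕ) (w : Fin 3 → ℤ) : Prop :=
  (∀ i, |w i| ≤ V) ∧ eval w (h3 H) = 0 ∧ 0 < w 2 ∧ ∃ a : Fin 3 → ℤ, a 0 * w 0 + a 1 * w 1 + a 2 * w 2 = 1

lemma rat_inj {H : Mv 4 ℤ} {w w' : Fin 3 → ℤ} (h : Dir H V w) (h' : Dir H V w') (h0 : w 1 * w' 2 - w 2 * w' 1 = 0)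
    (h1 : w 2 * w' 0 - w 0 * w' 2 = 0) : w = w' := by
  obtain ⟨-, -, hp, a, ha⟩ := h
  obtain ⟨-, -, hp', a', ha'⟩ := h'
  have h2 : w 2 = w' 2 := by
    refine Int.dvd_antisymm hp.le hp'.le ⟨a 0 * w' 0 + a 1 * w' 1 + a 2 * w' 2, ?_⟩ ⟨a' 0 * w 0 + a' 1 * w 1 + a' 2 * w 2, ?_⟩
    · linear_combination (- w' 2) * ha - a 0 * h1 + a 1 * h0
    · linear_combination (- w 2) * ha' + a' 0 * h1 - a' 1 * h0
  rw [← h2] at h0 h1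
  funext i
  fin_cases i
  · exact ya hp.ne' (show w 2 * w 0 = w 2 * w' 0 by linarith)
  · exact ya hp.ne' (show w 2 * w 1 = w 2 * w' 1 by linarith)
  · exact h2

lemma rat_inj' {H : Mv 4 ℤ} {w w' : Fin 3 → ℤ} (h : Dir H V w) (h' : Dir H V w') (hr : rat w = rat w') : w = w' := by
  have e0 := congrFun hr 0
  have e1 := congrFun hr 1
  have hp : (w 2:ℚ) ≠ 0 := by exact_mod_cast h.2.2.1.ne'
  have hp' : (w' 2:ℚ) ≠ 0 := by exact_mod_cast h'.2.2.1.ne'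
  simp only [rat, Matrix.cons_val_zero, Matrix.cons_val_one, Matrix.cons_val_fin_one] at e0 e1
  field_simp at e0 e1
  refine rat_inj h h' ?_ ?_
  · have : w 1 * w' 2 = w 2 * w' 1 := by qify; linarith
    linarith
  · have : w 0 * w' 2 = w 2 * w' 0 := by qify; linarith
    linarith

lemma dir_p (hd : 2 ≤ d) (H : Mv 4 ℤ) (hH : H.IsHomogeneous d) (hY : YM d (map (icr ℚ) (hs 0 H)))
    (hi : Irreducible (map (icr ℚ) (hs 0 H))) (V p : ℕ) [hp : Fact p.Prime] (hpV : 2 * V < p) (W : Finset (Fin 3 → ℤ))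
    (hW : ∀ w ∈ W, Dir H V w ∧ ¬ (p:ℤ) ∣ eval w (pderiv 0 (h3 H))) : W.card ≤ d * (d * p) := by
  classical
  have hu : ∀ w ∈ W, ∃ u : ℤ, (u : ZMod p) * (w 2 : ℤ) = 1 := fun w hw => by
    have h1 : ((w 2 : ℤ) : ZMod p) ≠ 0 := fun h0 => by
      have h2 := (hW w hw).1.1 2
      have h3 := Int.le_of_dvd (hW w hw).1.2.2.1 ((zj _ _).mp h0)
      have := le_abs_self (w 2)
      omega
    refine ⟨(((w 2 : ℤ) : ZMod p)⁻¹).val, ?_⟩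
    simp [xi h1]
  choose! u hu using hu
  let c : (Fin 3 → ℤ) → Fin 2 → ZMod p := fun w => ![(u w : ZMod p) * (w 0 : ℤ), (u w : ZMod p) * (w 1 : ℤ)]
  have hcl : (W.image c).card ≤ d * p := by
    rcases W.eq_empty_or_nonempty with rfl | ⟨w0, hw0⟩
    · simp
    have hne : map (icr (ZMod p)) (hs 0 H) ≠ 0 := fun h0 => by
      have h1 := rat_eval (hH.pderiv (i := 0)) w0 (icr (ZMod p)) (u w0) (by simpa using hu w0 hw0)
      rw [← hs_pd, ← pderiv_map, h0, zp, zp, ← h3_pd] at h1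
      rcases vy.mp h1.symm with h2 | h2
      · have := hu w0 hw0
        replace h2 := eq_zero_of_pow_eq_zero h2
        rw [h2, zero_mul] at this
        exact zero_ne_one this
      · exact (hW w0 hw0).2 ((zj _ _).mp h2)
    have := sz hne Finset.univ (W.image c) (by simp) fun P hP => by
      obtain ⟨w, hw, rfl⟩ := zy.mp hP
      have := rat_eval hH w (icr (ZMod p)) (u w) (by simpa using hu w hw)
      rw [(hW w hw).1.2.1, zp, mul_zero] at this
      exact this
    rw [va, ku, pow_one] at this
    refine this.trans (zv _ ((td_map_le _ _).trans (subst_td hH.totalDegree_le _ fun i => ?_)))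
    fin_cases i <;> simp
  refine (zi (f := c) W d fun κ hκ => ?_).trans (zx _ hcl)
  by_contra hcon
  obtain ⟨w, hw, w', hw', hne⟩ := Finset.one_lt_card.mp (by omega : 1 < (W.filter fun w => c w = κ).card)
  have hD : ∀ x ∈ W.filter fun w => c w = κ, Dir H V x := fun x hx => (hW x (zz.mp hx).1).1
  have hdet : ∀ x ∈ W.filter fun w => c w = κ, (w 1 * w' 2 - w 2 * w' 1) * x 0 + (w 2 * w' 0 - w 0 * w' 2) * x 1 + (w 0 * w' 1 - w 1 * w' 0) * x 2 = 0 := fun x hx => by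
    have hcong : ∀ x ∈ W.filter fun w => c w = κ, ∀ j, (p:ℤ) ∣ u x * x j - u w * w j := fun x hx j => by
      rw [← ZMod.intCast_eq_intCast_iff_dvd_sub]
      have h1 := (zz.mp hw).2.trans (zz.mp hx).2.symm
      have h3 := hu x (zz.mp hx).1
      have h4 := hu w (zz.mp hw).1
      push_cast
      fin_cases j
      · exact congrFun h1 0
      · exact congrFun h1 1
      · simpa using h4.trans h3.symm
    have h1 := det3 p hp.out (h3_hom hH) ![fun j => u w * w j, fun j => u w' * w' j, fun j => u x * x j] (fun i => by
        fin_cases i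
        · simp [hom_smul' (h3_hom hH), (hD w hw).2.1]
        · simp [hom_smul' (h3_hom hH), (hD w' hw').2.1]
        · simp [hom_smul' (h3_hom hH), (hD x hx).2.1]) (fun i j => by
        fin_cases i
        · simp
        · exact hcong w' hw' j
        · exact hcong x hx j) (by
        simp only [Matrix.cons_val_zero]
        rw [hom_smul' (h3_hom hH).pderiv]
        intro h
        rcases (xx.mp hp.out).dvd_or_dvd h with h | h
        · have h2 := (zj _ _).mpr ((xx.mp hp.out).dvd_of_dvd_pow h)
          have := hu w (zz.mp hw).1
          rw [h2, zero_mul] at this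
          exact zero_ne_one this
        · exact (hW w (zz.mp hw).1).2 h)
    have hup : ∀ x ∈ W.filter fun w => c w = κ, IsCoprime ((p:ℤ)^3) (u x) := fun x hx =>
      ((xx.mp hp.out).coprime_iff_not_dvd.mpr fun h => by
        have := hu x (zz.mp hx).1
        rw [(zj _ _).mpr h, zero_mul] at this
        exact zero_ne_one this).pow_left
    obtain ⟨D, hDe⟩ : ∃ D, D = (w 1 * w' 2 - w 2 * w' 1) * x 0 + (w 2 * w' 0 - w 0 * w' 2) * x 1 + (w 0 * w' 1 - w 1 * w' 0) * x 2 := ⟨_, rfl⟩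
    rw [show (Matrix.of ![fun j => u w * w j, fun j => u w' * w' j, fun j => u x * x j]).det = u w * (u w' * (u x * D)) by
      rw [Matrix.det_fin_three, hDe]; simp; ring] at h1
    have h2 := (hup x hx).dvd_of_dvd_mul_left ((hup w' hw').dvd_of_dvd_mul_left ((hup w hw).dvd_of_dvd_mul_left h1))
    rw [← hDe]
    refine vw h2 ?_
    have hb := fun i => (hD w hw).1 i
    have hb' := fun i => (hD w' hw').1 i
    have hbx := fun i => (hD x hx).1 i
    have h6 : ∀ i j, |w i * w' j| ≤ (V:ℤ) * V := fun i j => by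
      rw [ue]; exact yc (hb i) (hb' j) (vq _) (Int.natCast_nonneg _)
    have h7 : ∀ i j k l m, |(w i * w' j - w k * w' l) * x m| ≤ 2 * (V:ℤ) ^ 3 := fun i j k l m => by
      rw [ue]
      refine (yc ((abs_sub _ _).trans (yq (h6 i j) (h6 k l))) (hbx m) (vq _) (by positivity)).trans_eq (by ring)
    have h8 : |D| ≤ 6 * (V:ℤ) ^ 3 := by
      rw [hDe]
      have := abs_add_three ((w 1 * w' 2 - w 2 * w' 1) * x 0) ((w 2 * w' 0 - w 0 * w' 2) * x 1) ((w 0 * w' 1 - w 1 * w' 0) * x 2)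
      linarith [h7 1 2 2 1 0, h7 2 0 0 2 1, h7 0 1 1 0 2]
    have h9 : (2 * (V:ℤ)) ^ 3 < (p:ℤ) ^ 3 := pow_lt_pow_left₀ (by exact_mod_cast hpV) (by positivity) (by norm_num)
    have h10 : (0:ℤ) ≤ (V:ℤ) ^ 3 := by positivity
    rw [kr] at h9
    linarith
  refine hcon ?_
  rw [← yk (f := rat) fun x hx y hy h => rat_inj' (hD x hx) (hD y hy) h]
  refine lin_cnt hd hY hi (fun i => ((![w 1 * w' 2 - w 2 * w' 1, w 2 * w' 0 - w 0 * w' 2, w 0 * w' 1 - w 1 * w' 0] i : ℤ) : ℚ)) (fun h => hne ?_) _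
    fun P hP => ?_
  · have e0 := congrFun h 0
    have e1 := congrFun h 1
    simp only [Pi.zero_apply, Int.cast_eq_zero] at e0 e1
    exact rat_inj (hD w hw) (hD w' hw') e0 e1
  · obtain ⟨x, hx, rfl⟩ := zy.mp hP
    have hx2 : (x 2:ℚ) ≠ 0 := by exact_mod_cast (hD x hx).2.2.1.ne'
    refine ⟨?_, ?_⟩
    · have := rat_eval hH x (icr ℚ) (x 2:ℚ)⁻¹ (by simp [hx2])
      rw [(hD x hx).2.1, zp, mul_zero] at this
      exact this
    · have h1 : (((w 1 * w' 2 - w 2 * w' 1) * x 0 + (w 2 * w' 0 - w 0 * w' 2) * x 1 + (w 0 * w' 1 - w 1 * w' 0) * x 2 : ℤ) : ℚ) = 0 := by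
        rw [hdet x hx, yr]
      push_cast at h1
      simp [rat]
      field_simp
      linear_combination h1

lemma h3_ym {H : Mv 4 ℤ} (hH : H.IsHomogeneous d) (hY : YM d H) : YM d (h3 H) := by
  refine ⟨(h3_hom hH).totalDegree_le, ?_⟩
  rw [h3, subst_lead hY.1 _ 1 (by simp) (fun i => by fin_cases i <;> simp [degreeOf_X_ne'])]
  simpa using hY.2

lemma dirs (d : ℕ) (hd : 2 ≤ d) (η : ℝ) (hη : 0 < η) (C0 : ℕ) : ∃ C : ℕ, ∀ B : ℕ, 1 ≤ B →
    ∀ H : Mv 4 ℤ, H.IsHomogeneous d → YM d H →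
    Irreducible (map (icr Qb) (hs 0 H)) → (∀ m, |coeff m H| ≤ (C0 * B ^ C0 : ℕ)) →
    ∀ V : ℕ, 1 ≤ V → V ≤ 4 * B → ∀ W : Finset (Fin 3 → ℤ), (∀ w ∈ W, (∀ i, |w i| ≤ V) ∧ eval w (h3 H) = 0 ∧ 0 ≤ w 2 ∧
      ∃ a : Fin 3 → ℤ, a 0 * w 0 + a 1 * w 1 + a 2 * w 2 = 1) → (W.card:ℝ) ≤ C * (B:ℝ)^η * V := by
  classical
  obtain ⟨J, hJ1, hJ2, hJ3⟩ : ∃ J : ℕ, 1 ≤ J ∧ ((C0+d:ℕ):ℝ) ≤ η * J ∧ (d+1)^4*d*C0*4^d ≤ 2^J := by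
    obtain ⟨G, hG⟩ := vu (((C0+d:ℕ):ℝ)/η)
    rw [zm hη] at hG
    refine ⟨G + 1 + (d+1)^4*d*C0*4^d, by omega, ?_, ?_⟩
    · push_cast at hG ⊢
      have : 0 ≤ η * (1 + (d+1)^4*d*C0*4^d) := by positivity
      linarith
    · exact Nat.lt_two_pow_self.le.trans (zg (by norm_num) (by omega))
  refine ⟨3*d + (9*d + (d*d + J*(d*(d*(2^J*2))))), fun B hB H hH hY hi hco V hV hVB W hW => ?_⟩
  have hBr : (1:ℝ) ≤ B := by exact_mod_cast hB
  have hb1 : (1:ℝ) ≤ (B:ℝ)^η := xr hBr hη.le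
  have hVr : (1:ℝ) ≤ V := by exact_mod_cast hV
  have hfib : ∀ T ⊆ W, T.card ≤ d * (T.image tail).card := fun T hT => fib_card (h3_ym hH hY) T fun w hw => (hW w (hT hw)).2.1
  have hA : (W.filter fun w => ¬ 0 < w 2).card ≤ 3*d*V := by
    refine (hfib _ (ky _ _)).trans ?_
    have h1 : (((W.filter fun w => ¬ 0 < w 2).image tail).image fun x : Fin 2 → ℤ => (fun _ : Fin 1 => x 0)).card ≤ (2*V+1)^1 :=
      box_card _ V fun P hP i => by
        obtain ⟨x, hx, rfl⟩ := zy.mp hP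
        obtain ⟨w, hw, rfl⟩ := zy.mp hx
        exact (hW w (zz.mp hw).1).1 1
    rw [yk] at h1
    · calc _ ≤ d * (2*V+1)^1 := zx _ h1
        _ ≤ d * (3*V) := zx _ (by rw [pow_one]; omega)
        _ = _ := by ring
    · intro x hx y hy h
      obtain ⟨w, hw, rfl⟩ := zy.mp hx
      obtain ⟨w', hw', rfl⟩ := zy.mp hy
      have hw := zz.mp hw
      have hw' := zz.mp hw'
      have h2 := (hW w hw.1).2.2.1
      have h3 := (hW w' hw'.1).2.2.1
      funext i
      fin_cases i
      · exact congrFun h 0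
      · show w 2 = w' 2
        omega
  have hBd : ((W.filter fun w => 0 < w 2).card:ℝ) ≤ (9*d + (d*d + J*(d*(d*(2^J*2)))) : ℕ) * (B:ℝ)^η * V := by
    obtain ⟨W', hW'⟩ : ∃ W', W' = W.filter fun w => 0 < w 2 := ⟨_, rfl⟩
    rw [← hW']
    have hDir : ∀ w ∈ W', Dir H V w := fun w hw => by
      rw [hW', zz] at hw
      exact ⟨(hW w hw.1).1, (hW w hw.1).2.1, hw.2, (hW w hw.1).2.2.2⟩
    rcases lt_or_ge (V:ℝ) ((B:ℝ)^η) with hlt | hge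
    · have h1 : W'.card ≤ d*(3*V)^2 := (hfib _ (hW' ▸ ky _ _)).trans (zx _ ((box_card _ V fun P hP i => by
        obtain ⟨w, hw, rfl⟩ := zy.mp hP
        exact (hDir w hw).1 _).trans (yd (by omega) 2)))
      calc (W'.card:ℝ) ≤ d*(3*V)^2 := by exact_mod_cast h1
        _ = 9*d*V*V := by ring
        _ ≤ 9*d*(B:ℝ)^η*V := by gcongr
        _ ≤ _ := by push_cast; gcongr; linarith [show (0:ℝ) ≤ d*d + J*(d*(d*(2^J*2))) by positivity]
    have hYs : YM d (map (icr ℚ) (hs 0 H)) :=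
      ⟨(td_map_le _ _).trans (hs_ym hY 0).1, by rw [xf]; simpa using (hs_ym hY 0).2⟩
    have his : Irreducible (map (icr ℚ) (hs 0 H)) := irr_of_map (algebraMap ℚ Qb) (by
      rwa [map_map, RingHom.ext_int (RingHom.comp _ _) (icr _)])
    obtain ⟨PP, hPc, hPP⟩ := primes J (2*V) (by omega)
    have hZ : (W'.filter fun w => eval w (pderiv 0 (h3 H)) = 0).card ≤ d*d := by
      obtain ⟨hn, htd⟩ := fy_spec (by omega) hYs (by exact_mod_cast (by omega : d ≠ 0))
      rw [← yk (f := rat) fun x hx y hy h => rat_inj' (hDir x (zz.mp hx).1) (hDir y (zz.mp hy).1) h]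
      have hz : ∀ (e : ℕ) (G : Mv 4 ℤ), G.IsHomogeneous e → ∀ w ∈ W', eval w (h3 G) = 0 → eval (rat w) (map (icr ℚ) (hs 0 G)) = 0 := fun e G hG w hw h0 => by
        have hx2 : (w 2:ℚ) ≠ 0 := by exact_mod_cast (hDir w hw).2.2.1.ne'
        have := rat_eval hG w (icr ℚ) (w 2:ℚ)⁻¹ (by simp [hx2])
        rw [h0, zp, mul_zero] at this
        exact this
      refine (bez1 his hn htd _ (fun P hP => ?_) fun P hP => ?_).trans (zv _ hYs.1)
      · obtain ⟨w, hw, rfl⟩ := zy.mp hP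
        have hw := zz.mp hw
        exact hz d H hH w hw.1 (hDir w hw.1).2.1
      · obtain ⟨w, hw, rfl⟩ := zy.mp hP
        have hw := zz.mp hw
        rw [pderiv_map, hs_pd]
        exact hz _ _ hH.pderiv w hw.1 (h3_pd H ▸ hw.2)
    have hP : (W'.filter fun w => ¬ eval w (pderiv 0 (h3 H)) = 0) ⊆ PP.biUnion fun p => W'.filter fun w => ¬ (p:ℤ) ∣ eval w (pderiv 0 (h3 H)) := fun w hw => by
      rw [zz] at hw
      have hDw := hDir w hw.1
      obtain ⟨p, hp, hpn⟩ := some_prime PP (2*V) (fun p hp => ⟨(hPP p hp).1, (hPP p hp).2.1⟩) _ hw.2 (by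
        rw [h3_pd, h3_eval, hPc]
        refine (eval_le' (d := d) (pderiv 0 H) ((td_pderiv _ _).trans (by have := hY.1; omega)) (d*(C0*B^C0)) (fun m => pderiv_coeff H hY.1 _ hco _ _) _ (4*B) (by omega) fun i => ?_).trans ?_
        · have : ((V:ℤ)) ≤ (4*B:ℕ) := by exact_mod_cast hVB
          fin_cases i
          · exact (hDw.1 0).trans this
          · exact (hDw.1 1).trans this
          · exact (hDw.1 2).trans this
          · simp
        · have : (((d+1)^(3+1)*(d*(C0*B^C0))*(4*B)^d : ℕ):ℝ) ≤ ((2*V)^J:ℕ) := by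
            have h1 : B~^(C0+d) ≤ (V:ℝ)^J := by
              calc B~^(C0+d) = B~^((C0+d:ℕ):ℝ) := (xk _ _).symm
                _ ≤ B~^(η*J) := zk hBr hJ2
                _ = ((B:ℝ)^η)^J := by rw [qy (by linarith), xk]
                _ ≤ _ := by gcongr
            have h2 : (((d+1)^4*d*C0*4^d:ℕ):ℝ) ≤ ((2^J:ℕ):ℝ) := by exact_mod_cast hJ3
            calc (((d+1)^(3+1)*(d*(C0*B^C0))*(4*B)^d : ℕ):ℝ) = (((d+1)^4*d*C0*4^d:ℕ):ℝ) * B~^(C0+d) := by push_cast; ring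
              _ ≤ ((2^J:ℕ):ℝ) * (V:ℝ)^J := by gcongr
              _ = _ := by push_cast; ring
          exact_mod_cast this) (by omega)
      exact jg.mpr ⟨p, hp, zz.mpr ⟨hw.1, hpn⟩⟩
    have hcP : (W'.filter fun w => ¬ eval w (pderiv 0 (h3 H)) = 0).card ≤ J * (d*(d*(2^J*(2*V)))) := by
      refine (zu hP).trans ((vs _ _ _ fun p hp => ?_).trans_eq (by rw [hPc]))
      have : Fact p.Prime := ⟨(hPP p hp).1⟩
      refine (dir_p hd H hH hYs his V p (hPP p hp).2.1 _ fun w hw => ⟨hDir w (zz.mp hw).1, (zz.mp hw).2⟩).trans ?_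
      exact zx _ (zx _ (hPP p hp).2.2)
    have hs := zn (s := W') fun w => eval w (pderiv 0 (h3 H)) = 0
    have h1 : W'.card ≤ (9*d + (d*d + J*(d*(d*(2^J*2)))))*V := by
      have : d*d*1 ≤ d*d*V := zx _ hV
      calc W'.card ≤ d*d*1 + J * (d*(d*(2^J*(2*V)))) := by omega
        _ ≤ 9*d*V + d*d*V + J * (d*(d*(2^J*(2*V)))) := by omega
        _ = _ := by ring
    calc (W'.card:ℝ) ≤ (9*d + (d*d + J*(d*(d*(2^J*2)))):ℕ)*1*V := by rw [qu]; exact_mod_cast h1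
      _ ≤ _ := by gcongr
  have hs := zn (s := W) fun w => 0 < w 2
  have h0 : (W.card:ℝ) = ((W.filter fun w => 0 < w 2).card:ℝ) + (W.filter fun w => ¬ 0 < w 2).card := by exact_mod_cast hs.symm
  have h1 : ((W.filter fun w => ¬ 0 < w 2).card:ℝ) ≤ 3*d*V := by exact_mod_cast hA
  have h2 : 3*(d:ℝ)*V ≤ 3*d*(B:ℝ)^η*V := by
    have : 3*(d:ℝ)*1*V ≤ 3*d*(B:ℝ)^η*V := by gcongr
    linarith
  rw [h0]
  push_cast at hBd ⊢
  linarith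

lemma prim_dir (w : Fin 3 → ℤ) (hw : w ≠ 0) : ∃ (k : ℤ) (w' a : Fin 3 → ℤ), k ≠ 0 ∧ (∀ i, w i = k * w' i) ∧ 0 ≤ w' 2 ∧ a 0 * w' 0 + a 1 * w' 1 + a 2 * w' 2 = 1 := by
  obtain ⟨k, hk⟩ := (inferInstance : (Ideal.span (Set.range w)).IsPrincipal)
  have h1 : ∀ i, ∃ c, w i = k * c := fun i => by
    have : w i ∈ Ideal.span (Set.range w) := Ideal.subset_span ⟨i, rfl⟩
    rw [hk] at this
    exact Ideal.mem_span_singleton.mp this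
  choose w' hw' using h1
  have hk0 : k ≠ 0 := fun h => hw (funext fun i => by simp [hw' i, h])
  obtain ⟨a, ha⟩ := Ideal.mem_span_range_iff_exists_fun.mp (show k ∈ Ideal.span (Set.range w) by rw [hk]; exact Ideal.mem_span_singleton_self k)
  have hb : a 0 * w' 0 + a 1 * w' 1 + a 2 * w' 2 = 1 := by
    rw [Fin.sum_univ_three, hw' 0, hw' 1, hw' 2] at ha
    exact ya hk0 (by linarith)
  rcases le_or_gt 0 (w' 2) with h | h
  · exact ⟨k, w', a, hk0, hw', h, hb⟩
  · exact ⟨-k, -w', -a, by simpa, fun i => by simp [hw' i], by simpa using h.le, by simpa using hb⟩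

lemma prim_line (hd : 1 ≤ d) (H : Mv 4 ℤ) (hH : H.IsHomogeneous d) (hY : YM d H) (P w : Fin 3 → ℤ) (hw : w ≠ 0)
    (h : ∀ s : ℤ, eval (fun i => P i + w i * s) (dh H) = 0) (B : ℕ) (hB : ∀ i, |w i| ≤ B) :
    ∃ w' : Fin 3 → ℤ, (∀ i, |w' i| ≤ B) ∧ eval w' (h3 H) = 0 ∧ 0 ≤ w' 2 ∧ (∃ a : Fin 3 → ℤ, a 0 * w' 0 + a 1 * w' 1 + a 2 * w' 2 = 1) ∧
      (w' 1 ≠ 0 ∨ w' 2 ≠ 0) ∧ ∀ s : ℤ, eval (fun i => P i + w' i * s) (dh H) = 0 := by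
  obtain ⟨k, w', a, hk, hw', h2, ha⟩ := prim_dir w hw
  have hQ : ∀ s : ℚ, eval (fun i => (P i:ℚ) + w' i * s) (map (icr ℚ) (dh H)) = 0 := fun s => by
    have h1 := ln_all (fun i => (P i:ℚ)) (fun i => (w i:ℚ)) (map (icr ℚ) (dh H)) fun s => by
      have := ev_q (dh H) fun i => P i + w i * s
      rw [h s] at this
      simpa using this
    have h3 := ln_eval (fun i => (P i:ℚ)) (fun i => (w i:ℚ)) (map (icr ℚ) (dh H)) (s/k)
    rw [h1, qv] at h3
    refine Eq.trans ?_ h3.symm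
    congr 2; funext i
    have hk' : (k:ℚ) ≠ 0 := by exact_mod_cast hk
    rw [hw' i]; push_cast; field_simp
  have h3 : eval w' (h3 H) = 0 := by
    have h4 : ln ![(w' 0:ℚ), w' 1, w' 2, 0] ![(P 0:ℚ), P 1, P 2, 1] (map (icr ℚ) H) = 0 :=
      Polynomial.eq_zero_of_infinite_isRoot _ ((Set.finite_singleton (0:ℚ)).infinite_compl.mono fun t ht => by
        have ht : t ≠ 0 := ht
        have := hQ t⁻¹
        rw [dh_map, dh_eval] at this
        replace this := congrArg (t^d * ·) this
        beta_reduce at this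
        rw [mul_zero, ← hom_smul' (hH.map _)] at this
        show Polynomial.eval _ _ = 0
        rw [ln_eval]
        refine Eq.trans ?_ this
        congr 2; funext i
        fin_cases i <;> simp <;> field_simp <;> ring)
    have h5 := ln_eval ![(w' 0:ℚ), w' 1, w' 2, 0] ![(P 0:ℚ), P 1, P 2, 1] (map (icr ℚ) H) 0
    rw [h4, qv] at h5
    have h6 := ev_q H ![w' 0, w' 1, w' 2, 0]
    rw [h3_eval]
    have : ((eval ![w' 0, w' 1, w' 2, 0] H : ℤ) : ℚ) = 0 := by
      rw [← h6, h5]; congr 2; funext i; fin_cases i <;> simp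
    exact_mod_cast this
  refine ⟨w', fun i => ?_, h3, h2, ⟨a, ha⟩, ?_, fun s => ?_⟩
  · refine je ?_ (hB i)
    rw [hw' i, ue]
    exact le_mul_of_one_le_left (vq _) (Int.one_le_abs hk)
  · by_contra hc
    push Not at hc
    have h4 : eval (fun i => w' 0 * (cons 1 0 : Fin 4 → ℤ) i) H = 0 := by
      rw [h3_eval] at h3
      refine Eq.trans ?_ h3
      congr 2; funext i; fin_cases i <;> simp [hc] <;> exact Or.inr rfl
    rw [hom_smul' hH, ← hom_lead hH, vy] at h4
    rcases h4 with h4 | h4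
    · have := eq_zero_of_pow_eq_zero h4
      rw [this, hc.1, hc.2] at ha
      simp at ha
    · exact hY.2 h4
  · have h4 := hQ s
    have h5 := ev_q (dh H) fun i => P i + w' i * s
    push_cast at h5
    rw [h4] at h5
    exact_mod_cast h5.symm

lemma lines (d : ℕ) (hd : 2 ≤ d) (ε : ℝ) (hε : 0 < ε) (C0 : ℕ) : ∃ C : ℕ, ∀ B : ℕ, 1 ≤ B →
    ∀ H : Mv 4 ℤ, H.IsHomogeneous d → YM d H →
    Irreducible (map (icr Qb) (hs 0 H)) → (∀ m, |coeff m H| ≤ (C0 * B ^ C0 : ℕ)) →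
    ∀ Z : Finset (Fin 3 → ℤ), (∀ P ∈ Z, (∀ i, |P i| ≤ B) ∧ ∃ w : Fin 3 → ℤ, w ≠ 0 ∧ (∀ i, |w i| ≤ 2*B) ∧
      ∀ s : ℤ, eval (fun i => P i + w i * s) (dh H) = 0) → (Z.card:ℝ) ≤ C * B~^(1+ε) := by
  classical
  obtain ⟨C, hC⟩ := dirs d hd (ε/2) (by positivity) C0
  obtain ⟨K, hK⟩ := vu (2 + 4/ε)
  refine ⟨C*8*(d*(2*d*d))*K, fun B hB H hH hY hi hco Z hZ => ?_⟩
  have hBr : (1:ℝ) ≤ B := by exact_mod_cast hB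
  have h1 : ∀ P ∈ Z, ∃ w' : Fin 3 → ℤ, (∀ i, |w' i| ≤ (2*B:ℕ)) ∧ eval w' (h3 H) = 0 ∧ 0 ≤ w' 2 ∧ (∃ a : Fin 3 → ℤ, a 0 * w' 0 + a 1 * w' 1 + a 2 * w' 2 = 1) ∧
      (w' 1 ≠ 0 ∨ w' 2 ≠ 0) ∧ ∀ s : ℤ, eval (fun i => P i + w' i * s) (dh H) = 0 := fun P hP => by
    obtain ⟨-, w, hw, hb, hl⟩ := hZ P hP
    exact prim_line (by omega) H hH hY P w hw hl (2*B) (by exact_mod_cast hb)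
  choose! w hw using h1
  let m : (Fin 3 → ℤ) → ℕ := fun P => max (w P 0).natAbs (max (w P 1).natAbs (w P 2).natAbs)
  have hm1 : ∀ P i, |w P i| ≤ m P := fun P i => by
    fin_cases i <;> simp [m]
  have hm2 : ∀ P, ∃ j, |w P j| = m P := fun P => by
    rcases max_choice (w P 0).natAbs (max (w P 1).natAbs (w P 2).natAbs) with h | h
    · exact ⟨0, by simp only [m, h]; simp⟩
    · rcases max_choice (w P 1).natAbs (w P 2).natAbs with h' | h'
      · exact ⟨1, by simp only [m, h, h']; simp⟩
      · exact ⟨2, by simp only [m, h, h']; simp⟩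
  have hm0 : ∀ P ∈ Z, m P ≠ 0 := fun P hP h0 => by
    have := (hw P hP).2.2.2.2.1
    have h1 := hm1 P 1
    have h2 := hm1 P 2
    rw [h0] at h1 h2
    simp at h1 h2
    simp [h1, h2] at this
  have hm3 : ∀ P ∈ Z, m P ≤ 2*B := fun P hP => by
    obtain ⟨j, hj⟩ := hm2 P
    have := (hw P hP).1 j
    rw [hj] at this
    exact_mod_cast this
  have hk : ∀ k ∈ Z.image fun P => Nat.log 2 (m P), (Z.filter fun P => Nat.log 2 (m P) = k).card ≤ ⌊C*8*(d*(2*d*d)) * (B~^(ε/2)*B)⌋₊ := fun k hk => by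
    obtain ⟨Zk, hZk⟩ : ∃ Zk, Zk = Z.filter fun P => Nat.log 2 (m P) = k := ⟨_, rfl⟩
    rw [← hZk]
    have hZm : ∀ P ∈ Zk, P ∈ Z ∧ 2^k ≤ m P ∧ m P < 2^(k+1) := fun P hP => by
      rw [hZk, zz] at hP
      exact ⟨hP.1, hP.2 ▸ Nat.pow_log_le_self 2 (hm0 P hP.1), hP.2 ▸ Nat.lt_pow_succ_log_self (by norm_num) _⟩
    have hkB : 2^k ≤ 2*B := by
      obtain ⟨P, hP, rfl⟩ := zy.mp hk
      exact (Nat.pow_log_le_self 2 (hm0 P hP)).trans (hm3 P hP)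
    have hV1 : 1 ≤ 2^k := kx
    have hW := hC B hB H hH hY hi hco (2^(k+1)) kx (by rw [pow_succ]; omega) (Zk.image w) fun v hv => by
      obtain ⟨P, hP, rfl⟩ := zy.mp hv
      obtain ⟨h1, h2, h3⟩ := hZm P hP
      have h4 := hw P h1
      exact ⟨fun i => (hm1 P i).trans (by exact_mod_cast h3.le), h4.2.1, h4.2.2.1, h4.2.2.2.1⟩
    have hP := zi (f := w) Zk ((1 + 2 * B / 2^k) * (d * (2 * d * d))) fun v hv => by
      obtain ⟨P, hP, rfl⟩ := zy.mp hv
      obtain ⟨h1, h2, h3⟩ := hZm P hP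
      have h4 := hw P h1
      obtain ⟨a, ha⟩ := h4.2.2.2.1
      obtain ⟨j, hj⟩ := hm2 P
      refine perdir hd H hH hY hi (w P) a ha h4.2.2.2.2.1 B (2^k) hV1 ⟨j, by rw [hj]; exact_mod_cast h2⟩ _ fun Q hQ => ?_
      obtain ⟨hQ1, hQ2⟩ := zz.mp hQ
      have h5 := (hZm Q hQ1).1
      exact ⟨(hZ Q h5).1, hQ2 ▸ (hw Q h5).2.2.2.2.2⟩
    refine kv ?_
    have h6 : (1 + 2*B/2^k) * 2^(k+1) ≤ 8*B := by
      have := Nat.div_mul_le_self (2*B) (2^k)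
      rw [pow_succ]; linarith
    have h7 : (((1 + 2*B/2^k : ℕ)):ℝ) * (2^(k+1) : ℕ) ≤ 8*B := by exact_mod_cast h6
    calc (Zk.card:ℝ) ≤ (((1 + 2 * B / 2^k : ℕ) * (d * (2 * d * d)) * (Zk.image w).card)) := by exact_mod_cast hP
      _ ≤ ((1 + 2 * B / 2^k : ℕ) * (d * (2 * d * d))) * (C * B~^(ε/2) * (2^(k+1):ℕ)) := by gcongr
      _ = (((1 + 2*B/2^k : ℕ)):ℝ) * (2^(k+1) : ℕ) * (C * (d*(2*d*d)) * B~^(ε/2)) := by ring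
      _ ≤ 8*B * (C * (d*(2*d*d)) * B~^(ε/2)) := by gcongr
      _ = _ := by ring
  have hS := zi (f := fun P => Nat.log 2 (m P)) Z _ hk
  have hI : ((Z.image fun P => Nat.log 2 (m P)).card:ℝ) ≤ K * B~^(ε/2) := by
    have h1 : (Z.image fun P => Nat.log 2 (m P)) ⊆ range (Nat.log 2 B + 2) := fun k hk => by
      obtain ⟨P, hP, rfl⟩ := zy.mp hk
      have := Nat.log_mono_right (b := 2) (hm3 P hP)
      rw [xb, Nat.log_mul_base (by norm_num) (by omega)] at this
      rw [zo]; omega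
    have h2 := zu h1
    rw [xh] at h2
    have h3 := Real.natLog_le_logb B 2
    have h4 := Real.log_le_rpow_div (x := B) (by linarith) (show 0 < ε/2 by positivity)
    have h5 : Real.logb 2 B ≤ 2 * log B := by
      rw [Real.logb, zm (Real.log_pos (by norm_num))]
      have := Real.log_two_gt_d9
      have h0 := Real.log_nonneg hBr
      nlinarith
    have h6 : (1:ℝ) ≤ B~^(ε/2) := xr hBr (by positivity)
    have h7 : ((Z.image fun P => Nat.log 2 (m P)).card:ℝ) ≤ Nat.log 2 B + 2 := by exact_mod_cast h2
    push_cast at h3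
    have h8 : B~^(ε/2)/(ε/2) = 2/ε * B~^(ε/2) := by field_simp
    have h9 : (2+4/ε) * B~^(ε/2) ≤ K * B~^(ε/2) := by gcongr
    have h10 : (2+4/ε) * B~^(ε/2) = 2 * B~^(ε/2) + 2*(2/ε * B~^(ε/2)) := by ring
    linarith
  have hBs : B~^(1+ε) = B~^(ε/2) * B * B~^(ε/2) := by
    rw [show 1+ε = ε/2+1+ε/2 by ring, jf (by linarith), jf (by linarith), Real.rpow_one]
  calc (Z.card:ℝ) ≤ (⌊C*8*(d*(2*d*d)) * (B~^(ε/2)*B)⌋₊:ℝ) * (Z.image fun P => Nat.log 2 (m P)).card := by exact_mod_cast hS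
    _ ≤ (C*8*(d*(2*d*d)) * (B~^(ε/2)*B)) * (K * B~^(ε/2)) := by
      gcongr
      exact qx (by positivity)
    _ = _ := by rw [hBs]; push_cast; ring

lemma aff [Field K] (e : Mv n K) (h : e.totalDegree ≤ 1) (x : Fin n → K) :
    eval x e = coeff 0 e + ∑ i, coeff (single i 1) e * x i := by
  classical
  have key : e = C (coeff 0 e) + ∑ i, C (coeff (single i 1) e) * X i := by
    ext m
    rw [coeff_add, ug, coeff_C]
    simp_rw [yz, coeff_X, mul_ite, qu, mul_zero]
    rcases Nat.lt_trichotomy m.degree 1 with h1 | h1 | h1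
    · rw [(Finsupp.degree_eq_zero_iff m).mp (by omega)]
      simp
    · obtain ⟨i, rfl⟩ := (Finsupp.sum_eq_one_iff m).mp h1
      rw [ji (by simp [eq_comm]), yh i] <;> simp +contextual [Finsupp.single_left_inj]
    · rw [ji (by rintro rfl; simp at h1), jq, vc]
      · simp
      · exact h.trans_lt h1
      · rintro i -
        rw [ji (by rintro rfl; simp at h1)]
  conv_lhs => rw [key]
  simp

lemma plane_par (c : Mv 2 ℚ) (hc : Irreducible c) (h : c.totalDegree ≤ 1) : ∃ (j : Fin 2) (l μ : Fin 2 → ℚ), ∀ x, eval x c = 0 → ∀ i, x i = l i * x j + μ i := by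
  have hx := aff c h
  obtain ⟨a, ha⟩ : ∃ a : Fin 2 → ℚ, a = fun i => coeff (single i 1) c := ⟨_, rfl⟩
  have hx : ∀ x, eval x c = coeff 0 c + (a 0 * x 0 + a 1 * x 1) := fun x => by rw [hx x, xd, ha]
  by_cases h0 : a 0 = 0
  · by_cases h1 : a 1 = 0
    · exfalso
      have : c = C (coeff 0 c) := jc fun x => by rw [hx, h0, h1]; simp
      have h2 := irr_td hc
      rw [this, totalDegree_C] at h2
      omega
    · refine ⟨0, ![1, 0], ![0, -coeff 0 c / a 1], fun x hx0 i => ?_⟩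
      rw [hx, h0] at hx0
      fin_cases i
      · simp
      · simp; field_simp; linarith
  · refine ⟨1, ![-a 1/a 0, 1], ![-coeff 0 c / a 0, 0], fun x hx0 i => ?_⟩
    rw [hx] at hx0
    fin_cases i
    · simp; field_simp; linarith
    · simp

/-- points on a plane section, off the lines -/
lemma sec_cnt (d : ℕ) (δ : ℝ) (hδ : 0 < δ) : ∃ C : ℕ, ∀ B : ℕ, 1 ≤ B → ∀ f : Mv 3 ℚ, YM d f →
    ∀ c : Mv 2 ℚ, Irreducible c → c.totalDegree ≤ 1 → ∀ T : Finset (Fin 3 → ℤ), (∀ P ∈ T, (∀ i, |P i| ≤ B) ∧ eval (fun i => (P i:ℚ)) f = 0 ∧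
      eval (fun i => (P (Fin.succ i) : ℚ)) c = 0 ∧ ¬ ∃ w : Fin 3 → ℤ, w ≠ 0 ∧ (∀ i, |w i| ≤ 2*B) ∧ ∀ s : ℚ, eval (fun i => P i + w i * s) f = 0) →
    (T.card:ℝ) ≤ C * B~^(1/2+δ) := by
  classical
  obtain ⟨C, hC⟩ := curve d δ hδ
  refine ⟨d*(C+1), fun B hB f hY c hc hc1 T hT => ?_⟩
  have hb1 : (1:ℝ) ≤ B~^(1/2+δ) := xr (by exact_mod_cast hB) (by positivity)
  obtain ⟨j, l, μ, hj⟩ := plane_par c hc hc1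
  obtain ⟨v, hv⟩ : ∃ v : Fin 3 → Mv 2 ℚ, v = cons (X 0) fun i => MvPolynomial.C (l i) * X 1 + MvPolynomial.C (μ i) := ⟨_, rfl⟩
  have hv1 : ∀ i, (v i).totalDegree ≤ 1 := fun i => by
    rw [hv]
    refine Fin.cases ?_ (fun i => ?_) i
    · exact totalDegree_X_le _
    · simp only [ys]
      refine (jj _ _).trans (vz ((ye _ _).trans ?_) (by simp))
      simp
  have hYg : YM d (aeval v f) := ⟨subst_td hY.1 v hv1, by
    rw [subst_lead hY.1 _ 1 (by simp [hv]) (fun i => ?_)]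
    · simpa using hY.2
    · rw [hv, ys]
      refine kf.mp ((jd _ _ _).trans (vz ((vn _ _ _).trans (degreeOf_X_ne' (by simp)).le) (by simp)))⟩
  obtain ⟨S, hS1, hS2, hS3⟩ := facs (aeval v f) (ym_ne hYg)
  let q : (Fin 3 → ℤ) → Fin 2 → ℤ := fun P => ![P 0, P j.succ]
  have hq : ∀ P ∈ T, ∀ i, eval (fun k => (q P k:ℚ)) (v i) = P i := fun P hP i => by
    rw [hv]
    refine Fin.cases ?_ (fun i => ?_) i
    · simp [q]
    · have := hj _ (hT P hP).2.2.1 i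
      simp [q, this]
  have hqi : Set.InjOn q T := fun P hP Q hQ h => by
    funext i
    have h1 := hq P hP i
    have h2 := hq Q hQ i
    rw [h, h2] at h1
    exact_mod_cast h1.symm
  have hg : ∀ P ∈ T, eval (fun k => (q P k:ℚ)) (aeval v f) = 0 := fun P hP => by
    rw [sub_eval, ← (hT P hP).2.1]; congr 2; funext i; exact hq P hP i
  have hcov : T ⊆ S.biUnion fun e => T.filter fun P => eval (fun k => (q P k:ℚ)) e = 0 := fun P hP => by
    obtain ⟨e, he, h0⟩ := hS3 _ (hg P hP)
    exact jg.mpr ⟨e, he, zz.mpr ⟨hP, h0⟩⟩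
  have hone : ∀ e ∈ S, (T.filter fun P => eval (fun k => (q P k:ℚ)) e = 0).card ≤ ⌊(C+1) * B~^(1/2+δ)⌋₊ := fun e he => by
    refine kv ?_
    rcases le_or_gt 2 e.totalDegree with h2 | h2
    · rw [← yk (hqi.mono (Finset.coe_subset.mpr (ky _ _)))]
      refine (hC B hB e (hS2 e he).1 h2 ((totalDegree_le_of_dvd_of_isDomain (hS2 e he).2 (ym_ne hYg)).trans hYg.1) _ fun Q hQ => ?_).trans (by gcongr; linarith)
      obtain ⟨P, hP, rfl⟩ := zy.mp hQ
      obtain ⟨h3, h4⟩ := zz.mp hP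
      refine ⟨fun i => ?_, h4⟩
      fin_cases i
      · exact (hT P h3).1 0
      · exact (hT P h3).1 j.succ
    · have : (T.filter fun P => eval (fun k => (q P k:ℚ)) e = 0).card ≤ 1 := by
        refine Finset.card_le_one.mpr fun P hP Q hQ => ?_
        obtain ⟨hP1, hP2⟩ := zz.mp hP
        obtain ⟨hQ1, hQ2⟩ := zz.mp hQ
        by_contra hne
        refine (hT P hP1).2.2.2 ⟨Q - P, sub_ne_zero.mpr (Ne.symm hne), fun i => ?_, fun s => ?_⟩
        · have := abs_sub (Q i) (P i)
          simp only [Pi.sub_apply]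
          linarith [(hT P hP1).1 i, (hT Q hQ1).1 i]
        · obtain ⟨u, hu⟩ : ∃ u : Fin 2 → ℚ, u = fun k => q P k + (q Q k - q P k) * s := ⟨_, rfl⟩
          have h3 : eval u e = 0 := by
            rw [aff e (by omega), xd] at hP2 hQ2 ⊢
            simp only [hu]
            linear_combination (1-s) * hP2 + s * hQ2
          have h4 : eval u (aeval v f) = 0 := by
            obtain ⟨r, hr⟩ := (hS2 e he).2
            rw [hr, zw, h3, zero_mul]
          rw [sub_eval] at h4
          refine Eq.trans ?_ h4
          congr 2
          funext i
          have h5 := hq P hP1 i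
          have h6 := hq Q hQ1 i
          simp only [Pi.sub_apply]
          push_cast
          rw [← h5, ← h6, hv, hu]
          refine Fin.cases ?_ (fun i => ?_) i
          · simp
          · simp; ring
      have : ((T.filter fun P => eval (fun k => (q P k:ℚ)) e = 0).card:ℝ) ≤ 1 := by exact_mod_cast this
      refine this.trans ?_
      have : 0 ≤ (C:ℝ) * B~^(1/2+δ) := by positivity
      linarith
  have h1 := (zu hcov).trans ((vs _ _ _ hone).trans (zv _ (hS1.trans hYg.1)))
  calc (T.card:ℝ) ≤ d * (⌊(C+1) * B~^(1/2+δ)⌋₊:ℝ) := by exact_mod_cast h1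
    _ ≤ d * ((C+1) * B~^(1/2+δ)) := by
      gcongr
      exact qx (by positivity)
    _ = _ := by push_cast; ring

lemma surf0 (d : ℕ) (hd : 4 ≤ d) (ε : ℝ) (hε : 0 < ε) (hε1 : ε ≤ 1) (C0 : ℕ) : ∃ C : ℕ, ∀ B : ℕ, 1 ≤ B →
    ∀ H : Mv 4 ℤ, H.IsHomogeneous d → YM d H →
    Irreducible (map (icr Qb) (hs 0 H)) → (∀ m, |coeff m H| ≤ (C0 * B ^ C0 : ℕ)) →
    ∀ Z : Finset (Fin 3 → ℤ), (∀ P ∈ Z, (∀ i, |P i| ≤ B) ∧ eval P (dh H) = 0) → (Z.card:ℝ) ≤ C * B~^(1+ε) := by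
  classical
  obtain ⟨E, C1, h1⟩ := tree d hd (ε/2) (by positivity) (by linarith) C0
  obtain ⟨C2, h2⟩ := curve E (ε/2) (by positivity)
  obtain ⟨C3, h3⟩ := sec_cnt d (ε/2) (by positivity)
  obtain ⟨C4, h4⟩ := lines d (by omega) ε hε C0
  refine ⟨C1 + C4 + C1*(d*C2+C3), fun B hB H hH hY hi hco Z hZ => ?_⟩
  have hBr : (1:ℝ) ≤ B := by exact_mod_cast hB
  obtain ⟨Sc, Bad, hS1, hS2, hS3, hBad⟩ := h1 B hB H hH hY hi hco Z hZ
  obtain ⟨hYQ, -⟩ := dhQ_irr (by omega) H hH hY hi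
  let L : (Fin 3 → ℤ) → Prop := fun P => ∃ w : Fin 3 → ℤ, w ≠ 0 ∧ (∀ i, |w i| ≤ 2*B) ∧ ∀ s : ℚ, eval (fun i => P i + w i * s) (map (icr ℚ) (dh H)) = 0
  have hl : ((Z.filter L).card:ℝ) ≤ C4 * B~^(1+ε) := h4 B hB H hH hY hi hco _ fun P hP => by
    obtain ⟨hP1, w, hw0, hw1, hw2⟩ := zz.mp hP
    refine ⟨(hZ P hP1).1, w, hw0, hw1, fun s => ?_⟩
    have h5 := ev_q (dh H) fun i => P i + w i * s
    push_cast at h5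
    rw [hw2 s] at h5
    exact_mod_cast h5.symm
  have hcov : Z ⊆ Bad ∪ Z.filter L ∪ Sc.biUnion fun c => Z.filter fun P => ¬ L P ∧ eval (fun i => (P (Fin.succ i) : ℚ)) c = 0 := fun P hP => by
    by_cases hb : P ∈ Bad
    · simp [hb]
    · by_cases hL : L P
      · simp [hL, hP]
      · obtain ⟨c, hc, h0⟩ := hS3 P hP hb
        exact Finset.mem_union_right _ (jg.mpr ⟨c, hc, zz.mpr ⟨hP, hL, h0⟩⟩)
  have hone : ∀ c ∈ Sc, (Z.filter fun P => ¬ L P ∧ eval (fun i => (P (Fin.succ i) : ℚ)) c = 0).card ≤ ⌊(d*C2+C3) * B~^(1/2+ε/2)⌋₊ := fun c hc => by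
    refine kv ?_
    have hp := Real.rpow_nonneg (by linarith : (0:ℝ) ≤ B) (1/2+ε/2)
    have e1 : 0 ≤ (d*C2) * B~^(1/2+ε/2) := by positivity
    have e2 : 0 ≤ C3 * B~^(1/2+ε/2) := by positivity
    rcases le_or_gt 2 c.totalDegree with h | h
    · have h5 := fib_card (dh_ym hY) (Z.filter fun P => ¬ L P ∧ eval (fun i => (P (Fin.succ i) : ℚ)) c = 0) fun P hP => (hZ P (zz.mp hP).1).2
      have h6 := h2 B hB c (hS2 c hc).1 h (hS2 c hc).2 ((Z.filter fun P => ¬ L P ∧ eval (fun i => (P (Fin.succ i) : ℚ)) c = 0).image tail) fun Q hQ => by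
        obtain ⟨P, hP, rfl⟩ := zy.mp hQ
        obtain ⟨h3, h4⟩ := zz.mp hP
        exact ⟨fun i => (hZ P h3).1 _, h4.2⟩
      calc ((Z.filter fun P => ¬ L P ∧ eval (fun i => (P (Fin.succ i) : ℚ)) c = 0).card:ℝ) ≤ d * (((Z.filter fun P => ¬ L P ∧ eval (fun i => (P (Fin.succ i) : ℚ)) c = 0).image tail).card:ℝ) := by exact_mod_cast h5
        _ ≤ d * (C2 * B~^(1/2+ε/2)) := by gcongr
        _ ≤ _ := by linarith
    · refine (h3 B hB _ hYQ c (hS2 c hc).1 (by omega) _ fun P hP => ?_).trans (by linarith)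
      obtain ⟨h5, h6, h7⟩ := zz.mp hP
      exact ⟨(hZ P h5).1, by rw [ev_q, (hZ P h5).2, yr], h7, h6⟩
  have h5 := (zu hcov).trans ((kz _ _).trans (Nat.add_le_add (kz _ _) (vs _ _ _ hone)))
  have h6 : B~^(1+ε/2) ≤ B~^(1+ε) := zk hBr (by linarith)
  have h7 : B~^(1+ε) = B~^(1/2+ε/2) * B~^(1/2+ε/2) := by
    rw [← jf (by linarith)]; congr 1; ring
  calc (Z.card:ℝ) ≤ Bad.card + (Z.filter L).card + Sc.card * (⌊(d*C2+C3) * B~^(1/2+ε/2)⌋₊:ℝ) := by exact_mod_cast h5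
    _ ≤ C1 * B~^(1+ε/2) + C4 * B~^(1+ε) + C1 * B~^(1/2+ε/2) * ((d*C2+C3) * B~^(1/2+ε/2)) := by
      gcongr
      exact qx (by positivity)
    _ ≤ C1 * B~^(1+ε) + C4 * B~^(1+ε) + C1 * B~^(1/2+ε/2) * ((d*C2+C3) * B~^(1/2+ε/2)) := by gcongr
    _ = _ := by rw [h7]; push_cast; ring

lemma surf (d : ℕ) (hd : 4 ≤ d) (ε : ℝ) (hε : 0 < ε) (hε1 : ε ≤ 1) : ∃ C : ℕ, ∀ B : ℕ, 1 ≤ B →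
    ∀ H : Mv 4 ℤ, H.IsHomogeneous d → YM d H →
    Irreducible (map (icr Qb) (hs 0 H)) →
    ∀ Z : Finset (Fin 3 → ℤ), (∀ P ∈ Z, (∀ i, |P i| ≤ B) ∧ eval P (dh H) = 0) → (Z.card:ℝ) ≤ C * B~^(1+ε) := by
  classical
  obtain ⟨N, hN⟩ : ∃ N, N = (d+1)^4 := ⟨_, rfl⟩
  have hN0 : 0 < N := by rw [hN]; positivity
  obtain ⟨C, hC⟩ := surf0 d hd ε hε hε1 (N^N + d*N)
  refine ⟨C + 6*d*d*d, fun B hB H hH hY hi Z hZ => ?_⟩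
  have hBr : (1:ℝ) ≤ B := by exact_mod_cast hB
  have hb1 : (B:ℝ) ≤ B~^(1+ε) := by
    conv_lhs => rw [← Real.rpow_one (B:ℝ)]
    exact zk hBr (by linarith)
  have hb0 : (0:ℝ) ≤ B~^(1+ε) := by linarith
  obtain ⟨hYQ, hiQ⟩ := dhQ_irr (by omega) H hH hY hi
  let q : (Fin 3 → ℤ) → Fin 4 → ℤ := fun P => ![P 0, P 1, P 2, 1]
  have hj : Injective (icr ℚ) := vh
  obtain ⟨g, hg0, hgs, hgc, hgZ⟩ := height (map (icr ℚ) H) (fun h => ym_ne hY (map_injective _ hj (by rw [h, zp]))) H.support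
    (support_map_subset _ _) d (fun m hm => (xg hm).trans hY.1) B hB (q '' Z) (by
      rintro _ ⟨P, hP, rfl⟩
      refine ⟨fun i => ?_, by rw [ev_q, ← dh_eval, (hZ P hP).2, yr]⟩
      fin_cases i
      · exact (hZ P hP).1 0
      · exact (hZ P hP).1 1
      · exact (hZ P hP).1 2
      · show |(1:ℤ)| ≤ B
        simpa using hB)
  have hgh : g.IsHomogeneous d := fun m hm => hH (yp.mp (hgs (yp.mpr hm)))
  have hgZ' : ∀ P ∈ Z, eval P (dh g) = 0 := fun P hP => by rw [dh_eval]; exact hgZ _ ⟨P, hP, rfl⟩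
  have hgd : (map (icr ℚ) (dh g)).totalDegree ≤ d := by
    rw [dh_map]
    exact subst_td (hgh.map _).totalDegree_le _ fun i => by fin_cases i <;> simp
  by_cases hdv : map (icr ℚ) (dh H) ∣ map (icr ℚ) (dh g)
  · obtain ⟨c, hc, hgc'⟩ := prop_of_dvd hdv (fun h => hg0 (map_injective _ hj (by
      rw [zp]; rw [dh_map] at h; exact dh_inj (hgh.map _) h))) (by rwa [ym_td hYQ])
    have he : map (icr ℚ) g = MvPolynomial.C c * map (icr ℚ) H := by
      have : map (icr ℚ) g - MvPolynomial.C c * map (icr ℚ) H = 0 :=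
        dh_inj (e := d) ((hgh.map _).sub ((hH.map _).C_mul c)) (by
          rw [dh_map, dh_map] at hgc'
          unfold dh at hgc' ⊢
          rw [map_sub, zw, hgc', aeval_C, algebraMap_eq, sub_self])
      exact kp.mp this
    refine (hC B hB g hgh ⟨hgh.totalDegree_le, fun h => ?_⟩ ?_ (fun m => (hgc m).trans ?_) Z fun P hP => ⟨(hZ P hP).1, hgZ' P hP⟩).trans ?_
    · have := congrArg (coeff (single 0 d)) he
      rw [xf, h, zp, yz, xf] at this
      exact xt hc (by simpa using hY.2) this.symm
    · have h1 := congrArg (map (algebraMap ℚ Qb)) he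
      rw [zw, map_map, map_map, map_C, RingHom.ext_int (RingHom.comp _ _) (icr _)] at h1
      rw [hs_map] at hi ⊢
      rw [h1]
      unfold hs at hi ⊢
      rw [zw, aeval_C, algebraMap_eq]
      exact (ja _ _ ((zl.mpr (by simpa using hc)).map MvPolynomial.C)).irreducible_iff.mpr hi
    · have hsc : H.support.card ≤ N := by rw [hN]; exact supp_card H hY.1
      have h2 : (H.support.card * B^d)^H.support.card ≤ (N * B^d)^N :=
        (yd (zv _ hsc) _).trans (zg (xa hN0 (Nat.pow_pos hB)) hsc)
      have h3 : (N * B^d)^N ≤ (N^N+d*N) * B^(N^N+d*N) := by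
        rw [kr, ← pow_mul]
        exact xs (by omega) (zg hB (by omega))
      exact_mod_cast h2.trans h3
    · gcongr; exact_mod_cast vj _ _
  · have h1 := cnt3Z (by omega) hYQ hiQ hdv hgd B Z fun P hP => ⟨(hZ P hP).1, (hZ P hP).2, hgZ' P hP⟩
    have h2 : Z.card ≤ 6*d*d*d*B := h1.trans (by
      have : 2*B+1 ≤ 3*B := by omega
      calc 2*d*d*d*(2*B+1) ≤ 2*d*d*d*(3*B) := zx _ this
        _ = _ := by ring)
    calc (Z.card:ℝ) ≤ 6*d*d*d*B := by exact_mod_cast h2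
      _ ≤ 6*d*d*d*B~^(1+ε) := by gcongr
      _ ≤ _ := by push_cast; gcongr; linarith [show (0:ℝ) ≤ C by positivity]

lemma hensel_ps [CommRing A] (P : Polynomial (PowerSeries A)) (hP : P.Monic) (α : A)
    (h0 : (P.map PowerSeries.constantCoeff).eval α = 0)
    (h1 : IsUnit ((P.map PowerSeries.constantCoeff).derivative.eval α)) :
    ∃ φ, P.eval φ = 0 ∧ PowerSeries.constantCoeff φ = α := by
  have key : ∀ Q : Polynomial (PowerSeries A), PowerSeries.constantCoeff (Q.eval (PowerSeries.C α)) =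
      (Q.map PowerSeries.constantCoeff).eval α := fun Q => by
    rw [Polynomial.eval_map, ← Polynomial.eval₂_hom]; simp
  obtain ⟨φ, hφ, h2⟩ := HenselianRing.is_henselian (I := Ideal.span {(PowerSeries.X : PowerSeries A)}) P hP
    (PowerSeries.C α) (by rw [Ideal.mem_span_singleton, PowerSeries.X_dvd_iff, key, h0])
    (IsUnit.map _ (PowerSeries.isUnit_iff_constantCoeff.mpr (by rwa [key, ← Polynomial.derivative_map])))
  rw [Ideal.mem_span_singleton, PowerSeries.X_dvd_iff, map_sub, PowerSeries.constantCoeff_C] at h2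
  exact ⟨φ, hφ, kp.mp h2⟩

lemma rt_dvd [CommRing R] [IsDomain R] (q : Polynomial R) (hq : q ≠ 0) (I : Finset ι) (φ : ι → R)
    (hφ : Set.InjOn φ I) (h : ∀ α ∈ I, q.eval (φ α) = 0) :
    ∏ α ∈ I, (pX - pC (φ α)) ∣ q := by
  classical
  rw [← Finset.prod_image (f := fun x => pX - pC x) hφ]
  refine (Multiset.prod_X_sub_C_dvd_iff_le_roots hq _).mpr ((Multiset.le_iff_subset (Finset.nodup _)).mpr ?_)
  intro x hx
  obtain ⟨α, hα, rfl⟩ := zy.mp (Finset.mem_val.mp hx)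
  exact (kb hq).mpr (h α hα)

lemma bert1 [Field Ω] [Infinite Ω] (p : Polynomial (Mv m Ω)) (hm : p.Monic)
    (hi : Irreducible p) (b : Fin m → Ω) (s : Finset Ω) (hs : s.card = p.natDegree)
    (h : ∀ α ∈ s, (p.map (eval b)).eval α = 0 ∧ (p.map (eval b)).derivative.eval α ≠ 0) (d : ℕ) :
    ∃ a : Fin m → Ω, ∀ g h : Polynomial (Polynomial Ω), (∀ n, (g.coeff n).natDegree ≤ d) →
      p.map (aeval fun i => pC (a i) * pX + pC (b i) :
        Mv m Ω →ₐ[Ω] _).toRingHom = g * h → g.natDegree ≠ 0 → h.natDegree ≠ 0 →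
      ∀ c, c ≠ 0 → g.leadingCoeff = pC c → False := by
  classical
  let τ : Mv m Ω →+* Polynomial (Mv m Ω) := (aeval fun i => pC (X i) * pX + pC (C (b i)) :
    Mv m Ω →ₐ[Ω] Polynomial (Mv m Ω)).toRingHom
  let ι : Polynomial (Mv m Ω) →+* PowerSeries (Mv m Ω) := Polynomial.coeToPowerSeries.ringHom
  let κ : Polynomial (Mv m Ω) →+* Mv m Ω :=
    Polynomial.eval₂RingHom (aeval fun i => X i - C (b i) : Mv m Ω →ₐ[Ω] Mv m Ω).toRingHom 1
  have hκ : κ.comp τ = RingHom.id _ := by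
    refine js (fun x => ?_) fun i => ?_
    · simp [κ, τ]
    · simp [κ, τ]
  have hι : PowerSeries.constantCoeff.comp (ι.comp τ) = C.comp (eval b) := by
    refine js (fun x => ?_) fun i => ?_
    · simp [ι, τ]
    · simp [ι, τ]
  have hinj : Injective ι := Polynomial.coe_injective _
  have hP := hm.map (ι.comp τ)
  have hcc : (p.map (ι.comp τ)).map PowerSeries.constantCoeff = (p.map (eval b)).map C := by
    rw [jp, hι, jp]
  have hφ0 : ∀ α ∈ s, ∃ φ, (p.map (ι.comp τ)).eval φ = 0 ∧ PowerSeries.constantCoeff φ = C α := fun α hα =>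
    hensel_ps _ hP _ (by rw [hcc, kw, (h α hα).1, zp])
      (by rw [hcc, Polynomial.derivative_map, kw]
          exact (zl.mpr (h α hα).2).map _)
  choose! φ hφ hφc using hφ0
  have hq : ∀ I ∈ s.powerset.filter (fun I => I.card ≠ 0 ∧ I.card ≠ s.card), ∃ n k, d < k ∧
      PowerSeries.coeff k ((∏ α ∈ I, (pX - pC (φ α))).coeff n) ≠ 0 := by
    intro I hI
    rw [zz, Finset.mem_powerset] at hI
    obtain ⟨hIs, hI0, hI1⟩ := hI
    by_contra! hc
    have hGm : (∏ α ∈ I, (pX - pC (φ α))).Monic :=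
      Polynomial.monic_prod_of_monic _ _ fun α _ => vb _
    have hGd : (∏ α ∈ I, (pX - pC (φ α))).natDegree = I.card := by
      rw [Polynomial.natDegree_prod_of_monic _ _ fun α _ => vb _]; simp
    obtain ⟨G, hG, hGn, hGM⟩ := Polynomial.lifts_and_natDegree_eq_and_monic (f := ι)
      ((Polynomial.lifts_iff_coeff_lifts _).mpr fun n =>
        ⟨PowerSeries.trunc (d+1) _, by
          refine PowerSeries.ext fun k => ?_
          simp only [ι, vr, Polynomial.coeff_coe, PowerSeries.coeff_trunc]
          split_ifs with hk
          · rfl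
          · exact (hc n k (by omega)).symm⟩) hGm
    have hdvd : G ∣ p.map τ := by
      rw [← Polynomial.map_dvd_map ι hinj hGM, hG, jp]
      refine rt_dvd _ hP.ne_zero I φ (fun x hx y hy e => ?_) fun α hα => hφ α (hIs hα)
      have := hφc x (hIs hx)
      rw [e, hφc y (hIs hy)] at this
      exact (C_injective _ _ this).symm
    have h2 := Polynomial.map_dvd κ hdvd
    rw [jp, hκ, Polynomial.map_id] at h2
    obtain ⟨Q, hQ⟩ := h2
    have hGκ := hGM.map κ
    have hQm : Q.Monic := hGκ.of_mul_monic_left (hQ ▸ hm)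
    have hdeg := congrArg Polynomial.natDegree hQ
    rw [hGκ.natDegree_mul hQm, hGM.natDegree_map, hGn, hGd, ← hs] at hdeg
    rcases hi.isUnit_or_isUnit hQ with hu | hu
    · rw [hGκ.isUnit_iff] at hu
      have := congrArg Polynomial.natDegree hu
      rw [hGM.natDegree_map, hGn, hGd, Polynomial.natDegree_one] at this; omega
    · rw [hQm.isUnit_iff] at hu
      rw [hu, Polynomial.natDegree_one] at hdeg; omega
  choose! n k hk hnk using hq
  obtain ⟨a, ha⟩ : ∃ a, eval a (∏ I ∈ s.powerset.filter (fun I => I.card ≠ 0 ∧ I.card ≠ s.card),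
      PowerSeries.coeff (k I) ((∏ α ∈ I, (pX - pC (φ α))).coeff (n I))) ≠ 0 := by
    by_contra! hc
    exact (ud.mpr hnk) (jc (by simpa using hc))
  rw [map_prod, ud] at ha
  refine ⟨a, fun g h hgd hgh hg0 hh0 c hc hl => ?_⟩
  let ι' : Polynomial Ω →+* PowerSeries Ω := Polynomial.coeToPowerSeries.ringHom
  have hinj' : Injective ι' := Polynomial.coe_injective _
  let ψ : PowerSeries (Mv m Ω) →+* PowerSeries Ω := PowerSeries.map (eval a)
  have hψ : ψ.comp (ι.comp τ) = ι'.comp (aeval fun i => pC (a i) * pX + pC (b i) :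
        Mv m Ω →ₐ[Ω] _).toRingHom := by
    refine js (fun x => ?_) fun i => ?_
    · simp [ι, τ, ψ, ι']
    · simp [ι, τ, ψ, ι']
  have hroot : ∀ α ∈ s, (g.map ι').eval (ψ (φ α)) * (h.map ι').eval (ψ (φ α)) = 0 := fun α hα => by
    rw [← Polynomial.eval_mul, ← jh, ← hgh, jp, ← hψ, ← jp,
      kw, hφ α hα, zp]
  have hψc : ∀ α ∈ s, PowerSeries.constantCoeff (ψ (φ α)) = α := fun α hα => by
    have : PowerSeries.constantCoeff (ψ (φ α)) = eval a (PowerSeries.constantCoeff (φ α)) := by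
      simp [ψ, ← PowerSeries.coeff_zero_eq_constantCoeff]
    rw [this, hφc α hα, eval_C]
  have hin : Set.InjOn (fun α => ψ (φ α)) s := fun x hx y hy e => by
    rw [← hψc x hx, ← hψc y hy]; exact congrArg _ e
  have hg0' : g.map ι' ≠ 0 := (Polynomial.map_ne_zero_iff hinj').mpr (by rintro rfl; simp at hg0)
  have hh0' : h.map ι' ≠ 0 := (Polynomial.map_ne_zero_iff hinj').mpr (by rintro rfl; simp at hh0)
  obtain ⟨I, hI⟩ : ∃ I, I = s.filter fun α => (g.map ι').eval (ψ (φ α)) = 0 := ⟨_, rfl⟩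
  obtain ⟨J, hJ⟩ : ∃ J, J = s.filter fun α => ¬ (g.map ι').eval (ψ (φ α)) = 0 := ⟨_, rfl⟩
  have hIJ : I.card + J.card = s.card := by rw [hI, hJ]; exact zn _
  have hGm : ∀ I : Finset Ω, (∏ α ∈ I, (pX - pC (ψ (φ α)))).Monic := fun I =>
    Polynomial.monic_prod_of_monic _ _ fun α _ => vb _
  have hGd : ∀ I : Finset Ω, (∏ α ∈ I, (pX - pC (ψ (φ α)))).natDegree = I.card := fun I => by
    rw [Polynomial.natDegree_prod_of_monic _ _ fun α _ => vb _]; simp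
  have hsI : I ⊆ s := hI ▸ ky _ _
  have d1 := rt_dvd _ hg0' I (fun α => ψ (φ α)) (hin.mono hsI) fun α hα => by
    rw [hI] at hα; exact (zz.mp hα).2
  have d2 := rt_dvd _ hh0' J (fun α => ψ (φ α)) (hin.mono (hJ ▸ ky _ _)) fun α hα => by
    rw [hJ] at hα
    exact (vy.mp (hroot α (zz.mp hα).1)).resolve_left (zz.mp hα).2
  have e1 := Polynomial.natDegree_le_of_dvd d1 hg0'
  have e2 := Polynomial.natDegree_le_of_dvd d2 hh0'
  rw [hGd, yl hinj'] at e1 e2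
  have e3 := congrArg Polynomial.natDegree hgh
  rw [hm.natDegree_map, Polynomial.natDegree_mul (by rintro rfl; simp at hg0) (by rintro rfl; simp at hh0), ← hs] at e3
  have e4 := Polynomial.eq_leadingCoeff_mul_of_monic_of_dvd_of_natDegree_le (hGm I) d1
    (by rw [hGd, yl hinj']; omega)
  rw [Polynomial.leadingCoeff_map_of_injective hinj', hl] at e4
  have hmem : I ∈ s.powerset.filter (fun I => I.card ≠ 0 ∧ I.card ≠ s.card) := by
    simp only [zz, Finset.mem_powerset]; exact ⟨hsI, by omega, by omega⟩
  have e5 := congrArg (fun q => PowerSeries.coeff (k I) (q.coeff (n I))) e4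
  have e6 : ∏ α ∈ I, (pX - pC (ψ (φ α))) =
      (∏ α ∈ I, (pX - pC (φ α))).map ψ := by
    rw [Polynomial.map_prod]; simp
  rw [e6] at e5
  have e7 : PowerSeries.coeff (k I) ((Polynomial.map ι' g).coeff (n I)) = 0 := by
    rw [jx]
    simp only [ι', vr, Polynomial.coeff_coe]
    exact Polynomial.coeff_eq_zero_of_natDegree_lt ((hgd _).trans_lt (hk I hmem))
  replace e5 := e7.symm.trans e5
  simp only [Polynomial.coeff_C_mul, jx, ι', ψ, vr,
    Polynomial.coe_C, PowerSeries.coeff_C_mul, PowerSeries.coeff_map] at e5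
  exact xt hc (ha I hmem) e5.symm

lemma aev_fin [CommRing K] [CommRing R] [Algebra K R] (f : Mv (n+1) K) (x : Fin n → R) :
    (finSuccEquiv K n f).map (aeval x : _ →ₐ[K] R).toRingHom = (aeval (cons pX fun i => pC (x i)) f : Polynomial R) := by
  induction f using za with
  | C a => simp [finSuccEquiv_apply]
  | add p q hp hq => simp only [yo, Polynomial.map_add, hp, hq]
  | mul_X p i hp =>
    rw [zw, jh, hp, zw]
    congr 1
    refine Fin.cases ?_ (fun j => ?_) i
    · simp [finSuccEquiv_X_zero]
    · simp [finSuccEquiv_X_succ]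

lemma der_fin [CommRing K] (f : Mv (n+1) K) :
    finSuccEquiv K n (pderiv 0 f) = (finSuccEquiv K n f).derivative := by
  induction f using za with
  | C a => simp [finSuccEquiv_apply]
  | add p q hp hq => simp only [yo, hp, hq]
  | mul_X p i hp =>
    rw [uk, yo, zc, zc, zw, zw, hp, zw, Polynomial.derivative_mul]
    refine Fin.cases ?_ (fun j => ?_) i
    · simp [finSuccEquiv_X_zero]; ring
    · simp [finSuccEquiv_X_succ, pderiv_X]; ring

lemma bertini [Field Ω] [IsAlgClosed Ω] [CharZero Ω] (hd : 1 ≤ d) (f : Mv (m+1) Ω)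
    (h : YM d f) (hi : Irreducible f) : ∃ a b : Fin m → Ω,
    Irreducible (aeval (cons (X 0) (fun i => C (a i) * X 1 + C (b i))) f : Mv 2 Ω) := by
  classical
  wlog h1 : coeff (single 0 d) f = 1 generalizing f
  · have hu : IsUnit (C (coeff (single 0 d) f)⁻¹ : Mv (m+1) Ω) :=
      (zl.mpr (uc h.2)).map C
    obtain ⟨a, b, hab⟩ := this (C (coeff (single 0 d) f)⁻¹ * f)
      ⟨by simpa using (ye _ _).trans (yq (totalDegree_C _).le h.1),
        by rw [yz]; exact xt (uc h.2) h.2⟩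
      ((ja _ _ hu).irreducible_iff.mpr hi)
      (by rw [yz]; exact xi h.2)
    refine ⟨a, b, ?_⟩
    rw [zw, aeval_C] at hab
    exact (ja _ _ ((zl.mpr (uc h.2)).map (algebraMap Ω _))).irreducible_iff.mp hab
  obtain ⟨p, hp⟩ : ∃ p, p = finSuccEquiv Ω m f := ⟨_, rfl⟩
  have hpd : p.natDegree = d := hp ▸ ym_deg h
  have hpm : p.Monic := by rw [Polynomial.Monic, Polynomial.leadingCoeff, hpd, hp, ym_coeff h.1, h1, C_1]
  have hpi : Irreducible p := hp ▸ (MulEquiv.irreducible_iff (finSuccEquiv Ω m)).mpr hi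
  obtain ⟨hf1, hf2⟩ := fy_spec hd h (by exact_mod_cast (by omega : d ≠ 0))
  obtain ⟨R, hR, -, hv⟩ := elim hd h hi hf1 hf2
  obtain ⟨b, hb⟩ : ∃ x, eval x R ≠ 0 := by
    by_contra hc; push Not at hc; exact hR (jc (by simpa using hc))
  have hsim : ∀ α, (p.map (eval b)).eval α = 0 → (p.map (eval b)).derivative.eval α ≠ 0 := fun α h0 h2 => by
    rw [Polynomial.derivative_map, hp, ← der_fin] at h2
    rw [hp] at h0
    have e := eval_cons_fin f (cons α b : Fin (m+1) → Ω)
    have e' := eval_cons_fin (pderiv 0 f) (cons α b : Fin (m+1) → Ω)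
    rw [ks, qz] at e e'
    have := hv _ (e.symm.trans h0) (e'.symm.trans h2)
    rw [ks] at this
    exact hb this
  have hm' := hpm.map (eval b)
  have hnd : (p.map (eval b)).roots.Nodup := by
    rw [Multiset.nodup_iff_count_le_one]
    intro α
    rw [Polynomial.count_roots]
    by_contra! hc
    obtain ⟨h2, h3⟩ := (Polynomial.one_lt_rootMultiplicity_iff_isRoot hm'.ne_zero).mp hc
    exact hsim α h2 h3
  obtain ⟨a, ha⟩ := bert1 p hpm hpi b (p.map (eval b)).roots.toFinset
    (by rw [Multiset.toFinset_card_of_nodup hnd, IsAlgClosed.card_roots_eq_natDegree, hpm.natDegree_map])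
    (fun α hα => by
      have := (kb hm'.ne_zero).mp (Multiset.mem_toFinset.mp hα)
      exact ⟨this, hsim α this⟩) d
  refine ⟨a, b, ?_⟩
  obtain ⟨v, hv⟩ : ∃ v : Fin (m+1) → Mv 2 Ω, v = cons (X 0) (fun i => C (a i) * X 1 + C (b i)) := ⟨_, rfl⟩
  rw [← hv]
  have hY : YM d (aeval v f : Mv 2 Ω) := by
    refine ⟨subst_td h.1 v fun i => ?_, ?_⟩
    · refine Fin.cases ?_ (fun j => ?_) i
      · rw [hv]; exact totalDegree_X_le _
      · rw [hv, ys]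
        refine (jj _ _).trans (vz ((ye _ _).trans ?_) (by simp))
        simp
    · rw [subst_lead h.1 v 1 (by rw [hv]; simp) fun i => ?_, one_pow, um]
      · exact h.2
      · rw [hv, ys]
        refine kf.mp ((jd _ _ _).trans (vz ((degreeOf_mul_le _ _ _).trans ?_) (by simp)))
        simp [degreeOf_X_ne' (show (0 : Fin 2) ≠ 1 by decide)]
  rw [irreducible_iff]
  refine ⟨fun hu => by rw [ym_unit hY] at hu; omega, fun g q hgq => ?_⟩
  obtain ⟨e1, e2, he, h3, h4⟩ := ym_factor hY hgq
  rw [ym_unit h3, ym_unit h4]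
  by_contra! hne
  obtain ⟨ρ, hρ⟩ : ∃ ρ : Mv 1 Ω →+* Polynomial Ω, ρ = (aeval fun _ => pX :
    Mv 1 Ω →ₐ[Ω] Polynomial Ω).toRingHom := ⟨_, rfl⟩
  have hl : ∀ {e} {g : Mv 2 Ω}, YM e g → ρ (finSuccEquiv Ω 1 g).leadingCoeff =
      pC (coeff (single 0 e) g) := fun hg => by
    rw [Polynomial.leadingCoeff, ym_deg hg, ym_coeff hg.1, hρ]; simp
  have hl0 : ∀ {e} {g : Mv 2 Ω}, YM e g → ρ (finSuccEquiv Ω 1 g).leadingCoeff ≠ 0 := fun hg => by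
    rw [hl hg]; exact Polynomial.C_ne_zero.mpr hg.2
  have hdg : ∀ {e} {g : Mv 2 Ω}, YM e g → ((finSuccEquiv Ω 1 g).map ρ).natDegree = e := fun hg => by
    rw [Polynomial.natDegree_map_of_leadingCoeff_ne_zero _ (hl0 hg), ym_deg hg]
  refine ha ((finSuccEquiv Ω 1 g).map ρ) ((finSuccEquiv Ω 1 q).map ρ) (fun n => ?_) ?_
    (by rw [hdg h3]; exact hne.1) (by rw [hdg h4]; exact hne.2) _ h3.2
    (by rw [Polynomial.leadingCoeff_map_of_leadingCoeff_ne_zero _ (hl0 h3), hl h3])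
  · rw [jx, hρ]
    have := totalDegree_coeff_fin g n
    have := h3.1
    exact (MvPolynomial.aeval_natDegree_le (m := d) (n := 1) _ (by omega) _
      (fun i => Polynomial.natDegree_X_le)).trans (by omega)
  · rw [← jh, ← zw, ← hgq, hρ, aev_fin, hp, aev_fin, ← jm]
    congr 1
    refine MvPolynomial.algHom_ext fun i => ?_
    rw [jm, jw, jw, hv]
    refine Fin.cases ?_ (fun j => ?_) i
    · simp
    · simp only [ys, yo, zw, jw, aeval_C]; rfl

lemma cd_mul [CommRing K] {f g : MvPolynomial σ (MvPolynomial τ K)}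
    (hf : ∀ m, (coeff m f).totalDegree ≤ a) (hg : ∀ m, (coeff m g).totalDegree ≤ b) (m : σ →₀ ℕ) :
    (coeff m (f * g)).totalDegree ≤ a + b := by
  classical
  rw [coeff_mul]
  exact yy fun x _ => (ye _ _).trans (yq (hf _) (hg _))

lemma cd_pow [CommRing K] {f : MvPolynomial σ (MvPolynomial τ K)}
    (hf : ∀ m, (coeff m f).totalDegree ≤ 1) (k : ℕ) : ∀ m, (coeff m (f ^ k)).totalDegree ≤ k := by
  classical
  induction k with
  | zero => intro m; rw [pow_zero, coeff_one]; split_ifs <;> simp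
  | succ k ih => intro m; rw [pow_succ]; exact cd_mul ih hf m

lemma cd_prod [CommRing K] (f : ι → MvPolynomial σ (MvPolynomial τ K))
    (hf : ∀ i m, (coeff m (f i)).totalDegree ≤ 1) (k : ι → ℕ) (s : Finset ι) :
    ∀ m, (coeff m (∏ i ∈ s, f i ^ k i)).totalDegree ≤ ∑ i ∈ s, k i := by
  classical
  induction s using Finset.induction_on with
  | empty => intro m; rw [Finset.prod_empty, coeff_one]; split_ifs <;> simp
  | insert i s hi ih => intro m; rw [Finset.prod_insert hi, Finset.sum_insert hi]; exact cd_mul (cd_pow (hf i) _) ih m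

lemma cd_aev [CommRing K] {f : MvPolynomial ι K} (h : f.totalDegree ≤ d)
    (v : ι → MvPolynomial σ (MvPolynomial τ K)) (hv : ∀ i m, (coeff m (v i)).totalDegree ≤ 1) (m : σ →₀ ℕ) :
    (coeff m (aeval v (map C f : MvPolynomial ι (MvPolynomial τ K)))).totalDegree ≤ d := by
  rw [aeval_def, up, ug]
  refine yy fun k hk => ?_
  rw [algebraMap_eq, yz, xf]
  refine (ye _ _).trans ?_
  rw [totalDegree_C, zero_add]
  exact (cd_prod v hv k _ m).trans ((xg (support_map_subset _ _ hk)).trans h)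

lemma td_aev [CommRing K] (g : MvPolynomial σ ℤ) (v : σ → MvPolynomial τ K) (d : ℕ)
    (hv : ∀ s, (v s).totalDegree ≤ d) : (aeval v g).totalDegree ≤ d * g.totalDegree := by
  rw [aeval_def, up]
  refine yy fun m hm => (ye _ _).trans ?_
  have h1 : (algebraMap ℤ (MvPolynomial τ K) (coeff m g)).totalDegree = 0 := by
    rw [eq_intCast, ← map_intCast (C : K →+* MvPolynomial τ K), totalDegree_C]
  rw [h1, zero_add]
  refine (totalDegree_finsetProd _ _).trans ?_
  calc _ ≤ ∑ i ∈ m.support, d * m i := zq fun i _ =>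
        (totalDegree_pow _ _).trans (by rw [xb]; exact zv _ (hv i))
    _ = d * m.degree := by rw [← yu]; rfl
    _ ≤ _ := zx _ (xg hm)

noncomputable def lnv [CommRing R] (a b : Fin m → R) : Fin (m+1) → Mv 2 R :=
  cons (X 0) fun i => C (a i) * X 1 + C (b i)

lemma lnv_map [CommRing R] [CommRing S] (φ : R →+* S) (a b : Fin m → R) (f : Mv (m+1) R) :
    map φ (aeval (lnv a b) f) = aeval (lnv (fun i => φ (a i)) (fun i => φ (b i))) (map φ f) := by
  rw [sub_map]
  congr 2
  funext i
  refine Fin.cases ?_ (fun j => ?_) i <;> simp [lnv]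

lemma lnv_ym [CommRing K] {f : Mv (m+1) K} (h : YM d f) (a b : Fin m → K) :
    YM d (aeval (lnv a b) f) := by
  refine ⟨subst_td h.1 _ fun i => ?_, ?_⟩
  · refine Fin.cases (totalDegree_X_le _) (fun j => ?_) i
    rw [lnv, ys]
    refine (jj _ _).trans (vz ((ye _ _).trans ?_) (by simp))
    rw [totalDegree_C, zero_add]; exact totalDegree_X_le _
  · rw [subst_lead h.1 _ 1 (by simp [lnv]) fun i => ?_, one_pow, um]
    · exact h.2
    · rw [lnv, ys]
      refine kf.mp ((jd _ _ _).trans (vz ((vn _ _ _).trans ?_) (by simp)))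
      rw [degreeOf_X_ne' (show (0 : Fin 2) ≠ 1 by decide)]

lemma uq [Field K] {f : Mv (m+1) K} (h : f.totalDegree ≤ d)
    (g : MvPolynomial (Fin (1+1) → Fin (d+1)) ℤ) : ∃ q : Mv (m+m) K, q.totalDegree ≤ d * g.totalDegree ∧
    ∀ a b : Fin m → K, eval (Fin.append a b) q = aeval (cf d (aeval (lnv a b) f)) g := by
  classical
  obtain ⟨fU, hU⟩ : ∃ fU : Mv 2 (Mv (m+m) K), fU =
    aeval (lnv (fun i => X (Fin.castAdd m i)) fun i => X (Fin.natAdd m i))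
      (map C f : Mv (m+1) (Mv (m+m) K)) := ⟨_, rfl⟩
  refine ⟨@aeval _ _ _ _ _ (Ring.toIntAlgebra _) (cf d fU) g, td_aev g _ d fun s => ?_, fun a b => ?_⟩
  · rw [cf, hU]
    refine cd_aev h _ (fun i m => ?_) _
    refine Fin.cases ?_ (fun j => ?_) i
    · rw [lnv, qz, coeff_X]; split_ifs <;> simp
    · rw [lnv, ys, coeff_add, yz, coeff_X, coeff_C]
      refine (jj _ _).trans (vz ?_ ?_) <;> split_ifs <;> simp
  · rw [aeval_hom, ← cf_map, hU, lnv_map, map_map]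
    have : (eval (Fin.append a b)).comp C = RingHom.id K := by ext; simp
    rw [this, map_id]
    simp only [eval_X, Fin.append_left, Fin.append_right]

lemma ln_ex (k d : ℕ) (hd : 1 ≤ d) : ∃ M : ℕ, ∀ F : Mv (k+3) ℤ, YM d F →
    Irreducible (map (icr Qb) F) → ∃ a b : Fin (k+2) → ℕ, (∀ i, a i ≤ M) ∧ (∀ i, b i ≤ M) ∧
    ((a 0 : ℤ) * b 1 - a 1 * b 0 ≠ 0) ∧
    Irreducible (map (icr Qb) (aeval (lnv (fun i => (a i : ℤ)) fun i => (b i : ℤ)) F)) := by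
  classical
  obtain ⟨N, hN⟩ := noether 1 d hd
  refine ⟨d * N.sup totalDegree + 2, fun F hY hi => ?_⟩
  obtain ⟨f, hf⟩ : ∃ f, f = map (icr Qb) F := ⟨_, rfl⟩
  have hfY : YM d f := by
    refine ⟨hf ▸ (td_map_le _ _).trans hY.1, ?_⟩
    rw [hf, xf]; simpa using hY.2
  rw [← hf] at hi
  obtain ⟨a, b, hab⟩ := bertini hd f hfY hi
  obtain ⟨g, hg, hg0⟩ := (hN _ _ (lnv_ym hfY a b)).mp hab
  obtain ⟨q, hqd, hq⟩ := uq hfY.1 g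
  have hdeg : q.totalDegree ≤ d * N.sup totalDegree := hqd.trans (zx _ (km (f := totalDegree) hg))
  have hq0 : q ≠ 0 := fun h0 => hg0 (by rw [← hq, h0, zp])
  let mi : Mv ((k+2)+(k+2)) Qb := X (Fin.castAdd (k+2) 0) * X (Fin.natAdd (k+2) 1) -
    X (Fin.castAdd (k+2) 1) * X (Fin.natAdd (k+2) 0)
  have hmi : mi ≠ 0 := fun h0 => by
    have := congrArg (eval (Fin.append (Pi.single 0 1) (Pi.single 1 1))) h0
    simp only [mi, map_sub, zw, eval_X, Fin.append_left, Fin.append_right] at this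
    simp at this
  have hmd : mi.totalDegree ≤ 2 := by
    refine (totalDegree_sub _ _).trans (vz ?_ ?_) <;>
      exact (ye _ _).trans (yq (totalDegree_X_le _) (totalDegree_X_le _))
  obtain ⟨v, hv, hv0⟩ := grid (q * mi) (xt hq0 hmi) (d * N.sup totalDegree + 2)
    ((ye _ _).trans (yq hdeg hmd))
  rw [zw] at hv0
  refine ⟨fun i => v (Fin.castAdd (k+2) i), fun i => v (Fin.natAdd (k+2) i), fun i => hv _, fun i => hv _, ?_, ?_⟩
  · have := yi hv0
    simp only [mi, map_sub, zw, eval_X] at this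
    exact_mod_cast this
  · rw [lnv_map, ← hf, hN _ _ (lnv_ym hfY _ _)]
    refine ⟨g, hg, ?_⟩
    rw [← hq]
    convert xl hv0 using 3
    funext i
    refine Fin.addCases (fun j => ?_) (fun j => ?_) i <;> simp only [Fin.append_left, Fin.append_right, eq_intCast, Int.cast_natCast]

lemma lat {M s t D c ρ0 ρ1 : ℤ} (hD : D ≠ 0) (hs0 : 0 ≤ s) (hs : s ≤ M) (ht0 : 0 ≤ t) (ht : t ≤ M)
    (h0 : 0 ≤ ρ0) (h0' : ρ0 < |D|) (h1 : 0 ≤ ρ1) (h1' : ρ1 < |D|) (h : D * c = s * ρ0 + t * ρ1) : |c| ≤ 2 * M := by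
  have hD' : 0 < |D| := abs_pos.mpr hD
  have e : |D| * |c| = s * ρ0 + t * ρ1 := by rw [← ue, h, ko (by positivity)]
  have e1 : s * ρ0 ≤ M * |D| := yc hs h0'.le h0 (hs0.trans hs)
  have e2 : t * ρ1 ≤ M * |D| := yc ht h1'.le h1 (hs0.trans hs)
  exact yt (by linarith) hD'

lemma abs_lin {M B s t x y : ℤ} (hs0 : 0 ≤ s) (hs : s ≤ M) (ht0 : 0 ≤ t) (ht : t ≤ M) (hx : |x| ≤ B) (hy : |y| ≤ B) :
    |s * x - t * y| ≤ 2 * M * B := by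
  have e1 : s * |x| ≤ M * B := yc hs hx (vq _) (hs0.trans hs)
  have e2 : t * |y| ≤ M * B := yc ht hy (vq _) (hs0.trans hs)
  have := abs_sub (s * x) (t * y)
  rw [ue, ue, ko hs0, ko ht0] at this
  linarith

lemma main1 (k d : ℕ) (hd : 4 ≤ d) (ε : ℝ) (hε : 0 < ε) (hε1 : ε ≤ 1) : ∃ C : ℕ, ∀ B : ℕ, 1 ≤ B →
    ∀ F : Mv (k+3) ℤ, F.IsHomogeneous d → YM d F →
    Irreducible (map (icr Qb) F) →
    ∀ Z : Finset (Fin (k+3) → ℤ), (∀ P ∈ Z, (∀ i, |P i| ≤ B) ∧ eval P F = 0) →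
    (Z.card:ℝ) ≤ C * B~^((k:ℝ)+1+ε) := by
  classical
  obtain ⟨M, hM⟩ := ln_ex k d (by omega)
  obtain ⟨C1, hC1⟩ := surf d hd ε hε hε1
  obtain ⟨K, hK⟩ : ∃ K, K = 4 * M * M + 2 * M + 1 := ⟨_, rfl⟩
  refine ⟨(2*K+1)^2 * (2*K+1)^k * (C1 * K ^ 2), fun B hB F hF hY hi Z hZ => ?_⟩
  obtain ⟨a, b, ha, hb, hD, hab⟩ := hM F hY hi
  obtain ⟨D, hDe⟩ : ∃ D : ℤ, D = (a 0 : ℤ) * b 1 - a 1 * b 0 := ⟨_, rfl⟩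
  rw [← hDe] at hD
  let η0 : (Fin (k+3) → ℤ) → ℤ := fun P => (b 1 * P 1 - b 0 * P 2) / D
  let η1 : (Fin (k+3) → ℤ) → ℤ := fun P => (a 0 * P 2 - a 1 * P 1) / D
  let c : (Fin (k+3) → ℤ) → Fin (k+2) → ℤ := fun P i => P i.succ - a i * η0 P - b i * η1 P
  let T : Finset (Fin (k+2) → ℤ) := Fintype.piFinset fun i =>
    if i.val < 2 then Finset.Icc (-(K:ℤ)) K else Finset.Icc (-(K * B : ℤ)) (K * B)
  have ha' : ∀ i, (a i : ℤ) ≤ M := fun i => by exact_mod_cast ha i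
  have hb' : ∀ i, (b i : ℤ) ≤ M := fun i => by exact_mod_cast hb i
  have hη0 : ∀ P ∈ Z, |η0 P| ≤ 2 * M * B := fun P hP => (Int.abs_ediv_le_abs _ _).trans
    (abs_lin (by positivity) (hb' _) (by positivity) (hb' _) ((hZ P hP).1 _) ((hZ P hP).1 _))
  have hη1 : ∀ P ∈ Z, |η1 P| ≤ 2 * M * B := fun P hP => (Int.abs_ediv_le_abs _ _).trans
    (abs_lin (by positivity) (ha' _) (by positivity) (ha' _) ((hZ P hP).1 _) ((hZ P hP).1 _))
  have hMK : 2 * M * B ≤ K * B := zv _ (by rw [hK]; omega)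
  have hcT : ∀ P ∈ Z, c P ∈ T := fun P hP => by
    have m0 := jy (b 1 * P 1 - b 0 * P 2) D
    have m1 := jy (a 0 * P 2 - a 1 * P 1) D
    have p0 := Int.emod_nonneg (b 1 * P 1 - b 0 * P 2) hD
    have p1 := Int.emod_nonneg (a 0 * P 2 - a 1 * P 1) hD
    have q0 := Int.emod_lt_abs (b 1 * P 1 - b 0 * P 2) hD
    have q1 := Int.emod_lt_abs (a 0 * P 2 - a 1 * P 1) hD
    refine uz.mpr fun i => ?_
    split_ifs with h2
    · rw [ki, ← abs_le]
      have h3 : |c P i| ≤ 2 * M := by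
        refine lat hD (by positivity) (ha' i) (by positivity) (hb' i) p0 q0 p1 q1 ?_
        rcases (by omega : i.val = 0 ∨ i.val = 1) with h | h
        · obtain rfl : i = 0 := jo h
          simp only [c, η0, η1, Fin.succ_zero_eq_one]
          linear_combination P 1 * hDe - (a 0 : ℤ) * m0 - (b 0 : ℤ) * m1
        · obtain rfl : i = 1 := jo h
          simp only [c, η0, η1, Fin.succ_one_eq_two]
          linear_combination P 2 * hDe - (a 1 : ℤ) * m0 - (b 1 : ℤ) * m1
      refine h3.trans ?_
      rw [hK]; push_cast; nlinarith
    · rw [ki, ← abs_le]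
      have h3 : |a i * η0 P - b i * -η1 P| ≤ 2 * M * (2 * M * B) :=
        abs_lin (by positivity) (ha' _) (by positivity) (hb' _) (hη0 P hP) (by rw [abs_neg]; exact hη1 P hP)
      have h4 := abs_sub (P i.succ) (a i * η0 P - b i * -η1 P)
      have h5 := (hZ P hP).1 i.succ
      have h6 : c P i = P i.succ - (a i * η0 P - b i * -η1 P) := by simp only [c]; ring
      rw [h6]
      refine h4.trans ((yq h5 h3).trans ?_)
      rw [hK]; push_cast; nlinarith [show (0:ℤ) ≤ M * B by positivity]
  have hrec : ∀ P (i : Fin (k+2)), P i.succ = a i * η0 P + b i * η1 P + c P i := fun P i => by simp only [c]; ring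
  have hfib : ∀ c0 ∈ T, ((Z.filter fun P => c P = c0).card : ℝ) ≤ C1 * K ^ 2 * B~^(1+ε) := fun c0 _ => by
    obtain ⟨w, hw⟩ : ∃ w : Fin (k+3) → Mv 4 ℤ, w =
      cons (X 0) fun i => C (a i : ℤ) * X 1 + C (b i : ℤ) * X 2 + C (c0 i) * X 3 := ⟨_, rfl⟩
    have hw1 : ∀ i, (w i).IsHomogeneous 1 := fun i => by
      have hCX : ∀ (e : ℤ) (j : Fin 4), (C e * X j : Mv 4 ℤ).IsHomogeneous 1 := fun e j => by
        simpa using (isHomogeneous_C _ e).mul (vi ℤ j)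
      rw [hw]
      refine Fin.cases (vi _ _) (fun j => ?_) i
      rw [ys]
      exact ((hCX _ _).add (hCX _ _)).add (hCX _ _)
    have hH : (aeval w F).IsHomogeneous d := by simpa using hF.aeval w hw1
    have hHY : YM d (aeval w F) := by
      refine ⟨hH.totalDegree_le, ?_⟩
      rw [subst_lead hY.1 _ 1 (by simp [hw]) fun i => ?_, one_pow, um]
      · exact hY.2
      · have hCX : ∀ (e : ℤ) (j : Fin 4), j ≠ 0 → (C e * X j : Mv 4 ℤ).degreeOf 0 ≤ 0 := fun e j hj =>
          (vn _ _ _).trans (degreeOf_X_ne' hj.symm).le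
        rw [hw, ys]
        exact kf.mp ((jd _ _ _).trans (vz ((jd _ _ _).trans
          (vz (hCX _ _ (by decide)) (hCX _ _ (by decide)))) (hCX _ _ (by decide))))
    have hhs : hs 0 (aeval w F) = aeval (lnv (fun i => (a i : ℤ)) fun i => (b i : ℤ)) F := by
      rw [hs, ← jm]
      congr 1
      refine MvPolynomial.algHom_ext fun i => ?_
      rw [jm, jw, jw, hw, lnv]
      refine Fin.cases ?_ (fun j => ?_) i <;> simp
    have hinj : Set.InjOn (fun P : Fin (k+3) → ℤ => ![P 0, η0 P, η1 P]) (Z.filter fun P => c P = c0) := by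
      intro P hP Q hQ e
      have hP := (zz.mp hP).2
      have hQ := (zz.mp hQ).2
      have e0 := congrFun e 0
      have e1 := congrFun e 1
      have e2 := congrFun e 2
      simp only [Matrix.cons_val] at e0 e1 e2
      funext i
      refine Fin.cases e0 (fun j => ?_) i
      rw [hrec P, hrec Q, hP, hQ, e1, e2]
    have := hC1 (K * B) (xa (by rw [hK]; omega) hB) (aeval w F) hH hHY (by rw [hhs]; exact hab)
      ((Z.filter fun P => c P = c0).image fun P => ![P 0, η0 P, η1 P]) (fun Q hQ => by
        obtain ⟨P, hP, rfl⟩ := zy.mp hQ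
        obtain ⟨hP, hc⟩ := zz.mp hP
        have hMK' : (2 * M * B : ℤ) ≤ K * B := by exact_mod_cast hMK
        have hBK : (B:ℤ) ≤ K * B := by exact_mod_cast Nat.le_mul_of_pos_left B (by rw [hK]; omega)
        refine ⟨fun i => ?_, ?_⟩
        · push_cast
          fin_cases i
          · exact ((hZ P hP).1 0).trans hBK
          · exact (hη0 P hP).trans hMK'
          · exact (hη1 P hP).trans hMK'
        · rw [dh_eval, sub_eval]
          refine Eq.trans ?_ (hZ P hP).2
          congr 2
          funext i
          rw [hw]
          refine Fin.cases ?_ (fun j => ?_) i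
          · simp
          · rw [hrec P j, hc]; simp)
    rw [yk hinj] at this
    refine this.trans ?_
    rw [uj]
    refine zt ?_ (by positivity)
    push_cast
    rw [Real.mul_rpow (by positivity) (by positivity)]
    refine zh ?_ (by positivity)
    rw [← xk]
    exact zk (by rw [hK]; push_cast; nlinarith [show (0:ℝ) ≤ M by positivity]) (by push_cast; linarith)
  have hT : T.card ≤ (2*K+1)^2 * (2*K+1)^k * B^k := by
    rw [Fintype.card_piFinset, xp, xp]
    have : ∀ n : ℕ, (Finset.Icc (-(n:ℤ)) n).card = 2 * n + 1 := fun n => by rw [Int.card_Icc]; omega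
    have h1 : ∀ i : Fin k, ¬ (i.succ.succ.val < 2) := fun i => by simp
    have h2 := this (K * B)
    push_cast at h2
    simp only [h1, if_false, h2, kh, va, Fintype.card_fin]
    rw [if_pos (by simp), if_pos (by simp), this, uj, ← kr, ← uj, ← sq]
    refine zx _ (yd ?_ _)
    rw [Nat.add_mul, um, uj]; omega
  have hsum : Z.card = ∑ c0 ∈ T, (Z.filter fun P => c P = c0).card := Finset.card_eq_sum_card_fiberwise hcT
  have hB0 : (0:ℝ) < B := by exact_mod_cast hB
  rw [hsum]
  push_cast
  calc _ ≤ ∑ c0 ∈ T, C1 * K ^ 2 * B~^(1+ε) := zq hfib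
    _ = T.card * (C1 * K ^ 2 * B~^(1+ε)) := by rw [Finset.sum_const, uu]
    _ ≤ ((2*K+1)^2 * (2*K+1)^k * B^k) * (C1 * K ^ 2 * B~^(1+ε)) := by
      refine zh (by exact_mod_cast hT) (by positivity)
    _ = _ := by
      rw [show (k:ℝ) + 1 + ε = k + (1 + ε) by ring, jf hB0 (k:ℝ), xk]; ring

/-- Theorem 0.1 / 8.2 of Salberger (hypersurface case): a geometrically integral
hypersurface `Z = {F = 0} ⊂ P^{r+1}` of degree `d ≥ 4` containing only finitely many
`(r-1)`-planes over `ℚ̄` satisfies `N(Z;B) = O_{d,r,ε}(B^{r+ε})`.  Rational points of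
height at most `B` are counted here by their primitive integral representatives. -/
theorem stmt_2 (r d : ℕ) (hr : 1 ≤ r) (hd : 4 ≤ d) (ε : ℝ) (hε : 0 < ε) :
    ∃ C : ℝ, ∀ F : MvPolynomial (Fin (r + 2)) ℤ,
      F.IsHomogeneous d →
      Irreducible (MvPolynomial.map (Int.castRingHom (AlgebraicClosure ℚ)) F) →
      {W : Submodule (AlgebraicClosure ℚ) (Fin (r + 2) → AlgebraicClosure ℚ) |
          Module.finrank (AlgebraicClosure ℚ) W = r ∧ ∀ x ∈ W, aeval x F = 0}.Finite →
      ∀ B : ℝ, 1 ≤ B →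
        (({ξ : Fin (r + 2) → ℤ | Finset.univ.gcd ξ = 1 ∧ (∀ i, (|ξ i| : ℝ) ≤ B) ∧
            eval ξ F = 0}.ncard : ℝ) ≤ C * B ^ ((r : ℝ) + ε)) := by
  obtain ⟨k, rfl⟩ : ∃ k, r = k + 1 := ⟨r - 1, by omega⟩
  obtain ⟨C0, hC⟩ := main1 k d hd (min ε 1) (lt_min hε one_pos) (min_le_right _ _)
  refine ⟨C0 * ((d:ℝ)+1)^(((k:ℝ)+1) + min ε 1), fun F hF hi _ B hB => ?_⟩
  classical
  have hj : Injective (icr Qb) := vh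
  obtain ⟨a, ha, hY⟩ := shear_ex _ hi.ne_zero d ((hF.map _).totalDegree hi.ne_zero)
  have he : map (icr Qb) (aeval (shv fun i => (a i : ℤ)) F) =
      aeval (shv fun i => (a i : Qb)) (map (icr Qb) F) := by
    rw [sub_map]
    congr 2
    funext i
    refine Fin.cases ?_ (fun j => ?_) i <;> simp [shv]
  have hH : (aeval (shv fun i => (a i : ℤ)) F).IsHomogeneous d := by
    simpa using hF.aeval (shv fun i => (a i : ℤ)) (shv_td _)
  have hHY : YM d (aeval (shv fun i => (a i : ℤ)) F) := by
    refine ⟨hH.totalDegree_le, fun h => hY.2 ?_⟩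
    rw [← he, xf, h, zp]
  obtain ⟨b, hb⟩ : ∃ b, b = ⌊B⌋₊ := ⟨_, rfl⟩
  have hb1 : 1 ≤ b := by rw [hb]; exact kv (by simpa using hB)
  have hbB : (b:ℝ) ≤ B := by rw [hb]; exact qx (by linarith)
  have hbd : ∀ ξ : Fin (k+1+2) → ℤ, (∀ i, (|ξ i| : ℝ) ≤ B) → ∀ i, |ξ i| ≤ b := fun ξ h i => by
    have h1 : (((ξ i).natAbs : ℕ) : ℝ) ≤ B := by rw [Nat.cast_natAbs]; push_cast; exact h i
    rw [Int.abs_eq_natAbs, hb]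
    exact_mod_cast kv h1
  let S := {ξ : Fin (k+1+2) → ℤ | Finset.univ.gcd ξ = 1 ∧ (∀ i, (|ξ i| : ℝ) ≤ B) ∧ eval ξ F = 0}
  have hS : S.Finite := (Set.Finite.pi fun _ => Set.finite_Icc (-(b:ℤ)) b).subset fun ξ h i _ =>
    abs_le.mp (hbd ξ h.2.1 i)
  let g : (Fin (k+1+2) → ℤ) → Fin (k+3) → ℤ := fun P => cons (P 0) fun i => P i.succ - a i * P 0
  have hg : Injective g := fun P Q e => by
    have h0 : P 0 = Q 0 := congrFun e 0
    funext i
    refine Fin.cases h0 (fun j => ?_) i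
    have h1 : P j.succ - a j * P 0 = Q j.succ - a j * Q 0 := congrFun e j.succ
    rw [h0] at h1
    linarith
  have := hC ((d+1)*b) (xa (by omega) hb1) _ hH hHY (by rw [he]; exact shv_irr _ hi)
    (hS.toFinset.image g) (fun Q hQ => by
      obtain ⟨P, hP, rfl⟩ := zy.mp hQ
      have hP := hS.mem_toFinset.mp hP
      have hPb := hbd P hP.2.1
      refine ⟨fun i => ?_, (shv_eval _ F P).trans hP.2.2⟩
      push_cast
      have hb0 : (0:ℤ) ≤ d * b := by positivity
      refine Fin.cases ?_ (fun j => ?_) i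
      · refine (hPb 0).trans ?_
        linarith
      · refine (abs_sub (P j.succ) (a j * P 0)).trans ?_
        have h1 : |(a j : ℤ) * P 0| ≤ d * b := by
          rw [ue, Nat.abs_cast]
          exact yc (by exact_mod_cast ha j) (hPb 0) (vq _) (by positivity)
        linarith [hPb j.succ])
  rw [zd _ hg, ← Set.ncard_eq_toFinset_card S hS] at this
  refine this.trans ?_
  push_cast
  rw [Real.mul_rpow (by positivity) (by positivity), ← uj]
  refine zt ?_ (by positivity)
  exact (Real.rpow_le_rpow (by positivity) hbB (by positivity)).trans
    (zk hB (by linarith [min_le_left ε 1]))
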